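/- Let Q be an extended Dynkin quiver which is not an oriented cycle. Given a decomposition symbol α = (μ,σ), there exist a monic polynomial a_α ∈ ℤ[T] and a universal polynomial n_α such that for every finite field k with q elements: |Aut(A)| = a_α(q) for every module A in the decomposition class S(α,k), and |S(α,k)| = n_α(q). -/

import Mathlib

open Polynomial

/-- A finite quiver, given by a finite set of vertices, a finite set of arrows,
and source/target maps. -/
structure QuiverData where
  V : Type
  A : Type
  [fintV : Fintype V]
  [decV : DecidableEq V]
  [fintA : Fintype A]
  s : A → V
  t : A → V

attribute [instance] QuiverData.fintV QuiverData.decV QuiverData.fintA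

/-- A representation of a quiver over a field `k`:  a finite dimensional vector
space at each vertex together with a linear map for each arrow.  This is the same
thing as a `kQ`-module (finite dimensionality is imposed separately via `FinDim`). -/
structure Repn (k : Type) [Field k] (Q : QuiverData) where
  space : Q.V → Type
  [addcg : ∀ v, AddCommGroup (space v)]
  [mod : ∀ v, Module k (space v)]
  map : ∀ a : Q.A, space (Q.s a) →ₗ[k] space (Q.t a)

attribute [instance] Repn.addcg Repn.mod

namespace Repn

variable {k : Type} [Field k] {Q : QuiverData}

/-- An isomorphism of representations. -/
structure Iso (M N : Repn k Q) where
  e : ∀ v, M.space v ≃ₗ[k] N.space v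
  comm : ∀ (a : Q.A) (x : M.space (Q.s a)), e (Q.t a) (M.map a x) = N.map a (e (Q.s a) x)

/-- Direct sum of two representations. -/
def dsum (M N : Repn k Q) : Repn k Q where
  space v := M.space v × N.space v
  map a := (M.map a).prodMap (N.map a)

/-- Direct sum of a family of representations. -/
def dsumFam {ι : Type} (X : ι → Repn k Q) : Repn k Q where
  space v := ∀ i, (X i).space v
  map a := LinearMap.pi fun i => ((X i).map a).comp (LinearMap.proj i)

/-- The zero representation(s). -/
def IsZero (M : Repn k Q) : Prop := ∀ (v : Q.V) (x : M.space v), x = 0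

/-- Pointwise finite dimensionality, i.e. `M` is a finite `kQ`-module. -/
def FinDim (M : Repn k Q) : Prop := ∀ v, FiniteDimensional k (M.space v)

/-- Indecomposability. -/
def Indec (M : Repn k Q) : Prop :=
  ¬ M.IsZero ∧ ∀ Y Z : Repn k Q, Nonempty (Iso M (Y.dsum Z)) → Y.IsZero ∨ Z.IsZero

/-- The dimension vector. -/
noncomputable def dimv (M : Repn k Q) : Q.V → ℕ := fun v => Module.finrank k (M.space v)

end Repn

/-- A subrepresentation of `X`, i.e. a `kQ`-submodule. -/
structure Subrep {k : Type} [Field k] {Q : QuiverData} (X : Repn k Q) where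
  sub : ∀ v, Submodule k (X.space v)
  stable : ∀ a : Q.A, (sub (Q.s a)).map (X.map a) ≤ sub (Q.t a)

namespace Subrep

variable {k : Type} [Field k] {Q : QuiverData} {X : Repn k Q}

/-- A subrepresentation as a representation. -/
def repn (U : Subrep X) : Repn k Q where
  space v := U.sub v
  map a := (X.map a).restrict fun _ hx => U.stable a (Submodule.mem_map_of_mem hx)

/-- The quotient representation `X/U`. -/
def quot (U : Subrep X) : Repn k Q where
  space v := X.space v ⧸ U.sub v
  map a := Submodule.mapQ (U.sub (Q.s a)) (U.sub (Q.t a)) (X.map a)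
    (Submodule.map_le_iff_le_comap.mp (U.stable a))

end Subrep

/-- The Hall number `F_{MN}^X`: the number of subrepresentations `U ≤ X` with
`U ≅ N` and `X/U ≅ M`. -/
noncomputable def hallNum {k : Type} [Field k] {Q : QuiverData} (M N X : Repn k Q) : ℕ :=
  Nat.card {U : Subrep X // Nonempty (Repn.Iso U.repn N) ∧ Nonempty (Repn.Iso U.quot M)}

/-- The number of automorphisms of a representation. -/
noncomputable def autCard {k : Type} [Field k] {Q : QuiverData} (M : Repn k Q) : ℕ :=
  Nat.card (Repn.Iso M M)

/-- The Euler form of the quiver `Q`. -/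
def eulerZ (Q : QuiverData) (d e : Q.V → ℤ) : ℤ :=
  (∑ v, d v * e v) - ∑ a, d (Q.s a) * e (Q.t a)

/-- The Tits quadratic form of `Q`. -/
def titsZ (Q : QuiverData) (d : Q.V → ℤ) : ℤ := eulerZ Q d d

/-- Coercion of a dimension vector to an integral vector. -/
def natc {Q : QuiverData} (d : Q.V → ℕ) : Q.V → ℤ := fun v => (d v : ℤ)

/-- Connectedness of the underlying graph of `Q`. -/
def QuiverData.Connected (Q : QuiverData) : Prop :=
  ∀ u v : Q.V, Relation.ReflTransGen
    (fun x y => ∃ a, (Q.s a = x ∧ Q.t a = y) ∨ (Q.s a = y ∧ Q.t a = x)) u v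

/-- `Q` is a Dynkin quiver iff it is connected and its Tits form is positive definite. -/
def IsDynkin (Q : QuiverData) : Prop :=
  Q.Connected ∧ ∀ d : Q.V → ℤ, d ≠ 0 → 0 < titsZ Q d

/-- `Q` is an extended Dynkin (affine) quiver iff it is connected and its Tits form is
positive semidefinite but not definite. -/
def IsAffine (Q : QuiverData) : Prop :=
  Q.Connected ∧ (∀ d : Q.V → ℤ, 0 ≤ titsZ Q d) ∧ ∃ d : Q.V → ℤ, d ≠ 0 ∧ titsZ Q d = 0

/-- `δ` is the minimal positive imaginary root of the affine quiver `Q`. -/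
def IsMinImagRoot (Q : QuiverData) (δ : Q.V → ℕ) : Prop :=
  δ ≠ 0 ∧ titsZ Q (natc δ) = 0 ∧
    ∀ d : Q.V → ℕ, d ≠ 0 → titsZ Q (natc d) = 0 → ∀ v, δ v ≤ d v

/-- `Q` is an oriented cycle iff every vertex has exactly one incoming and one
outgoing arrow (`Q` being connected). -/
def IsOrientedCycle (Q : QuiverData) : Prop :=
  ∀ v : Q.V, Nat.card {a : Q.A // Q.s a = v} = 1 ∧ Nat.card {a : Q.A // Q.t a = v} = 1

/-- The standard map whose kernel is `Hom(M,N)` and whose cokernel is `Ext¹(M,N)`. -/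
noncomputable def extMap {k : Type} [Field k] {Q : QuiverData} (M N : Repn k Q) :
    (∀ v, M.space v →ₗ[k] N.space v) →ₗ[k] (∀ a : Q.A, M.space (Q.s a) →ₗ[k] N.space (Q.t a)) :=
  LinearMap.pi fun a =>
    ((LinearMap.llcomp k (M.space (Q.s a)) (N.space (Q.s a)) (N.space (Q.t a)) (N.map a)).comp
        (LinearMap.proj (Q.s a)))
      - ((LinearMap.lcomp k (N.space (Q.t a)) (M.map a)).comp (LinearMap.proj (Q.t a)))

/-- `dim_k Hom(M,N)`. -/
noncomputable def homDim {k : Type} [Field k] {Q : QuiverData} (M N : Repn k Q) : ℕ :=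
  Module.finrank k (LinearMap.ker (extMap M N))

/-- `dim_k Ext¹(M,N)`. -/
noncomputable def extDim {k : Type} [Field k] {Q : QuiverData} (M N : Repn k Q) : ℕ :=
  Module.finrank k
    ((∀ a : Q.A, M.space (Q.s a) →ₗ[k] N.space (Q.t a)) ⧸ LinearMap.range (extMap M N))

section Affine

variable {k : Type} [Field k] {Q : QuiverData}

/-- The defect `∂(d) = ⟨δ, d⟩`. -/
def defectOf (Q : QuiverData) (δ : Q.V → ℕ) (d : Q.V → ℤ) : ℤ := eulerZ Q (natc δ) d

/-- An indecomposable preprojective module (negative defect). -/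
def IsPreprojIndec (δ : Q.V → ℕ) (M : Repn k Q) : Prop :=
  M.Indec ∧ M.FinDim ∧ defectOf Q δ (natc (Repn.dimv M)) < 0

/-- An indecomposable preinjective module (positive defect). -/
def IsPreinjIndec (δ : Q.V → ℕ) (M : Repn k Q) : Prop :=
  M.Indec ∧ M.FinDim ∧ 0 < defectOf Q δ (natc (Repn.dimv M))

/-- An indecomposable regular module (zero defect). -/
def IsRegIndec (δ : Q.V → ℕ) (M : Repn k Q) : Prop :=
  M.Indec ∧ M.FinDim ∧ defectOf Q δ (natc (Repn.dimv M)) = 0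

/-- Two indecomposable regular modules lie in the same tube iff they are connected by a
chain of nonzero homomorphisms among indecomposable regular modules. -/
def SameTube (δ : Q.V → ℕ) (X Y : Repn k Q) : Prop :=
  Relation.EqvGen
    (fun M N => IsRegIndec δ M ∧ IsRegIndec δ N ∧ (homDim M N ≠ 0 ∨ homDim N M ≠ 0)) X Y

/-- An indecomposable regular module lies in a homogeneous tube iff the dimension vector
of every indecomposable in its tube is a multiple of `δ`. -/
def InHomogTube (δ : Q.V → ℕ) (X : Repn k Q) : Prop :=
  IsRegIndec δ X ∧
    ∀ Y : Repn k Q, IsRegIndec δ Y → SameTube δ X Y → ∃ m : ℕ, ∀ v, Repn.dimv Y v = m * δ v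

/-- `M` decomposes as a finite direct sum of modules satisfying `P`. -/
def DecompInto (P : Repn k Q → Prop) (M : Repn k Q) : Prop :=
  ∃ (ι : Type) (_ : Fintype ι) (Xi : ι → Repn k Q),
    (∀ i, P (Xi i)) ∧ Nonempty (Repn.Iso M (Repn.dsumFam Xi))

/-- A regular module: a direct sum of indecomposable regular modules. -/
def IsRegularModule (δ : Q.V → ℕ) (M : Repn k Q) : Prop :=
  DecompInto (IsRegIndec δ) M

/-- A homogeneous regular module: all indecomposable summands lie in homogeneous tubes. -/
def IsHomogRegular (δ : Q.V → ℕ) (M : Repn k Q) : Prop :=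
  DecompInto (InHomogTube δ) M

/-- A regular module lying in a single non-homogeneous tube. -/
def SingleNonHomogTube (δ : Q.V → ℕ) (M : Repn k Q) : Prop :=
  ∃ (ι : Type) (_ : Fintype ι) (Xi : ι → Repn k Q),
    (∀ i, IsRegIndec δ (Xi i) ∧ ¬ InHomogTube δ (Xi i)) ∧
    (∀ i j, SameTube δ (Xi i) (Xi j)) ∧
    Nonempty (Repn.Iso M (Repn.dsumFam Xi))

/-- A regular subobject: a subrepresentation which is regular with regular quotient. -/
def IsRegSub (δ : Q.V → ℕ) {X : Repn k Q} (U : Subrep X) : Prop :=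
  IsRegularModule δ U.repn ∧ IsRegularModule δ U.quot

/-- A regular simple (quasi-simple) module: a simple object of the abelian category of
regular modules. -/
def IsRegSimple (δ : Q.V → ℕ) (X : Repn k Q) : Prop :=
  IsRegIndec δ X ∧
    ∀ U : Subrep X, IsRegSub δ U → (U.repn).IsZero ∨ (U.quot).IsZero

/-- `X` has a filtration by `ℓ` regular simples (i.e. `X` is regular of quasi-length `ℓ`). -/
def HasRegFilt (δ : Q.V → ℕ) : ℕ → Repn k Q → Prop
  | 0, X => X.IsZero
  | (ℓ+1), X => ∃ U : Subrep X,
      IsRegSimple δ U.quot ∧ IsRegularModule δ U.repn ∧ HasRegFilt δ ℓ U.repn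

/-- The regular socle of `X` has dimension vector `d`. -/
def QuasiSocleDim (δ : Q.V → ℕ) (X : Repn k Q) (d : Q.V → ℕ) : Prop :=
  ∃ U : Subrep X, IsRegSimple δ U.repn ∧ IsRegularModule δ U.quot ∧ Repn.dimv U.repn = d

/-- `X` is the indecomposable module (containing no homogeneous regular summand)
specified by the combinatorial symbol `p = (d, ℓ)`:  if `∂(d) ≠ 0` then `X` is the
unique indecomposable (preprojective or preinjective) of dimension vector `d` (and
`ℓ = 1`); if `∂(d) = 0` then `X` is the indecomposable in a non-homogeneous tube with
regular socle of dimension vector `d` and quasi-length `ℓ`. -/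
def RealizesIndecSymbol (δ : Q.V → ℕ) (X : Repn k Q) (p : (Q.V → ℕ) × ℕ) : Prop :=
  X.Indec ∧ X.FinDim ∧ ¬ InHomogTube δ X ∧
    ((defectOf Q δ (natc p.1) ≠ 0 ∧ p.2 = 1 ∧ Repn.dimv X = p.1) ∨
     (defectOf Q δ (natc p.1) = 0 ∧ QuasiSocleDim δ X p.1 ∧ HasRegFilt δ p.2 X))

/-- `X` is a direct summand of `R`. -/
def SummandOf (X R : Repn k Q) : Prop :=
  ∃ Z : Repn k Q, Nonempty (Repn.Iso R (X.dsum Z))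

/-- `R` is the homogeneous regular module `R(λ,x)` for some point `x` of degree `d`,
where `p = (λ, d)`:  a direct sum, over the parts `c` of `λ`, of indecomposables of
quasi-length `c` all lying in one homogeneous tube whose quasi-simple has dimension
vector `d·δ`. -/
def RealizesHomogPair (δ : Q.V → ℕ) (R : Repn k Q) (p : Multiset ℕ+ × ℕ+) : Prop :=
  ∃ (ι : Type) (hι : Fintype ι) (Xi : ι → Repn k Q) (len : ι → ℕ+),
    (∀ i, InHomogTube δ (Xi i) ∧
      QuasiSocleDim δ (Xi i) (fun v => (p.2 : ℕ) * δ v) ∧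
      HasRegFilt δ (len i : ℕ) (Xi i)) ∧
    (∀ i j, SameTube δ (Xi i) (Xi j)) ∧
    Multiset.map len hι.elems.val = p.1 ∧
    Nonempty (Repn.Iso R (Repn.dsumFam Xi))

/-- No indecomposable regular summand of `R` shares a tube with one of `R'`. -/
def TubeDisjoint (δ : Q.V → ℕ) (R R' : Repn k Q) : Prop :=
  ∀ X Y : Repn k Q, SummandOf X R → SummandOf Y R' →
    IsRegIndec δ X → IsRegIndec δ Y → ¬ SameTube δ X Y

end Affine

/-- A decomposition symbol `α = (μ, σ)` (Bongartz–Dudek):  `μ` is a multiset of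
combinatorial symbols specifying a module without homogeneous regular summands, and
`σ` is a Segre symbol, i.e. a multiset of pairs (partition, degree). -/
def DSymb (Q : QuiverData) : Type :=
  Multiset ((Q.V → ℕ) × ℕ) × Multiset (Multiset ℕ+ × ℕ+)

section Classes

variable {k : Type} [Field k] {Q : QuiverData}

/-- `M` lies in the decomposition class `S(α,k)`:  `M ≅ M(μ,k) ⊕ R(λ_1,x_1) ⊕ ⋯ ⊕ R(λ_r,x_r)`
where `M(μ,k)` is the module without homogeneous regular summands specified by `μ = α.1`
and the `x_i` are points lying in pairwise distinct homogeneous tubes, with partitions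
and degrees prescribed by the Segre symbol `α.2`. -/
def InDecompClass (δ : Q.V → ℕ) (α : DSymb Q) (M : Repn k Q) : Prop :=
  ∃ D R : Repn k Q, Nonempty (Repn.Iso M (D.dsum R)) ∧
    (∃ (ι : Type) (hι : Fintype ι) (Xi : ι → Repn k Q) (tag : ι → (Q.V → ℕ) × ℕ),
      (∀ i, RealizesIndecSymbol δ (Xi i) (tag i)) ∧
      Multiset.map tag hι.elems.val = α.1 ∧
      Nonempty (Repn.Iso D (Repn.dsumFam Xi))) ∧
    (∃ (κ : Type) (hκ : Fintype κ) (Rj : κ → Repn k Q) (ptag : κ → Multiset ℕ+ × ℕ+),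
      (∀ j, RealizesHomogPair δ (Rj j) (ptag j)) ∧
      (∀ j j', j ≠ j' → TubeDisjoint δ (Rj j) (Rj j')) ∧
      Multiset.map ptag hκ.elems.val = α.2 ∧
      Nonempty (Repn.Iso R (Repn.dsumFam Rj)))

/-- The number of isomorphism classes of representations satisfying `P`. -/
noncomputable def classCount (P : Repn k Q → Prop) : ℕ :=
  Nat.card (Quot (fun (M N : {M : Repn k Q // P M}) => Nonempty (Repn.Iso M.1 N.1)))

/-- `Σ_{A ∈ S(α,k), B ∈ S(β,k)} F_{AB}^C`: the number of subrepresentations `U ≤ C`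
with `U` in the class `β` and `C/U` in the class `α`. -/
noncomputable def pairHallSum (αP βP : Repn k Q → Prop) (C : Repn k Q) : ℕ :=
  Nat.card {U : Subrep C // βP U.repn ∧ αP U.quot}

/-- `Σ_{B ∈ S(β,k), C ∈ S(γ,k)} F_{AB}^C` for a fixed module `A`:  the sum over the
isomorphism classes `C` in `S(γ,k)` of the number of `U ≤ C` with `U ∈ S(β,k)` and
`C/U ≅ A`. -/
noncomputable def hallSumFixedQuot (γP βP : Repn k Q → Prop) (A : Repn k Q) : ℕ :=
  Nat.card (Σ c : Quot (fun (M N : {M : Repn k Q // γP M}) => Nonempty (Repn.Iso M.1 N.1)),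
    {U : Subrep (c.out.1) // βP U.repn ∧ Nonempty (Repn.Iso U.quot A)})

/-- `Σ_{A ∈ S(α,k), C ∈ S(γ,k)} F_{AB}^C` for a fixed module `B`. -/
noncomputable def hallSumFixedSub (γP αP : Repn k Q → Prop) (B : Repn k Q) : ℕ :=
  Nat.card (Σ c : Quot (fun (M N : {M : Repn k Q // γP M}) => Nonempty (Repn.Iso M.1 N.1)),
    {U : Subrep (c.out.1) // Nonempty (Repn.Iso U.repn B) ∧ αP U.quot})

end Classes

/-- `F` is a Hall polynomial for the decomposition symbols `(α, β; γ)`:  for every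
finite field `k` with `q` elements,
`F(q) = Σ_{A ∈ S(α,k), B ∈ S(β,k)} F_{AB}^C` for all `C ∈ S(γ,k)`,
`n_γ(q)F(q) = n_α(q) Σ_{B ∈ S(β,k), C ∈ S(γ,k)} F_{AB}^C` for all `A ∈ S(α,k)`, and
`n_γ(q)F(q) = n_β(q) Σ_{A ∈ S(α,k), C ∈ S(γ,k)} F_{AB}^C` for all `B ∈ S(β,k)`,
where `n_α(q) = |S(α,k)|`. -/
def IsHallPoly (Q : QuiverData) (δ : Q.V → ℕ) (α β γ : DSymb Q) (F : Polynomial ℚ) : Prop :=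
  ∀ (k : Type) [Field k] [Fintype k],
    (∀ C : Repn k Q, InDecompClass δ γ C →
      (pairHallSum (InDecompClass δ α) (InDecompClass δ β) C : ℚ)
        = F.eval ((Fintype.card k : ℚ))) ∧
    (∀ A : Repn k Q, InDecompClass δ α A →
      (classCount (fun M : Repn k Q => InDecompClass δ γ M) : ℚ) * F.eval ((Fintype.card k : ℚ))
        = (classCount (fun M : Repn k Q => InDecompClass δ α M) : ℚ) *
            (hallSumFixedQuot (InDecompClass δ γ) (InDecompClass δ β) A : ℚ)) ∧
    (∀ B : Repn k Q, InDecompClass δ β B →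
      (classCount (fun M : Repn k Q => InDecompClass δ γ M) : ℚ) * F.eval ((Fintype.card k : ℚ))
        = (classCount (fun M : Repn k Q => InDecompClass δ β M) : ℚ) *
            (hallSumFixedSub (InDecompClass δ γ) (InDecompClass δ α) B : ℚ))

/-- The Hall polynomial for `(α, β; γ)` exists. -/
def HallPolyExists (Q : QuiverData) (δ : Q.V → ℕ) (α β γ : DSymb Q) : Prop :=
  ∃ F : Polynomial ℚ, IsHallPoly Q δ α β γ F


open Polynomial

noncomputable section

namespace Repn

variable {k : Type} [Field k] {Q : QuiverData}
variable {T₁ C A' B' E' R' A B E L M M' N N' P R S T T' X X' Y Z : Repn k Q}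

/-- Homomorphisms of representations. -/
def Hm (M N : Repn k Q) : Type := ↥(LinearMap.ker (extMap M N))

noncomputable instance (M N : Repn k Q) : AddCommGroup (Hm M N) :=
  inferInstanceAs (AddCommGroup ↥(LinearMap.ker (extMap M N)))
noncomputable instance (M N : Repn k Q) : Module k (Hm M N) :=
  inferInstanceAs (Module k ↥(LinearMap.ker (extMap M N)))

instance (M N : Repn k Q) :
    CoeFun (Hm M N) (fun _ => ∀ v, M.space v →ₗ[k] N.space v) := ⟨Subtype.val⟩

lemma extMap_apply (M N : Repn k Q) (f : ∀ v, M.space v →ₗ[k] N.space v) (a : Q.A)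
    (x : M.space (Q.s a)) :
    extMap M N f a x = N.map a (f (Q.s a) x) - f (Q.t a) (M.map a x) := rfl

lemma mem_Hm {f : ∀ v, M.space v →ₗ[k] N.space v} :
    f ∈ LinearMap.ker (extMap M N) ↔ ∀ a x, f (Q.t a) (M.map a x) = N.map a (f (Q.s a) x) := by
  constructor
  · intro h a x
    have h1 : extMap M N f a x = 0 := by rw [LinearMap.mem_ker.mp h]; rfl
    rw [extMap_apply, sub_eq_zero] at h1
    exact h1.symm
  · intro h
    rw [LinearMap.mem_ker]
    funext a
    ext x
    rw [extMap_apply, h a x, sub_self]; rfl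

lemma Hm.comm (f : Hm M N) (a : Q.A) (x : M.space (Q.s a)) :
    f (Q.t a) (M.map a x) = N.map a (f (Q.s a) x) := mem_Hm.mp f.2 a x

lemma Hm.ext' {f g : Hm M N} (h : ∀ v x, f v x = g v x) : f = g :=
  Subtype.ext (funext fun v => LinearMap.ext (h v))

@[simp] lemma Hm.add_apply' {M N : Repn k Q} (f g : Hm M N) (v : Q.V) (x : M.space v) :
    (f + g : Hm M N) v x = f v x + g v x := rfl
@[simp] lemma Hm.sub_apply' {M N : Repn k Q} (f g : Hm M N) (v : Q.V) (x : M.space v) :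
    (f - g : Hm M N) v x = f v x - g v x := rfl
@[simp] lemma Hm.neg_apply' {M N : Repn k Q} (f : Hm M N) (v : Q.V) (x : M.space v) :
    (-f : Hm M N) v x = - f v x := rfl
@[simp] lemma Hm.smul_apply' {M N : Repn k Q} (c : k) (f : Hm M N) (v : Q.V) (x : M.space v) :
    (c • f : Hm M N) v x = c • f v x := rfl
@[simp] lemma Hm.zero_apply' {M N : Repn k Q} (v : Q.V) (x : M.space v) :
    (0 : Hm M N) v x = 0 := rfl

/-- Constructor. -/
def Hm.mk' (f : ∀ v, M.space v →ₗ[k] N.space v)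
    (h : ∀ a x, f (Q.t a) (M.map a x) = N.map a (f (Q.s a) x)) : Hm M N := ⟨f, mem_Hm.mpr h⟩

@[simp] lemma Hm.mk'_apply {M N : Repn k Q} (f : ∀ v, M.space v →ₗ[k] N.space v) (h) (v : Q.V) :
    (Hm.mk' f h : Hm M N) v = f v := rfl

def Hm.id (M : Repn k Q) : Hm M M := Hm.mk' (fun _ => LinearMap.id) (fun _ _ => rfl)
@[simp] lemma Hm.id_apply (M : Repn k Q) (v : Q.V) (x : M.space v) : Hm.id M v x = x := rfl

def Hm.comp (g : Hm N P) (f : Hm M N) : Hm M P :=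
  Hm.mk' (fun v => g v ∘ₗ f v) (fun a x => by simp [f.comm, g.comm])

@[simp] lemma Hm.comp_apply {M N P : Repn k Q} (g : Hm N P) (f : Hm M N) (v : Q.V)
    (x : M.space v) : g.comp f v x = g v (f v x) := rfl

/-- Post-composition as a linear map. -/
def Hm.compL (P : Repn k Q) (f : Hm M N) : Hm P M →ₗ[k] Hm P N where
  toFun g := f.comp g
  map_add' g h := Hm.ext' fun v x => by simp
  map_smul' c g := Hm.ext' fun v x => by simp

/-- Pre-composition as a linear map. -/
def Hm.compR (P : Repn k Q) (f : Hm M N) : Hm N P →ₗ[k] Hm M P where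
  toFun g := g.comp f
  map_add' g h := Hm.ext' fun v x => by simp
  map_smul' c g := Hm.ext' fun v x => by simp

@[simp] lemma Hm.compL_apply {M N : Repn k Q} (P : Repn k Q) (f : Hm M N) (g : Hm P M) :
    f.compL P g = f.comp g := rfl
@[simp] lemma Hm.compR_apply {M N : Repn k Q} (P : Repn k Q) (f : Hm M N) (g : Hm N P) :
    f.compR P g = g.comp f := rfl

lemma Hm.comp_assoc (h : Hm P R) (g : Hm N P) (f : Hm M N) :
    (h.comp g).comp f = h.comp (g.comp f) := rfl
@[simp] lemma Hm.id_comp {M N : Repn k Q} (f : Hm M N) : (Hm.id N).comp f = f := rfl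
@[simp] lemma Hm.comp_id {M N : Repn k Q} (f : Hm M N) : f.comp (Hm.id M) = f := rfl
@[simp] lemma Hm.comp_zero {M N P : Repn k Q} (f : Hm N P) : f.comp (0 : Hm M N) = 0 :=
  Hm.ext' fun v x => by simp
@[simp] lemma Hm.zero_comp {M N P : Repn k Q} (f : Hm M N) : (0 : Hm N P).comp f = 0 := rfl
lemma Hm.comp_add (f : Hm N P) (g h : Hm M N) :
    f.comp (g + h) = f.comp g + f.comp h := (f.compL M).map_add g h
lemma Hm.add_comp (f g : Hm N P) (h : Hm M N) :
    (f + g).comp h = f.comp h + g.comp h := rfl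
lemma Hm.comp_sub (f : Hm N P) (g h : Hm M N) :
    f.comp (g - h) = f.comp g - f.comp h := (f.compL M).map_sub g h
def Hm.Inj (f : Hm M N) : Prop := ∀ v, Function.Injective (f v)
def Hm.Surj (f : Hm M N) : Prop := ∀ v, Function.Surjective (f v)
def Hm.Bij (f : Hm M N) : Prop := ∀ v, Function.Bijective (f v)
lemma Hm.Bij.inj {f : Hm M N} (h : f.Bij) : f.Inj := fun v => (h v).1
lemma Hm.Bij.surj {f : Hm M N} (h : f.Bij) : f.Surj := fun v => (h v).2
lemma Hm.inj_iff {f : Hm M N} : f.Inj ↔ ∀ v x, f v x = 0 → x = 0 :=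
  forall_congr' fun v => injective_iff_map_eq_zero (f v)

lemma Hm.Inj.comp {g : Hm N P} {f : Hm M N} (hg : g.Inj) (hf : f.Inj) :
    (g.comp f).Inj := fun v => (hg v).comp (hf v)
lemma Hm.Surj.comp {g : Hm N P} {f : Hm M N} (hg : g.Surj) (hf : f.Surj) :
    (g.comp f).Surj := fun v => (hg v).comp (hf v)
lemma Hm.Bij.comp {g : Hm N P} {f : Hm M N} (hg : g.Bij) (hf : f.Bij) :
    (g.comp f).Bij := fun v => (hg v).comp (hf v)

/-- isomorphic -/
def Isom (M N : Repn k Q) : Prop := Nonempty (Iso M N)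

noncomputable def Hm.Bij.iso {M N : Repn k Q} {f : Hm M N} (h : f.Bij) : Iso M N where
  e v := LinearEquiv.ofBijective (f v) (h v)
  comm a x := f.comm a x

def Iso.hom (e : Iso M N) : Hm M N := Hm.mk' (fun v => (e.e v).toLinearMap) e.comm
@[simp] lemma Iso.hom_apply {M N : Repn k Q} (e : Iso M N) (v : Q.V) (x : M.space v) :
    e.hom v x = e.e v x := rfl

lemma Iso.hom_bij (e : Iso M N) : e.hom.Bij := fun v => (e.e v).bijective
def Iso.symm (e : Iso M N) : Iso N M where
  e v := (e.e v).symm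
  comm a x := by
    rw [LinearEquiv.symm_apply_eq, e.comm]; simp

@[simp] lemma Iso.symm_e {M N : Repn k Q} (e : Iso M N) (v : Q.V) :
    e.symm.e v = (e.e v).symm := rfl

def Iso.refl (M : Repn k Q) : Iso M M where
  e v := LinearEquiv.refl k _
  comm a x := rfl

def Iso.trans (e : Iso M N) (f : Iso N P) : Iso M P where
  e v := (e.e v).trans (f.e v)
  comm a x := by simp [e.comm, f.comm]

@[simp] lemma Iso.symm_hom_comp {M N : Repn k Q} (e : Iso M N) :
    e.symm.hom.comp e.hom = Hm.id M := Hm.ext' fun v x => by simp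
@[simp] lemma Iso.hom_comp_symm {M N : Repn k Q} (e : Iso M N) :
    e.hom.comp e.symm.hom = Hm.id N := Hm.ext' fun v x => by simp

lemma Isom.refl (M : Repn k Q) : Isom M M := ⟨Iso.refl M⟩
lemma Isom.symm : Isom M N → Isom N M := fun ⟨e⟩ => ⟨e.symm⟩
lemma Isom.trans : Isom M N → Isom N P → Isom M P :=
  fun ⟨e⟩ ⟨f⟩ => ⟨e.trans f⟩
lemma Hm.Bij.isom {f : Hm M N} (h : f.Bij) : Isom M N := ⟨h.iso⟩
lemma Iso.ext' {e f : Iso M N} (h : ∀ v x, e.e v x = f.e v x) : e = f := by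
  cases e; cases f; congr; funext v; exact LinearEquiv.ext (h v)

/-- Finite dimensional representations, as a class. -/
class FD (M : Repn k Q) : Prop where
  fd : M.FinDim

instance (M : Repn k Q) [h : FD M] (v : Q.V) : FiniteDimensional k (M.space v) := h.fd v

lemma Isom.fd (h : Isom M N) [FD M] : FD N := by
  obtain ⟨e⟩ := h
  exact ⟨fun v => Module.Finite.equiv (e.e v)⟩

lemma Isom.dimv (h : Isom M N) : dimv M = dimv N := by
  obtain ⟨e⟩ := h
  funext v
  exact (e.e v).finrank_eq

instance [FD M] [FD N] : FD (M.dsum N) :=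
  ⟨fun v => inferInstanceAs (FiniteDimensional k (M.space v × N.space v))⟩
instance {ι : Type} [Finite ι] {X : ι → Repn k Q} [∀ i, FD (X i)] : FD (dsumFam X) :=
  ⟨fun v => inferInstanceAs (FiniteDimensional k (∀ i, (X i).space v))⟩
instance [FD X] (U : Subrep X) : FD U.repn :=
  ⟨fun v => inferInstanceAs (FiniteDimensional k (U.sub v))⟩
instance [FD X] (U : Subrep X) : FD U.quot :=
  ⟨fun v => inferInstanceAs (FiniteDimensional k (X.space v ⧸ U.sub v))⟩

lemma isZero_iff_dimv [FD M] : M.IsZero ↔ dimv M = 0 := by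
  constructor
  · intro h; funext v
    have : Subsingleton (M.space v) := ⟨fun x y => by rw [h v x, h v y]⟩
    exact Module.finrank_zero_of_subsingleton
  · intro h v x
    have h1 : Module.finrank k (M.space v) = 0 := congrFun h v
    have := Module.finrank_zero_iff.mp h1
    exact Subsingleton.elim _ _

lemma Isom.isZero (h : Isom M N) (hM : M.IsZero) : N.IsZero := by
  obtain ⟨e⟩ := h
  intro v x
  have := hM v ((e.e v).symm x)
  simpa using this

lemma Isom.indec (h : Isom M N) (hM : M.Indec) : N.Indec :=
  ⟨fun hN => hM.1 (h.symm.isZero hN), fun Y Z hYZ => hM.2 Y Z (h.trans hYZ)⟩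

lemma IsZero.hom_eq (h : M.IsZero) (f : Hm M N) : f = 0 :=
  Hm.ext' fun v x => by rw [h v x]; simp
lemma IsZero.hom_eq' (h : N.IsZero) (f : Hm M N) : f = 0 :=
  Hm.ext' fun v x => h v _

lemma isZero_of_id (h : Hm.id M = 0) : M.IsZero := fun v x => by
  have := congrArg (fun f : Hm M M => f v x) h
  simpa using this

lemma IsZero.isom (h : M.IsZero) (h' : N.IsZero) : Isom M N := by
  refine Hm.Bij.isom (f := (0 : Hm M N)) fun v => ⟨fun x y _ => by rw [h v x, h v y], fun y => ⟨0, ?_⟩⟩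
  rw [h' v y]; rfl

/-! Subrepresentations -/

def Hm.ker (f : Hm M N) : Subrep M where
  sub v := LinearMap.ker (f v)
  stable a := by
    rintro _ ⟨x, hx, rfl⟩
    have hx' : f (Q.s a) x = 0 := hx
    simp [f.comm, hx']

def Hm.range (f : Hm M N) : Subrep N where
  sub v := LinearMap.range (f v)
  stable a := by
    rintro _ ⟨_, ⟨x, rfl⟩, rfl⟩
    exact ⟨M.map a x, by rw [f.comm]⟩

end Repn

namespace Subrep
open Repn
variable {k : Type} [Field k] {Q : QuiverData} {X : Repn k Q}

def incl (U : Subrep X) : Hm U.repn X := Hm.mk' (fun v => (U.sub v).subtype) (fun _ _ => rfl)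
def proj (U : Subrep X) : Hm X U.quot := Hm.mk' (fun v => (U.sub v).mkQ) (fun _ _ => rfl)
lemma incl_inj (U : Subrep X) : U.incl.Inj := fun v => Subtype.val_injective
lemma proj_surj (U : Subrep X) : U.proj.Surj := fun v => Submodule.mkQ_surjective _
@[simp] lemma incl_apply (U : Subrep X) (v : Q.V) (x : U.sub v) : U.incl v x = x.1 := rfl
lemma proj_eq_zero (U : Subrep X) (v : Q.V) (x : X.space v) : U.proj v x = 0 ↔ x ∈ U.sub v :=
  Submodule.Quotient.mk_eq_zero _

lemma ext'' {U W : Subrep X} (h : ∀ v, U.sub v = W.sub v) : U = W := by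
  cases U; cases W; congr; exact funext h

end Subrep

namespace Repn
variable {k : Type} [Field k] {Q : QuiverData}
variable {T₁ C A' B' E' R' A B E L M M' N N' P R S T T' X X' Y Z : Repn k Q}

/-- Corestriction to a subrep. -/
def Hm.cod (f : Hm M N) (U : Subrep N) (h : ∀ v x, f v x ∈ U.sub v) :
    Hm M U.repn :=
  Hm.mk' (fun v => (f v).codRestrict (U.sub v) (h v)) (fun a x => Subtype.ext (f.comm a x))

/-- Descending to the quotient. -/
def Hm.desc (f : Hm M N) (U : Subrep M) (h : ∀ v, ∀ x ∈ U.sub v, f v x = 0) :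
    Hm U.quot N :=
  Hm.mk' (fun v => (U.sub v).liftQ (f v) (fun x hx => h v x hx)) (fun a x => by
    obtain ⟨y, rfl⟩ := Submodule.mkQ_surjective _ x
    exact f.comm a y)

/-- Short exact sequences. -/
structure SES (A E B : Repn k Q) where
  i : Hm A E
  p : Hm E B
  inj : i.Inj
  surj : p.Surj
  zero : ∀ v x, p v (i v x) = 0
  ex : ∀ v y, p v y = 0 → ∃ x, i v x = y

def SES.ofSub (U : Subrep X) : SES U.repn X U.quot where
  i := U.incl
  p := U.proj
  inj := U.incl_inj
  surj := U.proj_surj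
  zero v x := (U.proj_eq_zero v _).mpr x.2
  ex v y h := ⟨⟨y, (U.proj_eq_zero v _).mp h⟩, rfl⟩

def SES.ofInj (f : Hm A E) (hf : f.Inj) : SES A E f.range.quot where
  i := f
  p := f.range.proj
  inj := hf
  surj := f.range.proj_surj
  zero v x := (f.range.proj_eq_zero v _).mpr ⟨x, rfl⟩
  ex v y h := (f.range.proj_eq_zero v _).mp h

def SES.ofSurj (f : Hm E B) (hf : f.Surj) : SES f.ker.repn E B where
  i := f.ker.incl
  p := f
  inj := f.ker.incl_inj
  surj := hf
  zero v x := x.2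
  ex v y h := ⟨⟨y, h⟩, rfl⟩

/-- image factorisation: `M → range f`. -/
def Hm.toRange (f : Hm M N) : Hm M f.range.repn :=
  f.cod f.range (fun v x => ⟨x, rfl⟩)

lemma Hm.toRange_surj (f : Hm M N) : f.toRange.Surj := by
  rintro v ⟨_, x, rfl⟩
  exact ⟨x, rfl⟩

/-- kernel–image sequence -/
def SES.kerIm (f : Hm M N) : SES f.ker.repn M f.range.repn where
  i := f.ker.incl
  p := f.toRange
  inj := f.ker.incl_inj
  surj := f.toRange_surj
  zero v x := Subtype.ext x.2
  ex v y h := ⟨⟨y, congrArg Subtype.val h⟩, rfl⟩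

def SES.congrB (σ : SES A E B) (e : Iso B B') : SES A E B' where
  i := σ.i
  p := e.hom.comp σ.p
  inj := σ.inj
  surj := e.hom_bij.surj.comp σ.surj
  zero v x := by simp [σ.zero]
  ex v y h := σ.ex v y (by simpa using h)

def SES.congrA (σ : SES A E B) (e : Iso A' A) : SES A' E B where
  i := σ.i.comp e.hom
  p := σ.p
  inj := σ.inj.comp e.hom_bij.inj
  surj := σ.surj
  zero v x := by simp [σ.zero]
  ex v y h := by
    obtain ⟨x, rfl⟩ := σ.ex v y h
    exact ⟨(e.e v).symm x, by simp⟩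

def SES.congrE (σ : SES A E B) (e : Iso E E') : SES A E' B where
  i := e.hom.comp σ.i
  p := σ.p.comp e.symm.hom
  inj := e.hom_bij.inj.comp σ.inj
  surj := σ.surj.comp e.symm.hom_bij.surj
  zero v x := by simp [σ.zero]
  ex v y h := by
    obtain ⟨x, hx⟩ := σ.ex v _ h
    exact ⟨x, by simp [hx]⟩

lemma SES.dimv (σ : SES A E B) [FD E] (v : Q.V) :
    dimv E v = dimv A v + dimv B v := by
  have h1 := LinearMap.finrank_range_add_finrank_ker (σ.p v)
  have h2 : LinearMap.ker (σ.p v) = LinearMap.range (σ.i v) := by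
    ext y; constructor
    · intro h; exact σ.ex v y h
    · rintro ⟨x, rfl⟩; exact σ.zero v x
  rw [h2, LinearMap.finrank_range_of_inj (σ.inj v),
    LinearMap.range_eq_top.mpr (σ.surj v), finrank_top] at h1
  unfold Repn.dimv
  omega

lemma Hm.Inj.fd {f : Hm A E} (hf : f.Inj) [FD E] : FD A :=
  ⟨fun v => Module.Finite.of_injective (f v) (hf v)⟩
lemma Hm.Surj.fd {f : Hm E B} (hf : f.Surj) [FD E] : FD B :=
  ⟨fun v => Module.Finite.of_surjective (f v) (hf v)⟩
lemma SES.fdA (σ : SES A E B) [FD E] : FD A := σ.inj.fd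
lemma SES.fdB (σ : SES A E B) [FD E] : FD B := σ.surj.fd
lemma SES.fdE (σ : SES A E B) [FD A] [FD B] : FD E := by
  refine ⟨fun v => ?_⟩
  have h2 : LinearMap.ker (σ.p v) = LinearMap.range (σ.i v) := by
    ext y; constructor
    · intro h; exact σ.ex v y h
    · rintro ⟨x, rfl⟩; exact σ.zero v x
  have : FiniteDimensional k (LinearMap.range (σ.p v)) := inferInstance
  have : FiniteDimensional k (LinearMap.ker (σ.p v)) := by rw [h2]; infer_instance
  have : FiniteDimensional k (E.space v ⧸ LinearMap.ker (σ.p v)) :=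
    Module.Finite.equiv ((σ.p v).quotKerEquivRange).symm
  exact Module.Finite.of_submodule_quotient (LinearMap.ker (σ.p v))

/-- Factoring through a mono. -/
lemma SES.factorA (σ : SES A E B) (f : Hm Y E)
    (h : σ.p.comp f = 0) : ∃ g : Hm Y A, σ.i.comp g = f := by
  have h1 : ∀ v y, ∃ x, σ.i v x = f v y := fun v y => σ.ex v _ (by
    have := congrArg (fun g : Hm Y B => g v y) h; exact this)
  let e : ∀ v, A.space v ≃ₗ[k] LinearMap.range (σ.i v) := fun v =>
    LinearEquiv.ofInjective (σ.i v) (σ.inj v)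
  have he : ∀ v (z : LinearMap.range (σ.i v)), σ.i v ((e v).symm z) = z.1 := fun v z => by
    have : (e v ((e v).symm z)).1 = z.1 := by rw [LinearEquiv.apply_symm_apply]
    exact this
  refine ⟨Hm.mk' (fun v => (e v).symm.toLinearMap ∘ₗ (f v).codRestrict _ (h1 v)) ?_, ?_⟩
  · intro a x
    apply σ.inj
    rw [σ.i.comm]
    simp only [Hm.mk'_apply, LinearMap.comp_apply, LinearEquiv.coe_coe, he]
    exact f.comm a x
  · apply Hm.ext'
    intro v x
    exact he v _

/-- Factoring through an epi. -/
lemma SES.factorB (σ : SES A E B) (f : Hm E Y)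
    (h : f.comp σ.i = 0) : ∃ g : Hm B Y, g.comp σ.p = f := by
  have h1 : ∀ v y, σ.p v y = 0 → f v y = 0 := fun v y hy => by
    obtain ⟨x, rfl⟩ := σ.ex v y hy
    exact congrArg (fun g : Hm A Y => g v x) h
  choose s hs using fun v => ((σ.p v).exists_rightInverse_of_surjective
    (LinearMap.range_eq_top.mpr (σ.surj v)))
  have hs' : ∀ v b, σ.p v (s v b) = b := fun v b => LinearMap.congr_fun (hs v) b
  have key : ∀ v y, f v (s v (σ.p v y)) = f v y := fun v y => by
    rw [← sub_eq_zero, ← map_sub]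
    exact h1 v _ (by simp [hs'])
  refine ⟨Hm.mk' (fun v => f v ∘ₗ s v) ?_, Hm.ext' key⟩
  intro a x
  obtain ⟨y, rfl⟩ := σ.surj _ x
  rw [← σ.p.comm]
  simp [key, f.comm]

/-- Retractions split. -/
lemma isom_dsum_of_retract (i : Hm A M) (r : Hm M A)
    (h : r.comp i = Hm.id A) : Isom M (A.dsum r.ker.repn) := by
  have h' : ∀ v x, r v (i v x) = x := fun v x => congrArg (fun g : Hm A A => g v x) h
  let j : Hm M r.ker.repn := (Hm.id M - i.comp r).cod r.ker (fun v x => by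
    change r v _ = 0
    simp [h'])
  have hj : ∀ v x, (j v x : r.ker.sub v).1 = x - i v (r v x) := fun v x => rfl
  refine Hm.Bij.isom (f := Hm.mk' (fun v => (r v).prod (j v)) ?_) ?_
  · intro a x
    exact Prod.ext (r.comm a x) (j.comm a x)
  · intro v
    constructor
    · rw [injective_iff_map_eq_zero]
      intro x hx
      have h1 : r v x = 0 := congrArg Prod.fst hx
      have h2 : j v x = 0 := congrArg Prod.snd hx
      have h3 : (j v x : r.ker.sub v).1 = 0 := congrArg Subtype.val h2
      rw [hj, h1] at h3; simpa using h3
    · rintro ⟨y, z⟩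
      refine ⟨i v y + (z : r.ker.sub v).1, ?_⟩
      have hz : r v (z : r.ker.sub v).1 = 0 := z.2
      refine Prod.ext ?_ (Subtype.ext ?_)
      · change r v _ = y
        simp [h', hz]
      · change (j v _ : r.ker.sub v).1 = _
        rw [hj]; simp [h', hz]

def inl (M N : Repn k Q) : Hm M (M.dsum N) :=
  Hm.mk' (fun v => LinearMap.inl k _ _) (fun a x => by
    refine Prod.ext rfl ?_; exact ((N.map a).map_zero).symm)
def inr (M N : Repn k Q) : Hm N (M.dsum N) :=
  Hm.mk' (fun v => LinearMap.inr k _ _) (fun a x => by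
    refine Prod.ext ?_ rfl; exact ((M.map a).map_zero).symm)
def fst (M N : Repn k Q) : Hm (M.dsum N) M := Hm.mk' (fun v => LinearMap.fst k _ _) (fun a x => rfl)
def snd (M N : Repn k Q) : Hm (M.dsum N) N := Hm.mk' (fun v => LinearMap.snd k _ _) (fun a x => rfl)
@[simp] lemma fst_inl (M N : Repn k Q) : (fst M N).comp (inl M N) = Hm.id M := rfl
@[simp] lemma snd_inr (M N : Repn k Q) : (snd M N).comp (inr M N) = Hm.id N := rfl
@[simp] lemma fst_inr (M N : Repn k Q) : (fst M N).comp (inr M N) = 0 := rfl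
lemma dsum_id (M N : Repn k Q) : (inl M N).comp (fst M N) + (inr M N).comp (snd M N) = Hm.id _ :=
  Hm.ext' fun v x => by
    refine Prod.ext ?_ ?_
    · exact add_zero _
    · exact zero_add _

def SES.dsum (M N : Repn k Q) : SES M (M.dsum N) N where
  i := inl M N
  p := snd M N
  inj v x y h := congrArg Prod.fst h
  surj v y := ⟨(0, y), rfl⟩
  zero v x := rfl
  ex v y h := ⟨y.1, Prod.ext rfl h.symm⟩

lemma indec_retract (hX : X.Indec) (i : Hm A X) (r : Hm X A)
    (h : r.comp i = Hm.id A) (hA : ¬ A.IsZero) : i.Bij := by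
  have h' : ∀ v x, r v (i v x) = x := fun v x => congrArg (fun g : Hm A A => g v x) h
  have h1 := hX.2 _ _ (isom_dsum_of_retract i r h)
  have h2 : r.ker.repn.IsZero := h1.resolve_left hA
  intro v
  refine ⟨(Function.LeftInverse.injective (h' v)), fun y => ⟨r v y, ?_⟩⟩
  have h3 : r v (y - i v (r v y)) = 0 := by simp [h']
  have h4 := h2 v ⟨y - i v (r v y), h3⟩
  have h5 : y - i v (r v y) = 0 := congrArg Subtype.val h4
  exact (sub_eq_zero.mp h5).symm

/-- Isomorphism class of complements: swap. -/
lemma dsum_comm (M N : Repn k Q) : Isom (M.dsum N) (N.dsum M) :=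
  ⟨{ e := fun v => LinearEquiv.prodComm k (M.space v) (N.space v), comm := fun a x => rfl }⟩
lemma dsum_assoc (M N P : Repn k Q) : Isom ((M.dsum N).dsum P) (M.dsum (N.dsum P)) :=
  ⟨{ e := fun v => LinearEquiv.prodAssoc k (M.space v) (N.space v) (P.space v),
     comm := fun a x => rfl }⟩
lemma dsum_congr : Isom M M' → Isom N N' → Isom (M.dsum N) (M'.dsum N') :=
  fun ⟨e⟩ ⟨f⟩ => ⟨{
    e := fun v => LinearEquiv.prodCongr (e.e v) (f.e v)
    comm := fun a x => Prod.ext (e.comm a x.1) (f.comm a x.2) }⟩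
lemma dsum_zero (h : N.IsZero) : Isom (M.dsum N) M := by
  refine Hm.Bij.isom (f := fst M N) fun v => ⟨?_, fun y => ⟨(y, 0), rfl⟩⟩
  intro x y hxy
  exact Prod.ext hxy ((h v _).trans (h v _).symm)
lemma zero_dsum (h : M.IsZero) : Isom (M.dsum N) N :=
  (dsum_comm M N).trans (dsum_zero h)

lemma dimv_dsum (M N : Repn k Q) [FD M] [FD N] (v : Q.V) :
    dimv (M.dsum N) v = dimv M v + dimv N v := (SES.dsum M N).dimv v

end Repn
end

noncomputable section
namespace Repn
variable {k : Type} [Field k] {Q : QuiverData}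
variable {T₁ C A' B' E' R' A B E L M M' N N' P R S T T' X X' Y Z : Repn k Q}

/-- integral dimension vector -/
abbrev dz (M : Repn k Q) : Q.V → ℤ := natc (dimv M)
lemma SES.dz (σ : SES A E B) [FD E] : dz E = dz A + dz B := by
  funext v
  simp [Repn.dz, natc, σ.dimv v]

lemma Isom.dz (h : Isom M N) : dz M = dz N := by
  unfold Repn.dz; rw [h.dimv]

lemma dz_dsum (M N : Repn k Q) [FD M] [FD N] : dz (M.dsum N) = dz M + dz N := (SES.dsum M N).dz

/-- total dimension -/
def tdim (M : Repn k Q) : ℕ := ∑ v, dimv M v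
lemma SES.tdim (σ : SES A E B) [FD E] : tdim E = tdim A + tdim B := by
  simp [Repn.tdim, σ.dimv, Finset.sum_add_distrib]

lemma Isom.tdim (h : Isom M N) : tdim M = tdim N := by
  unfold Repn.tdim; rw [h.dimv]

lemma tdim_eq_zero [FD M] : tdim M = 0 ↔ M.IsZero := by
  rw [isZero_iff_dimv, Repn.tdim, Finset.sum_eq_zero_iff]
  constructor
  · intro h; funext v; exact h v (Finset.mem_univ v)
  · intro h v _; rw [h]; rfl

lemma tdim_pos [FD M] (h : ¬ M.IsZero) : 0 < tdim M :=
  Nat.pos_of_ne_zero fun h0 => h (tdim_eq_zero.mp h0)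

lemma Hm.Inj.dimv_le {f : Hm A E} (hf : f.Inj) [FD E] (v : Q.V) :
    dimv A v ≤ dimv E v := LinearMap.finrank_le_finrank_of_injective (hf v)

lemma Hm.Surj.dimv_le {f : Hm A E} (hf : f.Surj) [FD A] (v : Q.V) :
    dimv E v ≤ dimv A v := LinearMap.finrank_le_finrank_of_surjective (hf v)

lemma Hm.Inj.bij_of_dimv {f : Hm A E} (hf : f.Inj) [FD A] [FD E]
    (h : ∀ v, dimv E v ≤ dimv A v) : f.Bij := fun v =>
  ⟨hf v, (LinearMap.injective_iff_surjective_of_finrank_eq_finrank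
    (le_antisymm (hf.dimv_le v) (h v))).mp (hf v)⟩

lemma Hm.Inj.bij_of_tdim {f : Hm A E} (hf : f.Inj) [FD A] [FD E]
    (h : tdim E ≤ tdim A) : f.Bij := by
  refine hf.bij_of_dimv fun v => ?_
  have h1 : ∀ v ∈ Finset.univ, dimv A v ≤ dimv E v := fun v _ => hf.dimv_le v
  have h2 := (Finset.sum_eq_sum_iff_of_le h1).mp (le_antisymm (Finset.sum_le_sum h1) h)
  exact (h2 v (Finset.mem_univ v)).ge

instance (M N : Repn k Q) [FD M] [FD N] : FiniteDimensional k (Hm M N) :=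
  inferInstanceAs (FiniteDimensional k ↥(LinearMap.ker (extMap M N)))

lemma homDim_eq (M N : Repn k Q) : homDim M N = Module.finrank k (Hm M N) := rfl
lemma homDim_eq_zero [FD M] [FD N] : homDim M N = 0 ↔ ∀ f : Hm M N, f = 0 := by
  rw [homDim_eq, Module.finrank_zero_iff]
  exact ⟨fun h f => Subsingleton.elim _ _, fun h => ⟨fun f g => by rw [h f, h g]⟩⟩

lemma homDim_ne_zero [FD M] [FD N] :
    homDim M N ≠ 0 ↔ ∃ f : Hm M N, f ≠ 0 := by
  rw [Ne, homDim_eq_zero]; push Not; rfl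

lemma homDim_pos_of [FD M] [FD N] {f : Hm M N} (h : f ≠ 0) : 0 < homDim M N :=
  Nat.pos_of_ne_zero (homDim_ne_zero.mpr ⟨f, h⟩)

/-- one-cochains -/
abbrev C1 (M N : Repn k Q) := ∀ a : Q.A, M.space (Q.s a) →ₗ[k] N.space (Q.t a)
def Ext (M N : Repn k Q) : Type := C1 M N ⧸ LinearMap.range (extMap M N)

instance (M N : Repn k Q) : AddCommGroup (Ext M N) :=
  inferInstanceAs (AddCommGroup (C1 M N ⧸ LinearMap.range (extMap M N)))
instance (M N : Repn k Q) : Module k (Ext M N) :=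
  inferInstanceAs (Module k (C1 M N ⧸ LinearMap.range (extMap M N)))
instance (M N : Repn k Q) [FD M] [FD N] : FiniteDimensional k (Ext M N) :=
  inferInstanceAs (FiniteDimensional k (C1 M N ⧸ LinearMap.range (extMap M N)))

lemma extDim_eq (M N : Repn k Q) : extDim M N = Module.finrank k (Ext M N) := rfl
def Ext.mk (M N : Repn k Q) : C1 M N →ₗ[k] Ext M N := (LinearMap.range (extMap M N)).mkQ

lemma Ext.mk_surj (M N : Repn k Q) : Function.Surjective (Ext.mk M N) :=
  Submodule.mkQ_surjective _

lemma Ext.mk_eq_zero {c : C1 M N} :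
    Ext.mk M N c = 0 ↔ ∃ f, extMap M N f = c := by
  exact Submodule.Quotient.mk_eq_zero (LinearMap.range (extMap M N)) (x := c)

lemma Ext.mk_extMap (f) : Ext.mk M N (extMap M N f) = 0 :=
  Ext.mk_eq_zero.mpr ⟨f, rfl⟩

/-- Euler form identity -/
lemma euler (M N : Repn k Q) [FD M] [FD N] :
    (homDim M N : ℤ) - extDim M N = eulerZ Q (dz M) (dz N) := by
  have h1 := LinearMap.finrank_range_add_finrank_ker (extMap M N)
  have h2 := Submodule.finrank_quotient_add_finrank (LinearMap.range (extMap M N))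
  have h3 : Module.finrank k (∀ v, M.space v →ₗ[k] N.space v) = ∑ v, dimv M v * dimv N v := by
    rw [Module.finrank_pi_fintype]
    exact Finset.sum_congr rfl fun v _ => Module.finrank_linearMap _ _ _ _
  have h4 : Module.finrank k (C1 M N) = ∑ a, dimv M (Q.s a) * dimv N (Q.t a) := by
    rw [Module.finrank_pi_fintype]
    exact Finset.sum_congr rfl fun v _ => Module.finrank_linearMap _ _ _ _
  have h5 : eulerZ Q (dz M) (dz N) = ((∑ v, dimv M v * dimv N v : ℕ) : ℤ)
      - ((∑ a, dimv M (Q.s a) * dimv N (Q.t a) : ℕ) : ℤ) := by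
    simp [eulerZ, natc]
  rw [h5, ← h3, ← h4]
  unfold homDim extDim
  unfold C1 at *
  omega

lemma eulerZ_add_left (x y z : Q.V → ℤ) : eulerZ Q (x + y) z = eulerZ Q x z + eulerZ Q y z := by
  simp only [eulerZ, Pi.add_apply, add_mul, Finset.sum_add_distrib]; ring
lemma eulerZ_add_right (x y z : Q.V → ℤ) : eulerZ Q z (x + y) = eulerZ Q z x + eulerZ Q z y := by
  simp only [eulerZ, Pi.add_apply, mul_add, Finset.sum_add_distrib]; ring
lemma eulerZ_smul_left (c : ℤ) (x z : Q.V → ℤ) : eulerZ Q (c • x) z = c * eulerZ Q x z := by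
  simp only [eulerZ, Pi.smul_apply, smul_eq_mul, mul_sub, Finset.mul_sum, mul_assoc]
lemma eulerZ_smul_right (c : ℤ) (x z : Q.V → ℤ) : eulerZ Q z (c • x) = c * eulerZ Q z x := by
  simp only [eulerZ, Pi.smul_apply, smul_eq_mul, mul_sub, Finset.mul_sum, mul_left_comm]
lemma eulerZ_zero_right (z : Q.V → ℤ) : eulerZ Q z 0 = 0 := by simp [eulerZ]
lemma eulerZ_neg_left (x z : Q.V → ℤ) : eulerZ Q (-x) z = - eulerZ Q x z := by
  have := eulerZ_smul_left (-1) x z; simpa using this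
lemma eulerZ_neg_right (x z : Q.V → ℤ) : eulerZ Q z (-x) = - eulerZ Q z x := by
  have := eulerZ_smul_right (-1) x z; simpa using this
lemma eulerZ_sub_left (x y z : Q.V → ℤ) : eulerZ Q (x - y) z = eulerZ Q x z - eulerZ Q y z := by
  rw [sub_eq_add_neg, eulerZ_add_left, eulerZ_neg_left]; ring
lemma eulerZ_sub_right (x y z : Q.V → ℤ) : eulerZ Q z (x - y) = eulerZ Q z x - eulerZ Q z y := by
  rw [sub_eq_add_neg, eulerZ_add_right, eulerZ_neg_right]; ring

/-! exactness -/

lemma Hm.Inj.compL_inj {f : Hm M N} (hf : f.Inj) (P : Repn k Q) :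
    Function.Injective (f.compL P) := fun g h e => Hm.ext' fun v x =>
  hf v (congrArg (fun z : Hm P N => z v x) e)

lemma Hm.Surj.compR_inj {f : Hm M N} (hf : f.Surj) (P : Repn k Q) :
    Function.Injective (f.compR P) := fun g h e => Hm.ext' fun v x => by
  obtain ⟨y, rfl⟩ := hf v x
  exact (congrArg (fun z : Hm M P => z v y) e)

lemma SES.range_compL (σ : SES A E B) (Y : Repn k Q) :
    LinearMap.range (σ.i.compL Y) = LinearMap.ker (σ.p.compL Y) := by
  ext f
  constructor
  · rintro ⟨g, rfl⟩
    exact Hm.ext' fun v x => σ.zero v _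
  · intro h
    exact σ.factorA f h

lemma SES.range_compR (σ : SES A E B) (Y : Repn k Q) :
    LinearMap.range (σ.p.compR Y) = LinearMap.ker (σ.i.compR Y) := by
  ext f
  constructor
  · rintro ⟨g, rfl⟩
    exact Hm.ext' fun v x => by simp [σ.zero]
  · intro h
    exact σ.factorB f h

lemma SES.finrank_range_compL (σ : SES A E B) (Y : Repn k Q) [FD E] [FD Y] :
    Module.finrank k (LinearMap.range (σ.p.compL Y)) + homDim Y A = homDim Y E := by
  have := σ.fdA
  rw [homDim_eq, homDim_eq, ← LinearMap.finrank_range_add_finrank_ker (σ.p.compL Y),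
    ← σ.range_compL, LinearMap.finrank_range_of_inj (σ.inj.compL_inj Y)]

lemma SES.finrank_range_compR (σ : SES A E B) (Y : Repn k Q) [FD E] [FD Y] :
    Module.finrank k (LinearMap.range (σ.i.compR Y)) + homDim B Y = homDim E Y := by
  have := σ.fdB
  rw [homDim_eq, homDim_eq, ← LinearMap.finrank_range_add_finrank_ker (σ.i.compR Y),
    ← σ.range_compR, LinearMap.finrank_range_of_inj (σ.surj.compR_inj Y)]

lemma SES.hom_le_add_left (σ : SES A E B) (Y : Repn k Q) [FD E] [FD Y] :
    homDim Y E ≤ homDim Y A + homDim Y B := by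
  have := σ.finrank_range_compL Y
  have := σ.fdB
  have h2 : Module.finrank k (LinearMap.range (σ.p.compL Y)) ≤ homDim Y B :=
    Submodule.finrank_le _
  omega
lemma SES.hom_le_add_right (σ : SES A E B) (Y : Repn k Q) [FD E] [FD Y] :
    homDim E Y ≤ homDim A Y + homDim B Y := by
  have := σ.finrank_range_compR Y
  have := σ.fdA
  have h2 : Module.finrank k (LinearMap.range (σ.i.compR Y)) ≤ homDim A Y :=
    Submodule.finrank_le _
  omega

lemma SES.euler_left (σ : SES A E B) (Y : Repn k Q) [FD E] [FD Y] :
    (homDim Y E : ℤ) - extDim Y E = (homDim Y A - extDim Y A) + (homDim Y B - extDim Y B) := by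
  have := σ.fdA
  have := σ.fdB
  rw [euler, euler, euler, σ.dz, eulerZ_add_right]
lemma SES.euler_right (σ : SES A E B) (Y : Repn k Q) [FD E] [FD Y] :
    (homDim E Y : ℤ) - extDim E Y = (homDim A Y - extDim A Y) + (homDim B Y - extDim B Y) := by
  have := σ.fdA
  have := σ.fdB
  rw [euler, euler, euler, σ.dz, eulerZ_add_left]

def Ext.push (M : Repn k Q) (g : Hm N N') : Ext M N →ₗ[k] Ext M N' :=
  Submodule.mapQ _ _
    (LinearMap.pi fun a => (LinearMap.llcomp k _ _ _ (g (Q.t a))).comp (LinearMap.proj a))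
    (by
      rintro _ ⟨f, rfl⟩
      refine ⟨fun v => g v ∘ₗ f v, ?_⟩
      funext a; ext x
      simp [extMap_apply, g.comm])

def Ext.pull (N : Repn k Q) (g : Hm M' M) : Ext M N →ₗ[k] Ext M' N :=
  Submodule.mapQ _ _
    (LinearMap.pi fun a => (LinearMap.lcomp k _ (g (Q.s a))).comp (LinearMap.proj a))
    (by
      rintro _ ⟨f, rfl⟩
      refine ⟨fun v => f v ∘ₗ g v, ?_⟩
      funext a; ext x
      simp [extMap_apply, g.comm])

lemma Ext.push_mk (M : Repn k Q) (g : Hm N N') (c : C1 M N) :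
    Ext.push M g (Ext.mk M N c) = Ext.mk M N' (fun a => g (Q.t a) ∘ₗ c a) := rfl
lemma Ext.pull_mk (N : Repn k Q) (g : Hm M' M) (c : C1 M N) :
    Ext.pull N g (Ext.mk M N c) = Ext.mk M' N (fun a => c a ∘ₗ g (Q.s a)) := rfl

lemma Ext.ind {P : Ext M N → Prop} (h : ∀ c, P (Ext.mk M N c)) (x) : P x := by
  obtain ⟨c, rfl⟩ := Ext.mk_surj M N x
  exact h c

lemma Ext.push_comp {N N' N'' : Repn k Q} (M : Repn k Q) (h : Hm N' N'') (g : Hm N N') (x) :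
    Ext.push M (h.comp g) x = Ext.push M h (Ext.push M g x) := by
  induction x using Ext.ind with | h c => rfl
lemma Ext.pull_comp {M M' M'' : Repn k Q} (N : Repn k Q) (h : Hm M' M) (g : Hm M'' M') (x) :
    Ext.pull N (h.comp g) x = Ext.pull N g (Ext.pull N h x) := by
  induction x using Ext.ind with | h c => rfl
lemma Ext.push_pull (h : Hm M' M) (g : Hm N N') (x) :
    Ext.push M' g (Ext.pull N h x) = Ext.pull N' h (Ext.push M g x) := by
  induction x using Ext.ind with | h c => rfl
lemma Ext.push_id (M : Repn k Q) (x) : Ext.push M (Hm.id N) x = x := by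
  induction x using Ext.ind with | h c => rfl
lemma Ext.pull_id (N : Repn k Q) (x) : Ext.pull N (Hm.id M) x = x := by
  induction x using Ext.ind with | h c => rfl
lemma Ext.push_add (M : Repn k Q) (g h : Hm N N') (x) :
    Ext.push M (g + h) x = Ext.push M g x + Ext.push M h x := by
  induction x using Ext.ind with | h c => rfl
lemma Ext.push_smul (M : Repn k Q) (r : k) (h : Hm N N') (x) :
    Ext.push M (r • h) x = r • Ext.push M h x := by
  induction x using Ext.ind with | h c => rfl
lemma Ext.pull_add (N : Repn k Q) (g h : Hm M' M) (x) :
    Ext.pull N (g + h) x = Ext.pull N g x + Ext.pull N h x := by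
  induction x using Ext.ind with
  | h c => rw [Ext.pull_mk, Ext.pull_mk, Ext.pull_mk, ← map_add]; congr 1; funext a; ext y; simp
lemma Ext.pull_smul (N : Repn k Q) (r : k) (h : Hm M' M) (x) :
    Ext.pull N (r • h) x = r • Ext.pull N h x := by
  induction x using Ext.ind with
  | h c => rw [Ext.pull_mk, Ext.pull_mk, ← map_smul]; congr 1; funext a; ext y; simp

lemma Hm.Surj.push_surj {g : Hm N N'} (hg : g.Surj) (M : Repn k Q) :
    Function.Surjective (Ext.push M g) := by
  intro x
  induction x using Ext.ind with
  | h c =>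
    choose s hs using fun v => ((g v).exists_rightInverse_of_surjective
      (LinearMap.range_eq_top.mpr (hg v)))
    refine ⟨Ext.mk M N (fun a => s _ ∘ₗ c a), ?_⟩
    rw [Ext.push_mk]
    congr 1; funext a
    rw [← LinearMap.comp_assoc, hs, LinearMap.id_comp]

lemma Hm.Inj.pull_surj {g : Hm M' M} (hg : g.Inj) (N : Repn k Q) :
    Function.Surjective (Ext.pull N g) := by
  intro x
  induction x using Ext.ind with
  | h c =>
    choose s hs using fun v => ((g v).exists_leftInverse_of_injective
      (LinearMap.ker_eq_bot.mpr (hg v)))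
    refine ⟨Ext.mk M N (fun a => c a ∘ₗ s _), ?_⟩
    rw [Ext.pull_mk]
    congr 1; funext a
    rw [LinearMap.comp_assoc, hs, LinearMap.comp_id]

lemma Hm.Surj.ext_le {g : Hm N N'} (hg : g.Surj) (M : Repn k Q) [FD M] [FD N] :
    extDim M N' ≤ extDim M N :=
  LinearMap.finrank_le_finrank_of_surjective (hg.push_surj M)
lemma Hm.Inj.ext_le {g : Hm M' M} (hg : g.Inj) (N : Repn k Q) [FD M] [FD N] :
    extDim M' N ≤ extDim M N :=
  LinearMap.finrank_le_finrank_of_surjective (hg.pull_surj N)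

lemma extDim_eq_zero [FD M] [FD N] : extDim M N = 0 ↔ ∀ x : Ext M N, x = 0 := by
  rw [extDim_eq, Module.finrank_zero_iff]
  exact ⟨fun h f => Subsingleton.elim _ _, fun h => ⟨fun f g => by rw [h f, h g]⟩⟩

lemma SES.extend (σ : SES A E B) [FD E] [FD Z]
    (h : extDim B Z = 0) (g : Hm A Z) : ∃ f : Hm E Z, f.comp σ.i = g := by
  have := σ.fdA
  have h1 := σ.finrank_range_compR Z
  have h2 := σ.euler_right Z
  have h3 := σ.inj.ext_le Z
  have h4 : LinearMap.range (σ.i.compR Z) = ⊤ := by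
    apply Submodule.eq_top_of_finrank_eq
    apply le_antisymm (Submodule.finrank_le _)
    rw [← homDim_eq]
    omega
  have h5 : g ∈ LinearMap.range (σ.i.compR Z) := by rw [h4]; trivial
  exact h5

lemma SES.lift (σ : SES A E B) [FD E] [FD Z]
    (h : extDim Z A = 0) (g : Hm Z B) : ∃ f : Hm Z E, σ.p.comp f = g := by
  have := σ.fdB
  have h1 := σ.finrank_range_compL Z
  have h2 := σ.euler_left Z
  have h3 := σ.surj.ext_le Z
  have h4 : LinearMap.range (σ.p.compL Z) = ⊤ := by
    apply Submodule.eq_top_of_finrank_eq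
    apply le_antisymm (Submodule.finrank_le _)
    rw [← homDim_eq]
    omega
  have h5 : g ∈ LinearMap.range (σ.p.compL Z) := by rw [h4]; trivial
  exact h5

/-- splitting -/
def SES.Split (σ : SES A E B) : Prop := ∃ r : Hm E A, r.comp σ.i = Hm.id A
lemma SES.split_of_ext (σ : SES A E B) [FD E] (h : extDim B A = 0) :
    σ.Split := by
  have := σ.fdA
  exact σ.extend h _

lemma SES.quot_isom (σ : SES A E B) : Isom σ.i.range.quot B := by
  refine Hm.Bij.isom (f := σ.p.desc σ.i.range (by rintro v _ ⟨x, rfl⟩; exact σ.zero v x))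
    fun v => ⟨?_, ?_⟩
  · rw [injective_iff_map_eq_zero]
    intro x hx
    obtain ⟨y, rfl⟩ := σ.i.range.proj_surj v x
    exact (σ.i.range.proj_eq_zero v y).mpr (σ.ex v y hx)
  · intro b
    obtain ⟨y, rfl⟩ := σ.surj v b
    exact ⟨σ.i.range.proj v y, rfl⟩

lemma SES.Split.isom {σ : SES A E B} (h : σ.Split) : Isom E (A.dsum B) := by
  obtain ⟨r, hr⟩ := h
  have h' : ∀ v x, r v (σ.i v x) = x := fun v x => congrArg (fun g : Hm A A => g v x) hr
  refine Hm.Bij.isom (f := Hm.mk' (N := A.dsum B) (fun v => (r v).prod (σ.p v)) ?_) ?_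
  · intro a x
    exact Prod.ext (r.comm a x) (σ.p.comm a x)
  · intro v
    constructor
    · rw [injective_iff_map_eq_zero]
      intro x hx
      have h1 : r v x = 0 := congrArg Prod.fst hx
      have h2 : σ.p v x = 0 := congrArg Prod.snd hx
      obtain ⟨y, rfl⟩ := σ.ex v x h2
      rw [h'] at h1; rw [h1]; simp
    · rintro ⟨y, z⟩
      obtain ⟨w, rfl⟩ := σ.surj v z
      refine ⟨σ.i v (y - r v w) + w, Prod.ext ?_ ?_⟩
      · change r v _ = y
        simp [h']
      · change σ.p v _ = _
        simp [σ.zero]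

lemma SES.split_of_section (σ : SES A E B) (s : Hm B E)
    (h : σ.p.comp s = Hm.id B) : σ.Split := by
  have h' : ∀ v x, σ.p v (s v x) = x := fun v x => congrArg (fun g : Hm B B => g v x) h
  obtain ⟨r, hr⟩ := σ.factorA (Hm.id E - s.comp σ.p) (Hm.ext' fun v x => by simp [h'])
  refine ⟨r, Hm.ext' fun v x => σ.inj v ?_⟩
  have := congrArg (fun g : Hm E E => g v (σ.i v x)) hr
  simpa [σ.zero] using this

/-- the extension attached to a cocycle -/
def extn (c : C1 B A) : Repn k Q where
  space v := A.space v × B.space v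
  map a := ((A.map a).comp (LinearMap.fst k _ _) + (c a).comp (LinearMap.snd k _ _)).prod
    ((B.map a).comp (LinearMap.snd k _ _))

def SES.extn (c : C1 B A) : SES A (extn c) B where
  i := Hm.mk' (N := Repn.extn c) (fun v => LinearMap.inl k _ _) (fun a x => by
    refine Prod.ext ?_ ?_
    · change A.map a x = A.map a x + c a 0
      simp
    · change (0 : B.space _) = B.map a 0
      simp)
  p := Hm.mk' (M := Repn.extn c) (fun v => LinearMap.snd k _ _) (fun a x => rfl)
  inj v x y h := congrArg Prod.fst h
  surj v y := ⟨((0, y) : A.space v × B.space v), rfl⟩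
  zero v x := rfl
  ex v y h := ⟨Prod.fst (α := A.space v) (β := B.space v) y, Prod.ext rfl h.symm⟩

lemma exists_nonsplit [FD A] [FD B] (h : extDim B A ≠ 0) :
    ∃ (E : Repn k Q) (_ : FD E) (σ : SES A E B), ¬ σ.Split := by
  have h1 : ∃ x : Ext B A, x ≠ 0 := by
    by_contra h'; push Not at h'; exact h (extDim_eq_zero.mpr h')
  obtain ⟨x, hx⟩ := h1
  obtain ⟨c, rfl⟩ := Ext.mk_surj _ _ x
  refine ⟨extn c, (SES.extn c).fdE, SES.extn c, ?_⟩
  rintro ⟨r, hr⟩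
  apply hx
  have h' : ∀ v (x : A.space v), r v ((x, 0) : A.space v × B.space v) = x :=
    fun v x => congrArg (fun g : Hm A A => g v x) hr
  refine Ext.mk_eq_zero.mpr ⟨fun v => r v ∘ₗ (LinearMap.inr k (A.space v) (B.space v)), ?_⟩
  funext a; ext b
  rw [extMap_apply]
  have h2 := r.comm a (((0, b)) : A.space _ × B.space _)
  have h3 : (extn c).map a ((0, b) : A.space _ × B.space _)
      = (((c a b, 0) : A.space (Q.t a) × B.space (Q.t a)) + (0, B.map a b)
        : A.space (Q.t a) × B.space (Q.t a)) := by
    refine Prod.ext ?_ ?_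
    · change A.map a 0 + c a b = c a b + 0
      simp
    · change B.map a b = 0 + B.map a b
      simp
  rw [h3] at h2
  have h4 := (r (Q.t a)).map_add (((c a b, 0) : A.space (Q.t a) × B.space (Q.t a)))
    (((0, B.map a b) : A.space (Q.t a) × B.space (Q.t a)))
  have h5 := h' _ (c a b)
  rw [h5] at h4
  change A.map a (r (Q.s a) ((0, b) : A.space _ × B.space _)) - r (Q.t a) ((0, B.map a b) : A.space (Q.t a) × B.space (Q.t a)) = c a b
  rw [← h2, sub_eq_iff_eq_add]
  exact h4

def Hm.pow (f : Hm M M) (n : ℕ) : Hm M M :=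
  Hm.mk' (fun v => (f v) ^ n) (by
    intro a x
    induction n with
    | zero => rfl
    | succ n ih => rw [pow_succ', pow_succ', Module.End.mul_apply, Module.End.mul_apply, ih, f.comm])

/-- Fitting's lemma. -/
lemma fitting [FD M] (hM : M.Indec) (f : Hm M M) :
    f.Bij ∨ ∃ n, f.pow n = 0 := by
  have h1 : ∀ v, ∃ N, ∀ n ≥ N, IsCompl (LinearMap.ker ((f v) ^ n)) (LinearMap.range ((f v) ^ n)) :=
    fun v => Filter.eventually_atTop.mp (LinearMap.eventually_isCompl_ker_pow_range_pow (f v))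
  choose N hN using h1
  let n := (∑ v, N v) + 1
  have hn : ∀ v, IsCompl (LinearMap.ker ((f v) ^ n)) (LinearMap.range ((f v) ^ n)) := fun v => by
    apply hN v
    have := Finset.single_le_sum (f := N) (fun _ _ => Nat.zero_le _) (Finset.mem_univ v)
    change N v ≤ (∑ v, N v) + 1
    omega
  let g := f.pow n
  let e : Isom (g.ker.repn.dsum g.range.repn) M := by
    refine Hm.Bij.isom (f := Hm.mk' (M := g.ker.repn.dsum g.range.repn)
      (fun v => (Submodule.prodEquivOfIsCompl _ _ (hn v)).toLinearMap) ?_) fun v =>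
        (Submodule.prodEquivOfIsCompl _ _ (hn v)).bijective
    rintro a ⟨x, y⟩
    exact ((M.map a).map_add x.1 y.1).symm
  rcases hM.2 _ _ e.symm with h | h
  · left
    have hinj : f.Inj := by
      rw [Hm.inj_iff]
      intro v x hx
      have : g v x = 0 := by
        change ((f v) ^ n) x = 0
        rw [show n = (∑ v, N v) + 1 from rfl, pow_succ, Module.End.mul_apply, hx, map_zero]
      exact congrArg Subtype.val (h v ⟨x, this⟩)
    exact hinj.bij_of_tdim le_rfl
  · right
    exact ⟨n, Hm.ext' fun v x => congrArg Subtype.val (h v ⟨g v x, x, rfl⟩)⟩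

lemma bij_id_sub_of_nilp [FD M] {f : Hm M M} {n : ℕ} (h : f.pow n = 0) :
    (Hm.id M - f).Bij := by
  have hinj : (Hm.id M - f).Inj := by
    rw [Hm.inj_iff]
    intro v x hx
    have h1 : f v x = x := by
      have : x - f v x = 0 := hx
      exact (sub_eq_zero.mp this).symm
    have h2 : ∀ m, ((f v) ^ m) x = x := by
      intro m
      induction m with
      | zero => rfl
      | succ m ih => rw [pow_succ, Module.End.mul_apply, h1, ih]
    rw [← h2 n]
    exact congrArg (fun g : Hm M M => g v x) h
  exact hinj.bij_of_tdim le_rfl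

/-- local endomorphism ring -/
lemma indec_bij_of_add [FD M] (hM : M.Indec) {f g : Hm M M} (h : (f + g).Bij) :
    f.Bij ∨ g.Bij := by
  let u := h.iso
  have hu : u.hom = f + g := Hm.ext' fun v x => rfl
  have e1 : Hm.id M - u.symm.hom.comp f = u.symm.hom.comp g := by
    rw [sub_eq_iff_eq_add, ← Hm.comp_add, add_comm g f, ← hu, Iso.symm_hom_comp]
  have back : ∀ p : Hm M M, (u.symm.hom.comp p).Bij → p.Bij := by
    intro p hp
    have : u.hom.comp (u.symm.hom.comp p) = p := by
      rw [← Hm.comp_assoc, Iso.hom_comp_symm, Hm.id_comp]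
    rw [← this]
    exact u.hom_bij.comp hp
  rcases fitting hM (u.symm.hom.comp f) with h1 | ⟨n, h1⟩
  · exact Or.inl (back _ h1)
  · right
    apply back
    rw [← e1]
    exact bij_id_sub_of_nilp h1

lemma not_bij_zero (hM : ¬ M.IsZero) : ¬ (0 : Hm M N).Bij := by
  intro h
  apply hM
  intro v x
  exact (h v).1 (by simp)

def Fam.incl {ι : Type} [DecidableEq ι] (X : ι → Repn k Q) (i : ι) : Hm (X i) (dsumFam X) :=
  Hm.mk' (N := dsumFam X) (fun v => LinearMap.single k (fun j => (X j).space v) i) (fun a x => by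
    funext j
    change (Pi.single i ((X i).map a x) : ∀ j, (X j).space (Q.t a)) j
      = (X j).map a ((Pi.single i x : ∀ j, (X j).space (Q.s a)) j)
    by_cases h : j = i
    · subst h; simp
    · simp [Pi.single_eq_of_ne h])

def Fam.proj {ι : Type} (X : ι → Repn k Q) (i : ι) : Hm (dsumFam X) (X i) :=
  Hm.mk' (M := dsumFam X) (fun v => LinearMap.proj i) (fun a x => rfl)

lemma Fam.proj_incl {ι : Type} [DecidableEq ι] (X : ι → Repn k Q) (i : ι) :
    (Fam.proj X i).comp (Fam.incl X i) = Hm.id (X i) := Hm.ext' fun v x => by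
  change (Pi.single i x : ∀ j, (X j).space v) i = x
  simp

lemma Fam.proj_incl_ne {ι : Type} [DecidableEq ι] (X : ι → Repn k Q) {i j : ι} (h : j ≠ i) :
    (Fam.proj X j).comp (Fam.incl X i) = 0 := Hm.ext' fun v x => by
  change (Pi.single i x : ∀ j, (X j).space v) j = 0
  simp [h]

lemma Hm.sum_apply' {ι : Type} (s : Finset ι) (f : ι → Hm M N) (v : Q.V)
    (x : M.space v) : (∑ i ∈ s, f i) v x = ∑ i ∈ s, f i v x := by
  classical
  induction s using Finset.induction_on with
  | empty => rfl
  | insert a s ha ih => rw [Finset.sum_insert ha, Finset.sum_insert ha, ← ih]; rfl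

lemma Fam.sum_id {ι : Type} [Fintype ι] [DecidableEq ι] (X : ι → Repn k Q) :
    ∑ i, (Fam.incl X i).comp (Fam.proj X i) = Hm.id (dsumFam X) := Hm.ext' fun v x => by
  rw [Hm.sum_apply']
  exact Finset.univ_sum_single (M := fun j => (X j).space v) x

def Fam.lift {ι : Type} {X : ι → Repn k Q} (f : ∀ i, Hm Y (X i)) :
    Hm Y (dsumFam X) :=
  Hm.mk' (N := dsumFam X) (fun v => LinearMap.pi fun i => f i v) (fun a x => by
    funext i; exact (f i).comm a x)

lemma Fam.hom_ext {ι : Type} {X : ι → Repn k Q} {f g : Hm Y (dsumFam X)}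
    (h : ∀ i, (Fam.proj X i).comp f = (Fam.proj X i).comp g) : f = g := Hm.ext' fun v x => by
  funext i
  exact congrArg (fun z : Hm Y (X i) => z v x) (h i)

lemma Fam.hom_ext' {ι : Type} [Finite ι] [DecidableEq ι] {X : ι → Repn k Q}
    {f g : Hm (dsumFam X) Y} (h : ∀ i, f.comp (Fam.incl X i) = g.comp (Fam.incl X i)) : f = g := by
  have := Fintype.ofFinite ι
  rw [← Hm.comp_id f, ← Hm.comp_id g, ← Fam.sum_id X]
  refine Hm.ext' fun v x => ?_
  simp only [Hm.comp_apply, Hm.sum_apply', map_sum]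
  exact Finset.sum_congr rfl fun i _ => congrArg (fun z : Hm (X i) Y => z v (x i)) (h i)

/-- Hom into a finite family -/
def Fam.homEquiv {ι : Type} (X : ι → Repn k Q) (Y : Repn k Q) :
    Hm Y (dsumFam X) ≃ₗ[k] (∀ i, Hm Y (X i)) where
  toFun f i := (Fam.proj X i).comp f
  invFun f := Fam.lift f
  left_inv f := Fam.hom_ext fun i => rfl
  right_inv f := rfl
  map_add' f g := rfl
  map_smul' c f := rfl

/-- Hom out of a finite family -/
def Fam.homEquiv' {ι : Type} [Fintype ι] [DecidableEq ι] (X : ι → Repn k Q) (Y : Repn k Q) :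
    Hm (dsumFam X) Y ≃ₗ[k] (∀ i, Hm (X i) Y) where
  toFun f i := f.comp (Fam.incl X i)
  invFun f := ∑ i, (f i).comp (Fam.proj X i)
  left_inv f := Fam.hom_ext' fun i => by
    refine Hm.ext' fun v x => ?_
    simp only [Hm.comp_apply, Hm.sum_apply']
    rw [Finset.sum_eq_single i]
    · rw [← Hm.comp_apply (Fam.proj X i), Fam.proj_incl]; rfl
    · intro j _ hj
      rw [← Hm.comp_apply (Fam.proj X j) (Fam.incl X i), Fam.proj_incl_ne X hj]; simp
    · simp
  right_inv f := funext fun i => by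
    refine Hm.ext' fun v x => ?_
    simp only [Hm.comp_apply, Hm.sum_apply']
    rw [Finset.sum_eq_single i]
    · rw [← Hm.comp_apply (Fam.proj X i), Fam.proj_incl]; rfl
    · intro j _ hj
      rw [← Hm.comp_apply (Fam.proj X j) (Fam.incl X i), Fam.proj_incl_ne X hj]; simp
    · simp
  map_add' f g := rfl
  map_smul' c f := rfl

lemma homDim_fam_left {ι : Type} [Fintype ι] (X : ι → Repn k Q) (Y : Repn k Q)
    [∀ i, FD (X i)] [FD Y] : homDim (dsumFam X) Y = ∑ i, homDim (X i) Y := by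
  classical
  rw [homDim_eq, (Fam.homEquiv' X Y).finrank_eq, Module.finrank_pi_fintype]; rfl

lemma dimv_fam {ι : Type} [Fintype ι] (X : ι → Repn k Q) [∀ i, FD (X i)] (v : Q.V) :
    dimv (dsumFam X) v = ∑ i, dimv (X i) v :=
  Module.finrank_pi_fintype k (M := fun i => (X i).space v)

lemma dz_fam {ι : Type} [Fintype ι] (X : ι → Repn k Q) [∀ i, FD (X i)] :
    dz (dsumFam X) = ∑ i, dz (X i) := by
  funext v
  simp [dz, natc, dimv_fam]

lemma dsumFam_equiv {ι κ : Type} (X : κ → Repn k Q) (f : ι ≃ κ) :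
    Isom (dsumFam fun i => X (f i)) (dsumFam X) :=
  ⟨{
    e := fun v => LinearEquiv.piCongrLeft k (fun j => (X j).space v) f
    comm := fun a x => by
      funext j
      obtain ⟨i, rfl⟩ := f.surjective j
      have h1 := Equiv.piCongrLeft_apply_apply (fun j => (X j).space (Q.t a)) f
        ((dsumFam fun i => X (f i)).map a x) i
      have h2 := Equiv.piCongrLeft_apply_apply (fun j => (X j).space (Q.s a)) f x i
      exact h1.trans (congrArg ((X (f i)).map a) h2.symm) }⟩

lemma dsumFam_option {ι : Type} (X : Option ι → Repn k Q) :
    Isom (dsumFam X) ((X none).dsum (dsumFam fun i => X (some i))) := by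
  refine Hm.Bij.isom (f := Hm.mk' (M := dsumFam X) (N := (X none).dsum (dsumFam fun i => X (some i)))
    (fun v => (LinearMap.proj (R := k) (φ := fun j => (X j).space v) none).prod
      (LinearMap.pi fun i => LinearMap.proj (φ := fun j => (X j).space v) (some i)))
      (fun a x => rfl)) fun v => ⟨?_, ?_⟩
  · intro x y h
    funext i
    cases i with
    | none => exact congrArg Prod.fst h
    | some i => exact congrFun (congrArg Prod.snd h) i
  · rintro ⟨x, y⟩
    exact ⟨fun i => match i with
      | none => x
      | some i => y i, rfl⟩

lemma dsumFam_sum {ι κ : Type} (X : ι ⊕ κ → Repn k Q) :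
    Isom (dsumFam X) ((dsumFam fun i => X (.inl i)).dsum (dsumFam fun i => X (.inr i))) := by
  refine Hm.Bij.isom (f := Hm.mk' (M := dsumFam X)
    (N := (dsumFam fun i => X (.inl i)).dsum (dsumFam fun i => X (.inr i)))
    (fun v => (LinearMap.pi fun i => LinearMap.proj (R := k) (φ := fun j => (X j).space v) (.inl i)).prod
      (LinearMap.pi fun i => LinearMap.proj (φ := fun j => (X j).space v) (.inr i)))
      (fun a x => rfl)) fun v => ⟨?_, ?_⟩
  · intro x y h
    funext i
    cases i with
    | inl i => exact congrFun (congrArg Prod.fst h) i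
    | inr i => exact congrFun (congrArg Prod.snd h) i
  · rintro ⟨x, y⟩
    exact ⟨fun i => match i with
      | .inl i => x i
      | .inr i => y i, rfl⟩

lemma dsumFam_empty {ι : Type} [IsEmpty ι] (X : ι → Repn k Q) : (dsumFam X).IsZero :=
  fun _ _ => funext fun i => isEmptyElim i

lemma dsumFam_unique {ι : Type} [Unique ι] (X : ι → Repn k Q) : Isom (dsumFam X) (X default) := by
  refine Hm.Bij.isom (f := Fam.proj X default) fun v => ⟨?_, ?_⟩
  · intro x y h
    funext i
    rw [Unique.eq_default i]; exact h
  · intro x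
    exact ⟨fun i => (Unique.eq_default i) ▸ x, rfl⟩

/-- Existence of decompositions. -/
lemma exists_decomp (M : Repn k Q) [FD M] :
    ∃ (n : ℕ) (X : Fin n → Repn k Q), (∀ i, (X i).Indec ∧ FD (X i)) ∧ Isom M (dsumFam X) := by
  suffices H : ∀ (d : ℕ) (M : Repn k Q) [FD M], tdim M ≤ d → ∃ (ι : Type) (_ : Fintype ι)
      (X : ι → Repn k Q), (∀ i, (X i).Indec ∧ FD (X i)) ∧ Isom M (dsumFam X) by
    obtain ⟨ι, _, X, h1, h2⟩ := H _ M le_rfl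
    exact ⟨_, fun i => X ((Fintype.equivFin ι).symm i), fun i => h1 _,
      h2.trans (dsumFam_equiv X (Fintype.equivFin ι).symm).symm⟩
  intro d
  induction d with
  | zero =>
    intro M _ h
    have : M.IsZero := tdim_eq_zero.mp (by omega)
    exact ⟨Empty, inferInstance, fun i => i.elim, fun i => i.elim, this.isom (dsumFam_empty _)⟩
  | succ d ih =>
    intro M _ h
    by_cases hz : M.IsZero
    · exact ⟨Empty, inferInstance, fun i => i.elim, fun i => i.elim, hz.isom (dsumFam_empty _)⟩
    by_cases hM : M.Indec
    · exact ⟨Unit, inferInstance, fun _ => M, fun _ => ⟨hM, inferInstance⟩,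
        (dsumFam_unique fun _ : Unit => M).symm⟩
    · have : ∃ Y Z : Repn k Q, Isom M (Y.dsum Z) ∧ ¬ Y.IsZero ∧ ¬ Z.IsZero := by
        by_contra h'
        push Not at h'
        refine hM ⟨hz, fun Y Z hYZ => ?_⟩
        by_contra h2
        push Not at h2
        exact h2.2 (h' Y Z hYZ h2.1)
      obtain ⟨Y, Z, e, hY, hZ⟩ := this
      have : FD (Y.dsum Z) := e.fd
      have : FD Y := (SES.dsum Y Z).fdA
      have : FD Z := (SES.dsum Y Z).fdB
      have h1 := (SES.dsum Y Z).tdim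
      rw [← e.tdim] at h1
      have := tdim_pos hY
      have := tdim_pos hZ
      obtain ⟨ι, _, X, hX, eX⟩ := ih Y (by omega)
      obtain ⟨κ, _, X', hX', eX'⟩ := ih Z (by omega)
      refine ⟨ι ⊕ κ, inferInstance, Sum.elim X X', ?_, ?_⟩
      · rintro (i | i)
        · exact hX i
        · exact hX' i
      · exact e.trans ((dsum_congr eX eX').trans (dsumFam_sum (Sum.elim X X')).symm)

end Repn
end

noncomputable section
namespace Repn
/-- Standing hypotheses. -/
structure Aff (Q : QuiverData) (δ : Q.V → ℕ) : Prop where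
  aff : IsAffine Q
  nc : ¬ IsOrientedCycle Q
  min : IsMinImagRoot Q δ

abbrev opQ (Q : QuiverData) : QuiverData where
  V := Q.V
  A := Q.A
  s := Q.t
  t := Q.s

lemma eulerZ_op (Q : QuiverData) (x y : Q.V → ℤ) : eulerZ (opQ Q) x y = eulerZ Q y x := by
  change (∑ v : Q.V, x v * y v) - ∑ a : Q.A, x (Q.t a) * y (Q.s a) = _
  unfold eulerZ
  congr 1
  · exact Finset.sum_congr rfl fun _ _ => mul_comm _ _
  · exact Finset.sum_congr rfl fun _ _ => mul_comm _ _

namespace Aff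

variable {Q : QuiverData} {δ : Q.V → ℕ}

lemma op (H : Aff Q δ) : Aff (opQ Q) (δ : (opQ Q).V → ℕ) := by
  have ht : ∀ x : Q.V → ℤ, titsZ (opQ Q) x = titsZ Q x := fun x => eulerZ_op Q x x
  refine ⟨⟨?_, ?_, ?_⟩, ?_, ?_⟩
  · intro u v
    refine Relation.ReflTransGen.mono (fun x y => ?_) u v (H.aff.1 u v)
    rintro ⟨a, h⟩
    exact ⟨a, h.symm.imp And.symm And.symm⟩
  · intro d; rw [show titsZ (opQ Q) d = titsZ Q d from ht d]; exact H.aff.2.1 d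
  · obtain ⟨d, h1, h2⟩ := H.aff.2.2
    exact ⟨d, h1, (ht d).trans h2⟩
  · intro h
    exact H.nc fun v => ⟨(h v).2, (h v).1⟩
  · refine ⟨H.min.1, (ht _).trans H.min.2.1, fun d h1 h2 v => H.min.2.2 d h1 ((ht _).symm.trans h2) v⟩

lemma q_nonneg (H : Aff Q δ) (x : Q.V → ℤ) : 0 ≤ eulerZ Q x x := H.aff.2.1 x
lemma rad_of (H : Aff Q δ) {x : Q.V → ℤ} (hx : eulerZ Q x x = 0) (y : Q.V → ℤ) :
    eulerZ Q x y + eulerZ Q y x = 0 := by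
  have key : ∀ n : ℤ, 0 ≤ eulerZ Q y y + n * (eulerZ Q x y + eulerZ Q y x) := by
    intro n
    have := H.q_nonneg (n • x + y)
    simp only [eulerZ_add_left, eulerZ_add_right, eulerZ_smul_left, eulerZ_smul_right, hx] at this
    linarith
  set b := eulerZ Q x y + eulerZ Q y x
  have h0 := H.q_nonneg y
  by_contra hb
  have h1 := key (-(eulerZ Q y y + 1) * b)
  have h2 : 0 < b * b := mul_self_pos.mpr hb
  nlinarith

lemma rad (H : Aff Q δ) (y : Q.V → ℤ) : eulerZ Q y (natc δ) = - eulerZ Q (natc δ) y := by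
  have := H.rad_of H.min.2.1 y
  linarith

lemma qδ (H : Aff Q δ) : eulerZ Q (natc δ) (natc δ) = 0 := H.min.2.1
lemma euler_single_right (x : Q.V → ℤ) (v : Q.V) :
    eulerZ Q x (Pi.single v 1) = x v - ∑ a with Q.t a = v, x (Q.s a) := by
  simp [eulerZ, Pi.single_apply, Finset.sum_filter]

lemma euler_single_left (x : Q.V → ℤ) (v : Q.V) :
    eulerZ Q (Pi.single v 1) x = x v - ∑ a with Q.s a = v, x (Q.t a) := by
  simp [eulerZ, Pi.single_apply, Finset.sum_filter]

lemma δ_pos (H : Aff Q δ) (v : Q.V) : 0 < δ v := by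
  by_contra h0
  have step : ∀ x y : Q.V, (∃ a, (Q.s a = x ∧ Q.t a = y) ∨ (Q.s a = y ∧ Q.t a = x)) →
      δ x = 0 → δ y = 0 := by
    rintro x y ⟨a, ha⟩ hx
    have h1 := H.rad (Pi.single x 1)
    rw [euler_single_left, euler_single_right] at h1
    have e1 : (0:ℤ) ≤ ∑ a with Q.s a = x, natc δ (Q.t a) :=
      Finset.sum_nonneg fun _ _ => Int.natCast_nonneg _
    have e2 : (0:ℤ) ≤ ∑ a with Q.t a = x, natc δ (Q.s a) :=
      Finset.sum_nonneg fun _ _ => Int.natCast_nonneg _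
    have hx' : natc δ x = 0 := by simp [natc, hx]
    rcases ha with ⟨h2, h3⟩ | ⟨h2, h3⟩
    · have := Finset.single_le_sum (f := fun a => natc δ (Q.t a)) (s := Finset.univ.filter fun a => Q.s a = x)
        (fun _ _ => Int.natCast_nonneg _) (Finset.mem_filter.mpr ⟨Finset.mem_univ a, h2⟩)
      have h5 : (natc δ (Q.t a) : ℤ) ≤ 0 := by linarith
      rw [h3] at h5
      simp only [natc] at h5
      omega
    · have := Finset.single_le_sum (f := fun a => natc δ (Q.s a)) (s := Finset.univ.filter fun a => Q.t a = x)
        (fun _ _ => Int.natCast_nonneg _) (Finset.mem_filter.mpr ⟨Finset.mem_univ a, h3⟩)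
      have h5 : (natc δ (Q.s a) : ℤ) ≤ 0 := by linarith
      rw [h2] at h5
      simp only [natc] at h5
      omega
  apply H.min.1
  funext w
  have := H.aff.1 v w
  induction this with
  | refl => simpa using h0
  | tail _ h ih => exact step _ _ h ih

lemma nat_mul (H : Aff Q δ) (x : Q.V → ℕ) (hx : eulerZ Q (natc x) (natc x) = 0) :
    ∃ m : ℕ, x = fun v => m * δ v := by
  induction hn : (∑ v, x v) using Nat.strong_induction_on generalizing x with
  | _ n ih =>
    by_cases h0 : x = 0
    · exact ⟨0, by simp [h0]; rfl⟩
    have hle := H.min.2.2 x h0 hx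
    have hsub : natc (fun v => x v - δ v) = natc x - natc δ := by
      funext v
      simp [natc, Nat.cast_sub (hle v)]
    obtain ⟨m, hm⟩ := ih (∑ v, (x v - δ v)) (by
      rw [← hn]
      obtain ⟨v, hv⟩ : ∃ v, x v ≠ 0 := by
        by_contra h; push Not at h; exact h0 (funext h)
      refine Finset.sum_lt_sum (fun _ _ => Nat.sub_le _ _) ⟨v, Finset.mem_univ v, ?_⟩
      have := H.δ_pos v
      omega) (fun v => x v - δ v) (by
      rw [hsub]
      simp only [eulerZ_sub_left, eulerZ_sub_right, hx, H.rad (natc x), H.qδ]; ring) rfl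
    refine ⟨m + 1, funext fun v => ?_⟩
    have h1 := congrFun hm v
    have h2 := hle v
    change x v - δ v = m * δ v at h1
    rw [add_mul]; omega

lemma int_mul (H : Aff Q δ) (x : Q.V → ℤ) (hx : eulerZ Q x x = 0) : ∃ m : ℤ, x = m • natc δ := by
  let N : ℕ := ∑ v, (x v).natAbs
  have hN : ∀ v, 0 ≤ x v + N * δ v := by
    intro v
    have h1 : (x v).natAbs ≤ N := Finset.single_le_sum (f := fun v => (x v).natAbs)
      (fun _ _ => Nat.zero_le _) (Finset.mem_univ v)
    have h2 := H.δ_pos v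
    have h3 : N ≤ N * δ v := Nat.le_mul_of_pos_right N h2
    have h4 : (N : ℤ) ≤ N * δ v := by exact_mod_cast h3
    omega
  have e : natc (fun v => (x v + N * δ v).toNat) = x + (N : ℤ) • natc δ := by
    funext v
    simp only [natc, Int.toNat_of_nonneg (hN v)]
    rfl
  obtain ⟨m, hm⟩ := H.nat_mul (fun v => (x v + N * δ v).toNat) (by
    rw [e]
    simp only [eulerZ_add_left, eulerZ_add_right, eulerZ_smul_left, eulerZ_smul_right, hx, H.rad x, H.qδ]
    ring)
  refine ⟨m - N, ?_⟩
  rw [hm] at e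
  rw [sub_smul, eq_sub_iff_add_eq, ← e]
  funext v
  simp [natc]

lemma closed_univ (H : Aff Q δ) (C : Finset Q.V) (hC : C.Nonempty)
    (h : ∀ v ∈ C, ∃ a, Q.s a = v ∧ Q.t a ∈ C) : C = Finset.univ ∧ Fintype.card Q.A ≤ Fintype.card Q.V := by
  let x : Q.V → ℤ := fun v => if v ∈ C then 1 else 0
  have h1 : ∑ v, x v * x v = C.card := by simp [x]
  have h2 : ∑ a, x (Q.s a) * x (Q.t a) = ((Finset.univ.filter fun a => Q.s a ∈ C ∧ Q.t a ∈ C).card : ℤ) := by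
    rw [Finset.card_filter]
    push_cast
    refine Finset.sum_congr rfl fun a _ => ?_
    simp only [x]
    split_ifs <;> simp_all
  have h3 : C.card ≤ (Finset.univ.filter fun a => Q.s a ∈ C ∧ Q.t a ∈ C).card := by
    have : Nonempty Q.A := ⟨(h _ hC.choose_spec).choose⟩
    choose! f hf using h
    refine Finset.card_le_card_of_injOn f ?_ ?_
    · intro v hv
      simp only [Finset.coe_filter, Finset.mem_univ, true_and, Set.mem_setOf_eq]
      rw [(hf v hv).1]
      exact ⟨hv, (hf v hv).2⟩
    · intro v hv w hw e
      rw [← (hf v hv).1, ← (hf w hw).1, e]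
  have hq := H.q_nonneg x
  have hq0 : eulerZ Q x x = 0 := by
    unfold eulerZ at hq ⊢
    rw [h1, h2] at hq ⊢
    omega
  obtain ⟨m, hm⟩ := H.int_mul x hq0
  have hmx : ∀ v, x v = m * δ v := fun v => congrFun hm v
  have hCu : C = Finset.univ := by
    obtain ⟨v, hv⟩ := hC
    have e1 := hmx v
    simp only [x, hv, if_true] at e1
    have hmpos : 0 < m := by
      by_contra hneg
      have := mul_nonpos_of_nonpos_of_nonneg (not_lt.mp hneg) (Int.natCast_nonneg (δ v))
      omega
    ext w
    simp only [Finset.mem_univ, iff_true]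
    by_contra hw
    have e2 := hmx w
    simp only [x, hw, if_false] at e2
    have : 0 < m * (δ w : ℤ) := mul_pos hmpos (by exact_mod_cast H.δ_pos w)
    omega
  refine ⟨hCu, ?_⟩
  subst hCu
  unfold eulerZ at hq0
  rw [h1, h2] at hq0
  simp at hq0
  omega

lemma wf (H : Aff Q δ) : WellFounded (fun x m : Q.V => ∃ a, Q.s a = m ∧ Q.t a = x) := by
  rw [WellFounded.wellFounded_iff_has_min]
  by_contra hcon
  push Not at hcon
  obtain ⟨S, ⟨v0, hv0⟩, hS⟩ := hcon
  classical
  have hcl : ∀ v ∈ S.toFinset, ∃ a, Q.s a = v ∧ Q.t a ∈ S.toFinset := by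
    intro v hv
    obtain ⟨x, hx, a, h1, h2⟩ := hS v (by simpa using hv)
    exact ⟨a, h1, by simpa [h2] using hx⟩
  obtain ⟨hu, hcard⟩ := H.closed_univ S.toFinset ⟨v0, by simpa using hv0⟩ hcl
  have hs : Function.Surjective Q.s := fun v => by
    obtain ⟨a, h, _⟩ := hcl v (by rw [hu]; simp)
    exact ⟨a, h⟩
  have hs' : Function.Bijective Q.s := by
    have : Fintype.card Q.A = Fintype.card Q.V := le_antisymm hcard (Fintype.card_le_of_surjective _ hs)
    exact (Fintype.bijective_iff_surjective_and_card _).mpr ⟨hs, this⟩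
  obtain ⟨hu2, _⟩ := H.closed_univ (Finset.univ.image Q.t) ⟨Q.t (hs v0).choose, by simp⟩ (by
    intro v _
    obtain ⟨a, ha⟩ := hs v
    exact ⟨a, ha, by simp⟩)
  have ht : Function.Surjective Q.t := fun v => by
    have : v ∈ Finset.univ.image Q.t := by rw [hu2]; simp
    simpa using this
  have ht' : Function.Bijective Q.t := by
    have : Fintype.card Q.A = Fintype.card Q.V := le_antisymm hcard (Fintype.card_le_of_surjective _ hs)
    exact (Fintype.bijective_iff_surjective_and_card _).mpr ⟨ht, this⟩
  apply H.nc
  have aux : ∀ f : Q.A → Q.V, Function.Bijective f → ∀ v, Nat.card {a // f a = v} = 1 := by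
    intro f hf v
    rw [Nat.card_eq_one_iff_unique]
    obtain ⟨a, ha⟩ := hf.2 v
    exact ⟨⟨fun x y => Subtype.ext (hf.1 (x.2.trans y.2.symm))⟩, ⟨⟨a, ha⟩⟩⟩
  exact fun v => ⟨aux _ hs' v, aux _ ht' v⟩

lemma wf' (H : Aff Q δ) : WellFounded (fun x m : Q.V => ∃ a, Q.t a = m ∧ Q.s a = x) := H.op.wf
lemma nondeg_left (H : Aff Q δ) (x : Q.V → ℤ) (h : ∀ y, eulerZ Q x y = 0) : x = 0 := by
  funext v
  induction v using H.wf'.induction with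
  | _ v ih =>
    have := h (Pi.single v 1)
    rw [euler_single_right, Finset.sum_eq_zero] at this
    · simpa using this
    · intro a ha
      exact ih _ ⟨a, (Finset.mem_filter.mp ha).2, rfl⟩

lemma nondeg_right (H : Aff Q δ) (x : Q.V → ℤ) (h : ∀ y, eulerZ Q y x = 0) : x = 0 :=
  H.op.nondeg_left x fun y => (eulerZ_op Q x y).trans (h y)

end Aff

end Repn
end

noncomputable section
namespace Repn
variable {k : Type} [Field k] {Q : QuiverData}
variable {T₁ C A' B' E' R' A B E L M M' N N' P R S T T' X X' Y Z : Repn k Q}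

lemma Isom.homDim_left (h : Isom M M') (N : Repn k Q) :
    homDim M N = homDim M' N := by
  obtain ⟨e⟩ := h
  rw [homDim_eq, homDim_eq]
  refine LinearEquiv.finrank_eq (LinearEquiv.ofLinear (e.symm.hom.compR N) (e.hom.compR N) ?_ ?_)
  · refine LinearMap.ext fun f => Hm.ext' fun v x => ?_
    change f v (e.e v ((e.e v).symm x)) = f v x
    rw [LinearEquiv.apply_symm_apply]
  · refine LinearMap.ext fun f => Hm.ext' fun v x => ?_
    change f v ((e.e v).symm (e.e v x)) = f v x
    rw [LinearEquiv.symm_apply_apply]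

lemma Isom.homDim_right (h : Isom M M') (N : Repn k Q) :
    homDim N M = homDim N M' := by
  obtain ⟨e⟩ := h
  rw [homDim_eq, homDim_eq]
  refine LinearEquiv.finrank_eq (LinearEquiv.ofLinear (e.hom.compL N) (e.symm.hom.compL N) ?_ ?_)
  · refine LinearMap.ext fun f => Hm.ext' fun v x => ?_
    change e.e v ((e.e v).symm (f v x)) = f v x
    rw [LinearEquiv.apply_symm_apply]
  · refine LinearMap.ext fun f => Hm.ext' fun v x => ?_
    change (e.e v).symm (e.e v (f v x)) = f v x
    rw [LinearEquiv.symm_apply_apply]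

lemma Isom.extDim_right (h : Isom M M') (N : Repn k Q) [FD M] [FD N] :
    extDim N M = extDim N M' := by
  have := h.fd
  have h1 := euler N M
  have h2 := euler N M'
  rw [← h.dz, ← h.homDim_right] at h2
  omega

/-! duality -/

def dual (M : Repn k Q) : Repn k (opQ Q) where
  space (v : Q.V) := Module.Dual k (M.space v)
  map a := (M.map a).dualMap

def udual (M : Repn k (opQ Q)) : Repn k Q := dual (Q := opQ Q) M

instance (M : Repn k Q) [FD M] : FD (dual M) :=
  ⟨fun v => inferInstanceAs (FiniteDimensional k (Module.Dual k (M.space v)))⟩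

instance (M : Repn k (opQ Q)) [FD M] : FD (udual M) :=
  ⟨fun v => inferInstanceAs (FiniteDimensional k (Module.Dual k (M.space v)))⟩

lemma dimv_dual (M : Repn k Q) : dimv (dual M) = dimv M := funext fun v =>
  Subspace.dual_finrank_eq (K := k) (V := M.space v)

def Hm.dual (f : Hm M N) : Hm (dual N) (dual M) :=
  Hm.mk' (M := Repn.dual N) (N := Repn.dual M) (fun v => (f v).dualMap) (fun a (φ : Module.Dual k (N.space (Q.t a))) => by
    refine LinearMap.ext fun x => ?_
    change φ (N.map a (f _ x)) = φ (f _ (M.map a x))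
    rw [f.comm])

def Hm.dualL (M N : Repn k Q) : Hm M N →ₗ[k] Hm (Repn.dual N) (Repn.dual M) where
  toFun f := f.dual
  map_add' f g := Hm.ext' fun v φ => LinearMap.ext fun x => φ.map_add (f v x) (g v x)
  map_smul' c f := Hm.ext' fun v φ => LinearMap.ext fun x => φ.map_smul c (f v x)

lemma Hm.dualL_inj (M N : Repn k Q) : Function.Injective (Hm.dualL M N) := by
  intro f g h
  refine Hm.ext' fun v x => ?_
  rw [← sub_eq_zero, ← Module.forall_dual_apply_eq_zero_iff k]
  intro φ
  rw [map_sub, sub_eq_zero]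
  exact congrArg (fun z : Hm (Repn.dual N) (Repn.dual M) => (show Module.Dual k (M.space v) from z v φ) x) h

lemma Isom.dual : Isom M N → Isom (dual M) (dual N) := fun ⟨e⟩ =>
  ⟨{
    e := fun v => (e.e v).symm.dualMap
    comm := fun a (φ : Module.Dual k (M.space (Q.t a))) => by
      refine LinearMap.ext fun x => ?_
      change φ (M.map a ((e.e _).symm x)) = φ ((e.e _).symm (N.map a x))
      congr 1
      rw [LinearEquiv.eq_symm_apply, e.comm, LinearEquiv.apply_symm_apply] }⟩

lemma dual_udual (M : Repn k Q) [FD M] : Isom M (udual (dual M)) :=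
  ⟨{
    e := fun v => Module.evalEquiv k (M.space v)
    comm := fun a φ => rfl }⟩

lemma dual_dsum (M N : Repn k Q) : Isom (dual (M.dsum N)) ((dual M).dsum (dual N)) :=
  ⟨{
    e := fun v => (Module.dualProdDualEquivDual k (M.space v) (N.space v)).symm
    comm := fun a (φ : Module.Dual k (M.space (Q.t a) × N.space (Q.t a))) => by
      refine Prod.ext ?_ ?_
      · refine LinearMap.ext fun x => ?_
        change φ (M.map a x, N.map a 0) = φ (M.map a x, 0)
        rw [map_zero]
      · refine LinearMap.ext fun x => ?_
        change φ (M.map a 0, N.map a x) = φ (0, N.map a x)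
        rw [map_zero] }⟩

lemma dual_isZero (h : (dual M).IsZero) : M.IsZero := fun v x => by
  rw [← Module.forall_dual_apply_eq_zero_iff k]
  intro φ
  rw [show φ = 0 from h v φ]; rfl

lemma homDim_dual (M N : Repn k Q) [FD M] [FD N] : homDim (dual N) (dual M) = homDim M N := by
  refine le_antisymm ?_ (LinearMap.finrank_le_finrank_of_injective (Hm.dualL_inj M N))
  have h := LinearMap.finrank_le_finrank_of_injective (Hm.dualL_inj (dual N) (dual M))
  have h2 : homDim M N = homDim (udual (dual M)) (udual (dual N)) := by
    rw [(dual_udual M).homDim_left, (dual_udual N).homDim_right]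
  rw [h2]
  exact h

lemma Indec.dual [FD M] (h : M.Indec) : (dual M).Indec := by
  refine ⟨fun h0 => h.1 (dual_isZero h0), fun Y Z e => ?_⟩
  have e1 : Isom M (udual (Y.dsum Z)) := (dual_udual M).trans (Isom.dual (Q := opQ Q) e)
  have e2 : Isom M ((udual Y).dsum (udual Z)) := e1.trans (dual_dsum (Q := opQ Q) Y Z)
  rcases h.2 _ _ e2 with h | h
  · exact Or.inl (dual_isZero h)
  · exact Or.inr (dual_isZero h)

lemma dz_dual (M : Repn k Q) : @Eq (Q.V → ℤ) (dz (Q := opQ Q) (dual M)) (dz M) :=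
  funext fun v => congrArg (Nat.cast (R := ℤ)) (congrFun (dimv_dual M) v)

lemma defect_dual {δ : Q.V → ℕ} (H : Aff Q δ) (M : Repn k Q) :
    defectOf (opQ Q) δ (dz (dual M)) = - defectOf Q δ (dz M) := by
  have h3 : eulerZ (opQ Q) (natc δ) (dz (dual M)) = eulerZ Q (dz M) (natc δ) := by
    refine (eulerZ_op Q _ _).trans ?_
    rw [dz_dual]; rfl
  unfold defectOf
  rw [← H.rad]
  exact h3

lemma Isom.of_dual [FD M] [FD N] (h : Isom (Repn.dual M) (Repn.dual N)) : Isom M N :=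
  (dual_udual M).trans ((Isom.dual (Q := opQ Q) h).trans (dual_udual N).symm)

/-! representations with zero maps -/

def zrep (k : Type) [Field k] {Q : QuiverData} (ι : Q.V → Type) : Repn k Q where
  space v := ι v → k
  map _ := 0

instance (ι : Q.V → Type) [∀ v, Finite (ι v)] : FD (zrep k ι) :=
  ⟨fun v => inferInstanceAs (FiniteDimensional k (ι v → k))⟩

lemma dimv_zrep (y : Q.V → ℕ) : dimv (zrep k (Q := Q) fun v => Fin (y v)) = y := funext fun v => by
  change Module.finrank k (Fin (y v) → k) = _
  simp

/-! paths and projectives -/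

inductive Pth (Q : QuiverData) (v : Q.V) : Q.V → Type
  | nil : Pth Q v v
  | cons (a : Q.A) (p : Pth Q v (Q.s a)) : Pth Q v (Q.t a)

lemma pth_finite {δ : Q.V → ℕ} (H : Aff Q δ) (v w : Q.V) : Finite (Pth Q v w) := by
  induction w using H.wf'.induction with
  | _ w ih =>
    have : ∀ a : {a // Q.t a = w}, Finite (Pth Q v (Q.s a.1)) := fun a => ih _ ⟨a.1, a.2, rfl⟩
    let g : PLift (v = w) ⊕ (Σ a : {a // Q.t a = w}, Pth Q v (Q.s a.1)) → Pth Q v w := fun z =>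
      match z with
      | .inl h => h.down ▸ Pth.nil
      | .inr ⟨a, p⟩ => a.2 ▸ Pth.cons a.1 p
    refine Finite.of_surjective g ?_
    intro p
    cases p with
    | nil => exact ⟨.inl ⟨rfl⟩, rfl⟩
    | cons a p => exact ⟨.inr ⟨⟨a, rfl⟩, p⟩, rfl⟩

lemma pth_loop {δ : Q.V → ℕ} (H : Aff Q δ) (v w : Q.V) (p : Pth Q v w) (h : v = w) :
    p = h ▸ Pth.nil := by
  have key : ∀ w, Pth Q v w → Relation.ReflTransGen (fun x m : Q.V => ∃ a, Q.s a = m ∧ Q.t a = x) w v := by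
    intro w p
    induction p with
    | nil => exact .refl
    | cons a p ih => exact .head ⟨a, rfl, rfl⟩ ih
  cases p with
  | nil => rfl
  | cons a p =>
    exfalso
    have h1 : Relation.TransGen (fun x m : Q.V => ∃ a, Q.s a = m ∧ Q.t a = x) (Q.t a) v :=
      Relation.TransGen.head' ⟨a, rfl, rfl⟩ (key _ p)
    rw [← h] at h1
    exact H.wf.transGen.irrefl.irrefl v h1

def prj (k : Type) [Field k] (Q : QuiverData) (v : Q.V) : Repn k Q where
  space w := Pth Q v w →₀ k
  map a := Finsupp.lmapDomain k k (Pth.cons a)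

def prj.b (k : Type) [Field k] {Q : QuiverData} {v w : Q.V} (p : Pth Q v w) : (prj k Q v).space w :=
  (Finsupp.single p 1 : Pth Q v w →₀ k)

def prj.e (k : Type) [Field k] (Q : QuiverData) (v : Q.V) : (prj k Q v).space v := prj.b k Pth.nil
lemma prj.fd {δ : Q.V → ℕ} (H : Aff Q δ) (v : Q.V) : FD (prj k Q v) := ⟨fun w => by
  have := pth_finite H v w
  exact inferInstanceAs (FiniteDimensional k (Pth Q v w →₀ k))⟩

/-- linear extension of a function on paths -/
def prj.lc {v w : Q.V} {Y : Type} [AddCommGroup Y] [Module k Y] (g : Pth Q v w → Y) :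
    (prj k Q v).space w →ₗ[k] Y := Finsupp.linearCombination k g

lemma prj.lc_b {v w : Q.V} {Y : Type} [AddCommGroup Y] [Module k Y] (g : Pth Q v w → Y)
    (p : Pth Q v w) : prj.lc g (prj.b k p) = g p := by
  refine (Finsupp.linearCombination_single k (v := g) 1 p).trans ?_
  rw [one_smul]

lemma prj.lext {v w : Q.V} {Y : Type} [AddCommGroup Y] [Module k Y]
    {f g : (prj k Q v).space w →ₗ[k] Y} (h : ∀ p, f (prj.b k p) = g (prj.b k p)) : f = g :=
  Finsupp.lhom_ext' fun p => LinearMap.ext_ring (h p)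

lemma prj.map_b {v : Q.V} (a : Q.A) (p : Pth Q v (Q.s a)) :
    (prj k Q v).map a (prj.b k p) = prj.b k (Pth.cons a p) :=
  Finsupp.mapDomain_single

def prj.evp {Y : Repn k Q} {v : Q.V} (y : Y.space v) : ∀ w, Pth Q v w → Y.space w
  | _, .nil => y
  | _, .cons a p => Y.map a (prj.evp y _ p)

def prj.ev {v : Q.V} (y : Y.space v) : Hm (prj k Q v) Y :=
  Hm.mk' (M := prj k Q v) (fun w => prj.lc (prj.evp y w)) (fun a x => by
    refine LinearMap.congr_fun (f := (prj.lc (prj.evp y (Q.t a))).comp ((prj k Q v).map a))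
      (g := (Y.map a).comp (prj.lc (prj.evp y (Q.s a)))) (prj.lext fun p => ?_) x
    rw [LinearMap.comp_apply, prj.map_b, prj.lc_b, LinearMap.comp_apply, prj.lc_b]
    rfl)

lemma prj.ev_e {v : Q.V} (y : Y.space v) : prj.ev y v (prj.e k Q v) = y :=
  prj.lc_b (prj.evp y v) Pth.nil

lemma prj.hom_ext {v : Q.V} {f g : Hm (prj k Q v) Y}
    (h : f v (prj.e k Q v) = g v (prj.e k Q v)) : f = g := by
  have key : ∀ w (p : Pth Q v w), f w (prj.b k p) = g w (prj.b k p) := by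
    intro w p
    induction p with
    | nil => exact h
    | cons a p ih => rw [← prj.map_b, f.comm, g.comm, ih]
  refine Hm.ext' fun w x => ?_
  have : f w = g w := prj.lext (key w)
  rw [this]

lemma prj.ev_eq {v : Q.V} (f : Hm (prj k Q v) Y) :
    f = prj.ev (f v (prj.e k Q v)) := prj.hom_ext (by rw [prj.ev_e])

def prj.homEquiv (Y : Repn k Q) (v : Q.V) : Hm (prj k Q v) Y ≃ₗ[k] Y.space v where
  toFun f := f v (prj.e k Q v)
  invFun y := prj.ev y
  left_inv f := (prj.ev_eq f).symm
  right_inv y := prj.ev_e y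
  map_add' f g := rfl
  map_smul' c f := rfl

lemma prj.homDim (Y : Repn k Q) (v : Q.V) : homDim (prj k Q v) Y = dimv Y v :=
  (prj.homEquiv Y v).finrank_eq

def prj.solve {Y : Repn k Q} {v : Q.V} (c : C1 (prj k Q v) Y) : ∀ w, Pth Q v w → Y.space w
  | _, .nil => 0
  | _, .cons a p => Y.map a (prj.solve c _ p) - c a (prj.b k p)

def IsProj (P : Repn k Q) : Prop := ∀ (Y : Repn k Q) [FD Y], extDim P Y = 0
lemma prj.isProj {δ : Q.V → ℕ} (H : Aff Q δ) (v : Q.V) : IsProj (prj k Q v) := by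
  intro Y _
  have := prj.fd (k := k) H v
  rw [extDim_eq_zero]
  intro x
  induction x using Ext.ind with | h c =>
  rw [Ext.mk_eq_zero]
  refine ⟨fun w => prj.lc (prj.solve c w), funext fun a => prj.lext fun p => ?_⟩
  rw [extMap_apply, prj.map_b, prj.lc_b, prj.lc_b]
  simp [prj.solve]

lemma euler_prj {δ : Q.V → ℕ} (H : Aff Q δ) (v : Q.V) (y : Q.V → ℤ) :
    eulerZ Q (dz (prj k Q v)) y = y v := by
  have := prj.fd (k := k) H v
  have h1 : ∀ y : Q.V → ℕ, eulerZ Q (dz (prj k Q v)) (natc y) = y v := by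
    intro y
    have := euler (prj k Q v) (zrep k fun v => Fin (y v))
    rw [prj.isProj H v, prj.homDim] at this
    simp only [dz, dimv_zrep] at this
    simpa using this.symm
  have h2 : y = natc (fun v => (y v).toNat) - natc (fun v => (-y v).toNat) := by
    funext v
    simp only [natc, Pi.sub_apply]
    omega
  rw [h2, eulerZ_sub_right, h1, h1]
  simp only [natc, Pi.sub_apply]

lemma prj.defect {δ : Q.V → ℕ} (H : Aff Q δ) (v : Q.V) :
    defectOf Q δ (dz (prj k Q v)) = - δ v := by
  have := H.rad (dz (prj k Q v))
  rw [euler_prj H] at this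
  simp only [natc] at this
  simp only [defectOf, this, neg_neg]

lemma prj.one {δ : Q.V → ℕ} (H : Aff Q δ) (v : Q.V) : dimv (prj k Q v) v = 1 := by
  have : Unique (Pth Q v v) := ⟨⟨Pth.nil⟩, fun p => pth_loop H v v p rfl⟩
  change Module.finrank k (Pth Q v v →₀ k) = 1
  rw [Module.finrank_finsupp_self, Fintype.card_unique]

lemma prj.eq_smul_e {δ : Q.V → ℕ} (H : Aff Q δ) (v : Q.V) (x : (prj k Q v).space v) :
    ∃ c : k, x = c • prj.e k Q v := by
  have h1 := prj.one (k := k) H v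
  have h2 : prj.e k Q v ≠ 0 := fun h => by
    have := prj.lc_b (k := k) (fun _ : Pth Q v v => (1 : k)) Pth.nil
    rw [show prj.b k Pth.nil = 0 from h, map_zero] at this
    exact zero_ne_one this
  obtain ⟨c, hc⟩ := (finrank_eq_one_iff_of_nonzero' (prj.e k Q v) h2).mp h1 x
  exact ⟨c, hc.symm⟩

lemma IsProj.sub [FD P] (h : IsProj P) {f : Hm A P} (hf : f.Inj) : IsProj A :=
  fun Y _ => Nat.le_zero.mp ((hf.ext_le Y).trans (h Y).le)

lemma hom_proj [FD X] [FD P] (hX : X.Indec) (hn : ¬ IsProj X) (hP : IsProj P)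
    (f : Hm X P) : f = 0 := by
  let σ := SES.kerIm f
  have hI : IsProj f.range.repn := hP.sub f.range.incl_inj
  rcases hX.2 _ _ (σ.split_of_ext (hI _)).isom with h | h
  · exfalso
    apply hn
    refine hP.sub (f := f) ?_
    rw [Hm.inj_iff]
    intro v x hx
    exact congrArg Subtype.val (h v ⟨x, hx⟩)
  · exact Hm.ext' fun v x => congrArg Subtype.val (h v ⟨f v x, x, rfl⟩)

lemma proj_indec {δ : Q.V → ℕ} (H : Aff Q δ) [FD P] (hP : P.Indec) (hp : IsProj P) :
    ∃ v, Isom P (prj k Q v) := by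
  have hne : {v : Q.V | ∃ x : P.space v, x ≠ 0}.Nonempty := by
    by_contra hc
    apply hP.1
    intro v x
    by_contra hx
    exact hc ⟨v, x, hx⟩
  obtain ⟨v, ⟨x, hx⟩, hmin⟩ := H.wf'.has_min _ hne
  have hmin' : ∀ a, Q.t a = v → ∀ y : P.space (Q.s a), y = 0 := by
    intro a ha y
    by_contra hy
    exact hmin (Q.s a) ⟨y, hy⟩ ⟨a, ha, rfl⟩
  obtain ⟨ξ, hξ⟩ : ∃ ξ : Module.Dual k (P.space v), ξ x = 1 := by
    obtain ⟨φ, hφ⟩ : ∃ φ : Module.Dual k (P.space v), φ x ≠ 0 := by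
      by_contra hc
      push Not at hc
      exact hx ((Module.forall_dual_apply_eq_zero_iff k x).mp hc)
    exact ⟨(φ x)⁻¹ • φ, by simp [hφ]⟩
  let S : Repn k Q := zrep k fun w => PLift (v = w)
  let g0 : Hm P S := Hm.mk' (N := S) (fun w => LinearMap.pi fun h =>
      { toFun := fun y => ξ (h.down ▸ y : P.space v)
        map_add' := fun y z => by obtain ⟨rfl⟩ := h; exact map_add ξ y z
        map_smul' := fun c y => by obtain ⟨rfl⟩ := h; exact map_smul ξ c y }) (fun a y => by
    funext ⟨h⟩
    have hz : P.map a y = 0 := by rw [hmin' a h.symm y, map_zero]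
    have key : ∀ w (h : v = w) (z : P.space w), z = 0 → ξ (h ▸ z : P.space v) = 0 := by
      rintro w rfl z rfl
      exact map_zero ξ
    exact key _ h _ hz)
  let q : Hm (prj k Q v) S := prj.ev (fun _ => (1 : k))
  have hqe : q v (prj.e k Q v) = fun _ => (1 : k) := prj.ev_e (Y := S) _
  have hq : q.Surj := by
    intro w z
    by_cases h : v = w
    · subst h
      refine ⟨z ⟨rfl⟩ • prj.e k Q v, ?_⟩
      rw [map_smul, hqe]
      funext ⟨_⟩
      exact mul_one _
    · refine ⟨0, ?_⟩
      funext ⟨h'⟩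
      exact absurd h' h
  have := prj.fd (k := k) H v
  obtain ⟨g, hg⟩ := (SES.ofSurj q hq).lift (hp _) g0
  refine ⟨v, ?_⟩
  have h1 : g v x = prj.e k Q v := by
    obtain ⟨c, hc⟩ := prj.eq_smul_e H v (g v x)
    have h2 : q v (g v x) = g0 v x := congrArg (fun z : Hm P S => z v x) hg
    rw [hc, map_smul, hqe] at h2
    have h3 := congrFun h2 ⟨rfl⟩
    have h4 : c * 1 = ξ x := h3
    rw [hξ, mul_one] at h4
    rw [hc, h4, one_smul]
  have h2 : g.comp (prj.ev x) = Hm.id _ := prj.hom_ext (by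
    rw [Hm.comp_apply, prj.ev_e, h1]; rfl)
  refine (indec_retract hP (prj.ev x) g h2 fun h0 => ?_).isom.symm
  apply hx
  rw [← prj.ev_e x, h0 v (prj.e k Q v), map_zero]

/-- elementary extension classes -/
def el {X Y : Repn k Q} (a : Q.A) (ξ : Module.Dual k (X.space (Q.s a))) (y : Y.space (Q.t a)) :
    Ext X Y := by
  classical
  exact Ext.mk X Y (Pi.single a (ξ.smulRight y))

lemma push_el {X Y Z : Repn k Q} (g : Hm Y Z) (a : Q.A) (ξ : Module.Dual k (X.space (Q.s a)))
    (y : Y.space (Q.t a)) : Ext.push X g (el a ξ y) = el a ξ (g _ y) := by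
  classical
  unfold el
  rw [Ext.push_mk]
  congr 1
  funext b
  obtain rfl | h := eq_or_ne b a
  · simp only [Pi.single_eq_same]
    ext x
    simp
  · simp only [Pi.single_eq_of_ne h, LinearMap.comp_zero]

/-- two linear maps out of `Hom(U,W)` agree if they agree on rank one maps -/
lemma rank_one_ext {U W Z : Type} [AddCommGroup U] [Module k U] [FiniteDimensional k U]
    [AddCommGroup W] [Module k W] [AddCommGroup Z] [Module k Z]
    {f g : (U →ₗ[k] W) →ₗ[k] Z} (h : ∀ (ξ : Module.Dual k U) (w : W),
      f (ξ.smulRight w) = g (ξ.smulRight w)) : f = g := by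
  have h2 : f ∘ₗ (dualTensorHomEquiv k U W).toLinearMap
      = g ∘ₗ (dualTensorHomEquiv k U W).toLinearMap := by
    apply TensorProduct.ext'
    intro ξ w
    have : dualTensorHomEquiv k U W (TensorProduct.tmul k ξ w) = ξ.smulRight w := by
      ext x; simp
    simp only [LinearMap.comp_apply, LinearEquiv.coe_coe, this, h]
  ext x
  have := LinearMap.congr_fun h2 ((dualTensorHomEquiv k U W).symm x)
  simpa using this

lemma exists_rank_one {U W Z : Type} [AddCommGroup U] [Module k U] [FiniteDimensional k U]
    [AddCommGroup W] [Module k W] [AddCommGroup Z] [Module k Z]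
    (B : Module.Dual k U →ₗ[k] W →ₗ[k] Z) : ∃ f : (U →ₗ[k] W) →ₗ[k] Z,
      ∀ ξ w, f (ξ.smulRight w) = B ξ w := by
  refine ⟨(TensorProduct.lift B) ∘ₗ (dualTensorHomEquiv k U W).symm.toLinearMap, fun ξ w => ?_⟩
  have : dualTensorHomEquiv k U W (TensorProduct.tmul k ξ w) = ξ.smulRight w := by
    ext x; simp
  rw [← this]
  simp

lemma Ext.lext [FD X] {Z : Type} [AddCommGroup Z] [Module k Z]
    {f g : Ext X Y →ₗ[k] Z} (h : ∀ a ξ y, f (el a ξ y) = g (el a ξ y)) : f = g := by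
  classical
  have h2 : f ∘ₗ Ext.mk X Y = g ∘ₗ Ext.mk X Y := by
    apply LinearMap.pi_ext'
    intro a
    apply rank_one_ext
    intro ξ y
    simpa [el] using h a ξ y
  ext x
  induction x using Ext.ind with
  | h c => exact LinearMap.congr_fun h2 c

def elL (a : Q.A) : Module.Dual k (X.space (Q.s a)) →ₗ[k] Y.space (Q.t a) →ₗ[k]
    Ext X Y := by
  classical
  exact LinearMap.mk₂ k (fun ξ y => el a ξ y)
    (fun m₁ m₂ n => by
      unfold el; rw [← map_add, ← Pi.single_add]; congr 2; ext; simp [add_smul])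
    (fun c m n => by
      unfold el; rw [← map_smul, ← Pi.single_smul]; congr 2; ext; simp [smul_smul])
    (fun m n₁ n₂ => by
      unfold el; rw [← map_add, ← Pi.single_add]; congr 2; ext; simp [smul_add])
    (fun c m n => by
      unfold el; rw [← map_smul, ← Pi.single_smul]; congr 2; ext; simp [smul_smul, mul_comm])

lemma elL_apply {X Y : Repn k Q} (a : Q.A) (ξ : Module.Dual k (X.space (Q.s a)))
    (y : Y.space (Q.t a)) : elL a ξ y = el a ξ y := rfl

/-- the map `P_{t a} → P_{s a}` -/
def prj.arr (k : Type) [Field k] {Q : QuiverData} (a : Q.A) :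
    Hm (prj k Q (Q.t a)) (prj k Q (Q.s a)) :=
  prj.ev ((prj k Q (Q.s a)).map a (prj.e k Q (Q.s a)))

/-- Auslander--Reiten translate -/
def tau (X : Repn k Q) : Repn k Q where
  space w := Module.Dual k (Ext X (prj k Q w))
  map a := (Ext.push X (prj.arr k a)).dualMap

/-- evaluation of an element of `tau X` -/
def tau.at' {w : Q.V} (φ : (tau X).space w) : Module.Dual k (Ext X (prj k Q w)) := φ
def tau.of {w : Q.V} (φ : Module.Dual k (Ext X (prj k Q w))) : (tau X).space w := φ

lemma extMap_eq (f) (a : Q.A) :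
    extMap X Y f a = Y.map a ∘ₗ f (Q.s a) - f (Q.t a) ∘ₗ X.map a := rfl

lemma tau.ext {w : Q.V} {φ ψ : (tau X).space w}
    (h : ∀ η, tau.at' φ η = tau.at' ψ η) : φ = ψ :=
  LinearMap.ext (σ := RingHom.id k) (f := tau.at' φ) (g := tau.at' ψ) h

lemma tau_fd {δ : Q.V → ℕ} (H : Aff Q δ) (X : Repn k Q) [FD X] : FD (tau X) := ⟨fun w => by
  have := prj.fd (k := k) H w
  exact inferInstanceAs (FiniteDimensional k (Module.Dual k (Ext X (prj k Q w))))⟩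

lemma dimv_tau (X : Repn k Q) (w : Q.V) : dimv (tau X) w = extDim X (prj k Q w) :=
  Subspace.dual_finrank_eq

lemma prj.ev_add {v : Q.V} (x y : Y.space v) :
    prj.ev (x + y) = prj.ev x + prj.ev y := prj.hom_ext (by simp [prj.ev_e])
lemma prj.ev_smul {v : Q.V} (c : k) (y : Y.space v) :
    prj.ev (c • y) = c • prj.ev y := prj.hom_ext (by simp [prj.ev_e])
lemma prj.ev_comp {v : Q.V} (y : Y.space v) (g : Hm Y Z) :
    g.comp (prj.ev y) = prj.ev (g v y) := prj.hom_ext (by simp [prj.ev_e, Hm.comp_apply])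
lemma prj.ev_map (a : Q.A) (y : Y.space (Q.s a)) :
    prj.ev (Y.map a y) = (prj.ev y).comp (prj.arr k a) := by
  apply prj.hom_ext
  rw [prj.ev_e, Hm.comp_apply, prj.arr, prj.ev_e, Hm.comm, prj.ev_e]
lemma prj.ev_e_id (v : Q.V) : prj.ev (prj.e k Q v) = Hm.id (prj k Q v) :=
  prj.hom_ext (by rw [prj.ev_e]; rfl)

/-- the Auslander--Reiten map -/
def AR (φ : Module.Dual k (Ext X Y)) : Hm Y (tau X) :=
  Hm.mk' (N := tau X) (fun w =>
    { toFun := fun y => (φ ∘ₗ Ext.push X (prj.ev y) : Module.Dual k (Ext X (prj k Q w)))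
      map_add' := fun x y => by
        refine tau.ext fun η => ?_
        change φ (Ext.push X (prj.ev (x + y)) η) = φ (Ext.push X (prj.ev x) η) + φ (Ext.push X (prj.ev y) η)
        rw [prj.ev_add, Ext.push_add, map_add]
      map_smul' := fun c y => by
        refine tau.ext fun η => ?_
        change φ (Ext.push X (prj.ev (c • y)) η) = c * φ (Ext.push X (prj.ev y) η)
        rw [prj.ev_smul, Ext.push_smul, map_smul]; rfl }) (fun a y => by
    refine tau.ext fun η => ?_
    change φ (Ext.push X (prj.ev (Y.map a y)) η) = φ (Ext.push X (prj.ev y) (Ext.push X (prj.arr k a) η))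
    rw [prj.ev_map, Ext.push_comp])

lemma AR_apply (φ : Module.Dual k (Ext X Y)) {w} (y : Y.space w) (η) :
    tau.at' (AR φ w y) η = φ (Ext.push X (prj.ev y) η) := rfl

lemma el_eq_push {X Y : Repn k Q} (a : Q.A) (ξ : Module.Dual k (X.space (Q.s a)))
    (y : Y.space (Q.t a)) : el a ξ y = Ext.push X (prj.ev y) (el a ξ (prj.e k Q (Q.t a))) := by
  rw [push_el, prj.ev_e]

lemma AR_inj [FD X] {φ ψ : Module.Dual k (Ext X Y)} (h : AR φ = AR ψ) :
    φ = ψ := by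
  apply Ext.lext
  intro a ξ y
  rw [el_eq_push, ← AR_apply, h, AR_apply]

lemma AR_prj {w} (ψ : Module.Dual k (Ext X (prj k Q w))) :
    AR ψ = prj.ev (tau.of ψ) := by
  apply prj.hom_ext
  rw [prj.ev_e]
  refine tau.ext fun η => ?_
  rw [AR_apply, prj.ev_e_id, Ext.push_id]; rfl

lemma AR_surj [FD X] (h : Hm Y (tau X)) : ∃ φ : Module.Dual k (Ext X Y), AR φ = h := by
  classical
  have hB : ∀ a : Q.A, ∃ f : (X.space (Q.s a) →ₗ[k] Y.space (Q.t a)) →ₗ[k] k,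
      ∀ ξ y, f (ξ.smulRight y) = tau.at' (h _ y) (el a ξ (prj.e k Q (Q.t a))) := by
    intro a
    obtain ⟨f, hf⟩ := exists_rank_one (U := X.space (Q.s a)) (W := Y.space (Q.t a)) (Z := k)
      (LinearMap.mk₂ k (fun ξ y => tau.at' (h _ y) (el a ξ (prj.e k Q (Q.t a))))
        (fun m₁ m₂ n => by simp only [← elL_apply]; simp)
        (fun c m n => by simp only [← elL_apply]; simp)
        (fun m n₁ n₂ => by rw [map_add]; rfl)
        (fun c m n => by rw [map_smul]; rfl))
    exact ⟨f, hf⟩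
  choose f hf using hB
  let φ0 : C1 X Y →ₗ[k] k := LinearMap.lsum k _ k f
  have hφ0 : ∀ c, φ0 c = ∑ a, f a (c a) := fun c => by simp [φ0, LinearMap.lsum_apply]
  have hk : φ0 ∘ₗ extMap X Y = 0 := by
    apply LinearMap.pi_ext'
    intro w
    apply rank_one_ext
    intro ξ y
    simp only [LinearMap.comp_apply, LinearMap.zero_apply]
    rw [hφ0]
    let g : ∀ v, X.space v →ₗ[k] (prj k Q w).space v := Pi.single w (ξ.smulRight (prj.e k Q w))
    have c1 : ∀ a, f a (extMap X Y (LinearMap.single k _ w (ξ.smulRight y)) a) =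
        tau.at' (h w y) (Ext.mk X (prj k Q w) (Pi.single a (extMap X (prj k Q w) g a))) := by
      intro a
      rw [extMap_eq, extMap_eq, Pi.single_sub, map_sub, map_sub, map_sub]
      congr 1
      · obtain rfl | hw := eq_or_ne w (Q.s a)
        · have e1 : Y.map a ∘ₗ (LinearMap.single k (fun v => X.space v →ₗ[k] Y.space v) (Q.s a) (ξ.smulRight y)) (Q.s a)
              = ξ.smulRight (Y.map a y) := by ext x; simp
          have e2 : (prj k Q (Q.s a)).map a ∘ₗ g (Q.s a)
              = ξ.smulRight ((prj k Q (Q.s a)).map a (prj.e k Q (Q.s a))) := by ext x; simp [g]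
          rw [e1, e2, hf, h.comm]
          change tau.at' (h (Q.s a) y) (Ext.push X (prj.arr k a) (el a ξ (prj.e k Q (Q.t a)))) = _
          rw [push_el, prj.arr, prj.ev_e]
          rfl
        · have e1 : (LinearMap.single k (fun v => X.space v →ₗ[k] Y.space v) w (ξ.smulRight y)) (Q.s a) = 0 :=
            Pi.single_eq_of_ne hw.symm _
          have e2 : g (Q.s a) = 0 := Pi.single_eq_of_ne hw.symm _
          rw [e1, e2, LinearMap.comp_zero, LinearMap.comp_zero, Pi.single_zero, map_zero, map_zero, map_zero]
      · obtain rfl | hw := eq_or_ne w (Q.t a)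
        · have e1 : (LinearMap.single k (fun v => X.space v →ₗ[k] Y.space v) (Q.t a) (ξ.smulRight y)) (Q.t a) ∘ₗ X.map a
              = LinearMap.smulRight (ξ ∘ₗ X.map a) y := by ext x; simp
          have e2 : g (Q.t a) ∘ₗ X.map a
              = LinearMap.smulRight (ξ ∘ₗ X.map a) (prj.e k Q (Q.t a)) := by ext x; simp [g]
          rw [e1, e2, hf]
          rfl
        · have e1 : (LinearMap.single k (fun v => X.space v →ₗ[k] Y.space v) w (ξ.smulRight y)) (Q.t a) = 0 :=
            Pi.single_eq_of_ne hw.symm _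
          have e2 : g (Q.t a) = 0 := Pi.single_eq_of_ne hw.symm _
          rw [e1, e2, LinearMap.zero_comp, LinearMap.zero_comp, Pi.single_zero, map_zero, map_zero, map_zero]
    simp only [c1]
    rw [← map_sum, ← map_sum, Finset.univ_sum_single, Ext.mk_extMap, map_zero]
  let φ : Module.Dual k (Ext X Y) := (LinearMap.range (extMap X Y)).liftQ φ0 (by
    rintro _ ⟨x, rfl⟩
    exact LinearMap.congr_fun hk x)
  have hφ : ∀ c, φ (Ext.mk X Y c) = φ0 c := fun c => rfl
  have hφe : ∀ a ξ y, φ (el a ξ y) = tau.at' (h _ y) (el a ξ (prj.e k Q (Q.t a))) := by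
    intro a ξ y
    unfold el
    rw [hφ, hφ0, Finset.sum_eq_single a]
    · rw [Pi.single_eq_same, hf]; rfl
    · intro b _ hb
      rw [Pi.single_eq_of_ne hb, map_zero]
    · simp
  refine ⟨φ, Hm.ext' fun w y => tau.ext fun η => ?_⟩
  rw [AR_apply]
  refine LinearMap.congr_fun (f := φ ∘ₗ Ext.push X (prj.ev y)) (g := tau.at' (h w y)) (Ext.lext fun a ξ p => ?_) η
  rw [LinearMap.comp_apply, push_el, hφe]
  have h2 : h.comp (prj.ev y) = AR (tau.at' (h w y)) := by
    rw [AR_prj, prj.ev_comp]; rfl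
  have h3 : h _ (prj.ev y _ p) = AR (tau.at' (h w y)) _ p := by rw [← h2]; rfl
  rw [h3, AR_apply, push_el, prj.ev_e]

lemma homDim_tau [FD X] [FD Y] : homDim Y (tau X) = extDim X Y := by
  rw [extDim_eq, ← Subspace.dual_finrank_eq, homDim_eq]
  refine (LinearEquiv.finrank_eq (LinearEquiv.ofBijective
    ({ toFun := AR, map_add' := fun x y => ?_, map_smul' := fun c y => ?_ } :
      Module.Dual k (Ext X Y) →ₗ[k] Hm Y (tau X)) ⟨fun x y h => AR_inj h, AR_surj⟩)).symm
  · refine Hm.ext' fun w y => tau.ext fun η => rfl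
  · refine Hm.ext' fun w y => tau.ext fun η => rfl

end Repn
end

noncomputable section
namespace Repn
variable {k : Type} [Field k] {Q : QuiverData} {δ : Q.V → ℕ}
variable {T₁ C A' B' E' R' A B E L M M' N N' P R S T T' X X' Y Z : Repn k Q} {i : Hm T X} {n : ℕ}

def eulerL (Q : QuiverData) (x : Q.V → ℤ) : (Q.V → ℤ) →ₗ[ℤ] ℤ where
  toFun y := eulerZ Q x y
  map_add' y z := eulerZ_add_right y z x
  map_smul' c y := eulerZ_smul_right c y x
def eulerR (Q : QuiverData) (x : Q.V → ℤ) : (Q.V → ℤ) →ₗ[ℤ] ℤ where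
  toFun y := eulerZ Q y x
  map_add' y z := eulerZ_add_left y z x
  map_smul' c y := eulerZ_smul_left c y x
@[simp] lemma eulerL_apply (x y : Q.V → ℤ) : eulerL Q x y = eulerZ Q x y := rfl
@[simp] lemma eulerR_apply (x y : Q.V → ℤ) : eulerR Q x y = eulerZ Q y x := rfl
lemma prj_span (H : Aff Q δ) (B : (Q.V → ℤ) →ₗ[ℤ] ℤ) (h : ∀ w, B (dz (prj k Q w)) = 0) (y) :
    B y = 0 := by
  have key : y = (∑ v, y v • dz (prj k Q v)) - ∑ a, y (Q.s a) • dz (prj k Q (Q.t a)) := by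
    rw [← sub_eq_zero]
    apply H.nondeg_left
    intro z
    have h1 := fun x => eulerR_apply z x
    rw [← h1, map_sub, map_sub, map_sum, map_sum]
    simp only [map_smul, eulerR_apply, euler_prj H, smul_eq_mul]
    simp [eulerZ]
  rw [key, map_sub, map_sum, map_sum]
  simp only [map_smul, h, smul_zero, Finset.sum_const_zero, sub_zero]

/-- no homomorphism to projectives -/
def NP (X : Repn k Q) : Prop := ∀ v (f : Hm X (prj k Q v)), f = 0
lemma np_of_indec (H : Aff Q δ) [FD X] (hX : X.Indec) (hn : ¬ IsProj X) : NP X := by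
  intro v f
  have := prj.fd (k := k) H v
  exact hom_proj hX hn (prj.isProj H v) f

lemma tau_euler (H : Aff Q δ) [FD X] (hX : NP X) (y : Q.V → ℤ) :
    eulerZ Q y (dz (tau X)) = - eulerZ Q (dz X) y := by
  have := prj_span (k := k) H (eulerR Q (dz (tau X)) + eulerL Q (dz X)) (fun w => by
    have := prj.fd (k := k) H w
    have := tau_fd H X
    rw [LinearMap.add_apply, eulerR_apply, eulerL_apply, euler_prj H, ← euler]
    have h0 : homDim X (prj k Q w) = 0 := by
      rw [homDim_eq_zero]; exact hX w
    rw [h0]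
    simp [natc, dimv_tau]) y
  simp at this
  linarith

lemma extDim_tau (H : Aff Q δ) [FD X] [FD Y] (hX : NP X) :
    extDim Y (tau X) = homDim X Y := by
  have := tau_fd H X
  have h1 := euler Y (tau X)
  have h2 := euler X Y
  rw [tau_euler H hX, homDim_tau] at h1
  omega

lemma defect_tau (H : Aff Q δ) [FD X] (hX : NP X) :
    defectOf Q δ (dz (tau X)) = defectOf Q δ (dz X) := by
  unfold defectOf
  rw [tau_euler H hX, H.rad]
  ring

lemma homDim_tau_tau (H : Aff Q δ) [FD X] [FD Y] (hX : NP X) :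
    homDim (tau X) (tau Y) = homDim X Y := by
  have := tau_fd H X
  rw [homDim_tau, extDim_tau H hX]

def tauMap (f : Hm X Y) : Hm (tau X) (tau Y) :=
  Hm.mk' (M := tau X) (N := tau Y) (fun w => (Ext.pull (prj k Q w) f).dualMap) (fun a φ => by
    refine tau.ext fun η => ?_
    change tau.at' φ (Ext.push X (prj.arr k a) (Ext.pull (prj k Q (Q.t a)) f η))
      = tau.at' φ (Ext.pull (prj k Q (Q.s a)) f (Ext.push Y (prj.arr k a) η))
    rw [Ext.push_pull])

lemma tauMap_apply (f : Hm X Y) {w} (φ : (tau X).space w) (η) :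
    tau.at' (tauMap f w φ) η = tau.at' φ (Ext.pull (prj k Q w) f η) := rfl

lemma tauMap_comp (g : Hm Y Z) (f : Hm X Y) :
    tauMap (g.comp f) = (tauMap g).comp (tauMap f) := Hm.ext' fun w φ => tau.ext fun η => by
  rw [tauMap_apply, Hm.comp_apply, tauMap_apply, tauMap_apply, Ext.pull_comp]

lemma tauMap_id (X : Repn k Q) : tauMap (Hm.id X) = Hm.id (tau X) :=
  Hm.ext' fun w φ => tau.ext fun η => by rw [tauMap_apply, Ext.pull_id]; rfl

def tauL (X Y : Repn k Q) : Hm X Y →ₗ[k] Hm (tau X) (tau Y) where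
  toFun := tauMap
  map_add' f g := Hm.ext' fun w φ => tau.ext fun η => by
    rw [tauMap_apply, Ext.pull_add, map_add]; rfl
  map_smul' c f := Hm.ext' fun w φ => tau.ext fun η => by
    rw [tauMap_apply, Ext.pull_smul, map_smul]; rfl

lemma Isom.tau (h : Isom X Y) : Isom (tau X) (tau Y) := by
  obtain ⟨e⟩ := h
  refine Hm.Bij.isom (f := tauMap e.hom) fun w => ?_
  refine Function.bijective_iff_has_inverse.mpr ⟨tauMap e.symm.hom w, fun x => ?_, fun x => ?_⟩
  · rw [← Hm.comp_apply, ← tauMap_comp, Iso.symm_hom_comp, tauMap_id]; rfl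
  · rw [← Hm.comp_apply, ← tauMap_comp, Iso.hom_comp_symm, tauMap_id]; rfl

/-- `g` lifts along `E → B` if it kills extension classes. -/
lemma SES.lift_of_pull (σ : SES A E B) (g : Hm Z B)
    (h : ∀ x : Ext B A, Ext.pull A g x = 0) : ∃ f : Hm Z E, σ.p.comp f = g := by
  have hs : ∀ v, ∃ s : B.space v →ₗ[k] E.space v, (σ.p v) ∘ₗ s = LinearMap.id := fun v =>
    (σ.p v).exists_rightInverse_of_surjective (LinearMap.range_eq_top.mpr (σ.surj v))
  choose s hs using hs
  have hs' : ∀ v x, σ.p v (s v x) = x := fun v x => LinearMap.congr_fun (hs v) x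
  have hr : ∀ v, ∃ r : E.space v →ₗ[k] A.space v, r ∘ₗ (σ.i v) = LinearMap.id := fun v =>
    (σ.i v).exists_leftInverse_of_injective (LinearMap.ker_eq_bot.mpr (σ.inj v))
  choose r hr using hr
  have hr' : ∀ v x, σ.p v x = 0 → σ.i v (r v x) = x := by
    intro v x hx
    obtain ⟨y, rfl⟩ := σ.ex v x hx
    congr 1
    exact LinearMap.congr_fun (hr v) y
  let c : C1 B A := fun a => r (Q.t a) ∘ₗ (E.map a ∘ₗ s (Q.s a) - s (Q.t a) ∘ₗ B.map a)
  have hc : ∀ a x, σ.i _ (c a x) = E.map a (s _ x) - s _ (B.map a x) := by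
    intro a x
    apply hr'
    simp only [LinearMap.sub_apply, LinearMap.comp_apply, map_sub, hs']
    rw [Hm.comm, hs', sub_self]
  have h1 := h (Ext.mk B A c)
  rw [Ext.pull_mk, Ext.mk_eq_zero] at h1
  obtain ⟨u, hu⟩ := h1
  have hu' : ∀ a x, A.map a (u _ x) - u _ (Z.map a x) = c a (g _ x) := fun a x =>
    LinearMap.congr_fun (congrFun hu a) x
  refine ⟨Hm.mk' (fun v => s v ∘ₗ g v - (σ.i v) ∘ₗ u v) (fun a x => ?_), Hm.ext' fun v x => ?_⟩
  · simp only [LinearMap.sub_apply, LinearMap.comp_apply, map_sub]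
    have h2 := congrArg (σ.i _) (hu' a x)
    rw [hc, map_sub, Hm.comm] at h2
    rw [Hm.comm, ← sub_eq_zero]
    have h3 := sub_eq_zero.mpr h2
    rw [← h3]
    abel
  · have h0 : σ.p v (σ.i v (u v x)) = 0 := σ.zero v _
    simp [hs', h0]

lemma exists_cover (H : Aff Q δ) (X : Repn k Q) [FD X] : ∃ (ι : Type) (_ : Fintype ι) (v : ι → Q.V)
    (p : Hm (dsumFam fun i => prj k Q (v i)) X), p.Surj := by
  classical
  let b := fun v => Module.finBasis k (X.space v)
  refine ⟨Σ v, Fin (Module.finrank k (X.space v)), inferInstance, fun i => i.1,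
    (Fam.homEquiv' _ X).symm fun i => prj.ev (b i.1 i.2), fun v => ?_⟩
  rw [← LinearMap.range_eq_top, eq_top_iff, ← (b v).span_eq, Submodule.span_le]
  rintro _ ⟨j, rfl⟩
  refine ⟨Fam.incl (fun i : (Σ v, Fin (Module.finrank k (X.space v))) => prj k Q i.1) ⟨v, j⟩ v (prj.e k Q v), ?_⟩
  have := congrFun ((Fam.homEquiv' (fun i : (Σ v, Fin (Module.finrank k (X.space v))) => prj k Q i.1) X).apply_symm_apply
    fun i => prj.ev (b i.1 i.2)) ⟨v, j⟩
  have h2 := congrArg (fun z : Hm (prj k Q v) X => z v (prj.e k Q v)) this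
  exact h2.trans (prj.ev_e _)

lemma tau_faithful (H : Aff Q δ) [FD X] [FD Y] (hX : NP X) (f : Hm X Y)
    (hf : tauMap f = 0) : f = 0 := by
  obtain ⟨ι, _, v, p, hp⟩ := exists_cover H Y
  have h1 : ∀ w (η : Ext Y (prj k Q w)), Ext.pull (prj k Q w) f η = 0 := by
    intro w η
    rw [← Module.forall_dual_apply_eq_zero_iff k]
    intro φ
    have : tau.at' (tauMap f w (tau.of φ)) η = 0 := by rw [hf]; rfl
    exact this
  have h2 : ∀ Z (η : Ext Y Z), Ext.pull Z f η = 0 := by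
    intro Z η
    refine LinearMap.congr_fun (f := Ext.pull Z f) (g := 0) (Ext.lext fun a ξ y => ?_) η
    rw [el_eq_push, ← Ext.push_pull, h1, map_zero]; rfl
  obtain ⟨g, hg⟩ := (SES.ofSurj p hp).lift_of_pull f (h2 _)
  have : g = 0 := Fam.hom_ext fun i => by
    rw [hX _ ((Fam.proj _ i).comp g), Hm.comp_zero]
  rw [← hg, this, Hm.comp_zero]

lemma tauL_bij (H : Aff Q δ) [FD X] [FD Y] (hX : NP X) :
    Function.Bijective (tauL X Y) := by
  have := tau_fd H X
  have := tau_fd H Y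
  have h1 : Function.Injective (tauL X Y) :=
    (injective_iff_map_eq_zero _).mpr fun f hf => tau_faithful H hX f hf
  refine ⟨h1, (LinearMap.injective_iff_surjective_of_finrank_eq_finrank ?_).mp h1⟩
  exact (homDim_tau_tau H hX).symm

lemma tau_indec (H : Aff Q δ) [FD X] (hX : X.Indec) (hn : ¬ IsProj X) :
    (tau X).Indec := by
  have hN := np_of_indec H hX hn
  have := tau_fd H X
  constructor
  · intro h0
    apply hn
    intro Y _
    rw [← homDim_tau, homDim_eq_zero]
    exact fun f => h0.hom_eq' f
  · rintro Y Z ⟨e⟩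
    let i : Hm Y (tau X) := e.symm.hom.comp (inl Y Z)
    let r : Hm (tau X) Y := (fst Y Z).comp e.hom
    let i' : Hm Z (tau X) := e.symm.hom.comp (inr Y Z)
    let r' : Hm (tau X) Z := (snd Y Z).comp e.hom
    have hri : r.comp i = Hm.id Y := by
      have : r.comp i = (fst Y Z).comp ((e.hom.comp e.symm.hom).comp (inl Y Z)) := rfl
      rw [this, Iso.hom_comp_symm, Hm.id_comp, fst_inl]
    have hri' : r.comp i' = 0 := by
      have : r.comp i' = (fst Y Z).comp ((e.hom.comp e.symm.hom).comp (inr Y Z)) := rfl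
      rw [this, Iso.hom_comp_symm, Hm.id_comp, fst_inr]
    have hri2 : r'.comp i' = Hm.id Z := by
      have : r'.comp i' = (snd Y Z).comp ((e.hom.comp e.symm.hom).comp (inr Y Z)) := rfl
      rw [this, Iso.hom_comp_symm, Hm.id_comp, snd_inr]
    let p : Hm (tau X) (tau X) := i.comp r
    have hpp : p.comp p = p := by
      have : p.comp p = i.comp ((r.comp i).comp r) := rfl
      rw [this, hri, Hm.id_comp]
    obtain ⟨g, hg⟩ := (tauL_bij H (X := X) (Y := X) hN).2 p
    have hgg : g.comp g = g := by
      apply (tauL_bij H (X := X) (Y := X) hN).1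
      refine (tauMap_comp g g).trans ?_
      have hg' : tauMap g = p := hg
      rw [hg']
      exact hpp.trans hg.symm
    rcases fitting hX g with hb | ⟨n, hn⟩
    · right
      have h1 : g = Hm.id X := Hm.ext' fun v x => by
        apply (hb v).1
        exact congrArg (fun z : Hm X X => z v x) hgg
      have h2 : p = Hm.id _ := hg.symm.trans (by rw [h1]; exact tauMap_id X)
      apply isZero_of_id
      have h3 : r'.comp (p.comp i') = r'.comp (i.comp (r.comp i')) := rfl
      rw [hri', h2, Hm.id_comp, hri2, Hm.comp_zero, Hm.comp_zero] at h3
      exact h3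
    · left
      have h1 : g = 0 := by
        have : ∀ n, g.pow (n+1) = g := by
          intro n
          induction n with
          | zero => rfl
          | succ n ih =>
            have : g.pow (n+2) = (g.pow (n+1)).comp g := rfl
            rw [this, ih, hgg]
        cases n with
        | zero =>
          have h3 : Hm.id X = 0 := hn
          rw [← Hm.comp_id g, h3, Hm.comp_zero]
        | succ n => rw [← this n, hn]
      have h2 : p = 0 := hg.symm.trans (by rw [h1, map_zero])
      apply isZero_of_id
      have h3 : r.comp (p.comp i) = (r.comp i).comp (r.comp i) := rfl
      rw [hri, h2, Hm.zero_comp, Hm.comp_zero] at h3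
      exact h3.symm

lemma isom_of_tau (H : Aff Q δ) [FD X] [FD Y] (hX : NP X) (hY : NP Y)
    (h : Isom (tau X) (tau Y)) : Isom X Y := by
  obtain ⟨e⟩ := h
  obtain ⟨f, hf⟩ := (tauL_bij H (X := X) (Y := Y) hX).2 e.hom
  obtain ⟨g, hg⟩ := (tauL_bij H (X := Y) (Y := X) hY).2 e.symm.hom
  have hf' : tauMap f = e.hom := hf
  have hg' : tauMap g = e.symm.hom := hg
  have h1 : g.comp f = Hm.id X := (tauL_bij H hX).1 ((tauMap_comp g f).trans (by
    rw [hf', hg', Iso.symm_hom_comp]; exact (tauMap_id X).symm))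
  have h2 : f.comp g = Hm.id Y := (tauL_bij H hY).1 ((tauMap_comp f g).trans (by
    rw [hf', hg', Iso.hom_comp_symm]; exact (tauMap_id Y).symm))
  refine Hm.Bij.isom (f := f) fun v => Function.bijective_iff_has_inverse.mpr ⟨g v, fun x => ?_, fun x => ?_⟩
  · exact congrArg (fun z : Hm X X => z v x) h1
  · exact congrArg (fun z : Hm Y Y => z v x) h2

lemma euler_single_self (v : Q.V) : eulerZ Q (Pi.single v 1) (Pi.single v 1) ≤ 1 := by
  rw [Aff.euler_single_left]
  have : 0 ≤ ∑ a with Q.s a = v, (Pi.single v 1 : Q.V → ℤ) (Q.t a) :=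
    Finset.sum_nonneg fun a _ => by
      rw [Pi.single_apply]; split_ifs <;> simp
  simp at this ⊢
  linarith

lemma aux_ij (i j t : ℕ) (h : i < j) : i + (t+1) * (j-i) = j + t * (j-i) := by
  obtain ⟨d, rfl⟩ := Nat.exists_eq_add_of_lt h
  rw [show i + d + 1 - i = d + 1 by omega]; ring

lemma cox_period (H : Aff Q δ) (x : ℕ → Q.V → ℤ)
    (hc : ∀ i y, eulerZ Q y (x (i+1)) = - eulerZ Q (x i) y) (hx : ∀ i v, 0 ≤ x i v)
    (hd : defectOf Q δ (x 0) ≤ 0) : defectOf Q δ (x 0) = 0 ∧ ∃ n, 0 < n ∧ x n = x 0 := by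
  have hdef : ∀ i, defectOf Q δ (x i) = defectOf Q δ (x 0) := by
    intro i
    induction i with
    | zero => rfl
    | succ i ih =>
      rw [← ih]; unfold defectOf
      rw [hc, H.rad]; ring
  have hq : ∀ i, eulerZ Q (x i) (x i) = eulerZ Q (x 0) (x 0) := by
    intro i
    induction i with
    | zero => rfl
    | succ i ih => rw [hc, hc, neg_neg, ih]
  let N : ℤ := eulerZ Q (x 0) (x 0) + 1
  let B : ℕ → Q.V → ℤ := fun i v => eulerZ Q (x i) (Pi.single v 1) + eulerZ Q (Pi.single v 1) (x i)
  have hB : ∀ i, B i ∈ Finset.Icc (fun _ => -N : Q.V → ℤ) (fun _ => N) := by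
    intro i
    rw [Finset.mem_Icc]
    constructor
    · intro v
      have h1 := H.q_nonneg (x i + Pi.single v 1)
      rw [eulerZ_add_left, eulerZ_add_right, eulerZ_add_right, hq] at h1
      have h2 := euler_single_self v
      simp only [B, N]; linarith
    · intro v
      have h1 := H.q_nonneg (x i - Pi.single v 1)
      rw [eulerZ_sub_left, eulerZ_sub_right, eulerZ_sub_right, hq] at h1
      have h2 := euler_single_self v
      simp only [B, N]; linarith
  obtain ⟨i, j, hij, hBij⟩ : ∃ i j, i < j ∧ B i = B j := by
    have hni : ¬ Function.Injective (fun i => (⟨B i, hB i⟩ :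
        ↥(Finset.Icc (fun _ => -N : Q.V → ℤ) (fun _ => N)))) := not_injective_infinite_finite _
    unfold Function.Injective at hni
    push Not at hni
    obtain ⟨a, b, h1, h2⟩ := hni
    have h3 : B a = B b := congrArg Subtype.val h1
    rcases lt_or_gt_of_ne h2 with h | h
    · exact ⟨a, b, h, h3⟩
    · exact ⟨b, a, h, h3.symm⟩
  have hqD : eulerZ Q (x j - x i) (x j - x i) = 0 := by
    have h1 : ∀ v, eulerL Q (x j - x i) (Pi.single v 1) + eulerR Q (x j - x i) (Pi.single v 1) = 0 := by
      intro v
      have := congrFun hBij v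
      simp only [B] at this
      simp only [eulerL_apply, eulerR_apply, eulerZ_sub_left, eulerZ_sub_right]
      linarith
    have h2 : eulerL Q (x j - x i) + eulerR Q (x j - x i) = 0 := by
      apply LinearMap.pi_ext'
      intro v
      apply LinearMap.ext_ring
      exact h1 v
    have h3 := LinearMap.congr_fun h2 (x j - x i)
    simp only [LinearMap.add_apply, eulerL_apply, eulerR_apply, LinearMap.zero_apply] at h3
    linarith
  obtain ⟨m, hm⟩ := H.int_mul _ hqD
  have hstep : ∀ r, x (j + r) = x (i + r) + m • natc δ := by
    intro r
    induction r with
    | zero => simpa [sub_eq_iff_eq_add, add_comm] using hm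
    | succ r ih =>
      rw [← sub_eq_zero]
      apply H.nondeg_right
      intro y
      rw [eulerZ_sub_right, eulerZ_add_right, eulerZ_smul_right, ← add_assoc, ← add_assoc, hc, hc, ih,
        eulerZ_add_left, eulerZ_smul_left, H.rad]
      ring
  let s : Q.V → ℤ := ∑ r ∈ Finset.Ico i j, x r
  have hs1 : ∀ y, eulerZ Q y s + eulerZ Q s y = m * defectOf Q δ y := by
    intro y
    have e1 : eulerZ Q y s = ∑ r ∈ Finset.Ico i j, eulerZ Q y (x r) := map_sum (eulerL Q y) _ _
    have e2 : eulerZ Q s y = ∑ r ∈ Finset.Ico i j, eulerZ Q (x r) y := map_sum (eulerR Q y) _ _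
    have e3 : ∑ r ∈ Finset.Ico i j, eulerZ Q (x r) y = - ∑ r ∈ Finset.Ico i j, eulerZ Q y (x (r+1)) := by
      rw [← Finset.sum_neg_distrib]
      exact Finset.sum_congr rfl fun r _ => by rw [hc]; ring
    have e4 := Finset.sum_Ico_sub (fun r => eulerZ Q y (x r)) hij.le
    rw [Finset.sum_sub_distrib] at e4
    have e5 := hstep 0
    rw [add_zero, add_zero] at e5
    rw [e5, eulerZ_add_right, eulerZ_smul_right, H.rad] at e4
    rw [e1, e2, e3]
    unfold defectOf
    linarith
  have hds : defectOf Q δ s = (j - i : ℕ) * defectOf Q δ (x 0) := by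
    have e1 : defectOf Q δ s = ∑ r ∈ Finset.Ico i j, defectOf Q δ (x r) := map_sum (eulerL Q (natc δ)) _ _
    rw [e1, Finset.sum_congr rfl fun r _ => hdef r]
    simp
  have hji : (0 : ℤ) < (j - i : ℕ) := by omega
  have h2q := hs1 s
  have hqs := H.q_nonneg s
  have hfin : m = 0 → ∃ n, 0 < n ∧ x n = x 0 := by
    rintro rfl
    simp only [zero_smul, add_zero] at hstep
    refine ⟨j - i, by omega, ?_⟩
    have hback : ∀ a b, x (a+1) = x (b+1) → x a = x b := by
      intro a b hab
      rw [← sub_eq_zero]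
      apply H.nondeg_left
      intro y
      have h1 := hc a y
      rw [hab, hc b y] at h1
      rw [eulerZ_sub_left]; linarith
    have h3 : ∀ r, r ≤ i → x (j - r) = x (i - r) := by
      intro r
      induction r with
      | zero => intro _; exact hstep 0
      | succ r ih =>
        intro hr
        apply hback
        have := ih (by omega)
        rwa [show j - (r+1) + 1 = j - r by omega, show i - (r+1) + 1 = i - r by omega]
    have := h3 i le_rfl
    rwa [Nat.sub_self] at this
  have hmneg : m < 0 → False := by
    intro hm0
    obtain ⟨v⟩ : Nonempty Q.V := by
      by_contra hc
      rw [not_nonempty_iff] at hc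
      exact H.min.1 (funext fun v => hc.elim v)
    have hit : ∀ t : ℕ, x (i + t * (j - i)) v = x i v + t * (m * δ v) := by
      intro t
      induction t with
      | zero => simp
      | succ t ih =>
        have h1 := congrFun (hstep (t * (j - i))) v
        rw [aux_ij i j t hij, h1, Pi.add_apply, ih]
        simp [natc]; ring
    have h1 := hit ((x i v).toNat + 1)
    have h2 := hx (i + ((x i v).toNat + 1) * (j - i)) v
    have h3 := H.δ_pos v
    have h4 : m * δ v ≤ -1 := by
      have : (1 : ℤ) ≤ δ v := by exact_mod_cast h3
      nlinarith
    have h5 := hx i v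
    have h6 : ((x i v).toNat : ℤ) = x i v := Int.toNat_of_nonneg h5
    rw [h1] at h2
    push_cast at h2
    rw [h6] at h2
    nlinarith
  rcases lt_or_eq_of_le hd with hd | hd
  · exfalso
    rw [hds] at h2q
    have hm0 : ¬ 0 < m := by
      intro h0
      have : m * (((j - i : ℕ) : ℤ) * defectOf Q δ (x 0)) < 0 :=
        mul_neg_of_pos_of_neg h0 (mul_neg_of_pos_of_neg hji hd)
      linarith
    have hm1 : m = 0 := by
      by_contra h; exact hmneg (by omega)
    rw [hm1, zero_mul] at h2q
    obtain ⟨M, hM⟩ := H.int_mul s (by linarith)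
    have : defectOf Q δ s = 0 := by
      unfold defectOf
      rw [hM, eulerZ_smul_right, H.qδ, mul_zero]
    rw [hds] at this
    rcases mul_eq_zero.mp this with h | h <;> omega
  · refine ⟨hd, hfin ?_⟩
    rw [hds, hd, mul_zero, mul_zero] at h2q
    have h0 := H.rad_of (x := s) (by linarith)
    obtain ⟨v⟩ : Nonempty Q.V := by
      by_contra hc
      rw [not_nonempty_iff] at hc
      exact H.min.1 (funext fun v => hc.elim v)
    have h1 := hs1 (dz (prj ℚ Q v))
    rw [prj.defect H, add_comm, h0] at h1
    rcases mul_eq_zero.mp h1.symm with h | h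
    · exact h
    · have := H.δ_pos v; omega

/-- level of a preprojective -/
def Pre : ℕ → Repn k Q → Prop
  | 0, X => IsProj X
  | n+1, X => ¬ IsProj X ∧ Pre n (tau X)

lemma proj_defect (H : Aff Q δ) [FD P] (hP : P.Indec) (hp : IsProj P) :
    defectOf Q δ (dz P) < 0 := by
  obtain ⟨v, hv⟩ := proj_indec H hP hp
  rw [hv.dz, prj.defect H]
  have := H.δ_pos v
  omega

lemma tau_iter (H : Aff Q δ) [FD X] (hX : X.Indec)
    (h : ∀ i, (∀ j < i, ¬ IsProj (tau^[j] X)) → ¬ IsProj (tau^[i] X)) (i : ℕ) :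
    FD (tau^[i] X) ∧ (tau^[i] X).Indec ∧ ¬ IsProj (tau^[i] X) := by
  induction i using Nat.strong_induction_on with
  | _ i ih =>
    have h3 := h i fun j hj => (ih j hj).2.2
    cases i with
    | zero => exact ⟨‹_›, hX, h3⟩
    | succ i =>
      obtain ⟨h4, h5, h6⟩ := ih i (by omega)
      rw [Function.iterate_succ_apply'] at h3 ⊢
      exact ⟨tau_fd H _, tau_indec H h5 h6, h3⟩

lemma exists_pre (H : Aff Q δ) [FD X] (hX : X.Indec)
    (hd : defectOf Q δ (dz X) < 0) : ∃ n, Pre n X := by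
  have h1 : ∃ i, IsProj (tau^[i] X) ∧ ∀ j < i, ¬ IsProj (tau^[j] X) := by
    by_contra hcon
    push Not at hcon
    have h2 := tau_iter H hX (fun i hi hp => by
      obtain ⟨j, hj, hj'⟩ := hcon i hp
      exact hi j hj hj')
    have := (cox_period H (fun i => dz (tau^[i] X)) (fun i y => by
      have := (h2 i).1
      have h3 := tau_euler H (np_of_indec H (h2 i).2.1 (h2 i).2.2) y
      rw [← Function.iterate_succ_apply' tau] at h3
      exact h3) (fun i v => by simp [dz, natc]) hd.le).1
    have h4 : defectOf Q δ (dz X) = 0 := this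
    omega
  obtain ⟨i, hi, hi'⟩ := h1
  refine ⟨i, ?_⟩
  clear hX hd
  clear ‹FD X›
  induction i generalizing X with
  | zero => exact hi
  | succ i ih =>
    exact ⟨hi' 0 (by omega), ih hi fun j hj => hi' (j+1) (by omega)⟩

lemma nonproj_of_defect (H : Aff Q δ) [FD X] (hX : X.Indec)
    (hd : 0 ≤ defectOf Q δ (dz X)) : ¬ IsProj X := fun h => by
  have := proj_defect H hX h; omega

lemma reg_period (H : Aff Q δ) [FD X] (hX : X.Indec)
    (hd : defectOf Q δ (dz X) = 0) : (∀ i, FD (tau^[i] X) ∧ (tau^[i] X).Indec ∧ ¬ IsProj (tau^[i] X) ∧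
      defectOf Q δ (dz (tau^[i] X)) = 0) ∧ ∃ n, 0 < n ∧ dimv (tau^[n] X) = dimv X := by
  have h1 : ∀ i, FD (tau^[i] X) ∧ (tau^[i] X).Indec ∧ ¬ IsProj (tau^[i] X) ∧
      defectOf Q δ (dz (tau^[i] X)) = 0 := by
    intro i
    induction i with
    | zero =>
      have hn : ¬ IsProj X := nonproj_of_defect H hX hd.ge
      have hF : FD X := inferInstance
      exact ⟨hF, hX, hn, hd⟩
    | succ i ih =>
      obtain ⟨h2, h3, h4, h5⟩ := ih
      rw [Function.iterate_succ_apply']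
      have h6 := tau_fd H (tau^[i] X)
      have h7 := defect_tau H (np_of_indec H h3 h4)
      rw [h5] at h7
      have h8 := tau_indec H h3 h4
      exact ⟨h6, h8, nonproj_of_defect H h8 h7.ge, h7⟩
  refine ⟨h1, ?_⟩
  obtain ⟨n, hn, h2⟩ := (cox_period H (fun i => dz (tau^[i] X)) (fun i y => by
      have := (h1 i).1
      have h3 := tau_euler H (np_of_indec H (h1 i).2.1 (h1 i).2.2.1) y
      rw [← Function.iterate_succ_apply' tau] at h3
      exact h3) (fun i v => by simp [dz, natc]) hd.le).2
  refine ⟨n, hn, funext fun v => ?_⟩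
  have := congrFun h2 v
  simpa [dz, natc] using this

/-- no maps from nonnegative defect to preprojectives -/
lemma hom_to_preproj (H : Aff Q δ) [FD X] [FD Y] (hX : X.Indec) (hY : Y.Indec)
    (hdX : defectOf Q δ (dz X) < 0) (hdY : 0 ≤ defectOf Q δ (dz Y)) : homDim Y X = 0 := by
  obtain ⟨n, hn⟩ := exists_pre H hX hdX
  induction n generalizing X Y with
  | zero =>
    rw [homDim_eq_zero]
    exact hom_proj hY (nonproj_of_defect H hY hdY) hn
  | succ n ih =>
    have hYn := nonproj_of_defect H hY hdY
    have NX := np_of_indec H hX hn.1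
    have NY := np_of_indec H hY hYn
    have := tau_fd H X
    have := tau_fd H Y
    rw [← homDim_tau_tau H NY]
    exact ih (tau_indec H hX hn.1) (tau_indec H hY hYn) (by rw [defect_tau H NX]; exact hdX)
      (by rw [defect_tau H NY]; exact hdY) hn.2

lemma hom_from_preinj (H : Aff Q δ) [FD X] [FD Y] (hX : X.Indec) (hY : Y.Indec)
    (hdX : defectOf Q δ (dz X) ≤ 0) (hdY : 0 < defectOf Q δ (dz Y)) : homDim Y X = 0 := by
  rw [← homDim_dual]
  exact hom_to_preproj H.op hY.dual hX.dual (by rw [defect_dual H]; omega) (by rw [defect_dual H]; omega)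

lemma preproj_hom_or_ext (H : Aff Q δ) [FD X] [FD Y] (hX : X.Indec) (hY : Y.Indec)
    (hdX : defectOf Q δ (dz X) < 0) : homDim X Y = 0 ∨ extDim X Y = 0 := by
  obtain ⟨n, hn⟩ := exists_pre H hX hdX
  induction n generalizing X Y with
  | zero => exact Or.inr (hn Y)
  | succ n ih =>
    by_cases hp : IsProj Y
    · left
      rw [homDim_eq_zero]
      exact hom_proj hX hn.1 hp
    · have NX := np_of_indec H hX hn.1
      have NY := np_of_indec H hY hp
      have := tau_fd H X
      have := tau_fd H Y
      have := ih (tau_indec H hX hn.1) (tau_indec H hY hp) (by rw [defect_tau H NX]; exact hdX) hn.2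
      rwa [homDim_tau_tau H NX, extDim_tau H NY, homDim_tau] at this

lemma preproj_hom (H : Aff Q δ) [FD X] [FD Y] (hX : X.Indec) (hY : Y.Indec)
    (hdX : defectOf Q δ (dz X) < 0) : homDim X Y = (eulerZ Q (dz X) (dz Y)).toNat := by
  have h1 := euler X Y
  have := preproj_hom_or_ext H hX hY hdX
  omega

lemma preproj_brick (H : Aff Q δ) [FD X] (hX : X.Indec)
    (hdX : defectOf Q δ (dz X) < 0) : homDim X X = 1 := by
  obtain ⟨n, hn⟩ := exists_pre H hX hdX
  induction n generalizing X with
  | zero =>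
    obtain ⟨v, hv⟩ := proj_indec H hX hn
    rw [hv.homDim_left, hv.homDim_right, prj.homDim, prj.one H]
  | succ n ih =>
    have NX := np_of_indec H hX hn.1
    have := tau_fd H X
    rw [← homDim_tau_tau H NX]
    exact ih (tau_indec H hX hn.1) (by rw [defect_tau H NX]; exact hdX) hn.2

lemma preproj_isom (H : Aff Q δ) [FD X] [FD Y] (hX : X.Indec) (hY : Y.Indec)
    (hdX : defectOf Q δ (dz X) < 0) (h : dz X = dz Y) : Isom X Y := by
  have key : ∀ {X Y : Repn k Q} [FD X] [FD Y], X.Indec → Y.Indec → defectOf Q δ (dz X) < 0 →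
      dz X = dz Y → ¬ IsProj X → ¬ IsProj Y := by
    intro X Y _ _ hX hY hdX h hn hp
    have h1 : homDim X Y = 0 := by rw [homDim_eq_zero]; exact hom_proj hX hn hp
    have h2 := preproj_hom H hX hY hdX
    have h3 := preproj_hom H hX hX hdX
    rw [← h] at h2
    rw [preproj_brick H hX hdX] at h3
    omega
  obtain ⟨n, hn⟩ := exists_pre H hX hdX
  induction n generalizing X Y with
  | zero =>
    have hp : IsProj Y := by
      by_contra hp
      exact key hY hX (h ▸ hdX) h.symm hp hn
    obtain ⟨v, hv⟩ := proj_indec H hX hn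
    obtain ⟨w, hw⟩ := proj_indec H hY hp
    have : v = w := by
      by_contra hvw
      have h1 := euler_prj (k := k) H v (Pi.single v 1)
      have h2 := euler_prj (k := k) H w (Pi.single v 1)
      rw [← hv.dz, h, hw.dz, h2] at h1
      simp [Ne.symm hvw] at h1
    subst this
    exact hv.trans hw.symm
  | succ n ih =>
    have hp := key hX hY hdX h hn.1
    have NX := np_of_indec H hX hn.1
    have NY := np_of_indec H hY hp
    have := tau_fd H X
    have := tau_fd H Y
    apply isom_of_tau H NX NY
    refine ih (tau_indec H hX hn.1) (tau_indec H hY hp) (by rw [defect_tau H NX]; exact hdX) ?_ hn.2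
    rw [← sub_eq_zero]
    apply H.nondeg_right
    intro y
    rw [eulerZ_sub_right, tau_euler H NX, tau_euler H NY, h, sub_self]

lemma preinj_hom (H : Aff Q δ) [FD X] [FD Y] (hX : X.Indec) (hY : Y.Indec)
    (hdY : 0 < defectOf Q δ (dz Y)) : homDim X Y = (eulerZ Q (dz X) (dz Y)).toNat := by
  have h1 := preproj_hom H.op hY.dual hX.dual (by rw [defect_dual H]; omega)
  rw [homDim_dual, eulerZ_op] at h1
  rw [h1]
  congr 2
  · exact dz_dual X
  · exact dz_dual Y

lemma preinj_brick (H : Aff Q δ) [FD X] (hX : X.Indec)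
    (hdX : 0 < defectOf Q δ (dz X)) : homDim X X = 1 := by
  rw [← homDim_dual]
  exact preproj_brick H.op hX.dual (by rw [defect_dual H]; omega)

lemma preinj_isom (H : Aff Q δ) [FD X] [FD Y] (hX : X.Indec) (hY : Y.Indec)
    (hdX : 0 < defectOf Q δ (dz X)) (h : dz X = dz Y) : Isom X Y := by
  apply Isom.of_dual
  exact preproj_isom H.op hX.dual hY.dual (by rw [defect_dual H]; omega)
    ((dz_dual X).trans (h.trans (dz_dual Y).symm))

/-- `ξ` is the class of the extension `σ`. -/
def SES.Cls (σ : SES A E B) (ξ : Ext B A) : Prop :=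
  ∃ (c : C1 B A) (s : ∀ v, B.space v →ₗ[k] E.space v), ξ = Ext.mk B A c ∧
    (∀ v x, σ.p v (s v x) = x) ∧
    ∀ a x, E.map a (s _ x) = s _ (B.map a x) + σ.i _ (c a x)

lemma SES.exists_cls (σ : SES A E B) : ∃ ξ, σ.Cls ξ := by
  have hs : ∀ v, ∃ s : B.space v →ₗ[k] E.space v, (σ.p v) ∘ₗ s = LinearMap.id := fun v =>
    (σ.p v).exists_rightInverse_of_surjective (LinearMap.range_eq_top.mpr (σ.surj v))
  choose s hs using hs
  have hs' : ∀ v x, σ.p v (s v x) = x := fun v x => LinearMap.congr_fun (hs v) x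
  have hr : ∀ v, ∃ r : E.space v →ₗ[k] A.space v, r ∘ₗ (σ.i v) = LinearMap.id := fun v =>
    (σ.i v).exists_leftInverse_of_injective (LinearMap.ker_eq_bot.mpr (σ.inj v))
  choose r hr using hr
  have hr' : ∀ v x, σ.p v x = 0 → σ.i v (r v x) = x := by
    intro v x hx
    obtain ⟨y, rfl⟩ := σ.ex v x hx
    congr 1
    exact LinearMap.congr_fun (hr v) y
  let c : C1 B A := fun a => r (Q.t a) ∘ₗ (E.map a ∘ₗ s (Q.s a) - s (Q.t a) ∘ₗ B.map a)
  have hc : ∀ a x, σ.i _ (c a x) = E.map a (s _ x) - s _ (B.map a x) := by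
    intro a x
    apply hr'
    simp only [LinearMap.sub_apply, LinearMap.comp_apply, map_sub, hs']
    rw [Hm.comm, hs', sub_self]
  exact ⟨_, c, s, rfl, hs', fun a x => by rw [hc]; abel⟩

lemma exists_ses [FD A] [FD B] (ξ : Ext B A) :
    ∃ (E : Repn k Q) (_ : FD E) (σ : SES A E B), σ.Cls ξ := by
  obtain ⟨c, rfl⟩ := Ext.mk_surj B A ξ
  refine ⟨Repn.extn c, (SES.extn c).fdE, SES.extn c, c, fun v => LinearMap.inr k _ _, rfl, ?_, ?_⟩
  · intro v x; rfl
  · intro a x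
    refine Prod.ext ?_ ?_
    · change A.map a 0 + c a x = 0 + c a x
      simp
    · change B.map a x = B.map a x + 0
      simp

/-- morphism of extensions -/
lemma SES.morph {σ : SES A E B} {σ' : SES A' E' B'}
    {ξ : Ext B A} {ξ' : Ext B' A'} (h1 : σ.Cls ξ) (h2 : σ'.Cls ξ') (g : Hm A A') (h : Hm B B')
    (hgh : Ext.push B g ξ = Ext.pull A' h ξ') :
    ∃ f : Hm E E', f.comp σ.i = σ'.i.comp g ∧ σ'.p.comp f = h.comp σ.p := by
  obtain ⟨c, s, rfl, hs, hc⟩ := h1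
  obtain ⟨c', s', rfl, hs', hc'⟩ := h2
  rw [Ext.push_mk, Ext.pull_mk, ← sub_eq_zero, ← map_sub, Ext.mk_eq_zero] at hgh
  obtain ⟨θ, hθ⟩ := hgh
  have hθ' : ∀ a x, A'.map a (θ _ x) - θ _ (B.map a x) = g _ (c a x) - c' a (h _ x) := fun a x =>
    LinearMap.congr_fun (congrFun hθ a) x
  have hr : ∀ v, ∃ r : E.space v →ₗ[k] A.space v, r ∘ₗ (σ.i v) = LinearMap.id := fun v =>
    (σ.i v).exists_leftInverse_of_injective (LinearMap.ker_eq_bot.mpr (σ.inj v))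
  choose r hr using hr
  have hex : ∀ v (y : E.space v), ∃ a b, y = σ.i v a + s v b := by
    intro v y
    obtain ⟨a, ha⟩ := σ.ex v (y - s v (σ.p v y)) (by rw [map_sub, hs, sub_self])
    exact ⟨a, σ.p v y, by rw [ha]; abel⟩
  let F : ∀ v, E.space v →ₗ[k] E'.space v := fun v =>
    (σ'.i v) ∘ₗ (g v) ∘ₗ (r v) ∘ₗ (LinearMap.id - s v ∘ₗ σ.p v)
      + (s' v) ∘ₗ (h v) ∘ₗ (σ.p v) + (σ'.i v) ∘ₗ θ v ∘ₗ σ.p v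
  have hF : ∀ v a b, F v (σ.i v a + s v b) = σ'.i v (g v a) + s' v (h v b) + σ'.i v (θ v b) := by
    intro v a b
    have e1 : σ.p v (σ.i v a + s v b) = b := by rw [map_add, hs]; rw [σ.zero v a, zero_add]
    have e2 : r v (σ.i v a) = a := LinearMap.congr_fun (hr v) a
    simp only [F, LinearMap.sub_apply, LinearMap.add_apply, LinearMap.comp_apply, LinearMap.id_apply, e1,
      add_sub_cancel_right, e2]
  refine ⟨Hm.mk' F ?_, Hm.ext' fun v x => ?_, Hm.ext' fun v y => ?_⟩
  · intro a y
    obtain ⟨x, b, rfl⟩ := hex _ y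
    have e1 : E.map a (σ.i _ x + s _ b) = σ.i _ (A.map a x + c a b) + s _ (B.map a b) := by
      rw [map_add, hc, ← Hm.comm, map_add]; abel
    have h3 := congrArg (σ'.i _) (hθ' a b)
    rw [map_sub, map_sub] at h3
    have e2 : E'.map a (σ'.i _ (g _ x)) = σ'.i _ (g _ (A.map a x)) := by rw [← Hm.comm, ← Hm.comm]
    have e3 : E'.map a (σ'.i _ (θ _ b)) = σ'.i _ (A'.map a (θ _ b)) := by rw [← Hm.comm]
    have e4 : E'.map a (s' _ (h _ b)) = s' _ (h _ (B.map a b)) + σ'.i _ (c' a (h _ b)) := by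
      rw [hc', ← Hm.comm]
    have e5 : σ'.i _ (g _ (A.map a x + c a b)) = σ'.i _ (g _ (A.map a x)) + σ'.i _ (g _ (c a b)) := by
      rw [map_add, map_add]
    rw [e1, hF, hF, map_add (E'.map a), map_add (E'.map a), e2, e3, e4, e5]
    rw [← sub_eq_zero] at h3 ⊢
    rw [← neg_eq_zero, ← h3]; abel
  · have := hF v x 0
    simpa using this
  · obtain ⟨x, b, rfl⟩ := hex _ y
    have e1 : σ.p v (σ.i v x + s v b) = b := by rw [map_add, hs]; rw [σ.zero v x, zero_add]
    rw [Hm.comp_apply, Hm.comp_apply, e1, Hm.mk'_apply, hF, map_add, map_add, hs', σ'.zero, σ'.zero]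
    abel

lemma SES.Cls.lift {σ : SES A E B} {ξ : Ext B A} (hξ : σ.Cls ξ) (g : Hm Z B) :
    Ext.pull A g ξ = 0 ↔ ∃ f : Hm Z E, σ.p.comp f = g := by
  obtain ⟨c, s, rfl, hs, hc⟩ := hξ
  constructor
  · intro h1
    rw [Ext.pull_mk, Ext.mk_eq_zero] at h1
    obtain ⟨u, hu⟩ := h1
    have hu' : ∀ a x, A.map a (u _ x) - u _ (Z.map a x) = c a (g _ x) := fun a x =>
      LinearMap.congr_fun (congrFun hu a) x
    refine ⟨Hm.mk' (fun v => s v ∘ₗ g v - (σ.i v) ∘ₗ u v) (fun a x => ?_), Hm.ext' fun v x => ?_⟩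
    · simp only [LinearMap.sub_apply, LinearMap.comp_apply, map_sub]
      have h2 := congrArg (σ.i _) (hu' a x)
      rw [map_sub, Hm.comm] at h2
      rw [Hm.comm, hc, ← sub_eq_zero]
      have h3 := sub_eq_zero.mpr h2
      rw [← h3]
      abel
    · have h0 : σ.p v (σ.i v (u v x)) = 0 := σ.zero v _
      simp [hs, h0]
  · rintro ⟨f, hf⟩
    have hf' : ∀ v x, σ.p v (f v x) = g v x := fun v x => congrArg (fun z : Hm Z B => z v x) hf
    have hr : ∀ v, ∃ r : E.space v →ₗ[k] A.space v, r ∘ₗ (σ.i v) = LinearMap.id := fun v =>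
      (σ.i v).exists_leftInverse_of_injective (LinearMap.ker_eq_bot.mpr (σ.inj v))
    choose r hr using hr
    have hr' : ∀ v x, σ.p v x = 0 → σ.i v (r v x) = x := by
      intro v x hx
      obtain ⟨y, rfl⟩ := σ.ex v x hx
      congr 1
      exact LinearMap.congr_fun (hr v) y
    rw [Ext.pull_mk, Ext.mk_eq_zero]
    let u : ∀ v, Z.space v →ₗ[k] A.space v := fun v => r v ∘ₗ (s v ∘ₗ g v - f v)
    have hu : ∀ v x, σ.i v (u v x) = s v (g v x) - f v x := by
      intro v x
      apply hr'
      simp only [LinearMap.sub_apply, LinearMap.comp_apply, map_sub, hs, hf', sub_self]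
    refine ⟨u, funext fun a => LinearMap.ext fun x => σ.inj _ ?_⟩
    change σ.i _ (A.map a (u _ x) - u _ (Z.map a x)) = σ.i _ (c a (g _ x))
    rw [map_sub, Hm.comm, hu, hu, map_sub, hc, ← Hm.comm f, Hm.comm g]
    abel

abbrev df (δ : Q.V → ℕ) (M : Repn k Q) : ℤ := defectOf Q δ (dz M)
lemma SES.df (σ : SES A E B) [FD E] : df δ E = df δ A + df δ B := by
  unfold Repn.df defectOf; rw [σ.dz, eulerZ_add_right]

lemma Isom.df (h : Isom A B) : df δ A = df δ B := by
  unfold Repn.df; rw [h.dz]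

lemma df_zero [FD A] (h : A.IsZero) : df δ A = 0 := by
  have : dz A = 0 := by
    funext v
    have := congrFun (isZero_iff_dimv.mp h) v
    simp [dz, natc, this]
  unfold df defectOf; rw [this, eulerZ_zero_right]

lemma df_fam {ι : Type} [Fintype ι] (X : ι → Repn k Q) [∀ i, FD (X i)] :
    df δ (dsumFam X) = ∑ i, df δ (X i) := by
  unfold df defectOf; rw [dz_fam]; exact map_sum (eulerL Q (natc δ)) _ _

/-- regular modules -/
def Reg (δ : Q.V → ℕ) (M : Repn k Q) : Prop :=
  df δ M = 0 ∧ ∀ (A : Repn k Q) (f : Hm A M), f.Inj → df δ A ≤ 0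

lemma Isom.reg (h : Isom M N) (hM : Reg δ M) : Reg δ N := by
  refine ⟨h.df.symm.trans hM.1, fun A f hf => ?_⟩
  obtain ⟨e⟩ := h
  exact hM.2 A (e.symm.hom.comp f) (e.symm.hom_bij.inj.comp hf)

lemma Reg.quot [FD M] (hM : Reg δ M) (f : Hm M B) (hf : f.Surj) : 0 ≤ df δ B := by
  have h1 := (SES.ofSurj f hf).df (δ := δ)
  have h2 := hM.2 _ _ (SES.ofSurj f hf).inj
  have h3 := hM.1
  omega

lemma Reg.sesA (σ : SES A E B) (hE : Reg δ E) (h : df δ A = 0) : Reg δ A :=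
  ⟨h, fun U f hf => hE.2 U (σ.i.comp f) (σ.inj.comp hf)⟩

lemma Reg.sesB [FD E] (σ : SES A E B) (hE : Reg δ E) (h : df δ A = 0) : Reg δ B := by
  have h1 := σ.df (δ := δ)
  have h2 := hE.1
  have hB : df δ B = 0 := by omega
  refine ⟨hB, fun U f hf => ?_⟩
  have := σ.fdB
  have h3 := (SES.ofInj f hf).df (δ := δ)
  have h4 := hE.quot ((SES.ofInj f hf).p.comp σ.p) ((SES.ofInj f hf).surj.comp σ.surj)
  omega

lemma Reg.ext [FD E] (σ : SES A E B) (hA : Reg δ A) (hB : Reg δ B) : Reg δ E := by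
  refine ⟨by rw [σ.df, hA.1, hB.1]; rfl, fun U f hf => ?_⟩
  have hU := hf.fd
  let g : Hm U B := σ.p.comp f
  have h1 := (SES.kerIm g).df (δ := δ)
  have h2 := hB.2 _ g.range.incl g.range.incl_inj
  have h4 : g.comp g.ker.incl = 0 := Hm.ext' fun v x => x.2
  obtain ⟨j, hj⟩ := σ.factorA (f.comp g.ker.incl) h4
  have h3 := hA.2 _ j (fun v x y hxy => by
    have e : ∀ z, σ.i v (j v z) = f v (g.ker.incl v z) := fun z =>
      congrArg (fun w : Hm g.ker.repn E => w v z) hj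
    have := congrArg (σ.i v) hxy
    rw [e, e] at this
    exact g.ker.incl_inj v (hf v this))
  omega

lemma Reg.ker_range [FD M] [FD N] (hM : Reg δ M) (hN : Reg δ N) (f : Hm M N) :
    Reg δ f.ker.repn ∧ Reg δ f.range.repn ∧ Reg δ f.range.quot := by
  have h1 := hM.quot f.toRange f.toRange_surj
  have h2 := hN.2 _ f.range.incl f.range.incl_inj
  have h3 := (SES.kerIm f).df (δ := δ)
  have h4 := hM.1
  exact ⟨Reg.sesA (SES.kerIm f) hM (by omega), Reg.sesA (SES.ofSub f.range) hN (by omega),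
    Reg.sesB (SES.ofSub f.range) hN (by omega)⟩

lemma Reg.zero [FD M] (h : M.IsZero) : Reg δ M := by
  refine ⟨df_zero h, fun A f hf => ?_⟩
  have := hf.fd
  have hA : A.IsZero := fun v x => hf v ((h v _).trans (h v _).symm)
  exact (df_zero hA).le

lemma Reg.dsum [FD M] [FD N] (hM : Reg δ M) (hN : Reg δ N) : Reg δ (M.dsum N) :=
  Reg.ext (SES.dsum M N) hM hN

lemma reg_of_indec (H : Aff Q δ) [FD X] (hX : X.Indec) (hd : df δ X = 0) : Reg δ X := by
  refine ⟨hd, fun A f hf => ?_⟩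
  have := hf.fd
  obtain ⟨n, Y, hY, ⟨e⟩⟩ := exists_decomp A
  have hfd : ∀ i, FD (Y i) := fun i => (hY i).2
  rw [(show Isom A _ from ⟨e⟩).df, df_fam]
  refine Finset.sum_nonpos fun i _ => ?_
  by_contra hc
  push Not at hc
  have h1 := homDim_eq_zero.mp (hom_from_preinj H hX (hY i).1 hd.le hc) (f.comp (e.symm.hom.comp (Fam.incl Y i)))
  apply (hY i).1.1
  intro v x
  have h2 : f v (e.symm.hom v (Fam.incl Y i v x)) = 0 := congrArg (fun g : Hm (Y i) X => g v x) h1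
  have h3 : Fam.incl Y i v x = 0 := (e.symm.hom_bij.inj v) ((hf v (h2.trans (map_zero _).symm)).trans (map_zero _).symm)
  have h4 : (Fam.proj Y i) v (Fam.incl Y i v x) = x := congrArg (fun g : Hm (Y i) (Y i) => g v x) (Fam.proj_incl Y i)
  rw [← h4, h3, map_zero]

lemma reg_fam {ι : Type} [Finite ι] (X : ι → Repn k Q) [∀ i, FD (X i)] (h : ∀ i, Reg δ (X i)) :
    Reg δ (dsumFam X) := by
  have : Fintype ι := Fintype.ofFinite ι
  obtain ⟨n, ⟨e⟩⟩ : ∃ n, Nonempty (ι ≃ Fin n) := ⟨_, ⟨Fintype.equivFin ι⟩⟩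
  refine (dsumFam_equiv X e.symm).reg ?_
  suffices key : ∀ (n : ℕ) (Y : Fin n → Repn k Q), (∀ i, Reg δ (Y i)) → (∀ i, FD (Y i)) →
    Reg δ (dsumFam Y) from key n _ (fun i => h _) (fun i => inferInstance)
  clear e n
  intro n
  induction n with
  | zero => intro Y _ _; exact Reg.zero (dsumFam_empty _)
  | succ n ih =>
    intro Y h' hf
    refine (dsumFam_equiv Y (finSuccEquiv n).symm).reg ?_
    refine (dsumFam_option _).symm.reg ?_
    exact Reg.dsum (h' _) (ih _ (fun i => h' _) (fun i => hf _))

lemma Reg.summand [FD M] (hM : Reg δ M) (h : Isom M (A.dsum B)) : Reg δ A := by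
  have h1 := h.reg hM
  have := h.fd
  have h2 := h1.2 A (inl A B) (SES.dsum A B).inj
  have h3 := h1.quot (fst A B) (fun v x => ⟨(x, 0), rfl⟩)
  exact Reg.sesA (SES.dsum A B) h1 (le_antisymm h2 h3)

lemma Reg.fam_comp {ι : Type} [Finite ι] [FD M] (hM : Reg δ M) {X : ι → Repn k Q}
    (h : Isom M (dsumFam X)) (i : ι) : Reg δ (X i) ∧ FD (X i) := by
  classical
  have h1 := h.fd
  obtain ⟨e⟩ := id h
  obtain ⟨N, h2⟩ : ∃ N, Isom M ((X i).dsum N) := ⟨_, isom_dsum_of_retract (e.symm.hom.comp (Fam.incl X i))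
    ((Fam.proj X i).comp e.hom) (by
      have : ((Fam.proj X i).comp e.hom).comp (e.symm.hom.comp (Fam.incl X i))
        = (Fam.proj X i).comp ((e.hom.comp e.symm.hom).comp (Fam.incl X i)) := rfl
      rw [this, Iso.hom_comp_symm, Hm.id_comp, Fam.proj_incl])⟩
  refine ⟨hM.summand h2, ?_⟩
  have := h2.fd
  exact (SES.dsum (X i) N).fdA

lemma regMod_iff (H : Aff Q δ) : IsRegularModule δ M ↔ FD M ∧ Reg δ M := by
  constructor
  · rintro ⟨ι, _, X, hX, e⟩
    have : ∀ i, FD (X i) := fun i => ⟨(hX i).2.1⟩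
    have h : Isom (dsumFam X) M := Isom.symm e
    exact ⟨h.fd, h.reg (reg_fam X fun i => reg_of_indec H (hX i).1 (hX i).2.2)⟩
  · rintro ⟨_, hM⟩
    obtain ⟨n, X, hX, e⟩ := exists_decomp M
    exact ⟨Fin n, inferInstance, X, fun i => ⟨(hX i).1, (hX i).2.fd, (hM.fam_comp e i).1.1⟩, e⟩

lemma reg_np (H : Aff Q δ) [FD M] (hM : Reg δ M) : NP M := by
  obtain ⟨n, X, hX, ⟨e⟩⟩ := exists_decomp M
  intro v f
  have hc := hM.fam_comp ⟨e⟩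
  have h1 : f.comp e.symm.hom = 0 := Fam.hom_ext' fun i => by
    have := (hX i).2
    rw [np_of_indec H (hX i).1 (nonproj_of_defect H (hX i).1 (hc i).1.1.ge) v ((f.comp e.symm.hom).comp (Fam.incl X i)),
      Hm.zero_comp]
  have h2 : (f.comp e.symm.hom).comp e.hom = f := by
    have : (f.comp e.symm.hom).comp e.hom = f.comp (e.symm.hom.comp e.hom) := rfl
    rw [this, Iso.symm_hom_comp, Hm.comp_id]
  rw [← h2, h1, Hm.zero_comp]

lemma Hm.eq_zero_of_range {f : Hm M N} (h : f.range.repn.IsZero) : f = 0 :=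
  Hm.ext' fun v x => congrArg Subtype.val (h v ⟨f v x, ⟨x, rfl⟩⟩)

lemma Hm.inj_of_ker {f : Hm M N} (h : f.ker.repn.IsZero) : f.Inj :=
  Hm.inj_iff.mpr fun v x hx => congrArg Subtype.val (h v ⟨x, hx⟩)

lemma Hm.ne_zero_of_inj {f : Hm M N} (h : f.Inj) (hM : ¬ M.IsZero) : f ≠ 0 := by
  rintro rfl
  exact hM fun v x => h v (by rfl)

lemma Hm.ne_zero_of_surj {f : Hm M N} (h : f.Surj) (hM : ¬ N.IsZero) : f ≠ 0 := by
  rintro rfl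
  exact hM fun v x => by obtain ⟨y, rfl⟩ := h v x; rfl

lemma Hm.comp_ne_zero_left {g : Hm N P} {f : Hm M N} (hg : g.Inj) (hf : f ≠ 0) :
    g.comp f ≠ 0 := fun h => hf (hg.compL_inj M (by
      change g.comp f = g.comp 0
      rw [h, Hm.comp_zero]))

lemma Hm.comp_ne_zero_right {g : Hm N P} {f : Hm M N} (hf : f.Surj) (hg : g ≠ 0) :
    g.comp f ≠ 0 := fun h => hg (hf.compR_inj P (by
      change g.comp f = (0 : Hm N P).comp f
      rw [h, Hm.zero_comp]))

/-- Stable objects, i.e. the simple objects of the category of regular modules. -/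
def Stab (δ : Q.V → ℕ) (S : Repn k Q) : Prop :=
  Reg δ S ∧ ¬ S.IsZero ∧ ∀ (A : Repn k Q) (f : Hm A S), f.Inj → df δ A = 0 → A.IsZero ∨ f.Bij

lemma Isom.stab (h : Isom S T) (hS : Stab δ S) : Stab δ T := by
  refine ⟨h.reg hS.1, fun h0 => hS.2.1 (h.symm.isZero h0), fun A f hf hA => ?_⟩
  obtain ⟨e⟩ := h
  refine (hS.2.2 A (e.symm.hom.comp f) (e.symm.hom_bij.inj.comp hf) hA).imp id fun h => ?_
  have h2 := e.hom_bij.comp h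
  have h3 : e.hom.comp (e.symm.hom.comp f) = f := by
    rw [← Hm.comp_assoc, Iso.hom_comp_symm, Hm.id_comp]
  rwa [h3] at h2

lemma Stab.inj [FD S] [FD M] (hS : Stab δ S) (hM : Reg δ M) {f : Hm S M}
    (hf : f ≠ 0) : f.Inj := by
  have h := hS.1.ker_range hM f
  rcases hS.2.2 _ f.ker.incl f.ker.incl_inj h.1.1 with h1 | h1
  · exact Hm.inj_of_ker h1
  · exfalso
    refine hf (Hm.ext' fun v x => ?_)
    obtain ⟨y, rfl⟩ := h1.surj v x
    exact y.2

lemma Stab.surj [FD S] [FD M] (hS : Stab δ S) (hM : Reg δ M) {f : Hm M S}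
    (hf : f ≠ 0) : f.Surj := by
  have h := hM.ker_range hS.1 f
  rcases hS.2.2 _ f.range.incl f.range.incl_inj h.2.1.1 with h1 | h1
  · exact absurd (Hm.eq_zero_of_range h1) hf
  · intro v x
    obtain ⟨⟨_, ⟨y, hy⟩⟩, rfl⟩ := h1.surj v x
    exact ⟨y, hy⟩

lemma Stab.bij [FD S] [FD T] (hS : Stab δ S) (hT : Stab δ T) {f : Hm S T}
    (hf : f ≠ 0) : f.Bij := fun v => ⟨hS.inj hT.1 hf v, hT.surj hS.1 hf v⟩

lemma Stab.isom_of_hom [FD S] [FD T] (hS : Stab δ S) (hT : Stab δ T)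
    (h : homDim S T ≠ 0) : Isom S T := by
  obtain ⟨f, hf⟩ := homDim_ne_zero.mp h
  exact (hS.bij hT hf).isom

lemma Stab.indec [FD S] (hS : Stab δ S) : S.Indec := by
  refine ⟨hS.2.1, fun Y Z h => ?_⟩
  have h' : Isom S (Y.dsum Z) := h
  have hY := hS.1.summand h'
  have h1 := (h'.stab hS).2.2 Y (inl Y Z) (SES.dsum Y Z).inj hY.1
  refine h1.imp id fun h2 v z => ?_
  obtain ⟨y, hy⟩ := h2.surj v (0, z)
  exact (congrArg Prod.snd hy).symm

lemma regSimple_iff (H : Aff Q δ) : IsRegSimple δ X ↔ FD X ∧ Stab δ X := by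
  constructor
  · rintro ⟨⟨h1, h2, h3⟩, h4⟩
    have : FD X := ⟨h2⟩
    have hX := reg_of_indec H h1 h3
    refine ⟨this, hX, h1.1, fun A f hf hA => ?_⟩
    have σ := SES.ofInj f hf
    have hfd := σ.fdA
    have e : Isom A f.range.repn := by
      have : f.toRange.Bij := fun v =>
        ⟨fun x y h => hf v (congrArg Subtype.val h), f.toRange_surj v⟩
      exact this.isom
    have := h4 f.range ⟨(regMod_iff H).mpr ⟨inferInstance, e.reg (Reg.sesA σ hX hA)⟩,
      (regMod_iff H).mpr ⟨inferInstance, Reg.sesB σ hX hA⟩⟩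
    refine this.imp (fun h => e.symm.isZero h) fun h v => ⟨hf v, fun x => ?_⟩
    have := h v (f.range.proj v x)
    exact (f.range.proj_eq_zero v x).mp this
  · rintro ⟨_, hX⟩
    refine ⟨⟨hX.indec, FD.fd, hX.1.1⟩, fun U hU => ?_⟩
    have := ((regMod_iff H).mp hU.1).2
    refine (hX.2.2 _ U.incl U.incl_inj this.1).imp id fun h v x => ?_
    obtain ⟨y, rfl⟩ := U.proj_surj v x
    obtain ⟨z, rfl⟩ := h.surj v y
    exact (U.proj_eq_zero v _).mpr z.2

lemma exists_stab_sub (M : Repn k Q) [hfd : FD M] (hM : Reg δ M) (h0 : ¬ M.IsZero) :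
    ∃ (S : Repn k Q) (_ : FD S) (f : Hm S M), Stab δ S ∧ f.Inj := by
  induction hn : tdim M using Nat.strong_induction_on generalizing M with
  | _ n ih =>
    by_cases hs : Stab δ M
    · exact ⟨M, hfd, Hm.id M, hs, fun v x y h => h⟩
    · have : ∃ (A : Repn k Q) (f : Hm A M), f.Inj ∧ df δ A = 0 ∧ ¬ A.IsZero ∧ ¬ f.Bij := by
        by_contra hc
        push Not at hc
        exact hs ⟨hM, h0, fun A f hf hA => or_iff_not_imp_left.mpr fun h => hc A f hf hA h⟩
      obtain ⟨A, f, hf, hA, hA0, hb⟩ := this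
      have hfA := hf.fd
      have h1 : tdim A < n := by
        by_contra h
        exact hb (hf.bij_of_tdim (by omega))
      obtain ⟨S, hS, g, h2, h3⟩ := ih _ h1 A (Reg.sesA (SES.ofInj f hf) hM hA) hA0 rfl
      exact ⟨S, hS, f.comp g, h2, hf.comp h3⟩

lemma exists_stab_quot (M : Repn k Q) [hfd : FD M] (hM : Reg δ M) (h0 : ¬ M.IsZero) :
    ∃ (S : Repn k Q) (_ : FD S) (f : Hm M S), Stab δ S ∧ f.Surj := by
  induction hn : tdim M using Nat.strong_induction_on generalizing M with
  | _ n ih =>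
    by_cases hs : Stab δ M
    · exact ⟨M, hfd, Hm.id M, hs, fun v x => ⟨x, rfl⟩⟩
    · have : ∃ (A : Repn k Q) (f : Hm A M), f.Inj ∧ df δ A = 0 ∧ ¬ A.IsZero ∧ ¬ f.Bij := by
        by_contra hc
        push Not at hc
        exact hs ⟨hM, h0, fun A f hf hA => or_iff_not_imp_left.mpr fun h => hc A f hf hA h⟩
      obtain ⟨A, f, hf, hA, hA0, hb⟩ := this
      have hfA := hf.fd
      have σ := SES.ofInj f hf
      have h4 := σ.tdim
      have h5 := tdim_pos hA0
      have h6 : ¬ f.range.quot.IsZero := fun h => hb (hf.bij_of_tdim (by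
        have := tdim_eq_zero.mpr h; omega))
      obtain ⟨S, hS, g, h2, h3⟩ := ih _ (by omega) f.range.quot (Reg.sesB σ hM hA) h6 rfl
      exact ⟨S, hS, g.comp σ.p, h2, h3.comp σ.surj⟩

/-! ### regular indecomposables and tau -/

lemma Reg.np (H : Aff Q δ) [FD M] (hM : Reg δ M) : NP M := reg_np H hM

/-- regular indecomposable -/
structure RI (δ : Q.V → ℕ) (X : Repn k Q) : Prop where
  fd : FD X
  ind : X.Indec
  reg : Reg δ X

lemma RI.tau (H : Aff Q δ) (h : RI δ X) : RI δ (tau X) := by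
  have := h.fd
  have := tau_fd H X
  have h1 := tau_indec H h.ind (nonproj_of_defect H h.ind h.reg.1.ge)
  exact ⟨this, h1, reg_of_indec H h1 ((defect_tau H (h.reg.np H)).trans h.reg.1)⟩

lemma Stab.ri [FD S] (h : Stab δ S) : RI δ S := ⟨inferInstance, h.indec, h.1⟩
lemma RI.iter (H : Aff Q δ) (h : RI δ X) (n : ℕ) : RI δ (Repn.tau^[n] X) := by
  induction n generalizing X with
  | zero => exact h
  | succ n ih => exact ih (h.tau H)

lemma tauMap_inj {f : Hm X Y} (hf : f.Inj) : (tauMap f).Inj := by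
  refine Hm.inj_iff.mpr fun w φ h => tau.ext fun η => ?_
  obtain ⟨η', rfl⟩ := hf.pull_surj (prj k Q w) η
  rw [← tauMap_apply, h]; rfl

lemma iter_nonzero (H : Aff Q δ) (n : ℕ) (hX : RI δ X) (hY : RI δ Y) (hZ : RI δ Z)
    (f : Hm X Y) (g : Hm Y Z) (hf : f ≠ 0) (hg : g ≠ 0) (hgf : g.comp f = 0) :
    ∃ (f' : Hm (tau^[n] X) (tau^[n] Y)) (g' : Hm (tau^[n] Y) (tau^[n] Z)),
      f' ≠ 0 ∧ g' ≠ 0 ∧ g'.comp f' = 0 := by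
  induction n generalizing X Y Z with
  | zero => exact ⟨f, g, hf, hg, hgf⟩
  | succ n ih =>
    have := hX.fd
    have := hY.fd
    have := hZ.fd
    refine ih (hX.tau H) (hY.tau H) (hZ.tau H) (tauMap f) (tauMap g)
      (fun h => hf (tau_faithful H (hX.reg.np H) f h)) (fun h => hg (tau_faithful H (hY.reg.np H) g h)) ?_
    rw [← tauMap_comp, hgf]
    exact map_zero (tauL X Z)

lemma Stab.tau_mono (H : Aff Q δ) [FD S] (hS : Stab δ S) (f : Hm S (tau S))
    (hf : f.Inj) (n : ℕ) : tdim (tau S) ≤ tdim (tau^[n+1] S) := by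
  have key : ∀ (n : ℕ) {X : Repn k Q} (_ : RI δ X) (f : Hm X (tau X)), f.Inj →
      tdim X ≤ tdim (tau^[n] X) := by
    intro n
    induction n with
    | zero => intro X _ f _; exact le_rfl
    | succ n ih =>
      intro X hX f hf
      have := hX.fd
      have := tau_fd H X
      have h1 : tdim X ≤ tdim (tau X) := Finset.sum_le_sum fun v _ => hf.dimv_le v
      exact h1.trans (ih (hX.tau H) (tauMap f) (tauMap_inj hf))
  exact key n (hS.ri.tau H) (tauMap f) (tauMap_inj hf)

/-- homogeneous stables -/
def Hg (S : Repn k Q) : Prop := Isom S (tau S)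
lemma Stab.hg_of_ext (H : Aff Q δ) [FD S] (hS : Stab δ S) (h : extDim S S ≠ 0) :
    Hg S := by
  have hfd := tau_fd H S
  rw [← homDim_tau] at h
  obtain ⟨f, hf⟩ := homDim_ne_zero.mp h
  have hi := hS.inj (hS.ri.tau H).reg hf
  obtain ⟨-, n, hn, hd⟩ := reg_period H hS.indec hS.1.1
  obtain ⟨m, rfl⟩ : ∃ m, n = m + 1 := ⟨n - 1, by omega⟩
  have h1 := hS.tau_mono H f hi m
  have h2 : tdim (tau^[m+1] S) = tdim S := by simp only [tdim, hd]
  exact (hi.bij_of_tdim (by omega)).isom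

lemma Stab.homDim_pos [FD S] (hS : Stab δ S) : 0 < homDim S S :=
  homDim_pos_of (f := Hm.id S) fun h => hS.2.1 (isZero_of_id h)

lemma Stab.ext_hg (H : Aff Q δ) [FD S] (_hS : Stab δ S) (h : Hg S) :
    extDim S S = homDim S S := by
  have hfd := tau_fd H S
  rw [← homDim_tau]
  exact h.symm.homDim_right _

lemma Stab.ext_real (H : Aff Q δ) [FD S] (hS : Stab δ S) (h : ¬ Hg S) :
    extDim S S = 0 := by
  by_contra h1
  exact h (hS.hg_of_ext H h1)

lemma Stab.q_hg (H : Aff Q δ) [FD S] (hS : Stab δ S) (h : Hg S) :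
    eulerZ Q (dz S) (dz S) = 0 := by
  rw [← euler, hS.ext_hg H h, sub_self]

lemma Stab.dim_hg (H : Aff Q δ) [FD S] (hS : Stab δ S) (h : Hg S) :
    ∃ e : ℕ, 0 < e ∧ dz S = (e : ℤ) • natc δ := by
  obtain ⟨m, hm⟩ := H.int_mul _ (hS.q_hg H h)
  have h1 : ¬ (dimv S = 0) := fun h => hS.2.1 (isZero_iff_dimv.mpr h)
  obtain ⟨v, hv⟩ := Function.ne_iff.mp h1
  have h2 := congrFun hm v
  simp only [natc, Pi.smul_apply, smul_eq_mul] at h2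
  have h3 : 0 < (dimv S v : ℤ) := by exact_mod_cast Nat.pos_of_ne_zero hv
  have h4 : 0 < m := by
    by_contra h5
    have : m * (δ v : ℤ) ≤ 0 := mul_nonpos_of_nonpos_of_nonneg (by omega) (by positivity)
    omega
  exact ⟨m.toNat, by omega, by rw [hm, Int.toNat_of_nonneg h4.le]⟩

/-! ### the endomorphism ring -/

/-- The endomorphism ring of a representation. -/
@[reducible] def endRing (S : Repn k Q) : Ring (Hm S S) :=
  { (inferInstance : AddCommGroup (Hm S S)) with
    mul := fun f g => f.comp g
    one := Hm.id S
    mul_assoc := fun f g h => Hm.comp_assoc f g h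
    one_mul := fun f => Hm.id_comp f
    mul_one := fun f => Hm.comp_id f
    left_distrib := fun f g h => Hm.comp_add f g h
    right_distrib := fun f g h => Hm.add_comp f g h
    zero_mul := fun f => Hm.zero_comp f
    mul_zero := fun f => Hm.comp_zero f }

/-- The division ring of endomorphisms when every nonzero endomorphism is bijective. -/
@[reducible] def endDiv (S : Repn k Q) (h0 : ¬ S.IsZero) (h : ∀ f : Hm S S, f ≠ 0 → f.Bij) :
    DivisionRing (Hm S S) :=
  letI := endRing S
  haveI : Nontrivial (Hm S S) := ⟨⟨1, 0, fun h1 => h0 (isZero_of_id h1)⟩⟩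
  DivisionRing.ofIsUnitOrEqZero fun f => by
    by_cases hf : f = 0
    · exact Or.inr hf
    · refine Or.inl ?_
      let e := (h f hf).iso
      have e1 : e.hom = f := Hm.ext' fun v x => rfl
      refine ⟨⟨f, e.symm.hom, ?_, ?_⟩, rfl⟩
      · have := e.hom_comp_symm
        rw [e1] at this
        exact this
      · have := e.symm_hom_comp
        rw [e1] at this
        exact this

/-- The vertex spaces are modules over the endomorphism ring. -/
@[reducible] def endModule (S : Repn k Q) (h0 : ¬ S.IsZero) (h : ∀ f : Hm S S, f ≠ 0 → f.Bij) (v : Q.V) :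
    letI := endDiv S h0 h
    Module (Hm S S) (S.space v) :=
  letI := endDiv S h0 h
  { smul := fun f x => f v x
    one_smul := fun x => rfl
    mul_smul := fun f g x => rfl
    smul_zero := fun f => map_zero (f v)
    smul_add := fun f x y => map_add (f v) x y
    add_smul := fun f g x => rfl
    zero_smul := fun x => rfl }

lemma homDim_dvd (S : Repn k Q) [FD S] (h0 : ¬ S.IsZero) (h : ∀ f : Hm S S, f ≠ 0 → f.Bij) (v : Q.V) :
    homDim S S ∣ dimv S v := by
  letI := endDiv S h0 h
  letI := endModule S h0 h v
  haveI : IsScalarTower k (Hm S S) (S.space v) := ⟨fun c f x => rfl⟩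
  have := Module.finrank_mul_finrank k (Hm S S) (S.space v)
  exact ⟨_, this.symm⟩

lemma Stab.endo_bij [FD S] (hS : Stab δ S) (f : Hm S S) (hf : f ≠ 0) : f.Bij :=
  hS.bij hS hf

lemma Stab.dvd [FD S] (hS : Stab δ S) (v : Q.V) : homDim S S ∣ dimv S v :=
  homDim_dvd S hS.2.1 hS.endo_bij v

lemma Stab.hom_real (H : Aff Q δ) [FD S] (hS : Stab δ S) (h : ¬ Hg S) :
    homDim S S = 1 := by
  have h1 := euler S S
  rw [hS.ext_real H h] at h1
  choose s hs using fun v => hS.dvd v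
  have h2 : dz S = (homDim S S : ℤ) • natc s := by
    funext v
    simp only [natc, Pi.smul_apply, smul_eq_mul]
    exact_mod_cast hs v
  rw [h2, eulerZ_smul_left, eulerZ_smul_right] at h1
  have h3 := hS.homDim_pos
  have h4 : (homDim S S : ℤ) * (homDim S S * eulerZ Q (natc s) (natc s)) = homDim S S * 1 := by
    rw [← h1]; simp
  have h5 := mul_left_cancel₀ (by exact_mod_cast h3.ne') h4
  have h6 := Int.isUnit_iff.mp (IsUnit.of_mul_eq_one _ h5)
  omega

lemma Stab.q_real (H : Aff Q δ) [FD S] (hS : Stab δ S) (h : ¬ Hg S) :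
    eulerZ Q (dz S) (dz S) = 1 := by
  rw [← euler, hS.ext_real H h, hS.hom_real H h]; rfl

lemma Stab.isom_of_dim (H : Aff Q δ) [FD S] [FD M] (hS : Stab δ S) (h : ¬ Hg S)
    (hM : Reg δ M) (hd : dimv S = dimv M) : Isom S M := by
  have h1 := euler S M
  have h2 : dz S = dz M := by simp only [dz, hd]
  rw [← h2, hS.q_real H h] at h1
  obtain ⟨f, hf⟩ := homDim_ne_zero.mp (show homDim S M ≠ 0 by omega)
  exact ((hS.inj hM hf).bij_of_dimv fun v => by rw [hd]).isom

lemma Stab.period (H : Aff Q δ) [FD S] (hS : Stab δ S) :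
    ∃ n, Isom S (tau^[n+1] S) := by
  by_cases h : Hg S
  · exact ⟨0, h⟩
  · obtain ⟨-, n, hn, hd⟩ := reg_period H hS.indec hS.1.1
    obtain ⟨m, rfl⟩ : ∃ m, n = m + 1 := ⟨n - 1, by omega⟩
    have hr := hS.ri.iter H (m+1)
    have := hr.fd
    exact ⟨m, hS.isom_of_dim H h hr.reg hd.symm⟩

lemma Stab.tau (H : Aff Q δ) [FD S] (hS : Stab δ S) : Stab δ (tau S) := by
  have hr := hS.ri.tau H
  have := hr.fd
  refine ⟨hr.reg, hr.ind.1, fun A f hf hA => ?_⟩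
  by_contra hc
  push Not at hc
  have hfA := hf.fd
  have σ := SES.ofInj f hf
  obtain ⟨U, hU, u, hUs, hu⟩ := exists_stab_sub A (Reg.sesA σ hr.reg hA) hc.1
  have h6 : ¬ f.range.quot.IsZero := fun h => hc.2 (hf.bij_of_tdim (by
        have := tdim_eq_zero.mpr h
        have := σ.tdim; omega))
  obtain ⟨C, hC, c, hCs, hcs⟩ := exists_stab_quot f.range.quot (Reg.sesB σ hr.reg hA) h6
  obtain ⟨n, hn⟩ := hS.period H
  obtain ⟨f', g', hf', hg', hgf⟩ := iter_nonzero H n hUs.ri hr hCs.ri (f.comp u)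
    (c.comp f.range.proj)
    (Hm.comp_ne_zero_left hf (Hm.ne_zero_of_inj hu hUs.2.1))
    (Hm.comp_ne_zero_right f.range.proj_surj (Hm.ne_zero_of_surj hcs hCs.2.1))
    (Hm.ext' fun v x => by
      have : f.range.proj v (f v (u v x)) = 0 := (f.range.proj_eq_zero v _).mpr ⟨_, rfl⟩
      change c v (f.range.proj v (f v (u v x))) = 0
      rw [this, map_zero])
  have h1 : Stab δ (Repn.tau^[n] (Repn.tau S)) := hn.stab hS
  have h2 := (hr.iter H n).fd
  have h3 := hCs.ri.iter H n
  have h4 := h3.fd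
  exact Hm.comp_ne_zero_left (h1.inj h3.reg hg') hf' hgf

lemma Stab.iter (H : Aff Q δ) [FD S] (hS : Stab δ S) (n : ℕ) :
    Stab δ (Repn.tau^[n] S) := by
  induction n with
  | zero => exact hS
  | succ n ih =>
    rw [Function.iterate_succ_apply']
    have := (hS.ri.iter H n).fd
    exact ih.tau H

lemma Stab.exists_inv (H : Aff Q δ) [FD S] (hS : Stab δ S) :
    ∃ (T : Repn k Q) (_ : FD T), Stab δ T ∧ Isom (Repn.tau T) S := by
  obtain ⟨n, hn⟩ := hS.period H
  refine ⟨Repn.tau^[n] S, (hS.ri.iter H n).fd, hS.iter H n, ?_⟩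
  rw [Function.iterate_succ_apply'] at hn
  exact hn.symm

lemma Isom.hg (h : Isom S T) (hS : Hg S) : Hg T :=
  (h.symm.trans hS).trans h.tau

lemma Ext.pull_neg' (N : Repn k Q) (g : Hm M' M) (x) :
    Ext.pull N (-g) x = - Ext.pull N g x := by
  have := Ext.pull_smul N (-1 : k) g x
  simpa using this

lemma Ext.pull_sub' (N : Repn k Q) (g h : Hm M' M) (x) :
    Ext.pull N (g - h) x = Ext.pull N g x - Ext.pull N h x := by
  rw [sub_eq_add_neg, Ext.pull_add, Ext.pull_neg', sub_eq_add_neg]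

lemma Ext.pull_bij_inj (N : Repn k Q) {g : Hm M' M} (hg : g.Bij) {x}
    (h : Ext.pull N g x = 0) : x = 0 := by
  have h1 : g.comp hg.iso.symm.hom = Hm.id M := hg.iso.hom_comp_symm
  rw [← Ext.pull_id N x, ← h1, Ext.pull_comp, h, map_zero]

/-- `Col δ n T X i`: `X` is uniserial with regular socle `i : T → X` and regular length `n+1`. -/
def Col (δ : Q.V → ℕ) : ℕ → (T X : Repn k Q) → Hm T X → Prop
  | 0, T, X, i => Stab δ T ∧ FD T ∧ FD X ∧ i.Bij
  | n+1, T, X, i => Stab δ T ∧ FD T ∧ FD X ∧ ∃ (T₁ Y : Repn k Q) (i₁ : Hm T₁ Y) (σ : SES T X Y),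
      σ.i = i ∧ Col δ n T₁ Y i₁ ∧
        ∀ (S : Repn k Q) (f : Hm S X), FD S → Stab δ S → σ.p.comp f = 0

lemma Col.stab (h : Col δ n T X i) : Stab δ T := by
  cases n <;> exact h.1
lemma Col.fdT (h : Col δ n T X i) : FD T := by
  cases n <;> exact h.2.1
lemma Col.fdX (h : Col δ n T X i) : FD X := by
  cases n <;> exact h.2.2.1

lemma Col.inj (h : Col δ n T X i) : i.Inj := by
  cases n with
  | zero => exact h.2.2.2.inj
  | succ n =>
    obtain ⟨_, _, _, T₁, Y, i₁, σ, rfl, _⟩ := h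
    exact σ.inj

lemma Col.soc (h : Col δ n T X i) [FD S]
    (hS : Stab δ S) (f : Hm S X) : ∃ g : Hm S T, i.comp g = f := by
  cases n with
  | zero =>
    refine ⟨h.2.2.2.iso.symm.hom.comp f, ?_⟩
    have h1 : i.comp h.2.2.2.iso.symm.hom = Hm.id X := h.2.2.2.iso.hom_comp_symm
    rw [← Hm.comp_assoc, h1, Hm.id_comp]
  | succ n =>
    obtain ⟨_, _, _, T₁, Y, i₁, σ, rfl, _, h2⟩ := h
    exact σ.factorA f (h2 S f inferInstance hS)

lemma Col.reg (h : Col δ n T X i) : Reg δ X := by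
  induction n generalizing T X with
  | zero => exact Isom.reg h.2.2.2.isom h.1.1
  | succ n ih =>
    obtain ⟨h1, _, _, T₁, Y, i₁, σ, rfl, h2, _⟩ := h
    exact Reg.ext σ h1.1 (ih h2)

lemma Col.nz (h : Col δ n T X i) : ¬ X.IsZero := fun h0 =>
  h.stab.2.1 fun v x => h.inj v (by rw [h0 v (i v x), h0 v (i v 0)])

lemma Col.hom_soc (h : Col δ n T X i) [FD S]
    (hS : Stab δ S) : homDim S X = homDim S T := by
  have := h.fdT
  have := h.fdX
  symm
  refine LinearEquiv.finrank_eq (LinearEquiv.ofBijective (i.compL S) ⟨h.inj.compL_inj S, fun f => ?_⟩)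
  exact h.soc hS f

lemma Col.ext_eq (H : Aff Q δ) (h : Col δ n T X i) [FD S] (hS : Stab δ S) : extDim X S = extDim T S := by
  have := h.fdT
  have := h.fdX
  obtain ⟨S', _, hS', e⟩ := hS.exists_inv H
  have := tau_fd H S'
  have h1 := e.extDim_right X
  have h2 := e.extDim_right T
  rw [← h1, ← h2, extDim_tau H (hS'.1.np H), extDim_tau H (hS'.1.np H), h.hom_soc hS']

lemma Col.pull_inj (H : Aff Q δ) (h : Col δ n T X i) [FD S] (hS : Stab δ S) : Function.Injective (Ext.pull S i) := by
  have := h.fdT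
  have := h.fdX
  exact (LinearMap.injective_iff_surjective_of_finrank_eq_finrank (h.ext_eq H hS)).mpr
    (h.inj.pull_surj S)

lemma Stab.isom_tau_of_ext [FD S] [FD T] (H : Aff Q δ) (hS : Stab δ S) (hT : Stab δ T)
    (h : extDim S T ≠ 0) : Isom (Repn.tau S) T := by
  have := tau_fd H S
  rw [← homDim_tau] at h
  exact (hT.isom_of_hom (hS.tau H) h).symm

lemma Col.step_tau (H : Aff Q δ) {n : ℕ} {i₁ : Hm T₁ Y} (hT : Stab δ T) [FD T]
    [FD X] (σ : SES T X Y) (h2 : Col δ n T₁ Y i₁)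
    (h : ∀ (S : Repn k Q) (f : Hm S X), FD S → Stab δ S → σ.p.comp f = 0) : Isom (tau T₁) T := by
  have := h2.fdT
  refine h2.stab.isom_tau_of_ext H hT fun h0 => ?_
  obtain ⟨f, hf⟩ := σ.lift h0 i₁
  rw [h T₁ f inferInstance h2.stab] at hf
  exact Hm.ne_zero_of_inj h2.inj h2.stab.2.1 hf.symm

/-- extending a class -/
lemma Col.of_cls (H : Aff Q δ) {n : ℕ} {i₁ : Hm T₁ Y} (hT : Stab δ T) [FD T]
    [FD X] (σ : SES T X Y) (h2 : Col δ n T₁ Y i₁) {ξ : Ext Y T} (hξ : σ.Cls ξ) (h0 : ξ ≠ 0) :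
    Col δ (n+1) T X σ.i := by
  refine ⟨hT, inferInstance, inferInstance, T₁, Y, i₁, σ, rfl, h2, fun S f hS hSs => ?_⟩
  have := h2.fdT
  by_contra hc
  obtain ⟨g, hg⟩ := h2.soc hSs (σ.p.comp f)
  have hgb : g.Bij := hSs.bij h2.stab fun h => hc (by rw [← hg, h, Hm.comp_zero])
  have h1 : Ext.pull T (i₁.comp g) ξ = 0 := (hξ.lift _).mpr ⟨f, hg.symm⟩
  rw [Ext.pull_comp] at h1
  have h3 := Ext.pull_bij_inj T hgb h1
  exact h0 (h2.pull_inj H hT (by rw [h3, map_zero]))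

lemma exists_col (H : Aff Q δ) (n : ℕ) [hT' : FD T] (hT : Stab δ T) :
    ∃ (X : Repn k Q) (i : Hm T X), Col δ n T X i := by
  induction n generalizing T with
  | zero => exact ⟨T, Hm.id T, hT, hT', hT', (Iso.refl T).hom_bij⟩
  | succ n ih =>
    obtain ⟨T₁, _, h1, e⟩ := hT.exists_inv H
    obtain ⟨Y, i₁, h2⟩ := ih h1
    have := h2.fdX
    have := tau_fd H T₁
    have h3 : extDim Y T ≠ 0 := by
      rw [h2.ext_eq H hT, ← e.extDim_right, extDim_tau H (h1.1.np H)]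
      exact h1.homDim_pos.ne'
    have h4 : ∃ ξ : Ext Y T, ξ ≠ 0 := by
      by_contra hc
      push Not at hc
      exact h3 (extDim_eq_zero.mpr hc)
    obtain ⟨ξ, hξ⟩ := h4
    obtain ⟨X, _, σ, hσ⟩ := exists_ses ξ
    exact ⟨X, σ.i, Col.of_cls H hT σ h2 hσ hξ⟩

def ColExt (k : Type) [Field k] {Q : QuiverData} (δ : Q.V → ℕ) (n n' : ℕ) : Prop :=
  ∀ {T X T' X' : Repn k Q} {i : Hm T X} {i' : Hm T' X'}, Col δ n T X i →
  Col δ n' T' X' i' → ∀ g : Hm T T', ∃ f : Hm X X', f.comp i = i'.comp g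

lemma col_K (H : Aff Q δ) {n n' : ℕ} (hE : ColExt k δ n n')
    {i' : Hm T' X'} (h : Col δ n T X i) (h' : Col δ n' T' X' i') [FD S] (hS : Stab δ S)
    (ht : Isom (tau T) S) (ht' : Isom (tau T') S) (ξ : Ext X S) (ξ' : Ext X' S) (h0 : ξ' ≠ 0) :
    ∃ f : Hm X X', Ext.pull S f ξ' = ξ := by
  have := h.fdT
  have := h.fdX
  have := h'.fdT
  have := h'.fdX
  have e : Isom T T' := isom_of_tau H (h.stab.1.np H) (h'.stab.1.np H) (ht.trans ht'.symm)
  let η := Ext.pull S i' ξ'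
  have hη : η ≠ 0 := fun h1 => h0 (h'.pull_inj H hS (by rw [map_zero]; exact h1))
  let Φ : Hm T T' →ₗ[k] Ext T S :=
    { toFun := fun g => Ext.pull S g η
      map_add' := fun a b => Ext.pull_add S a b η
      map_smul' := fun r a => Ext.pull_smul S r a η }
  have hΦ : Function.Injective Φ := by
    refine (injective_iff_map_eq_zero Φ).mpr fun g hg => ?_
    by_contra hg0
    exact hη (Ext.pull_bij_inj S (h.stab.bij h'.stab hg0) hg)
  have := tau_fd H T
  have hd : Module.finrank k (Hm T T') = Module.finrank k (Ext T S) := by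
    rw [← homDim_eq, ← extDim_eq, ← ht.extDim_right, extDim_tau H (h.stab.1.np H)]
    exact e.symm.homDim_right _
  obtain ⟨g, hg⟩ := (LinearMap.injective_iff_surjective_of_finrank_eq_finrank hd).mp hΦ (Ext.pull S i ξ)
  obtain ⟨f, hf⟩ := hE h h' g
  refine ⟨f, h.pull_inj H hS ?_⟩
  rw [← Ext.pull_comp, hf, Ext.pull_comp]
  exact hg

lemma col_ext (H : Aff Q δ) {n n' : ℕ} (hn : n ≤ n') : ColExt k δ n n' := by
  induction n generalizing n' with
  | zero =>
    intro T X T' X' i i' h h' g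
    refine ⟨(i'.comp g).comp h.2.2.2.iso.symm.hom, ?_⟩
    have h1 : h.2.2.2.iso.symm.hom.comp i = Hm.id T := h.2.2.2.iso.symm_hom_comp
    rw [Hm.comp_assoc, h1, Hm.comp_id]
  | succ n ih =>
    obtain ⟨m, rfl⟩ : ∃ m, n' = m + 1 := ⟨n' - 1, by omega⟩
    intro T X T' X' i i' h h' g
    by_cases hg : g = 0
    · exact ⟨0, by rw [hg, Hm.comp_zero, Hm.zero_comp]⟩
    have hE : ColExt k δ n m := fun h h' g => ih (show n ≤ m by omega) h h' g
    obtain ⟨hT, _, _, T₁, Y, i₁, σ, rfl, h2, h3⟩ := h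
    obtain ⟨hT', _, _, T₁', Y', i₁', σ', rfl, h2', h3'⟩ := h'
    have hgb := hT.bij hT' hg
    obtain ⟨ξ, hξ⟩ := σ.exists_cls
    obtain ⟨ξ', hξ'⟩ := σ'.exists_cls
    have h0 : ξ' ≠ 0 := by
      rintro rfl
      have := h2'.fdT
      obtain ⟨f, hf⟩ := (hξ'.lift i₁').mp (map_zero _)
      rw [h3' T₁' f inferInstance h2'.stab] at hf
      exact Hm.ne_zero_of_inj h2'.inj h2'.stab.2.1 hf.symm
    obtain ⟨f, hf⟩ := col_K H hE h2 h2' hT' ((Col.step_tau H hT σ h2 h3).trans hgb.isom)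
      (Col.step_tau H hT' σ' h2' h3') (Ext.push Y g ξ) ξ' h0
    obtain ⟨F, hF, -⟩ := SES.morph hξ hξ' g f hf.symm
    exact ⟨F, hF⟩

lemma Col.inj_of (h : Col δ n T X i) [FD M] (hM : Reg δ M)
    {f : Hm X M} (hf : f.comp i ≠ 0) : f.Inj := by
  have := h.fdT
  have := h.fdX
  by_contra hc
  have h0 : ¬ f.ker.repn.IsZero := fun h1 => hc (Hm.inj_of_ker h1)
  obtain ⟨S, _, s, hS, hs⟩ := exists_stab_sub _ (h.reg.ker_range hM f).1 h0
  obtain ⟨g, hg⟩ := h.soc hS (f.ker.incl.comp s)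
  have h1 : f.comp (f.ker.incl.comp s) = 0 := Hm.ext' fun v x => (s v x).2
  rw [← hg, ← Hm.comp_assoc] at h1
  have h2 : g ≠ 0 := by
    rintro rfl
    rw [Hm.comp_zero] at hg
    exact Hm.ne_zero_of_inj (f.ker.incl_inj.comp hs) hS.2.1 hg.symm
  exact Hm.comp_ne_zero_left (h.stab.inj hM hf) h2 h1

lemma Col.embed (H : Aff Q δ) {n n' : ℕ} (hn : n ≤ n') {i' : Hm T' X'}
    (h : Col δ n T X i) (h' : Col δ n' T' X' i') (e : Isom T T') : ∃ f : Hm X X', f.Inj := by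
  have := h.fdT
  have := h.fdX
  have := h'.fdX
  obtain ⟨e⟩ := e
  obtain ⟨f, hf⟩ := col_ext H hn h h' e.hom
  refine ⟨f, h.inj_of h'.reg ?_⟩
  rw [hf]
  exact Hm.ne_zero_of_inj (h'.inj.comp e.hom_bij.inj) h.stab.2.1

lemma Col.unique (H : Aff Q δ) {i' : Hm T' X'}
    (h : Col δ n T X i) (h' : Col δ n T' X' i') (e : Isom T T') : Isom X X' := by
  have := h.fdX
  have := h'.fdX
  obtain ⟨f, hf⟩ := h.embed H le_rfl h' e
  obtain ⟨g, hg⟩ := h'.embed H le_rfl h e.symm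
  exact (hf.bij_of_dimv fun v => hg.dimv_le v).isom

lemma Col.indec (h : Col δ n T X i) : X.Indec := by
  refine ⟨h.nz, fun A B e => ?_⟩
  have e' : Isom X (A.dsum B) := e
  have := h.fdX
  have := h.fdT
  have := e'.fd
  have := (SES.dsum A B).fdA
  have := (SES.dsum A B).fdB
  by_contra hc
  push Not at hc
  have hA := h.reg.summand e'
  have hB := h.reg.summand (e'.trans (dsum_comm A B))
  obtain ⟨S, _, s, hS, hs⟩ := exists_stab_sub A hA hc.1
  obtain ⟨R, _, r, hR, hr⟩ := exists_stab_sub B hB hc.2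
  obtain ⟨e⟩ := e
  have e1 : e.hom.comp e.symm.hom = Hm.id _ := e.hom_comp_symm
  obtain ⟨g, hg⟩ := h.soc hS (e.symm.hom.comp ((inl A B).comp s))
  obtain ⟨g', hg'⟩ := h.soc hR (e.symm.hom.comp ((inr A B).comp r))
  have k1 : e.hom.comp (i.comp g) = (inl A B).comp s := by
    rw [hg, ← Hm.comp_assoc, e1, Hm.id_comp]
  have k2 : e.hom.comp (i.comp g') = (inr A B).comp r := by
    rw [hg', ← Hm.comp_assoc, e1, Hm.id_comp]
  have k3 : ((fst A B).comp (e.hom.comp i)).comp g' = 0 := by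
    rw [Hm.comp_assoc, Hm.comp_assoc, k2]; rfl
  have k4 : ((fst A B).comp (e.hom.comp i)).comp g = s := by
    rw [Hm.comp_assoc, Hm.comp_assoc, k1]; rfl
  have hg'0 : g' ≠ 0 := by
    rintro rfl
    rw [Hm.comp_zero, Hm.comp_zero] at k2
    have : (inr A B).comp r ≠ 0 :=
      Hm.comp_ne_zero_left (fun v x y h => congrArg Prod.snd h) (Hm.ne_zero_of_inj hr hR.2.1)
    exact this k2.symm
  have k5 : (fst A B).comp (e.hom.comp i) = 0 := by
    by_contra k6
    exact Hm.comp_ne_zero_right (hR.bij h.stab hg'0).surj k6 k3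
  rw [k5, Hm.zero_comp] at k4
  exact Hm.ne_zero_of_inj hs hS.2.1 k4.symm

lemma Col.tdim_lt (H : Aff Q δ) {n n' : ℕ} (hn : n < n') {i' : Hm T' X'}
    (h : Col δ n T X i) (h' : Col δ n' T' X' i') (e : Isom T T') : tdim X < tdim X' := by
  induction n generalizing n' T X T' X' with
  | zero =>
    obtain ⟨m, rfl⟩ : ∃ m, n' = m + 1 := ⟨n' - 1, by omega⟩
    obtain ⟨hT', _, _, T₁', Y', i₁', σ', rfl, h2', h3'⟩ := h'
    have := h2'.fdX
    have h4 := tdim_pos h2'.nz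
    have h5 := σ'.tdim
    have h6 := (h.2.2.2.isom.symm.trans e).tdim
    omega
  | succ n ih =>
    obtain ⟨m, rfl⟩ : ∃ m, n' = m + 1 := ⟨n' - 1, by omega⟩
    obtain ⟨hT, _, _, T₁, Y, i₁, σ, rfl, h2, h3⟩ := h
    obtain ⟨hT', _, _, T₁', Y', i₁', σ', rfl, h2', h3'⟩ := h'
    have := h2.fdT
    have := h2'.fdT
    have e1 : Isom T₁ T₁' := isom_of_tau H (h2.stab.1.np H) (h2'.stab.1.np H)
      (((Col.step_tau H hT σ h2 h3).trans e).trans (Col.step_tau H hT' σ' h2' h3').symm)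
    have := ih (show n < m by omega) h2 h2' e1
    have h4 := σ.tdim
    have h5 := σ'.tdim
    have h6 := e.tdim
    omega

lemma RI.col (H : Aff Q δ) (hX : RI δ X) :
    ∃ (n : ℕ) (T : Repn k Q) (i : Hm T X), Col δ n T X i := by
  induction hn : tdim X using Nat.strong_induction_on generalizing X with
  | _ N ih =>
  have := hX.fd
  obtain ⟨T, _, i, hT, hi⟩ := exists_stab_sub X hX.reg hX.ind.1
  let σ := SES.ofInj i hi
  let Y := i.range.quot
  have hY : Reg δ Y := Reg.sesB σ hX.reg hT.1.1
  have htd := σ.tdim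
  have hTp := tdim_pos hT.2.1
  by_cases hY0 : Y.IsZero
  · refine ⟨0, T, i, hT, inferInstance, inferInstance, hi.bij_of_tdim ?_⟩
    have : tdim i.range.quot = 0 := tdim_eq_zero.mpr hY0
    omega
  obtain ⟨m, Z, hZ, ⟨e⟩⟩ := exists_decomp Y
  let σ' := σ.congrB e
  obtain ⟨ξ, hξ⟩ := σ'.exists_cls
  have hfd : ∀ j, FD (Z j) := fun j => (hZ j).2
  -- no lifts of sections
  have key : ∀ (j : Fin m) (u : Hm (Z j) (dsumFam Z)), (Fam.proj Z j).comp u = Hm.id _ →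
      Ext.pull T u ξ ≠ 0 := by
    intro j u hu h0
    obtain ⟨s, hs⟩ := (hξ.lift u).mp h0
    have hb := indec_retract hX.ind s ((Fam.proj Z j).comp σ'.p)
      (by rw [Hm.comp_assoc, hs, hu]) (hZ j).1.1
    have h1 : tdim (Z j) = tdim X := hb.isom.tdim
    have h2 : tdim (Z j) ≤ tdim Y := by
      have h3 : tdim (Z j) ≤ tdim (dsumFam Z) := by
        refine Finset.sum_le_sum fun v _ => ?_
        exact Hm.Surj.dimv_le (f := Fam.proj Z j) (fun v x => by
          classical
          exact ⟨Fam.incl Z j v x, congrArg (fun f : Hm (Z j) (Z j) => f v x) (Fam.proj_incl Z j)⟩) v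
      have h4 : tdim Y = tdim (dsumFam Z) := Isom.tdim ⟨e⟩
      omega
    have : tdim X = tdim T + tdim Y := htd
    omega
  have hcol : ∀ j, ∃ (n : ℕ) (T' : Repn k Q) (i' : Hm T' (Z j)), Col δ n T' (Z j) i' := by
    intro j
    refine ih (tdim (Z j)) ?_ ⟨hfd j, (hZ j).1, (hY.fam_comp ⟨e⟩ j).1⟩ rfl
    have h3 : tdim (Z j) ≤ tdim (dsumFam Z) := by
      refine Finset.sum_le_sum fun v _ => ?_
      exact Hm.Surj.dimv_le (f := Fam.proj Z j) (fun v x => by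
          classical
          exact ⟨Fam.incl Z j v x, congrArg (fun f : Hm (Z j) (Z j) => f v x) (Fam.proj_incl Z j)⟩) v
    have h4 : tdim Y = tdim (dsumFam Z) := Isom.tdim ⟨e⟩
    have : tdim X = tdim T + tdim Y := htd
    omega
  choose n T' i' hc using hcol
  have hτ : ∀ j, Isom (Repn.tau (T' j)) T := by
    intro j
    have := (hc j).fdT
    refine (hc j).stab.isom_tau_of_ext H hT fun h0 => ?_
    rw [← (hc j).ext_eq H hT] at h0
    exact key j (Fam.incl Z j) (Fam.proj_incl Z j) (extDim_eq_zero.mp h0 _)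
  have huniq : ∀ j j' : Fin m, j = j' := by
    intro j j'
    by_contra hjj
    wlog hle : n j ≤ n j' generalizing j j' with hw
    · exact hw j' j (fun h => hjj h.symm) (by omega)
    obtain ⟨f, hf⟩ := col_K H (fun h h' g => col_ext H hle h h' g) (hc j) (hc j') hT (hτ j) (hτ j')
      (Ext.pull T (Fam.incl Z j) ξ) (Ext.pull T (Fam.incl Z j') ξ)
      (key j' _ (Fam.proj_incl Z j'))
    refine key j (Fam.incl Z j - (Fam.incl Z j').comp f) ?_ ?_
    · rw [Hm.comp_sub, Fam.proj_incl, ← Hm.comp_assoc, Fam.proj_incl_ne Z hjj, Hm.zero_comp, sub_zero]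
    · rw [Ext.pull_sub', Ext.pull_comp, hf, sub_self]
  have hm : m ≠ 0 := by
    rintro rfl
    exact hY0 (Isom.isZero (Isom.symm ⟨e⟩) (dsumFam_empty Z))
  let j0 : Fin m := ⟨0, by omega⟩
  let _ : Unique (Fin m) := ⟨⟨j0⟩, fun j => huniq j j0⟩
  obtain ⟨e2⟩ := (dsumFam_unique Z)
  let σ2 := σ'.congrB e2
  obtain ⟨ξ2, hξ2⟩ := σ2.exists_cls
  refine ⟨n default + 1, T, σ2.i, Col.of_cls H hT σ2 (hc default) hξ2 fun h0 => ?_⟩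
  obtain ⟨s, hs⟩ := (hξ2.lift (Hm.id _)).mp (by rw [h0, map_zero])
  have hb := indec_retract hX.ind s σ2.p hs (hZ _).1.1
  have h1 : tdim (Z default) = tdim X := hb.isom.tdim
  have h2 := σ2.tdim
  omega

lemma SES.subs {T X Y U C : Repn k Q} (σ : SES T X Y) (ρ : SES U X C) (j : Hm T U)
    (hj : ρ.i.comp j = σ.i) (q : Hm Y C) (hq : q.comp σ.p = ρ.p) :
    ∃ s : SES T U q.ker.repn, s.i = j ∧ q.ker.incl.comp s.p = σ.p.comp ρ.i := by
  have hj' : ∀ v x, ρ.i v (j v x) = σ.i v x := fun v x => by rw [← hj]; rfl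
  have hq' : ∀ v x, q v (σ.p v x) = ρ.p v x := fun v x => by rw [← hq]; rfl
  refine ⟨{ i := j
            p := (σ.p.comp ρ.i).cod q.ker (fun v x => ?_)
            inj := fun v x y h => σ.inj v (by rw [← hj', ← hj', h])
            surj := fun v y => ?_
            zero := fun v x => ?_
            ex := fun v y h => ?_ }, rfl, rfl⟩
  · change q v (σ.p v (ρ.i v x)) = 0
    rw [hq', ρ.zero]
  · obtain ⟨y, hy⟩ := y
    obtain ⟨x, rfl⟩ := σ.surj v y
    have hy' : q v (σ.p v x) = 0 := hy
    rw [hq'] at hy'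
    obtain ⟨u, rfl⟩ := ρ.ex v x hy'
    exact ⟨u, rfl⟩
  · apply Subtype.ext
    change σ.p v (ρ.i v (j v x)) = 0
    rw [hj', σ.zero]
  · have h' : σ.p v (ρ.i v y) = 0 := congrArg Subtype.val h
    obtain ⟨x, hx⟩ := σ.ex v _ h'
    exact ⟨x, ρ.inj v (by rw [hj', hx])⟩

lemma Col.maxsub {n : ℕ} {T X U C : Repn k Q} {i : Hm T X} (h : Col δ n T X i) [FD C]
    (ρ : SES U X C) (hC : Stab δ C) :
    (n = 0 ∧ U.IsZero) ∨ ∃ (m : ℕ) (j : Hm T U), n = m + 1 ∧ Col δ m T U j := by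
  induction n generalizing T X U with
  | zero =>
    left
    have := h.fdX
    have hX : Stab δ X := h.2.2.2.isom.stab h.1
    have hb := hX.bij hC (Hm.ne_zero_of_surj ρ.surj hC.2.1)
    exact ⟨rfl, fun v x => ρ.inj v (by rw [map_zero]; exact hb.inj v (by rw [map_zero, ρ.zero]))⟩
  | succ n ih =>
    right
    have hind := h.indec
    obtain ⟨hT, _, _, T₁, Y, i₁, σ, rfl, h2, h3⟩ := h
    have hpi : ρ.p.comp σ.i = 0 := by
      by_contra hc
      have hb := hT.bij hC hc
      have h5 := indec_retract hind σ.i (hb.iso.symm.hom.comp ρ.p)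
        (by rw [Hm.comp_assoc]; exact hb.iso.symm_hom_comp) hT.2.1
      have h6 := σ.tdim
      have h7 := h5.isom.tdim
      have := h2.fdX
      have h8 := tdim_pos h2.nz
      omega
    obtain ⟨j, hj⟩ := ρ.factorA σ.i hpi
    obtain ⟨q, hq⟩ := σ.factorB ρ.p hpi
    obtain ⟨s, rfl, hs⟩ := σ.subs ρ j hj q hq
    have := ρ.fdA
    have hqs : q.Surj := fun v c => by
      obtain ⟨x, rfl⟩ := ρ.surj v c
      exact ⟨σ.p v x, by rw [← hq]; rfl⟩
    rcases ih h2 (SES.ofSurj q hqs) with ⟨rfl, h0⟩ | ⟨m, j₁, rfl, h4⟩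
    · refine ⟨0, s.i, rfl, hT, inferInstance, inferInstance, fun v => ⟨s.inj v, fun y => ?_⟩⟩
      exact s.ex v y (h0 v _)
    · refine ⟨m + 1, s.i, rfl, hT, inferInstance, inferInstance, T₁, _, j₁, s, rfl, h4,
        fun S f hS hSs => ?_⟩
      by_contra hc
      refine Hm.comp_ne_zero_left q.ker.incl_inj hc ?_
      rw [← Hm.comp_assoc, hs, Hm.comp_assoc]
      exact h3 S _ hS hSs

lemma ker_quot (f : Hm X C) (hf : f.Surj) : Isom f.ker.quot C := by
  have h := (SES.ofSurj f hf).quot_isom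
  have h2 : (SES.ofSurj f hf).i.range = f.ker :=
    Subrep.ext'' fun v => Submodule.range_subtype _
  rwa [h2] at h

lemma hasRegFilt_zero (H : Aff Q δ) (h0 : X.IsZero) {ℓ : ℕ} (h : HasRegFilt δ ℓ X) :
    ℓ = 0 := by
  cases ℓ with
  | zero => rfl
  | succ ℓ =>
    obtain ⟨U, hU, _⟩ := h
    refine absurd (fun v x => ?_) ((regSimple_iff H).mp hU).2.2.1
    obtain ⟨y, rfl⟩ := U.proj_surj v x
    rw [h0 v y, map_zero]

lemma Col.filt (H : Aff Q δ) (h : Col δ n T X i) {ℓ : ℕ} :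
    HasRegFilt δ ℓ X ↔ ℓ = n + 1 := by
  have := h.fdX
  constructor
  · intro hf
    induction ℓ generalizing n T X with
    | zero => exact absurd hf h.nz
    | succ ℓ ih =>
      obtain ⟨U, hU, _, hf⟩ := hf
      obtain ⟨_, hS⟩ := (regSimple_iff H).mp hU
      rcases h.maxsub (SES.ofSub U) hS with ⟨rfl, h0⟩ | ⟨m, j, rfl, h2⟩
      · rw [hasRegFilt_zero H h0 hf]
      · rw [ih h2 h2.fdX hf]
  · rintro rfl
    induction n generalizing T X with
    | zero =>
      obtain ⟨C, _, f, hC, hf⟩ := exists_stab_quot X h.reg h.nz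
      refine ⟨f.ker, ?_, ?_⟩
      · refine (regSimple_iff H).mpr ⟨inferInstance, Isom.stab (Isom.symm ?_) hC⟩
        exact ker_quot f hf
      · rcases h.maxsub (SES.ofSurj f hf) hC with ⟨_, h0⟩ | ⟨m, j, h1, _⟩
        · exact ⟨(regMod_iff H).mpr ⟨inferInstance, Reg.zero h0⟩, h0⟩
        · omega
    | succ n ih =>
      obtain ⟨C, _, f, hC, hf⟩ := exists_stab_quot X h.reg h.nz
      refine ⟨f.ker, ?_, ?_⟩
      · refine (regSimple_iff H).mpr ⟨inferInstance, Isom.stab (Isom.symm ?_) hC⟩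
        exact ker_quot f hf
      · rcases h.maxsub (SES.ofSurj f hf) hC with ⟨h1, h0⟩ | ⟨m, j, h1, h2⟩
        · omega
        · obtain rfl : n = m := by omega
          exact ⟨(regMod_iff H).mpr ⟨inferInstance, h2.reg⟩, ih h2 h2.fdX⟩

lemma Col.socdim (H : Aff Q δ) (h : Col δ n T X i)
    {d : Q.V → ℕ} : QuasiSocleDim δ X d ↔ dimv T = d := by
  have := h.fdX
  have := h.fdT
  constructor
  · rintro ⟨U, hU, _, rfl⟩
    obtain ⟨_, hS⟩ := (regSimple_iff H).mp hU
    obtain ⟨g, hg⟩ := h.soc hS U.incl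
    have hb := hS.bij h.stab (f := g) (by
      rintro rfl
      rw [Hm.comp_zero] at hg
      exact Hm.ne_zero_of_inj U.incl_inj hS.2.1 hg.symm)
    exact hb.isom.dimv.symm
  · rintro rfl
    have e : Isom T i.range.repn := by
      refine Hm.Bij.isom (f := i.toRange) fun v => ⟨fun x y hxy => ?_, i.toRange_surj v⟩
      exact h.inj v (congrArg Subtype.val hxy)
    refine ⟨i.range, (regSimple_iff H).mpr ⟨inferInstance, e.stab h.stab⟩,
      (regMod_iff H).mpr ⟨inferInstance, (Reg.ker_range h.stab.1 h.reg i).2.2⟩, e.symm.dimv⟩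

lemma Stab.hom_eq_zero [FD S] [FD T] (hS : Stab δ S) (hT : Stab δ T)
    (h : ¬ Isom S T) : homDim S T = 0 := by
  by_contra hc
  exact h (hS.isom_of_hom hT hc)

lemma Col.hom_zero {n' : ℕ} {i : Hm T X} {i' : Hm T' X'}
    (h : Col δ 0 T X i) (h' : Col δ n' T' X' i') : homDim X X' = homDim T T' := by
  have := h.fdX
  have := h.fdT
  rw [← h.2.2.2.isom.homDim_left X', h'.hom_soc h.1]

lemma Col.hom_succ (H : Aff Q δ) {n n' : ℕ} {i₁ : Hm T₁ Y} {i' : Hm T' X'}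
    [FD T] [FD X] (σ : SES T X Y) (h2 : Col δ n T₁ Y i₁) (h : Col δ (n+1) T X σ.i)
    (h' : Col δ n' T' X' i') :
    homDim X X' = homDim Y X' + if n + 1 ≤ n' then homDim T T' else 0 := by
  have := h'.fdX
  have := h'.fdT
  have h1 := σ.finrank_range_compR X'
  rw [← h1, add_comm]
  congr 1
  split_ifs with hn
  · have : LinearMap.range (σ.i.compR X') = ⊤ := by
      refine LinearMap.range_eq_top.mpr fun f => ?_
      obtain ⟨g, rfl⟩ := h'.soc h.stab f
      exact col_ext H hn h h' g
    rw [this, finrank_top]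
    exact h'.hom_soc h.stab
  · have : LinearMap.range (σ.i.compR X') = ⊥ := by
      refine LinearMap.range_eq_bot.mpr (LinearMap.ext fun f => ?_)
      by_contra hc
      have hc' : f.comp σ.i ≠ 0 := hc
      have hf := h.inj_of h'.reg hc'
      obtain ⟨g, hg⟩ := h'.soc h.stab (f.comp σ.i)
      have hb := h.stab.bij h'.stab (f := g) (by
        rintro rfl
        rw [Hm.comp_zero] at hg
        exact hc' hg.symm)
      have h5 := Col.tdim_lt H (by omega) h' h hb.isom.symm
      have h6 : tdim X ≤ tdim X' := Finset.sum_le_sum fun v _ => hf.dimv_le v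
      omega
    rw [this, finrank_bot]

lemma Col.congrT (h : Col δ n T X i) (e : Iso T' T) :
    Col δ n T' X (i.comp e.hom) := by
  have e' : Isom T T' := Isom.symm ⟨e⟩
  have := h.fdT
  have := e'.fd
  cases n with
  | zero => exact ⟨e'.stab h.1, inferInstance, h.fdX, h.2.2.2.comp e.hom_bij⟩
  | succ n =>
    obtain ⟨hT, _, _, T₁, Y, i₁, σ, rfl, h2, h3⟩ := h
    exact ⟨e'.stab hT, inferInstance, inferInstance, T₁, Y, i₁, σ.congrA e, rfl, h2, h3⟩

lemma Hg.of_tau (H : Aff Q δ) [FD T] [FD T₁] (hT : Stab δ T) (hT₁ : Stab δ T₁)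
    (e : Isom (tau T₁) T) (h : Hg T) : Isom T₁ T :=
  isom_of_tau H (hT₁.1.np H) (hT.1.np H) (e.trans h)

lemma Hg.of_tau' (e : Isom (tau T₁) T) (h : Hg T₁) : Isom T₁ T :=
  Isom.trans h e

lemma Col.dz_hg (H : Aff Q δ) (h : Col δ n T X i) (hg : Hg T) :
    dz X = ((n + 1 : ℕ) : ℤ) • dz T := by
  induction n generalizing T X with
  | zero => rw [← h.2.2.2.isom.dz]; simp
  | succ n ih =>
    obtain ⟨hT, _, _, T₁, Y, i₁, σ, rfl, h2, h3⟩ := h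
    have := h2.fdT
    have e := Hg.of_tau H hT h2.stab (Col.step_tau H hT σ h2 h3) hg
    rw [σ.dz, ih h2 (e.symm.hg hg), e.dz]
    push_cast
    module

lemma Col.hom_hg (H : Aff Q δ) {n n' : ℕ} {i' : Hm T' X'}
    (h : Col δ n T X i) (h' : Col δ n' T' X' i') (hg : Hg T ∨ Hg T') (h0 : homDim X X' ≠ 0) :
    Isom T T' := by
  have := h'.fdT
  induction n generalizing T X with
  | zero =>
    have := h.fdT
    rw [h.hom_zero h'] at h0
    exact h.stab.isom_of_hom h'.stab h0
  | succ n ih =>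
    have hh := h
    obtain ⟨hT, _, _, T₁, Y, i₁, σ, rfl, h2, h3⟩ := h
    have := h2.fdT
    rw [Col.hom_succ H σ h2 hh h'] at h0
    by_cases h4 : homDim T T' = 0
    · rw [h4, ite_self, add_zero] at h0
      have et := Col.step_tau H hT σ h2 h3
      have e : Isom T₁ T' := ih h2 (hg.imp (fun hg => (Hg.of_tau H hT h2.stab et hg).symm.hg hg) fun h => h) h0
      have hg1 : Hg T₁ := by
        rcases hg with hg | hg
        · exact (Hg.of_tau H hT h2.stab et hg).symm.hg hg
        · exact e.symm.hg hg
      exact (Hg.of_tau' et hg1).symm.trans e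
    · exact hT.isom_of_hom h'.stab h4

lemma Col.hom_min (H : Aff Q δ) {n n' : ℕ} {i' : Hm T' X'}
    (h : Col δ n T X i) (h' : Col δ n' T' X' i') (hg : Hg T) (e : Isom T T') :
    homDim X X' = homDim T T * min (n + 1) (n' + 1) := by
  have := h'.fdT
  induction n generalizing T X with
  | zero =>
    have := h.fdT
    rw [h.hom_zero h', ← e.homDim_right T]
    simp
  | succ n ih =>
    have hh := h
    obtain ⟨hT, _, _, T₁, Y, i₁, σ, rfl, h2, h3⟩ := h
    have := h2.fdT
    have e1 := Hg.of_tau H hT h2.stab (Col.step_tau H hT σ h2 h3) hg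
    rw [Col.hom_succ H σ h2 hh h', ih h2 (e1.symm.hg hg) (e1.trans e), ← e.homDim_right T,
      e1.homDim_left T₁, e1.homDim_right T]
    split_ifs with hn
    · rw [min_eq_left (by omega), min_eq_left (by omega)]; ring
    · rw [min_eq_right (by omega), min_eq_right (by omega), add_zero]

/-- `T` is the regular socle of `X`. -/
def Soc (δ : Q.V → ℕ) (X T : Repn k Q) : Prop := ∃ (n : ℕ) (i : Hm T X), Col δ n T X i
lemma regIndec_iff (H : Aff Q δ) : IsRegIndec δ X ↔ RI δ X := by
  constructor
  · rintro ⟨h1, h2, h3⟩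
    have : FD X := ⟨h2⟩
    exact ⟨⟨h2⟩, h1, reg_of_indec H h1 h3⟩
  · rintro ⟨h1, h2, h3⟩
    exact ⟨h2, h1.fd, h3.1⟩

lemma RI.soc (H : Aff Q δ) (h : RI δ X) : ∃ T, Soc δ X T := by
  obtain ⟨n, T, i, hc⟩ := h.col H
  exact ⟨T, n, i, hc⟩

lemma Col.ri (h : Col δ n T X i) : RI δ X :=
  ⟨h.fdX, h.indec, h.reg⟩

lemma Soc.congr (h : Soc δ X T) (e : Isom T' T) : Soc δ X T' := by
  obtain ⟨n, i, h⟩ := h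
  obtain ⟨e⟩ := e
  exact ⟨n, _, h.congrT e⟩

lemma Soc.hom_isom (H : Aff Q δ) (h : Soc δ X T) (h' : Soc δ X' T')
    (hg : Hg T ∨ Hg T') (h0 : homDim X X' ≠ 0) : Isom T T' := by
  obtain ⟨n, i, h⟩ := h
  obtain ⟨n', i', h'⟩ := h'
  exact h.hom_hg H h' hg h0

lemma SameTube.soc (H : Aff Q δ) (h : SameTube δ X Y) (hg : Hg T) :
    Soc δ X T ↔ Soc δ Y T := by
  induction h with
  | rel X Y h =>
    obtain ⟨hX, hY, h0⟩ := h
    rw [regIndec_iff H] at hX hY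
    obtain ⟨T1, h1⟩ := hX.soc H
    obtain ⟨T2, h2⟩ := hY.soc H
    constructor
    · intro h
      rcases h0 with h0 | h0
      · exact h2.congr (h.hom_isom H h2 (Or.inl hg) h0)
      · exact h2.congr (h2.hom_isom H h (Or.inr hg) h0).symm
    · intro h
      rcases h0 with h0 | h0
      · exact h1.congr (h1.hom_isom H h (Or.inr hg) h0).symm
      · exact h1.congr (h.hom_isom H h1 (Or.inl hg) h0)
  | refl X => rfl
  | symm X Y _ ih => exact ih.symm
  | trans X Y Z _ _ ih1 ih2 => exact ih1.trans ih2

lemma Col.sameTube_soc (H : Aff Q δ) (h : Col δ n T X i) :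
    SameTube δ X T := by
  have := h.fdT
  have := h.fdX
  refine .rel _ _ ⟨(regIndec_iff H).mpr h.ri, (regIndec_iff H).mpr h.stab.ri, Or.inr ?_⟩
  rw [h.hom_soc h.stab]
  exact h.stab.homDim_pos.ne'

lemma Col.homog_iff (H : Aff Q δ) (h : Col δ n T X i) :
    InHomogTube δ X ↔ Hg T := by
  have := h.fdT
  constructor
  · rintro ⟨_, h2⟩
    by_contra hg
    obtain ⟨m, hm⟩ := h2 T ((regIndec_iff H).mpr h.stab.ri) (h.sameTube_soc H)
    have h3 := h.stab.q_real H hg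
    have h4 : dz T = (m : ℤ) • natc δ := by
      funext v
      simp [natc, hm]
    rw [h4, eulerZ_smul_left, eulerZ_smul_right, H.qδ] at h3
    simp at h3
  · intro hg
    refine ⟨(regIndec_iff H).mpr h.ri, fun Y _ hXY => ?_⟩
    obtain ⟨n', i', h'⟩ := (SameTube.soc H hXY hg).mp ⟨n, i, h⟩
    obtain ⟨e, _, he⟩ := h.stab.dim_hg H hg
    refine ⟨(n' + 1) * e, fun v => ?_⟩
    have h5 := congrFun (h'.dz_hg H hg) v
    rw [he] at h5
    simp only [Pi.smul_apply, natc, smul_eq_mul] at h5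
    zify
    push_cast at h5
    rw [h5]
    ring

lemma sameTube_of_soc (H : Aff Q δ) (h : Soc δ X T) (h' : Soc δ Y T) :
    SameTube δ X Y := by
  obtain ⟨n, i, h⟩ := h
  obtain ⟨n', i', h'⟩ := h'
  exact .trans _ _ _ (h.sameTube_soc H) (.symm _ _ (h'.sameTube_soc H))

lemma Soc.unique (h : Soc δ X T) (h' : Soc δ X T') : Isom T T' := by
  obtain ⟨n, i, h⟩ := h
  obtain ⟨n', i', h'⟩ := h'
  have := h.fdT
  have := h'.fdT
  obtain ⟨g, hg⟩ := h'.soc h.stab i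
  refine (h.stab.bij h'.stab (f := g) ?_).isom
  rintro rfl
  rw [Hm.comp_zero] at hg
  exact Hm.ne_zero_of_inj h.inj h.stab.2.1 hg.symm

lemma Isom.col (e : Iso X Y) (h : Col δ n T X i) :
    Col δ n T Y (e.hom.comp i) := by
  have := h.fdX
  have hY : FD Y := Isom.fd ⟨e⟩
  cases n with
  | zero => exact ⟨h.1, h.2.1, hY, e.hom_bij.comp h.2.2.2⟩
  | succ n =>
    obtain ⟨hT, _, _, T₁, Z, i₁, σ, rfl, h2, h3⟩ := h
    refine ⟨hT, inferInstance, hY, T₁, Z, i₁, σ.congrE e, rfl, h2, fun S f hS hSs => ?_⟩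
    exact h3 S (e.symm.hom.comp f) hS hSs

/-- strict decrease of endomorphisms under non-split extensions -/
lemma SES.end_lt (σ : SES A E B) [FD A] [FD B] [FD E] (h : ¬ σ.Split) :
    homDim E E < homDim (A.dsum B) (A.dsum B) := by
  have s := SES.dsum A B
  have e1 : ∀ Y : Repn k Q, FD Y → homDim Y (A.dsum B) = homDim Y A + homDim Y B := fun Y _ => by
    have h1 := s.hom_le_add_left Y
    have h2 := (SES.dsum A B).finrank_range_compL Y
    have h3 : LinearMap.range ((SES.dsum A B).p.compL Y) = ⊤ :=
      LinearMap.range_eq_top.2 fun g => ⟨(inr A B).comp g, rfl⟩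
    rw [h3, finrank_top] at h2
    have := homDim_eq Y B
    omega
  have e2 : ∀ Y : Repn k Q, FD Y → homDim (A.dsum B) Y = homDim A Y + homDim B Y := fun Y _ => by
    have h1 := s.hom_le_add_right Y
    have h2 := (SES.dsum A B).finrank_range_compR Y
    have h3 : LinearMap.range ((SES.dsum A B).i.compR Y) = ⊤ :=
      LinearMap.range_eq_top.2 fun g => ⟨g.comp (fst A B), Hm.ext' fun v x => rfl⟩
    rw [h3, finrank_top] at h2
    have := homDim_eq A Y
    omega
  have a1 := σ.hom_le_add_right E
  have a2 := σ.hom_le_add_left A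
  have a3 : homDim B E < homDim B A + homDim B B := by
    have h1 := σ.finrank_range_compL B
    have h2 : Module.finrank k (LinearMap.range (σ.p.compL B)) < homDim B B := by
      refine Submodule.finrank_lt fun ht => h ?_
      obtain ⟨s, hs⟩ := LinearMap.range_eq_top.1 ht (Hm.id B)
      exact σ.split_of_section s hs
    omega
  rw [e1 _ inferInstance, e2 _ inferInstance, e2 _ inferInstance]
  omega

lemma brick_q (H : Aff Q δ) [FD X] (hX : X.Indec)
    (hd : defectOf Q δ (dz X) ≠ 0) : eulerZ Q (dz X) (dz X) = 1 := by
  rcases lt_or_gt_of_ne hd with h | h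
  · have h1 := preproj_hom H hX hX h
    have h2 := preproj_brick H hX h
    omega
  · have h1 := preinj_hom H hX hX h
    have h2 := preinj_brick H hX h
    omega

lemma exists_indec (H : Aff Q δ) (d : Q.V → ℕ) (hq : eulerZ Q (natc d) (natc d) = 1)
    (hd : defectOf Q δ (natc d) ≠ 0) :
    ∃ M : Repn k Q, FD M ∧ M.Indec ∧ dimv M = d := by
  have hne : ∃ n, ∃ M : Repn k Q, FD M ∧ dimv M = d ∧ homDim M M = n :=
    ⟨_, zrep k fun v => Fin (d v), inferInstance, dimv_zrep d, rfl⟩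
  classical
  obtain ⟨M, hfd, hMd, hMn⟩ := Nat.find_spec hne
  have hmin : ∀ N : Repn k Q, FD N → dimv N = d → homDim M M ≤ homDim N N := fun N h1 h2 => by
    rw [hMn]; exact Nat.find_min' hne ⟨N, h1, h2, rfl⟩
  have hsplit : ∀ A B : Repn k Q, FD A → FD B → Isom M (A.dsum B) → extDim B A = 0 :=
    fun A B _ _ e => by
    by_contra hc
    obtain ⟨E, _, σ, hσ⟩ := exists_nonsplit hc
    have h1 := σ.end_lt hσ
    have h2 : dimv E = d := by
      rw [← hMd, e.dimv]; exact funext fun v => by rw [dimv_dsum]; exact σ.dimv v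
    have h3 := hmin E inferInstance h2
    rw [e.homDim_left M, e.homDim_right] at h3
    omega
  obtain ⟨n, X, hX, e⟩ := exists_decomp M
  have hfdX : ∀ i, FD (X i) := fun i => (hX i).2
  have hdf : df δ M ≠ 0 := by unfold df dz; rw [hMd]; exact hd
  rw [e.df, df_fam] at hdf
  obtain ⟨j, -, hj⟩ := Finset.exists_ne_zero_of_sum_ne_zero hdf
  obtain ⟨e⟩ := e
  have e' : Isom M ((X j).dsum _) := isom_dsum_of_retract (e.symm.hom.comp (Fam.incl X j))
    ((Fam.proj X j).comp e.hom) (by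
      have h1 : (((Fam.proj X j).comp e.hom).comp (e.symm.hom.comp (Fam.incl X j)))
        = (Fam.proj X j).comp ((e.hom.comp e.symm.hom).comp (Fam.incl X j)) := rfl
      rw [h1, Iso.hom_comp_symm, Hm.id_comp, Fam.proj_incl])
  generalize hB : ((Fam.proj X j).comp e.hom).ker.repn = B at e'
  have hfB : FD B := hB ▸ inferInstance
  have x1 := hsplit _ _ inferInstance inferInstance e'
  have x2 := hsplit _ _ inferInstance inferInstance (e'.trans (dsum_comm _ _))
  have q1 := brick_q H (hX j).1 hj
  have dM : natc d = dz (X j) + dz B := by rw [← hMd, ← dz_dsum, ← e'.dz]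
  rw [dM, eulerZ_add_left, eulerZ_add_right, eulerZ_add_right, q1] at hq
  have y1 := euler (X j) B
  have y2 := euler B (X j)
  have q0 := H.q_nonneg (dz B)
  have q2 : eulerZ Q (dz B) (dz B) = 0 := by omega
  have q3 : eulerZ Q (dz B) (dz (X j)) = 0 := by omega
  obtain ⟨m, hm⟩ := H.nat_mul _ q2
  have hm' : dz B = (m : ℤ) • natc δ := by
    unfold dz; rw [hm]; funext v; simp [natc]
  rw [hm', eulerZ_smul_left] at q3
  have hm0 : m = 0 := by
    rcases mul_eq_zero.1 q3 with h | h
    · exact_mod_cast h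
    · exact absurd h hj
  have hz : B.IsZero := isZero_iff_dimv.2 (by rw [hm, hm0]; funext v; simp)
  exact ⟨M, hfd, (e'.trans (dsum_zero hz)).symm.indec (hX j).1, hMd⟩

/-- order on the preprojectives -/
lemma proj_inj [FD X] [FD Y] (hX : X.Indec) (hY : IsProj Y) (f : Hm X Y)
    (hf : f ≠ 0) : f.Inj := by
  have hp : IsProj f.range.repn := hY.sub f.range.incl_inj
  have σ : SES _ _ _ := SES.kerIm f
  obtain ⟨s, hs⟩ := (SES.kerIm f).lift (hp _) (Hm.id _)
  have hb := indec_retract hX s (SES.kerIm f).p hs fun hz => hf (Hm.eq_zero_of_range hz)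
  have : (SES.kerIm f).p.Inj := fun v x y hxy => by
    obtain ⟨x', rfl⟩ := (hb v).2 x
    obtain ⟨y', rfl⟩ := (hb v).2 y
    have h1 := congrFun (congrArg (fun g : Hm _ _ => (g v : _ → _)) hs) x'
    have h2 := congrFun (congrArg (fun g : Hm _ _ => (g v : _ → _)) hs) y'
    have h3 : x' = y' := by
      rw [show x' = _ from h1.symm, show y' = _ from h2.symm]; exact hxy
    rw [h3]
  exact f.range.incl_inj.comp this

lemma pre_order (H : Aff Q δ) : ∀ (b a : ℕ) {X Y : Repn k Q} [FD X] [FD Y], X.Indec → Y.Indec →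
    Pre a X → Pre b Y → homDim X Y ≠ 0 → a < b ∨ (a = b ∧ tdim (tau^[a] X) ≤ tdim (tau^[b] Y) ∧
      (tdim (tau^[a] X) = tdim (tau^[b] Y) → Isom X Y))
  | 0, a, X, Y, _, _, hX, hY, hPX, hPY, h => by
    obtain ⟨f, hf⟩ := homDim_ne_zero.1 h
    rcases a with _ | a
    · right
      have hi := proj_inj hX hPY f hf
      exact ⟨rfl, Finset.sum_le_sum fun v _ => hi.dimv_le v, fun ht => (hi.bij_of_tdim ht.ge).isom⟩
    · exact absurd (hom_proj hX hPX.1 hPY f) hf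
  | b+1, 0, X, Y, _, _, hX, hY, hPX, hPY, h => Or.inl (Nat.succ_pos b)
  | b+1, a+1, X, Y, _, _, hX, hY, hPX, hPY, h => by
    have := tau_fd H X
    have := tau_fd H Y
    have n1 := np_of_indec H hX hPX.1
    have n2 := np_of_indec H hY hPY.1
    rw [← homDim_tau_tau H n1] at h
    rcases pre_order H b a (tau_indec H hX hPX.1) (tau_indec H hY hPY.1) hPX.2 hPY.2 h with h | ⟨h, h1, h2⟩
    · left; omega
    · right
      refine ⟨by omega, ?_, ?_⟩
      · simpa only [Function.iterate_succ_apply] using h1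
      · intro ht
        simp only [Function.iterate_succ_apply] at ht
        exact isom_of_tau H n1 n2 (h2 ht)

lemma pre_defect (H : Aff Q δ) : ∀ (a : ℕ) {X : Repn k Q} [FD X], X.Indec → Pre a X →
    ∃ w, defectOf Q δ (dz X) = - δ w
  | 0, X, _, hX, h => by
    obtain ⟨w, e⟩ := proj_indec H hX h
    exact ⟨w, by rw [e.dz, prj.defect H]⟩
  | a+1, X, _, hX, h => by
    have := tau_fd H X
    rw [← defect_tau H (np_of_indec H hX h.1)]
    exact pre_defect H a (tau_indec H hX h.1) h.2

lemma preproj_defect (H : Aff Q δ) [FD X] (hX : X.Indec)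
    (hd : defectOf Q δ (dz X) < 0) : ∃ w, defectOf Q δ (dz X) = - δ w := by
  obtain ⟨n, hn⟩ := exists_pre H hX hd
  exact pre_defect H n hX hn

/-- Lemma G -/
lemma preproj_count (H : Aff Q δ) {n : ℕ} (X : Fin n → Repn k Q) (hX : ∀ i, (X i).Indec)
    [∀ i, FD (X i)] (D : ℕ) (hD : ∀ Y : Repn k Q, FD Y → D ∣ ∑ i, homDim (X i) Y)
    (hne : ∃ i, defectOf Q δ (dz (X i)) < 0) :
    D ≤ (Finset.univ.filter fun i => defectOf Q δ (dz (X i)) < 0).card := by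
  classical
  set Pp := Finset.univ.filter fun i => defectOf Q δ (dz (X i)) < 0 with hPp
  have hpre : ∀ i, ∃ a, defectOf Q δ (dz (X i)) < 0 → Pre a (X i) := fun i => by
    by_cases h : defectOf Q δ (dz (X i)) < 0
    · obtain ⟨a, ha⟩ := exists_pre H (hX i) h; exact ⟨a, fun _ => ha⟩
    · exact ⟨0, fun h' => absurd h' h⟩
  choose a ha using hpre
  have hne' : Pp.Nonempty := by
    obtain ⟨i, hi⟩ := hne; exact ⟨i, by simp [hPp, hi]⟩
  obtain ⟨j, hj, hjm⟩ := Finset.exists_min_image Pp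
    (fun i => toLex (a i, tdim (tau^[a i] (X i)))) hne'
  have hj' : defectOf Q δ (dz (X j)) < 0 := (Finset.mem_filter.1 hj).2
  have key : ∀ i, homDim (X i) (X j) ≠ 0 → i ∈ Pp ∧ homDim (X i) (X j) = 1 := fun i hi => by
    have hi' : defectOf Q δ (dz (X i)) < 0 := by
      by_contra hc
      exact hi (hom_to_preproj H (hX j) (hX i) hj' (not_lt.1 hc))
    have hiP : i ∈ Pp := by simp [hPp, hi']
    refine ⟨hiP, ?_⟩
    have hm := hjm i hiP
    rw [Prod.Lex.toLex_le_toLex] at hm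
    dsimp only at hm
    have e : Isom (X i) (X j) := by
      rcases pre_order H _ _ (hX i) (hX j) (ha i hi') (ha j hj') hi with h | ⟨h1, h2, h3⟩
      · omega
      · exact h3 (by omega)
    rw [e.homDim_left]
    exact preproj_brick H (hX j) hj'
  have h1 : ∑ i, homDim (X i) (X j) ≤ Pp.card := by
    rw [Finset.card_eq_sum_ones, ← Finset.sum_subset (Finset.subset_univ Pp)]
    · refine Finset.sum_le_sum fun i _ => ?_
      by_cases h : homDim (X i) (X j) = 0
      · omega
      · exact (key i h).2.le
    · intro i _ hi
      by_contra hc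
      exact hi (key i hc).1
  have h2 : 0 < ∑ i, homDim (X i) (X j) := by
    have := preproj_brick H (hX j) hj'
    have h3 := Finset.single_le_sum (f := fun i => homDim (X i) (X j)) (fun _ _ => Nat.zero_le _)
      (Finset.mem_univ j)
    omega
  exact (Nat.le_of_dvd h2 (hD (X j) inferInstance)).trans h1

def PP (δ : Q.V → ℕ) (M : Repn k Q) : Prop := ∀ X : Repn k Q, FD X → X.Indec →
  0 ≤ defectOf Q δ (dz X) → ∀ f : Hm X M, f = 0

lemma PP.sub (h : PP δ M) {f : Hm N M} (hf : f.Inj) : PP δ N := fun X _ hX hd g => by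
  have h1 := h X inferInstance hX hd (f.comp g)
  exact hf.compL_inj X (by rw [map_zero]; exact h1)

lemma PP.comp (hM : PP δ M) {n : ℕ} {X : Fin n → Repn k Q}
    (hX : ∀ i, (X i).Indec ∧ FD (X i)) (e : Iso M (dsumFam X)) (i) : defectOf Q δ (dz (X i)) < 0 := by
  classical
  by_contra hc
  have := (hX i).2
  have h1 := hM (X i) inferInstance (hX i).1 (not_lt.1 hc) (e.symm.hom.comp (Fam.incl X i))
  have h2 : (Fam.proj X i).comp ((e.hom.comp e.symm.hom).comp (Fam.incl X i)) = 0 := by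
    rw [Hm.comp_assoc, h1, Hm.comp_zero, Hm.comp_zero]
  rw [Iso.hom_comp_symm, Hm.id_comp, Fam.proj_incl] at h2
  exact (hX i).1.1 (isZero_of_id h2)

lemma PP.zero [FD M] (hM : PP δ M) (h : 0 ≤ df δ M) : M.IsZero := by
  obtain ⟨n, X, hX, ⟨e⟩⟩ := exists_decomp M
  have := fun i => (hX i).2
  have hc := hM.comp hX e
  rw [(show Isom M _ from ⟨e⟩).df, df_fam] at h
  rcases n with _ | n
  · exact (show Isom M _ from ⟨e⟩).symm.isZero fun v x => funext fun i => i.elim0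
  · exact absurd h (not_le.2 (Finset.sum_neg (fun i _ => hc i) ⟨0, Finset.mem_univ _⟩))

lemma PP.prj (H : Aff Q δ) (v : Q.V) : PP δ (prj k Q v) := fun X _ hX hd f => by
  have := Repn.prj.fd (k := k) H v
  exact hom_proj hX (nonproj_of_defect H hX hd) (Repn.prj.isProj H v) f

lemma PP.preproj (H : Aff Q δ) [FD L] (hL : L.Indec)
    (hd : defectOf Q δ (dz L) < 0) : PP δ L := fun X _ hX hdX f =>
  homDim_eq_zero.1 (hom_to_preproj H hL hX hd hdX) f

lemma PP.fam {ι : Type} [Fintype ι] {X : ι → Repn k Q} (h : ∀ i, PP δ (X i)) : PP δ (dsumFam X) :=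
  fun Y _ hY hd f => by
  classical
  exact Fam.hom_ext fun i => by
    rw [Hm.comp_zero]; exact h i Y inferInstance hY hd _

/-- Lemma B -/
lemma Stab.hom_bound [FD S] (hS : Stab δ S) (v : Q.V) : ∀ (n : ℕ) (M : Repn k Q) [FD M],
    tdim M = n → Reg δ M → homDim M S * dimv S v ≤ homDim S S * dimv M v := by
  intro n
  induction n using Nat.strong_induction_on with
  | _ n ih =>
    intro M _ hn hM
    by_cases h0 : homDim M S = 0
    · rw [h0, zero_mul]; exact Nat.zero_le _
    · obtain ⟨f, hf⟩ := homDim_ne_zero.1 h0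
      have hs := hS.surj hM hf
      let σ := SES.ofSurj f hs
      have h1 := ih (tdim f.ker.repn) (by
        have := σ.tdim; have := tdim_pos hS.2.1; omega) f.ker.repn rfl (hM.ker_range hS.1 f).1
      have h2 := σ.hom_le_add_right S
      have h3 : dimv M v = _ := σ.dimv v
      rw [h3]
      nlinarith [Nat.mul_le_mul_right (dimv S v) h2]

/-- An action of a field extension on a representation -/
structure Act (F : Type) [Field F] [Algebra k F] (M : Repn k Q) where
  ρ : F → Hm M M
  one : ρ 1 = Hm.id M
  mul : ∀ x y, ρ (x * y) = (ρ x).comp (ρ y)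
  add : ∀ x y, ρ (x + y) = ρ x + ρ y
  smul : ∀ (c : k) x, ρ (c • x) = c • ρ x

variable {F : Type} [Field F] [Algebra k F]

lemma Act.dvd (A : Act F M) (Y : Repn k Q) :
    Module.finrank k F ∣ homDim M Y := by
  let _ : Module F (Hm M Y) :=
    { smul := fun y f => f.comp (A.ρ y)
      one_smul := fun f => show f.comp (A.ρ 1) = f by rw [A.one]; rfl
      mul_smul := fun x y f => show f.comp (A.ρ (x * y)) = (f.comp (A.ρ y)).comp (A.ρ x) by
        rw [mul_comm, A.mul]; rfl
      smul_zero := fun x => show Hm.comp 0 (A.ρ x) = 0 from Hm.zero_comp _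
      smul_add := fun x f g => show (f + g).comp (A.ρ x) = _ from Hm.add_comp _ _ _
      add_smul := fun x y f => show f.comp (A.ρ (x + y)) = f.comp (A.ρ x) + f.comp (A.ρ y) by
        rw [A.add, Hm.comp_add]
      zero_smul := fun f => show f.comp (A.ρ 0) = 0 by
        rw [show (0 : F) = (0 : k) • 0 by simp, A.smul, zero_smul, Hm.comp_zero] }
  have : IsScalarTower k F (Hm M Y) := ⟨fun c x f => by
    show f.comp (A.ρ (c • x)) = c • f.comp (A.ρ x)
    rw [A.smul]; exact Hm.ext' fun v z => by simp [Hm.comp_apply]⟩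
  rw [homDim_eq, ← Module.finrank_mul_finrank k F (Hm M Y)]
  exact dvd_mul_right _ _

lemma Hm.Surj.fact {p : Hm M R} (hp : p.Surj) (f : Hm M Y)
    (h : ∀ v x, p v x = 0 → f v x = 0) : ∃ g : Hm R Y, g.comp p = f := by
  obtain ⟨e⟩ := ker_quot p hp
  have := (SES.ofSurj p hp).factorB f
  have h2 : f.comp (SES.ofSurj p hp).i = 0 := Hm.ext' fun v x => h v _ x.2
  obtain ⟨g, hg⟩ := this h2
  exact ⟨g, hg⟩

lemma Act.desc (A : Act F M) {p : Hm M R} (hp : p.Surj)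
    (h : ∀ y v x, p v x = 0 → p v (A.ρ y v x) = 0) : Nonempty (Act F R) := by
  have h1 : ∀ y, ∃ g : Hm R R, g.comp p = p.comp (A.ρ y) := fun y => hp.fact _ (h y)
  choose g hg using h1
  have c : ∀ {f f' : Hm R R}, f.comp p = f'.comp p → f = f' := fun h => hp.compR_inj _ h
  exact ⟨⟨g, c (by rw [hg, A.one]; rfl), fun x y => c (by
      rw [hg, A.mul, Hm.comp_assoc, hg, ← Hm.comp_assoc, ← Hm.comp_assoc, hg]),
    fun x y => c (by rw [hg, A.add, Hm.add_comp, hg, hg, Hm.comp_add]),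
    fun a x => c (by
      rw [hg, A.smul]
      exact Hm.ext' fun v z => by
        have := congrArg (fun f : Hm M R => f v z) (hg x)
        simp only [Hm.comp_apply] at this
        simp [Hm.comp_apply, this])⟩⟩

lemma sum_df_le (H : Aff Q δ) {r : ℕ} (hr : ∀ w, r ≤ δ w) {ι : Type} [Fintype ι] (X : ι → Repn k Q)
    [∀ i, FD (X i)] (hX : ∀ i, (X i).Indec) (hd : ∀ i, defectOf Q δ (dz (X i)) < 0) {D : ℕ}
    (hD : D ≤ Fintype.card ι) : df δ (dsumFam X) ≤ - (r * D : ℤ) := by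
  rw [df_fam]
  have h1 : ∑ i, df δ (X i) ≤ ∑ i : ι, (- (r : ℤ)) := Finset.sum_le_sum fun i _ => by
    obtain ⟨w, hw⟩ := preproj_defect H (hX i) (hd i)
    have := hr w
    show defectOf Q δ (dz (X i)) ≤ _
    omega
  rw [Finset.sum_const, nsmul_eq_mul, Finset.card_univ] at h1
  have : (r * D : ℤ) ≤ Fintype.card ι * r := by exact_mod_cast (by nlinarith)
  linarith

lemma main_le (H : Aff Q δ) {r : ℕ} (hr : ∀ w, r ≤ δ w) {S M N : Repn k Q} [FD S] [FD M] [FD N]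
    (hS : Stab δ S) {e : ℕ} (he : ∀ v, dimv S v = e * δ v) {D : ℕ} (hDF : D = Module.finrank k F)
    (hD : 0 < D) (hdM : df δ M = - (r * D : ℤ)) (hdN : df δ N = - (r * D : ℤ)) (hM : PP δ M) (hN : PP δ N)
    (hdim : ∀ v, dimv N v = dimv M v + D * δ v) (aM : Act F M) (aN : Act F N) (Φ : Hm M N)
    (hΦ : ∀ y, Φ.comp (aM.ρ y) = (aN.ρ y).comp Φ) (h0 : Φ ≠ 0) (g : Hm N S) (hg : g ≠ 0)
    (hgΦ : g.comp Φ = 0) : e ≤ homDim S S := by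
  classical
  have hΦ' : ∀ y v x, Φ v (aM.ρ y v x) = aN.ρ y v (Φ v x) := fun y v x =>
    congrArg (fun f : Hm M N => f v x) (hΦ y)
  have hinj : Φ.Inj := by
    obtain ⟨aI⟩ := aM.desc Φ.toRange_surj fun y v x hx => by
      have hx' : Φ v x = 0 := congrArg Subtype.val hx
      exact Subtype.ext (by
        show Φ v (aM.ρ y v x) = 0
        rw [hΦ', hx', map_zero])
    obtain ⟨n, X, hX, ⟨i⟩⟩ := exists_decomp Φ.range.repn
    have := fun i => (hX i).2
    have hIP : PP δ Φ.range.repn := hN.sub Φ.range.incl_inj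
    have hd := hIP.comp hX i
    have hi : Isom Φ.range.repn (dsumFam X) := ⟨i⟩
    have hn : n ≠ 0 := by
      rintro rfl
      exact h0 (Hm.eq_zero_of_range (hi.symm.isZero fun v x => funext fun i => i.elim0))
    have hc := preproj_count H X (fun i => (hX i).1) D (fun Y _ => by
      rw [← homDim_fam_left, ← hi.homDim_left, hDF]; exact aI.dvd Y) ⟨⟨0, by omega⟩, hd _⟩
    have hle := sum_df_le H hr X (fun i => (hX i).1) hd (hc.trans (Finset.card_le_univ _))
    rw [← hi.df] at hle
    have h2 := (SES.kerIm Φ).df (δ := δ)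
    exact Hm.inj_of_ker ((hM.sub Φ.ker.incl_inj).zero (by omega))
  let σ := SES.ofInj Φ hinj
  obtain ⟨aR⟩ := aN.desc (Φ.range.proj_surj) fun y v x hx => by
    obtain ⟨z, rfl⟩ := (Subrep.proj_eq_zero _ _ _).1 hx
    rw [← hΦ']
    exact (Subrep.proj_eq_zero _ _ _).2 ⟨_, rfl⟩
  have hdR : df δ Φ.range.quot = 0 := by have := σ.df (δ := δ); omega
  have hregR : Reg δ Φ.range.quot := by
    obtain ⟨n, X, hX, ⟨i⟩⟩ := exists_decomp Φ.range.quot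
    have := fun i => (hX i).2
    have hi : Isom Φ.range.quot (dsumFam X) := ⟨i⟩
    have hnn : ∀ i, 0 ≤ defectOf Q δ (dz (X i)) := by
      by_contra hc
      push Not at hc
      have hc' := preproj_count H X (fun i => (hX i).1) D (fun Y _ => by
        rw [← homDim_fam_left, ← hi.homDim_left, hDF]; exact aR.dvd Y) hc
      rw [← Fintype.card_subtype] at hc'
      have hle := sum_df_le H hr (fun j : {i // defectOf Q δ (dz (X i)) < 0} => X j.1)
        (fun j => (hX j.1).1) (fun j => j.2) hc'
      let p0 : Hm (dsumFam X) (dsumFam fun j : {i // defectOf Q δ (dz (X i)) < 0} => X j.1) :=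
        Fam.lift fun j => Fam.proj X j.1
      have hp0 : p0.Surj := fun v x => by
        refine ⟨fun i => if h : defectOf Q δ (dz (X i)) < 0 then x ⟨i, h⟩ else 0, funext fun j => ?_⟩
        show dite _ _ _ = _
        rw [dif_pos j.2]
      let p := p0.comp (i.hom.comp Φ.range.proj)
      have hp : p.Surj := hp0.comp (i.hom_bij.surj.comp Φ.range.proj_surj)
      have h2 := (SES.ofSurj p hp).df (δ := δ)
      have hz := (hN.sub p.ker.incl_inj).zero (by omega)
      have hpi := Hm.inj_of_ker hz
      refine h0 (hpi.compL_inj _ ?_)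
      rw [map_zero]
      refine Hm.ext' fun v x => ?_
      show p0 v (i.hom v (Φ.range.proj v (Φ v x))) = 0
      rw [(Subrep.proj_eq_zero _ _ _).2 (show _ ∈ Φ.range.sub v from ⟨x, rfl⟩), map_zero, map_zero]
    rw [hi.df, df_fam] at hdR
    refine hi.symm.reg (reg_fam X fun i => reg_of_indec H (hX i).1 ?_)
    exact (Finset.sum_eq_zero_iff_of_nonneg fun i _ => hnn i).1 hdR i (Finset.mem_univ _)
  obtain ⟨g', hg'⟩ := σ.factorB g hgΦ
  have hne : homDim Φ.range.quot S ≠ 0 := homDim_ne_zero.2 ⟨g', fun h => hg (by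
    rw [← hg', h, Hm.zero_comp])⟩
  have hDle := Nat.le_of_dvd (Nat.pos_of_ne_zero hne) (aR.dvd S)
  rw [← hDF] at hDle
  obtain ⟨v, -⟩ := Function.ne_iff.1 H.min.1
  have hB := hS.hom_bound v _ Φ.range.quot rfl hregR
  have hdR : dimv Φ.range.quot v = D * δ v := by
    have h1 : dimv N v = _ := σ.dimv v
    have := hdim v; omega
  rw [hdR, he] at hB
  have hδ := H.δ_pos v
  have h1 : (D * δ v) * e ≤ (D * δ v) * homDim S S := by
    nlinarith [Nat.mul_le_mul_right (e * δ v) hDle]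
  exact Nat.le_of_mul_le_mul_left h1 (by positivity)

open TensorProduct in
def tens (F : Type) [Field F] [Algebra k F] (L : Repn k Q) : Repn k Q where
  space v := F ⊗[k] L.space v
  map a := (L.map a).lTensor F

open TensorProduct in
def tens.t {v : Q.V} (x : F) (l : L.space v) : (tens F L).space v := x ⊗ₜ[k] l
lemma tens.t_smul {v : Q.V} (c : k) (x : F) (l : L.space v) :
    tens.t (c • x) l = c • tens.t x l := (TensorProduct.smul_tmul' c x l).symm

lemma tens.t_add {v : Q.V} (x y : F) (l : L.space v) :
    tens.t (x + y) l = tens.t x l + tens.t y l := TensorProduct.add_tmul x y l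

lemma tens.lext {v : Q.V} {Y : Type} [AddCommGroup Y] [Module k Y]
    {f g : (tens F L).space v →ₗ[k] Y} (h : ∀ x l, f (tens.t x l) = g (tens.t x l)) : f = g :=
  TensorProduct.ext' h

lemma tens.ext {f g : Hm (tens F L) Y}
    (h : ∀ v x l, f v (tens.t x l) = g v (tens.t x l)) : f = g :=
  Hm.ext' fun v x => LinearMap.congr_fun (tens.lext (h v)) x

def tens.mk (f : ∀ v, (tens F L).space v →ₗ[k] Y.space v)
    (h : ∀ a x (l : L.space (Q.s a)), f _ (tens.t x (L.map a l)) = Y.map a (f _ (tens.t x l))) :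
    Hm (tens F L) Y := Hm.mk' f fun a x => LinearMap.congr_fun (f := (f _) ∘ₗ ((tens F L).map a))
      (g := (Y.map a) ∘ₗ (f _)) (tens.lext fun x l => h a x l) x

open TensorProduct in
lemma tens_isom {ι : Type} [Fintype ι] (b : Module.Basis ι k F) (L : Repn k Q) :
    Isom (tens F L) (dsumFam fun _ : ι => L) := by
  classical
  refine Hm.Bij.isom (f := tens.mk (Y := dsumFam fun _ : ι => L)
    (fun v => ((TensorProduct.equivFinsuppOfBasisLeft (N := L.space v) b).trans
      (Finsupp.linearEquivFunOnFinite k (L.space v) ι)).toLinearMap) ?_) ?_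
  · intro a x y
    funext i
    show TensorProduct.equivFinsuppOfBasisLeft b (x ⊗ₜ L.map a y) i =
      L.map a (TensorProduct.equivFinsuppOfBasisLeft b (x ⊗ₜ y) i)
    simp [TensorProduct.equivFinsuppOfBasisLeft_apply_tmul_apply]
  · exact fun v => LinearEquiv.bijective _

lemma tens_facts [FiniteDimensional k F] (L : Repn k Q) [FD L] (hL : PP δ L) :
    FD (tens F L) ∧ PP δ (tens F L) ∧ df δ (tens F L) = Module.finrank k F * df δ L ∧
    ∀ v, dimv (tens F L) v = Module.finrank k F * dimv L v := by
  have e := tens_isom (Module.finBasis k F) L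
  have hfd : FD (tens F L) := e.symm.fd
  refine ⟨hfd, ?_, ?_, fun v => ?_⟩
  · obtain ⟨i⟩ := e
    exact (PP.fam fun _ => hL).sub i.hom_bij.inj
  · rw [e.df, df_fam]; simp
  · rw [e.dimv, dimv_fam]; simp

def tens.lift (φ : F →ₗ[k] Hm L Y) : Hm (tens F L) Y :=
  tens.mk (fun v => TensorProduct.lift
    (LinearMap.mk₂ k (fun x (l : L.space v) => φ x v l) (fun x y l => by simp) (fun c x l => by simp)
      (fun x l m => by simp) (fun c x l => by simp)))
    (fun a x l => by
      show φ x _ (L.map a l) = Y.map a (φ x _ l)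
      exact Hm.comm _ _ _)

lemma tens.lift_t (φ : F →ₗ[k] Hm L Y) (v) (x : F) (l : L.space v) :
    tens.lift φ v (tens.t x l) = φ x v l := rfl

/-- the map `f ⊗ y` -/
def tens.mp {L L' : Repn k Q} (f : Hm L L') (y : F) : Hm (tens F L) (tens F L') :=
  tens.mk (Y := tens F L') (fun v => TensorProduct.map (LinearMap.mulLeft k y) (f v))
    (fun a x l => by
      show tens.t (y * x) (f _ (L.map a l)) = tens.t (y * x) (L'.map a (f _ l))
      rw [Hm.comm])

lemma tens.mp_t {L L' : Repn k Q} (f : Hm L L') (y : F) (v) (x : F) (l : L.space v) :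
    tens.mp f y v (tens.t x l) = tens.t (y * x) (f v l) := rfl

def tensAct (L : Repn k Q) : Act F (tens F L) where
  ρ y := tens.mp (Hm.id L) y
  one := tens.ext fun v x l => by rw [tens.mp_t, one_mul]; rfl
  mul x y := tens.ext fun v z l => by
    rw [Hm.comp_apply, tens.mp_t, tens.mp_t, tens.mp_t, mul_assoc]; rfl
  add x y := tens.ext fun v z l => by
    rw [Hm.add_apply', tens.mp_t, tens.mp_t, tens.mp_t, add_mul, tens.t_add]
  smul c x := tens.ext fun v z l => by
    rw [Hm.smul_apply', tens.mp_t, tens.mp_t, smul_mul_assoc, tens.t_smul]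

lemma main_tens (H : Aff Q δ) {F : Type} [Field F] [Algebra k F] [FiniteDimensional k F]
    {v : Q.V} (hv : ∀ w, δ v ≤ δ w) {S L : Repn k Q} [FD S] [FD L]
    (hS : Stab δ S) {e : ℕ} (he : ∀ v, dimv S v = e * δ v) (hL : L.Indec)
    (hLd : ∀ w, dimv L w = dimv (prj k Q v) w + δ w) (hdL : defectOf Q δ (dz L) = - δ v)
    (a0 a1 : L.space v) (l0 l1 : L.space v →ₗ[k] k) (h00 : l0 a0 = 1) (h01 : l0 a1 = 0)
    (h10 : l1 a0 = 0) (h11 : l1 a1 = 1) (φ : F →ₗ[k] Hm L S) (hφ : φ ≠ 0) (c0 c1 : F)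
    (hc : c0 ≠ 0 ∨ c1 ≠ 0) (hrel : ∀ y, φ (c0 * y) v a0 = φ (c1 * y) v a1) : e ≤ homDim S S := by
  have hδv := H.δ_pos v
  have := prj.fd (k := k) H v
  obtain ⟨f1, p1, d1, n1⟩ := tens_facts (F := F) (prj k Q v) (PP.prj H v)
  obtain ⟨f2, p2, d2, n2⟩ := tens_facts (F := F) L (PP.preproj H hL (by omega))
  let Φ : Hm (tens F (prj k Q v)) (tens F L) := tens.mp (prj.ev a0) c0 - tens.mp (prj.ev a1) c1
  have hΦt : ∀ w x l, Φ w (tens.t x l) =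
    tens.t (c0 * x) (prj.ev a0 w l) - tens.t (c1 * x) (prj.ev a1 w l) := fun w x l => rfl
  refine main_le (F := F) H hv hS he (D := Module.finrank k F) rfl Module.finrank_pos ?_ ?_ p1 p2 ?_
    (tensAct _) (tensAct _) Φ ?_ ?_ (tens.lift φ) ?_ ?_
  · rw [d1]; unfold df; rw [prj.defect H]; ring
  · rw [d2]; unfold df; rw [hdL]; ring
  · intro w; rw [n1, n2, hLd]; ring
  · intro y
    refine tens.ext fun w x l => ?_
    show Φ w (tens.t (y * x) l) = (tens.mp (Hm.id L) y w) (Φ w (tens.t x l))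
    rw [hΦt, hΦt, map_sub, tens.mp_t, tens.mp_t, mul_left_comm, mul_left_comm c1]; rfl
  · intro h0
    have h1 : Φ v (tens.t 1 (prj.e k Q v)) = 0 := by rw [h0]; rfl
    rw [hΦt, prj.ev_e, prj.ev_e, mul_one, mul_one, sub_eq_zero] at h1
    have h2 : ∀ l : L.space v →ₗ[k] k, (l a0) • c0 = (l a1) • c1 := fun l => by
      have := congrArg (fun z => TensorProduct.rid k F (LinearMap.lTensor F l z)) h1
      unfold tens.t at this
      simpa using this
    have h3 := h2 l0
    have h4 := h2 l1
    rw [h00, h01, one_smul, zero_smul] at h3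
    rw [h10, h11, one_smul, zero_smul] at h4
    rcases hc with hc | hc
    · exact hc h3
    · exact hc h4.symm
  · intro h0
    refine hφ (LinearMap.ext fun x => Hm.ext' fun w l => ?_)
    rw [← tens.lift_t, h0]; rfl
  · refine tens.ext fun w x l => ?_
    have h1 : (φ (c0 * x)).comp (prj.ev a0) = (φ (c1 * x)).comp (prj.ev a1) := prj.hom_ext (by
      rw [Hm.comp_apply, Hm.comp_apply, prj.ev_e, prj.ev_e]; exact hrel x)
    have h2 := congrArg (fun f : Hm _ _ => f w l) h1
    rw [Hm.comp_apply, hΦt, map_sub, tens.lift_t, tens.lift_t]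
    exact sub_eq_zero.2 h2

lemma exists_eig {U : Type} [AddCommGroup U] [Module k U] [FiniteDimensional k U] [Nontrivial U]
    (C : U →ₗ[k] U) : ∃ (F : Type) (_ : Field F) (_ : Algebra k F) (_ : FiniteDimensional k F)
      (x : F) (φ : F →ₗ[k] U), φ ≠ 0 ∧ ∀ y, φ (x * y) = C (φ y) := by
  have hi : IsIntegral k C := Algebra.IsIntegral.isIntegral C
  obtain ⟨p, hp, q, hq⟩ := WfDvdMonoid.exists_irreducible_factor (minpoly.not_isUnit k C)
    (minpoly.ne_zero hi)
  have hq0 : aeval C q ≠ 0 := fun h => by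
    obtain ⟨s, hs⟩ := minpoly.dvd k C h
    have hq' : q ≠ 0 := fun h => minpoly.ne_zero hi (by rw [hq, h, mul_zero])
    rw [hq] at hs
    have : q * 1 = q * (p * s) := by rw [mul_one]; conv_lhs => rw [hs]
                                     ring
    have := mul_left_cancel₀ hq' this
    exact hp.not_isUnit (IsUnit.of_mul_eq_one _ this.symm)
  obtain ⟨w, hw⟩ : ∃ w, aeval C q w ≠ 0 := by
    by_contra hc; push Not at hc
    exact hq0 (LinearMap.ext hc)
  set u := aeval C q w with hu
  have hpu : aeval C p u = 0 := by
    have : aeval C (p * q) w = 0 := by rw [← hq, minpoly.aeval]; rfl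
    rwa [map_mul] at this
  have hmax : (Ideal.span {p}).IsMaximal := PrincipalIdealRing.isMaximal_of_irreducible hp
  let _ : Field (k[X] ⧸ Ideal.span {p}) := Ideal.Quotient.field _
  let ψ : k[X] →ₗ[k[X]] Module.AEval' C := LinearMap.toSpanSingleton _ _ (Module.AEval'.of C u)
  have hψ : ∀ s, ψ s = Module.AEval'.of C (aeval C s u) := fun s => by
    show s • Module.AEval'.of C u = _
    exact (Module.AEval.of_aeval_smul C s u).symm
  have hker : Ideal.span {p} ≤ LinearMap.ker ψ := by
    rw [Ideal.span_le, Set.singleton_subset_iff]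
    show ψ p = 0
    rw [hψ, hpu, map_zero]
  let ψ' : (k[X] ⧸ Ideal.span {p}) →ₗ[k[X]] Module.AEval' C := Submodule.liftQ _ ψ hker
  refine ⟨k[X] ⧸ Ideal.span {p}, inferInstance, inferInstance, ?_, Ideal.Quotient.mk _ X,
    (Module.AEval'.of C).symm.toLinearMap ∘ₗ (ψ'.restrictScalars k), ?_, ?_⟩
  · exact Module.Finite.of_basis (AdjoinRoot.powerBasis hp.ne_zero).basis
  · intro h0
    have h1 := LinearMap.congr_fun h0 (Ideal.Quotient.mk _ 1)
    have h2 : ψ' (Ideal.Quotient.mk _ 1) = ψ 1 := rfl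
    simp only [LinearMap.comp_apply, LinearMap.restrictScalars_apply, h2, hψ] at h1
    simp at h1
    exact hw h1
  · intro y
    obtain ⟨s, rfl⟩ := Ideal.Quotient.mk_surjective y
    rw [← map_mul]
    have h2 : ∀ s, ψ' (Ideal.Quotient.mk _ s) = ψ s := fun s => rfl
    simp only [LinearMap.comp_apply, LinearMap.restrictScalars_apply, h2, hψ]
    simp

lemma Aff.dvd_of (H : Aff Q δ) {f e : ℕ} (h : ∀ v, f ∣ e * δ v) : f ∣ e := by
  have hg : Finset.univ.gcd δ = 1 := by
    have h1 : ∀ v, Finset.univ.gcd δ ∣ δ v := fun v => Finset.gcd_dvd (Finset.mem_univ v)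
    choose d hd using h1
    set g := Finset.univ.gcd δ
    obtain ⟨v, -⟩ := Function.ne_iff.1 H.min.1
    have hg0 : g ≠ 0 := fun h => by
      have := H.δ_pos v; rw [hd v, h, zero_mul] at this; exact lt_irrefl _ this
    have e1 : natc δ = (g : ℤ) • natc d := funext fun w => by
      simp only [natc, Pi.smul_apply, smul_eq_mul]; rw [hd w]; push_cast; rfl
    have h2 := H.qδ
    rw [e1, eulerZ_smul_left, eulerZ_smul_right] at h2
    have h3 : eulerZ Q (natc d) (natc d) = 0 := by simpa [hg0] using h2
    have hdv : d v ≠ 0 := fun h => by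
      have := H.δ_pos v; rw [hd v, h, mul_zero] at this; exact lt_irrefl _ this
    have h4 := H.min.2.2 d (fun h => hdv (congrFun h v)) h3 v
    rw [hd v] at h4
    have h5 : g * d v ≤ 1 * d v := by omega
    have := Nat.le_of_mul_le_mul_right h5 (Nat.pos_of_ne_zero hdv)
    omega
  have h1 : f ∣ Finset.univ.gcd fun v => e * δ v := Finset.dvd_gcd fun v _ => h v
  rw [Finset.gcd_mul_left, hg, mul_one] at h1
  simpa using h1

lemma Stab.end_eq (H : Aff Q δ) [FD S] (hS : Stab δ S)
    {e : ℕ} (h0 : 0 < e) (he : ∀ v, dimv S v = e * δ v) : homDim S S = e := by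
  refine le_antisymm (Nat.le_of_dvd h0 (H.dvd_of fun v => he v ▸ hS.dvd v)) ?_
  obtain ⟨v0, -⟩ := Function.ne_iff.1 H.min.1
  obtain ⟨v, -, hv⟩ := Finset.exists_min_image Finset.univ δ ⟨v0, Finset.mem_univ _⟩
  have hv' : ∀ w, δ v ≤ δ w := fun w => hv w (Finset.mem_univ _)
  have hδv := H.δ_pos v
  have := prj.fd (k := k) H v
  have hdP := prj.defect (k := k) H v
  have hqP : eulerZ Q (dz (prj k Q v)) (dz (prj k Q v)) = 1 := by
    rw [euler_prj H]; simp [dz, natc, prj.one H]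
  have hsum : natc (fun w => dimv (prj k Q v) w + δ w) = dz (prj k Q v) + natc δ := by
    funext w; simp [natc]
  have hPδ := H.rad (dz (prj k Q v))
  have hdL' : defectOf Q δ (natc (fun w => dimv (prj k Q v) w + δ w)) = - δ v := by
    unfold defectOf at *
    rw [hsum, eulerZ_add_right, H.qδ, hdP]; ring
  obtain ⟨L, _, hL, hLd⟩ := exists_indec (k := k) H (fun w => dimv (prj k Q v) w + δ w)
    (by rw [hsum, eulerZ_add_left, eulerZ_add_right, eulerZ_add_right, H.qδ, hqP, hPδ]; ring)
    (by rw [hdL']; omega)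
  have hdzL : dz L = dz (prj k Q v) + natc δ := by rw [← hsum, ← hLd]
  have hdL : defectOf Q δ (dz L) = - δ v := by rw [← hdL', ← hLd]
  have hdS : dz S = (e : ℤ) • natc δ := by funext w; simp [dz, natc, he w]
  have hU : homDim L S = dimv S v := by
    rw [preproj_hom H hL hS.indec (by omega), hdzL, hdS, eulerZ_smul_right, eulerZ_add_left, H.qδ,
      euler_prj H, he]
    simp [natc]
    norm_cast
  have hLv : dimv L v = 1 + δ v := by rw [hLd]; show dimv (prj k Q v) v + δ v = _; rw [prj.one H]
  let b := Module.finBasis k (L.space v)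
  have hlt : 1 < Module.finrank k (L.space v) := by show 1 < dimv L v; omega
  let i0 : Fin (Module.finrank k (L.space v)) := ⟨0, by omega⟩
  let i1 : Fin (Module.finrank k (L.space v)) := ⟨1, hlt⟩
  have h01 : i0 ≠ i1 := by simp [i0, i1]
  have c1 : b.coord i0 (b i0) = 1 := by simp
  have c2 : b.coord i0 (b i1) = 0 := by simp [Finsupp.single_apply, h01.symm]
  have c3 : b.coord i1 (b i0) = 0 := by simp [Finsupp.single_apply, h01]
  have c4 : b.coord i1 (b i1) = 1 := by simp
  let ev : L.space v → (Hm L S →ₗ[k] S.space v) := fun a =>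
    { toFun := fun g => g v a
      map_add' := fun g g' => rfl
      map_smul' := fun c g => rfl }
  by_cases hB : Function.Injective (ev (b i1))
  · have hbij : Function.Bijective (ev (b i1)) := ⟨hB,
      (LinearMap.injective_iff_surjective_of_finrank_eq_finrank (by rw [← homDim_eq, hU]; rfl)).1 hB⟩
    let E := LinearEquiv.ofBijective _ hbij
    have : Nontrivial (Hm L S) := Module.nontrivial_of_finrank_pos (R := k) (by
      rw [← homDim_eq, hU, he]; positivity)
    obtain ⟨F, _, _, _, x, φ, hφ, hx⟩ := exists_eig (E.symm.toLinearMap ∘ₗ ev (b i0))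
    refine main_tens H hv' hS he hL (fun w => by rw [hLd]) hdL (b i0) (b i1) _ _ c1 c2 c3 c4 φ hφ 1 x
      (Or.inl one_ne_zero) fun y => ?_
    rw [one_mul, hx]
    have := E.apply_symm_apply (ev (b i0) (φ y))
    exact this.symm
  · obtain ⟨g, hg0, hg⟩ : ∃ g : Hm L S, g v (b i1) = 0 ∧ g ≠ 0 := by
      by_contra hc
      push Not at hc
      exact hB ((injective_iff_map_eq_zero _).2 hc)
    refine main_tens (F := k) H hv' hS he hL (fun w => by rw [hLd]) hdL (b i0) (b i1) _ _ c1 c2 c3 c4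
      (LinearMap.toSpanSingleton k _ g) (fun h => hg ?_) 0 1 (Or.inr one_ne_zero) fun y => ?_
    · have := LinearMap.congr_fun h 1
      simpa using this
    · simp [hg0]

end Repn
end

noncomputable section
namespace Repn
variable {k : Type} [Field k] {k' : Type} [Field k'] {Q : QuiverData} {δ : Q.V → ℕ}
variable {T₁ C A' B' E' R' A B E L M M' N N' P R S T T' X X' Y Z : Repn k Q} {i : Hm T X} {n : ℕ}

lemma natc_inj {d e : Q.V → ℕ} (h : natc d = natc e) : d = e :=
  funext fun v => by have := congrFun h v; simpa [natc] using this

lemma tau_dim (H : Aff Q δ) {U U₁ : Repn k' Q} [FD T] [FD T₁] [FD U] [FD U₁]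
    (hT : Reg δ T₁) (hU : Reg δ U₁) (e : Isom (tau T₁) T) (e' : Isom (tau U₁) U)
    (h : dimv T = dimv U) : dimv T₁ = dimv U₁ := by
  have h1 : dz T₁ - dz U₁ = 0 := H.nondeg_left _ fun y => by
    have h2 := tau_euler H (hT.np H) y
    have h3 := tau_euler H (hU.np H) y
    rw [e.dz] at h2; rw [e'.dz] at h3
    have : dz T = dz U := congrArg natc h
    rw [eulerZ_sub_left]; rw [this] at h2; linarith
  exact natc_inj (sub_eq_zero.1 h1)

lemma col_dim (H : Aff Q δ) : ∀ (n : ℕ) {T X : Repn k Q} {U Y : Repn k' Q} {i : Hm T X} {j : Hm U Y},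
    Col δ n T X i → Col δ n U Y j → dimv T = dimv U → dimv X = dimv Y
  | 0, T, X, U, Y, i, j, h, h', e => by
    rw [← h.2.2.2.isom.dimv, ← h'.2.2.2.isom.dimv, e]
  | n+1, T, X, U, Y, i, j, h, h', e => by
    obtain ⟨a1, a2, a3, T₁, Z, i₁, σ, hσ, hc, hs⟩ := h
    obtain ⟨b1, b2, b3, U₁, W, j₁, ρ, hρ, hc', hs'⟩ := h'
    have := hc.fdT; have := hc'.fdT; have := hc.fdX; have := hc'.fdX
    have h1 := tau_dim H hc.stab.1 hc'.stab.1 (Col.step_tau H a1 σ hc hs) (Col.step_tau H b1 ρ hc' hs') e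
    have h2 := col_dim H n hc hc' h1
    funext v
    rw [σ.dimv v, ρ.dimv v, e, h2]

lemma Stab.hom_num (H : Aff Q δ) [FD S] [FD T] (hS : Stab δ S) (hT : Stab δ T)
    (h : ¬ Hg S) : homDim S T = open Classical in if dimv S = dimv T then 1 else 0 := by
  split_ifs with hd
  · have e := hS.isom_of_dim H h hT.1 hd
    rw [← hS.hom_real H h]; exact (e.homDim_right S).symm
  · exact hS.hom_eq_zero hT fun e => hd e.dimv

lemma col_hom (H : Aff Q δ) {n' : ℕ} : ∀ (n : ℕ) {T X S Z : Repn k Q} {U Y R W : Repn k' Q} {i : Hm T X}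
    {j : Hm U Y} {i' : Hm S Z} {j' : Hm R W},
    Col δ n T X i → Col δ n U Y j → Col δ n' S Z i' → Col δ n' R W j' → ¬ Hg T → ¬ Hg U →
    dimv T = dimv U → dimv S = dimv R → homDim X Z = homDim Y W
  | 0, T, X, S, Z, U, Y, R, W, i, j, i', j', h, h', l, l', hT, hU, e, e' => by
    have := h.fdT; have := h'.fdT; have := l.fdT; have := l'.fdT
    rw [h.hom_zero l, h'.hom_zero l', h.stab.hom_num H l.stab hT, h'.stab.hom_num H l'.stab hU, e, e']
  | n+1, T, X, S, Z, U, Y, R, W, i, j, i', j', h, h', l, l', hT, hU, e, e' => by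
    have hh := h; have hh' := h'
    obtain ⟨a1, a2, a3, T₁, Z, i₁, σ, hσ, hc, hs⟩ := h
    obtain ⟨b1, b2, b3, U₁, W, j₁, ρ, hρ, hc', hs'⟩ := h'
    subst hσ hρ
    have := hc.fdT; have := hc'.fdT; have := hc.fdX; have := hc'.fdX
    have := l.fdT; have := l'.fdT
    have t1 := Col.step_tau H a1 σ hc hs
    have t2 := Col.step_tau H b1 ρ hc' hs'
    have h1 := tau_dim H hc.stab.1 hc'.stab.1 t1 t2 e
    have h2 := col_hom H n hc hc' l l' (fun hg => hT ((Hg.of_tau' t1 hg).hg hg))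
      (fun hg => hU ((Hg.of_tau' t2 hg).hg hg)) h1 e'
    rw [Col.hom_succ H σ hc hh l, Col.hom_succ H ρ hc' hh' l', h2, a1.hom_num H l.stab hT,
      b1.hom_num H l'.stab hU, e, e']

lemma rz_reg (H : Aff Q δ) {X : Repn k Q} {p : (Q.V → ℕ) × ℕ} (h : defectOf Q δ (natc p.1) = 0) :
    RealizesIndecSymbol δ X p ↔
      ∃ (n : ℕ) (T : Repn k Q) (i : Hm T X), Col δ n T X i ∧ ¬ Hg T ∧ dimv T = p.1 ∧ p.2 = n + 1 := by
  constructor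
  · rintro ⟨h1, h2, h3, h4 | ⟨h4, h5, h6⟩⟩
    · exact absurd h h4.1
    have : FD X := ⟨h2⟩
    have hX : RI δ X := by
      obtain ⟨U, hU, hU', -⟩ := h5
      have hr : Reg δ X := Reg.ext (SES.ofSub U) ((regSimple_iff H).1 hU).2.1 ((regMod_iff H).1 hU').2
      exact ⟨this, h1, hr⟩
    obtain ⟨n, T, i, hc⟩ := hX.col H
    exact ⟨n, T, i, hc, fun hg => h3 ((hc.homog_iff H).2 hg), (hc.socdim H).1 h5, (hc.filt H).1 h6⟩
  · rintro ⟨n, T, i, hc, hg, hd, hp⟩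
    exact ⟨hc.indec, hc.fdX.fd, fun hh => hg ((hc.homog_iff H).1 hh),
      Or.inr ⟨h, (hc.socdim H).2 hd, (hc.filt H).2 hp⟩⟩

lemma rz_ne (H : Aff Q δ) {X : Repn k Q} {p : (Q.V → ℕ) × ℕ} (h : defectOf Q δ (natc p.1) ≠ 0) :
    RealizesIndecSymbol δ X p ↔ X.Indec ∧ FD X ∧ p.2 = 1 ∧ dimv X = p.1 := by
  constructor
  · rintro ⟨h1, h2, h3, h4 | h4⟩
    · exact ⟨h1, ⟨h2⟩, h4.2⟩
    · exact absurd h4.1 h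
  · rintro ⟨h1, h2, h3, h4⟩
    refine ⟨h1, h2.fd, fun hh => h ?_, Or.inl ⟨h, h3, h4⟩⟩
    rw [← h4]; exact hh.1.2.2

abbrev Rz (δ : Q.V → ℕ) (X : Repn k Q) (p : (Q.V → ℕ) × ℕ) := RealizesIndecSymbol δ X p
lemma rz_fd {X : Repn k Q} {p : (Q.V → ℕ) × ℕ} (h : Rz δ X p) : FD X := ⟨h.2.1⟩

lemma rz_df (H : Aff Q δ) {X : Repn k Q} {p : (Q.V → ℕ) × ℕ} (h : Rz δ X p) :
    (defectOf Q δ (dz X) = defectOf Q δ (natc p.1)) := by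
  by_cases h0 : defectOf Q δ (natc p.1) = 0
  · obtain ⟨n, T, i, hc, -⟩ := (rz_reg H h0).1 h
    rw [h0]; exact ((regIndec_iff H).2 hc.ri).2.2
  · rw [show dz X = natc p.1 from congrArg natc ((rz_ne H h0).1 h).2.2.2]

lemma rz_dim (H : Aff Q δ) {X : Repn k Q} {Y : Repn k' Q} {p : (Q.V → ℕ) × ℕ}
    (h : Rz δ X p) (h' : Rz δ Y p) : dimv X = dimv Y := by
  by_cases h0 : defectOf Q δ (natc p.1) = 0
  · obtain ⟨n, T, i, hc, -, h3, h4⟩ := (rz_reg H h0).1 h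
    obtain ⟨n', T', i', hc', -, h3', h4'⟩ := (rz_reg H h0).1 h'
    obtain rfl : n = n' := by omega
    exact col_dim H n hc hc' (h3.trans h3'.symm)
  · rw [((rz_ne H h0).1 h).2.2.2, ((rz_ne H h0).1 h').2.2.2]

lemma rz_hom (H : Aff Q δ) {X X' : Repn k Q} {Y Y' : Repn k' Q} {p p' : (Q.V → ℕ) × ℕ}
    (h : Rz δ X p) (h' : Rz δ X' p') (l : Rz δ Y p) (l' : Rz δ Y' p') : homDim X X' = homDim Y Y' := by
  have := rz_fd h; have := rz_fd h'; have := rz_fd l; have := rz_fd l'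
  have e1 : dz X = dz Y := congrArg natc (rz_dim H h l)
  have e2 : dz X' = dz Y' := congrArg natc (rz_dim H h' l')
  have d1 := rz_df H h; have d2 := rz_df H h'; have d3 := rz_df H l; have d4 := rz_df H l'
  rcases lt_trichotomy (defectOf Q δ (natc p.1)) 0 with g | g | g
  · rw [preproj_hom H h.1 h'.1 (by omega), preproj_hom H l.1 l'.1 (by omega), e1, e2]
  · rcases lt_trichotomy (defectOf Q δ (natc p'.1)) 0 with g' | g' | g'
    · rw [hom_to_preproj H h'.1 h.1 (by omega) (by omega), hom_to_preproj H l'.1 l.1 (by omega) (by omega)]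
    · obtain ⟨n, T, i, hc, hg, h3, h4⟩ := (rz_reg H g).1 h
      obtain ⟨n', T', i', hc', hg', h3', h4'⟩ := (rz_reg H g').1 h'
      obtain ⟨m, U, j, kc, kg, k3, k4⟩ := (rz_reg H g).1 l
      obtain ⟨m', U', j', kc', kg', k3', k4'⟩ := (rz_reg H g').1 l'
      obtain rfl : n = m := by omega
      obtain rfl : n' = m' := by omega
      exact col_hom H n hc kc hc' kc' hg kg (h3.trans k3.symm) (h3'.trans k3'.symm)
    · rw [preinj_hom H h.1 h'.1 (by omega), preinj_hom H l.1 l'.1 (by omega), e1, e2]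
  · by_cases g' : defectOf Q δ (natc p'.1) ≤ 0
    · rw [hom_from_preinj H h'.1 h.1 (by omega) (by omega), hom_from_preinj H l'.1 l.1 (by omega) (by omega)]
    · rw [preinj_hom H h.1 h'.1 (by omega), preinj_hom H l.1 l'.1 (by omega), e1, e2]

lemma rz_isom (H : Aff Q δ) {X Y : Repn k Q} {p : (Q.V → ℕ) × ℕ}
    (h : Rz δ X p) (h' : Rz δ Y p) : Isom X Y := by
  have := rz_fd h; have := rz_fd h'
  have e1 : dz X = dz Y := congrArg natc (rz_dim H h h')
  have d1 := rz_df H h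
  rcases lt_trichotomy (defectOf Q δ (natc p.1)) 0 with g | g | g
  · exact preproj_isom H h.1 h'.1 (by omega) e1
  · obtain ⟨n, T, i, hc, hg, h3, h4⟩ := (rz_reg H g).1 h
    obtain ⟨n', T', i', hc', hg', h3', h4'⟩ := (rz_reg H g).1 h'
    obtain rfl : n = n' := by omega
    have := hc.fdT; have := hc'.fdT
    exact hc.unique H hc' (hc.stab.isom_of_dim H hg hc'.stab.1 (h3.trans h3'.symm))
  · exact preinj_isom H h.1 h'.1 (by omega) e1

lemma rz_inj (H : Aff Q δ) {X Y : Repn k Q} {p p' : (Q.V → ℕ) × ℕ}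
    (h : Rz δ X p) (h' : Rz δ Y p') (e : Isom X Y) : p = p' := by
  have d1 := rz_df H h; have d2 := rz_df H h'
  rw [e.dz, d2] at d1
  by_cases g : defectOf Q δ (natc p.1) = 0
  · obtain ⟨n, T, i, hc, hg, h3, h4⟩ := (rz_reg H g).1 h
    obtain ⟨n', T', i', hc', hg', h3', h4'⟩ := (rz_reg H (d1.trans g)).1 h'
    obtain ⟨f⟩ := e
    have hc1 := Isom.col f hc
    have e1 := Soc.unique ⟨_, _, hc1⟩ ⟨_, _, hc'⟩
    refine Prod.ext (by rw [← h3, ← h3', e1.dimv]) ?_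
    rw [h4, (hc'.filt H).1 ((hc1.filt H).2 rfl), h4']
  · have a := (rz_ne H g).1 h
    have b := (rz_ne H (d1 ▸ g)).1 h'
    exact Prod.ext (by rw [← a.2.2.2, ← b.2.2.2, e.dimv]) (by rw [a.2.2.1, b.2.2.1])

lemma rz_exists (H : Aff Q δ) [FD X] (hX : X.Indec) (h : ¬ InHomogTube δ X) :
    ∃ p, Rz δ X p := by
  by_cases g : defectOf Q δ (dz X) = 0
  · obtain ⟨n, T, i, hc⟩ := ((regIndec_iff H).1 ⟨hX, FD.fd, g⟩).col H
    have := hc.fdT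
    have : defectOf Q δ (natc (dimv T)) = 0 := ((regIndec_iff H).2 hc.stab.ri).2.2
    exact ⟨(dimv T, n+1), (rz_reg H this).2 ⟨n, T, i, hc, fun hg => h ((hc.homog_iff H).2 hg), rfl, rfl⟩⟩
  · exact ⟨(dimv X, 1), (rz_ne H g).2 ⟨hX, inferInstance, rfl, rfl⟩⟩

open Classical in
def hnum (δ : Q.V → ℕ) (p p' : (Q.V → ℕ) × ℕ) : ℕ :=
  if h : ∃ (n : ℕ) (k : Type) (_ : Field k) (X Y : Repn k Q), Rz δ X p ∧ Rz δ Y p' ∧ homDim X Y = n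
    then h.choose else 0

lemma hnum_eq (H : Aff Q δ) {X Y : Repn k Q} {p p' : (Q.V → ℕ) × ℕ}
    (h : Rz δ X p) (h' : Rz δ Y p') : homDim X Y = hnum δ p p' := by
  have hh : ∃ (n : ℕ) (k : Type) (_ : Field k) (X Y : Repn k Q), Rz δ X p ∧ Rz δ Y p' ∧ homDim X Y = n :=
    ⟨_, k, inferInstance, X, Y, h, h', rfl⟩
  rw [hnum, dif_pos hh]
  obtain ⟨k', _, X', Y', h1, h2, h3⟩ := hh.choose_spec
  rw [← h3]; exact rz_hom H h h' h1 h2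

open Classical in
def dnum (δ : Q.V → ℕ) (p : (Q.V → ℕ) × ℕ) : Q.V → ℕ :=
  if h : ∃ (n : Q.V → ℕ) (k : Type) (_ : Field k) (X : Repn k Q), Rz δ X p ∧ dimv X = n
    then h.choose else 0

lemma dnum_eq (H : Aff Q δ) {X : Repn k Q} {p : (Q.V → ℕ) × ℕ}
    (h : Rz δ X p) : dimv X = dnum δ p := by
  have hh : ∃ (n : Q.V → ℕ) (k : Type) (_ : Field k) (X : Repn k Q), Rz δ X p ∧ dimv X = n :=
    ⟨_, k, inferInstance, X, h, rfl⟩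
  rw [dnum, dif_pos hh]
  obtain ⟨k', _, X', h1, h3⟩ := hh.choose_spec
  rw [← h3]; exact rz_dim H h h1

/-- The non-invertible endomorphisms form a subspace of codimension `f`. -/
def RadF (X : Repn k Q) (f : ℕ) : Prop :=
  ∃ W : Submodule k (Hm X X), (∀ g, g ∈ W ↔ ¬ g.Bij) ∧ Module.finrank k W + f = homDim X X

lemma RadF.one [FD X] (hX : X.Indec) (h : homDim X X = 1) : RadF X 1 := by
  refine ⟨⊥, fun g => ?_, by rw [finrank_bot, h]⟩
  rw [Submodule.mem_bot]
  refine ⟨fun h0 => h0 ▸ not_bij_zero hX.1, fun hg => ?_⟩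
  by_contra h0
  rw [homDim_eq, finrank_eq_one_iff_of_nonzero' g h0] at h
  obtain ⟨c, hc⟩ := h (Hm.id X)
  have hcg : (Hm.id X).Bij := fun v => Function.bijective_id
  rw [← hc] at hcg
  apply hg
  have hc0 : c ≠ 0 := fun h => by rw [h, zero_smul] at hcg; exact not_bij_zero hX.1 hcg
  intro v
  constructor
  · intro x y hxy; exact (hcg v).1 (by simp [hxy])
  · intro y
    obtain ⟨x, hx⟩ := (hcg v).2 (c • y)
    refine ⟨x, ?_⟩
    have : c • g v x = c • y := by simpa using hx
    exact smul_right_injective _ hc0 this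

lemma Col.radF (H : Aff Q δ) (h : Col δ n T X i) :
    RadF X (homDim T T) := by
  have := h.fdT; have := h.fdX
  refine ⟨LinearMap.ker (i.compR X), fun g => ?_, ?_⟩
  · have hc : g ∈ LinearMap.ker (i.compR X) ↔ g.comp i = 0 := Iff.rfl
    rw [hc]
    constructor
    · intro h0 hb
      exact Hm.comp_ne_zero_left hb.inj (Hm.ne_zero_of_inj h.inj h.stab.indec.1) h0
    · intro hb; by_contra h0
      exact hb ((h.inj_of h.reg h0).bij_of_tdim le_rfl)
  · cases n with
    | zero =>
      have : LinearMap.ker (i.compR X) = ⊥ := LinearMap.ker_eq_bot.2 (Hm.Surj.compR_inj h.2.2.2.surj X)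
      rw [this, finrank_bot, h.hom_zero h, zero_add]
    | succ n =>
      have hh := h
      obtain ⟨a1, a2, a3, T₁, Z, i₁, σ, hσ, hc, hs⟩ := h
      subst hσ
      have := hc.fdX
      have h1 := Col.hom_succ H σ hc hh hh
      rw [if_pos le_rfl] at h1
      have h2 := σ.finrank_range_compR X
      have h3 := LinearMap.finrank_range_add_finrank_ker (σ.i.compR X)
      rw [← homDim_eq] at h3
      omega

lemma rz_radF (H : Aff Q δ) {X : Repn k Q} {p : (Q.V → ℕ) × ℕ} (h : Rz δ X p) : RadF X 1 := by
  have := rz_fd h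
  have d1 := rz_df H h
  rcases lt_trichotomy (defectOf Q δ (natc p.1)) 0 with g | g | g
  · exact RadF.one h.1 (preproj_brick H h.1 (by omega))
  · obtain ⟨n, T, i, hc, hg, h3, h4⟩ := (rz_reg H g).1 h
    have := hc.fdT
    rw [← hc.stab.hom_real H hg]; exact hc.radF H
  · exact RadF.one h.1 (preinj_brick H h.1 (by omega))

end Repn
end

noncomputable section
namespace Repn
variable {k : Type} [Field k] {Q : QuiverData} {δ : Q.V → ℕ}
variable {T₁ C A' B' E' R' A B E L M M' N N' P R S T T' X X' Y Z : Repn k Q} {i : Hm T X} {n : ℕ}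

def SM (s : Hm X M) : Prop := ∃ r : Hm M X, r.comp s = Hm.id X
lemma Hm.Bij.sm {s : Hm X M} (h : s.Bij) : SM s :=
  ⟨h.iso.symm.hom, Hm.ext' fun v x => (h.iso.e v).symm_apply_apply x⟩

lemma SM.of_bij {s : Hm X M} {r : Hm M X} (h : (r.comp s).Bij) : SM s := by
  obtain ⟨u, hu⟩ := h.sm
  exact ⟨u.comp r, by rw [← hu, Hm.comp_assoc]⟩

lemma SM.comp {s : Hm X M} {t : Hm M N} (hs : SM s) (ht : SM t) : SM (t.comp s) := by
  obtain ⟨r, hr⟩ := hs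
  obtain ⟨u, hu⟩ := ht
  refine ⟨r.comp u, ?_⟩
  rw [Hm.comp_assoc, ← Hm.comp_assoc u t s, hu, Hm.id_comp, hr]

lemma sm_dsum [FD X] (hX : X.Indec) (s : Hm X (A.dsum B)) :
    SM s ↔ SM ((fst A B).comp s) ∨ SM ((snd A B).comp s) := by
  constructor
  · rintro ⟨r, hr⟩
    have h1 : (r.comp (inl A B)).comp ((fst A B).comp s) + (r.comp (inr A B)).comp ((snd A B).comp s)
        = Hm.id X := by
      rw [← hr]
      have := congrArg (fun t => r.comp (t.comp s)) (dsum_id A B)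
      simp only [Hm.add_comp, Hm.comp_add, Hm.id_comp] at this
      rw [← this]; simp only [Hm.comp_assoc]
    have hid : (Hm.id X).Bij := fun v => Function.bijective_id
    rcases indec_bij_of_add hX (h1 ▸ hid) with h | h
    · exact Or.inl (SM.of_bij h)
    · exact Or.inr (SM.of_bij h)
  · rintro (⟨r, hr⟩ | ⟨r, hr⟩)
    · exact ⟨r.comp (fst A B), by rw [← hr, Hm.comp_assoc]⟩
    · exact ⟨r.comp (snd A B), by rw [← hr, Hm.comp_assoc]⟩

lemma sm_transA (s : Hm X (X.dsum M)) (h : ((fst X M).comp s).Bij) :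
    ∃ φ : Iso (X.dsum M) (X.dsum M), φ.hom.comp (inl X M) = s := by
  let φ : Hm (X.dsum M) (X.dsum M) := s.comp (fst X M) + (inr X M).comp (snd X M)
  have hφ : ∀ v (z : (X.dsum M).space v), φ v z = ((s v z.1).1 + 0, (s v z.1).2 + z.2) := fun v z => rfl
  have hb : φ.Bij := by
    intro v
    constructor
    · intro z w hzw
      rw [hφ, hφ] at hzw
      have h1 : z.1 = w.1 := (h v).1 (by
        have h1 := congrArg Prod.fst hzw
        simp only [add_zero] at h1; exact h1)
      have h2 := congrArg Prod.snd hzw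
      rw [h1] at h2
      exact Prod.ext h1 (add_left_cancel h2)
    · intro w
      obtain ⟨x, hx⟩ := (h v).2 w.1
      refine ⟨(x, w.2 - (s v x).2), ?_⟩
      refine (hφ v _).trans (Prod.ext (by rw [← hx]; exact add_zero _) ?_)
      exact add_sub_cancel _ _
  refine ⟨hb.iso, Hm.ext' fun v x => ?_⟩
  show φ v (x, 0) = s v x
  exact (hφ v _).trans (Prod.ext (add_zero _) (add_zero _))

lemma sm_trans [FD X] (hX : X.Indec) (s : Hm X (X.dsum M)) (h : SM s) :
    ∃ φ : Iso (X.dsum M) (X.dsum M), φ.hom.comp (inl X M) = s := by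
  rcases (sm_dsum hX s).1 h with h | ⟨r, hr⟩
  · obtain ⟨r, hr⟩ := h
    exact sm_transA s (indec_retract hX _ r hr hX.1)
  · let g : Hm X X := Hm.id X - (fst X M).comp s
    let E : Hm (X.dsum M) (X.dsum M) := Hm.id _ + (inl X M).comp (g.comp (r.comp (snd X M)))
    have hE : ∀ v (z : (X.dsum M).space v), E v z = (z.1 + g v (r v z.2), z.2 + 0) := fun v z => rfl
    have hb : E.Bij := by
      intro v
      constructor
      · intro z w hzw
        rw [hE, hE] at hzw
        have h1 : z.2 = w.2 := by simpa using congrArg Prod.snd hzw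
        have h2 := congrArg Prod.fst hzw
        rw [h1] at h2
        exact Prod.ext (add_right_cancel h2) h1
      · intro w
        refine ⟨(w.1 - g v (r v w.2), w.2), ?_⟩
        exact (hE v _).trans (Prod.ext (sub_add_cancel _ _) (add_zero _))
    obtain ⟨φ, hφ⟩ := sm_transA (E.comp s) (by
      have : (fst X M).comp (E.comp s) = Hm.id X := Hm.ext' fun v x => by
        have h1 : r v (s v x).2 = x := congrArg (fun t : Hm X X => t v x) hr
        show (s v x).1 + ((r v (s v x).2) - (s v (r v (s v x).2)).1) = x
        rw [h1]; abel
      rw [this]; exact fun v => Function.bijective_id)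
    refine ⟨φ.trans hb.iso.symm, Hm.ext' fun v x => ?_⟩
    show (hb.iso.e v).symm (φ.hom v (inl X M v x)) = s v x
    rw [LinearEquiv.symm_apply_eq]
    exact congrArg (fun t : Hm X (X.dsum M) => t v x) hφ

def fibEquiv :
    {φ : Iso (X.dsum M) (X.dsum M) // φ.hom.comp (inl X M) = inl X M} ≃ Hm M X × Iso M M where
  toFun φ := ((fst X M).comp (φ.1.hom.comp (inr X M)), Hm.Bij.iso (f := (snd X M).comp (φ.1.hom.comp (inr X M))) (by
    have h1 : ∀ v (x : X.space v), φ.1.e v (x, 0) = (x, 0) := fun v x =>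
      congrArg (fun t : Hm X (X.dsum M) => t v x) φ.2
    have h2 : ∀ v (x : X.space v) (m : M.space v), φ.1.e v (x, m) = inl X M v x + φ.1.e v (0, m) := fun v x m => by
      refine Eq.trans ?_ ((map_add (φ.1.e v) (inl X M v x) (inr X M v m)).trans (congrArg (· + φ.1.e v (0, m)) (h1 v x)))
      exact congrArg (φ.1.e v) (Prod.ext (add_zero x).symm (zero_add m).symm)
    intro v
    constructor
    · refine (injective_iff_map_eq_zero ((snd X M).comp (φ.1.hom.comp (inr X M)) v)).2 fun m hm => ?_
      have hm : (φ.1.e v (0, m)).2 = 0 := hm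
      have h3 : φ.1.e v (0, m) = φ.1.e v ((φ.1.e v (0, m)).1, 0) := by
        rw [h1]; exact Prod.ext rfl hm
      exact (congrArg Prod.snd ((φ.1.e v).injective h3) : _)
    · intro m'
      obtain ⟨⟨x, m⟩, hz⟩ := (φ.1.e v).surjective (0, m')
      refine ⟨m, ?_⟩
      exact (zero_add _).symm.trans (congrArg Prod.snd ((h2 v x m).symm.trans hz))))
  invFun b := ⟨Hm.Bij.iso (f := (inl X M).comp (fst X M) + (inl X M).comp (b.1.comp (snd X M)) +
      (inr X M).comp (b.2.hom.comp (snd X M))) (by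
    have hE : ∀ v (z : (X.dsum M).space v), ((inl X M).comp (fst X M) + (inl X M).comp (b.1.comp (snd X M)) +
      (inr X M).comp (b.2.hom.comp (snd X M))) v z = (z.1 + b.1 v z.2 + 0, 0 + 0 + b.2.e v z.2) := fun v z => rfl
    intro v
    constructor
    · intro z w hzw
      rw [hE, hE] at hzw
      have h1 : z.2 = w.2 := by simpa using congrArg Prod.snd hzw
      have h2 := congrArg Prod.fst hzw
      rw [h1] at h2
      exact Prod.ext (by simpa using h2) h1
    · intro w
      refine ⟨(w.1 - b.1 v ((b.2.e v).symm w.2), (b.2.e v).symm w.2), ?_⟩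
      exact (hE v _).trans (Prod.ext (by simp) (by simp))), Hm.ext' fun v x => by
    show ((x + b.1 v 0 + 0 : X.space v), (0 + 0 + b.2.e v 0 : M.space v)) = (x, 0)
    simp⟩
  left_inv φ := by
    have h1 : ∀ v (x : X.space v), φ.1.e v (x, 0) = (x, 0) := fun v x =>
      congrArg (fun t : Hm X (X.dsum M) => t v x) φ.2
    have h2 : ∀ v (x : X.space v) (m : M.space v), φ.1.e v (x, m) = inl X M v x + φ.1.e v (0, m) := fun v x m => by
      refine Eq.trans ?_ ((map_add (φ.1.e v) (inl X M v x) (inr X M v m)).trans (congrArg (· + φ.1.e v (0, m)) (h1 v x)))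
      exact congrArg (φ.1.e v) (Prod.ext (add_zero x).symm (zero_add m).symm)
    refine Subtype.ext (Iso.ext' fun v z => ?_)
    show ((z.1 + (φ.1.e v (0, z.2)).1 + 0 : X.space v), (0 + 0 + (φ.1.e v (0, z.2)).2 : M.space v)) = _
    refine Eq.trans ?_ (h2 v z.1 z.2).symm
    exact Prod.ext (add_zero _) (by rw [zero_add]; rfl)
  right_inv b := by
    refine Prod.ext (Hm.ext' fun v x => ?_) (Iso.ext' fun v x => ?_)
    · show (0 + b.1 v x + 0 : X.space v) = _
      simp
    · show (0 + 0 + b.2.e v x : M.space v) = _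
      simp

lemma card_hm [Finite k] (X Y : Repn k Q) [FD X] [FD Y] :
    Nat.card (Hm X Y) = Nat.card k ^ homDim X Y := by
  have : Module.Finite k (Hm X Y) := inferInstanceAs (Module.Finite k (LinearMap.ker (extMap X Y)))
  exact Module.natCard_eq_pow_finrank (K := k) (V := LinearMap.ker (extMap X Y))

instance [Finite k] (X Y : Repn k Q) [FD X] [FD Y] : Finite (Hm X Y) := by
  have : Module.Finite k (Hm X Y) := inferInstanceAs (Module.Finite k (LinearMap.ker (extMap X Y)))
  exact Module.finite_of_finite k

def nsm (X M : Repn k Q) : ℕ := Nat.card {s : Hm X M // ¬ SM s}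
lemma aut_dsum [Finite k] [FD X] [FD M] (hX : X.Indec) :
    autCard (X.dsum M) = (Nat.card k ^ homDim X (X.dsum M) - nsm X (X.dsum M)) *
      (Nat.card k ^ homDim M X * autCard M) := by
  classical
  rw [← card_hm, ← card_hm, autCard, autCard]
  have h1 : Nat.card {s : Hm X (X.dsum M) // SM s} = Nat.card (Hm X (X.dsum M)) - nsm X (X.dsum M) := by
    have := Nat.card_congr (Equiv.sumCompl (fun s : Hm X (X.dsum M) => SM s))
    rw [Nat.card_sum] at this
    unfold nsm; omega
  rw [← h1, ← Nat.card_prod, ← Nat.card_congr fibEquiv, ← Nat.card_prod]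
  have hsm : ∀ φ : Iso (X.dsum M) (X.dsum M), SM (φ.hom.comp (inl X M)) := fun φ =>
    SM.comp ⟨fst X M, Hm.ext' fun v x => rfl⟩ φ.hom_bij.sm
  choose φ0 h0 using fun s : {s : Hm X (X.dsum M) // SM s} => sm_trans hX s.1 s.2
  refine Nat.card_congr
    { toFun := fun φ => (⟨_, hsm φ⟩, ⟨φ.trans (φ0 ⟨_, hsm φ⟩).symm, Hm.ext' fun v x => ?_⟩)
      invFun := fun p => p.2.1.trans (φ0 p.1)
      left_inv := fun φ => Iso.ext' fun v x => ?_
      right_inv := fun p => ?_ }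
  · show ((φ0 ⟨_, hsm φ⟩).e v).symm (φ.hom v (inl X M v x)) = _
    rw [LinearEquiv.symm_apply_eq]
    exact (congrArg (fun t : Hm X (X.dsum M) => t v x) (h0 ⟨_, hsm φ⟩)).symm
  · exact ((φ0 ⟨_, hsm φ⟩).e v).apply_symm_apply _
  · have e1 : (⟨_, hsm (p.2.1.trans (φ0 p.1))⟩ : {s : Hm X (X.dsum M) // SM s}) = p.1 := by
      refine Subtype.ext ?_
      rw [← h0 p.1]
      refine Hm.ext' fun v x => ?_
      show (φ0 p.1).e v (p.2.1.hom.comp (inl X M) v x) = _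
      rw [p.2.2]; rfl
    refine Prod.ext e1 (Subtype.ext (Iso.ext' fun v x => ?_))
    show ((φ0 ⟨_, hsm (p.2.1.trans (φ0 p.1))⟩).e v).symm ((φ0 p.1).e v (p.2.1.e v x)) = _
    rw [e1]; exact ((φ0 p.1).e v).symm_apply_apply _

lemma nsm_dsum [Finite k] [FD X] (hX : X.Indec) :
    nsm X (A.dsum B) = nsm X A * nsm X B := by
  unfold nsm
  rw [← Nat.card_prod]
  refine Nat.card_congr
    { toFun := fun s => (⟨(fst A B).comp s.1, fun h => s.2 ((sm_dsum hX _).2 (Or.inl h))⟩,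
        ⟨(snd A B).comp s.1, fun h => s.2 ((sm_dsum hX _).2 (Or.inr h))⟩)
      invFun := fun p => ⟨(inl A B).comp p.1.1 + (inr A B).comp p.2.1, fun h => ?_⟩
      left_inv := fun s => Subtype.ext (Hm.ext' fun v x => ?_)
      right_inv := fun p => ?_ }
  · have e1 : (fst A B).comp ((inl A B).comp p.1.1 + (inr A B).comp p.2.1) = p.1.1 :=
      Hm.ext' fun v x => by show (p.1.1 v x + 0 : A.space v) = _; simp
    have e2 : (snd A B).comp ((inl A B).comp p.1.1 + (inr A B).comp p.2.1) = p.2.1 :=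
      Hm.ext' fun v x => by show (0 + p.2.1 v x : B.space v) = _; simp
    rcases (sm_dsum hX _).1 h with h | h
    · exact p.1.2 (e1 ▸ h)
    · exact p.2.2 (e2 ▸ h)
  · show (((s.1 v x).1 + 0 : A.space v), (0 + (s.1 v x).2 : B.space v)) = _
    exact Prod.ext (add_zero _) (zero_add _)
  · refine Prod.ext (Subtype.ext (Hm.ext' fun v x => ?_)) (Subtype.ext (Hm.ext' fun v x => ?_))
    · show (p.1.1 v x + 0 : A.space v) = _; simp
    · show (0 + p.2.1 v x : B.space v) = _; simp

lemma nsm_zero (hX : ¬ X.IsZero) (hM : M.IsZero) : nsm X M = 1 := by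
  unfold nsm
  rw [Nat.card_eq_one_iff_unique]
  refine ⟨⟨fun a b => Subtype.ext (by rw [hM.hom_eq' a.1, hM.hom_eq' b.1])⟩, ⟨0, ?_⟩⟩
  rintro ⟨r, hr⟩
  rw [Hm.comp_zero] at hr
  exact hX (isZero_of_id hr.symm)

lemma Isom.nsm (e : Isom M M') : nsm X M = nsm X M' := by
  obtain ⟨e⟩ := e
  have h1 : ∀ s : Hm X M, e.symm.hom.comp (e.hom.comp s) = s := fun s =>
    Hm.ext' fun v x => (e.e v).symm_apply_apply _
  have h2 : ∀ s : Hm X M', e.hom.comp (e.symm.hom.comp s) = s := fun s =>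
    Hm.ext' fun v x => (e.e v).apply_symm_apply _
  refine Nat.card_congr
    { toFun := fun s => ⟨e.hom.comp s.1, fun h => s.2 (h1 s.1 ▸ h.comp e.symm.hom_bij.sm)⟩
      invFun := fun s => ⟨e.symm.hom.comp s.1, fun h => s.2 (h2 s.1 ▸ h.comp e.hom_bij.sm)⟩
      left_inv := fun s => Subtype.ext (h1 s.1)
      right_inv := fun s => Subtype.ext (h2 s.1) }

lemma sm_indec (hX : ¬ X.IsZero) (hY : Y.Indec) (s : Hm X Y) : SM s ↔ s.Bij :=
  ⟨fun ⟨r, hr⟩ => indec_retract hY s r hr hX, fun h => h.sm⟩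

lemma nsm_ne [Finite k] [FD X] [FD Y] (hX : ¬ X.IsZero) (hY : Y.Indec)
    (h : ¬ Isom X Y) : nsm X Y = Nat.card k ^ homDim X Y := by
  rw [← card_hm]
  exact Nat.card_congr (Equiv.subtypeUnivEquiv fun s hs => h ((sm_indec hX hY s).1 hs).isom)

lemma nsm_self [Finite k] [FD X] [FD Y] (hX : X.Indec) {f : ℕ} (hf : RadF X f)
    (e : Isom X Y) : nsm X Y * Nat.card k ^ f = Nat.card k ^ homDim X Y := by
  rw [← e.nsm, ← e.homDim_right X]
  obtain ⟨W, hW, hd⟩ := hf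
  rw [← hd, pow_add]
  congr 1
  rw [← Module.natCard_eq_pow_finrank (K := k) (V := W)]
  exact Nat.card_congr (Equiv.subtypeEquivRight fun s => by rw [hW, sm_indec hX.1 hX])

def zr : Repn k Q where
  space _ := PUnit
  map _ := 0

lemma zr_zero : (zr : Repn k Q).IsZero := fun _ _ => rfl

instance : FD (zr : Repn k Q) := ⟨fun _ => (inferInstance : FiniteDimensional k PUnit)⟩

/-- Iterated direct sum of a list. -/
def ls : List (Repn k Q) → Repn k Q
  | [] => zr
  | X :: L => X.dsum (ls L)

section G
variable {G : Type*} {m : G → Repn k Q} {h : G → G → ℕ} {f : G → ℕ} {V : G → Prop}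

structure Good (m : G → Repn k Q) (h : G → G → ℕ) (f : G → ℕ) (V : G → Prop) : Prop where
  ind : ∀ g, V g → (m g).Indec
  fd : ∀ g, V g → FD (m g)
  rad : ∀ g, V g → RadF (m g) (f g)
  pos : ∀ g, 0 < f g
  hom : ∀ g g', V g → V g' → homDim (m g) (m g') = h g g'
  inj : ∀ g g', V g → V g' → Isom (m g) (m g') → g = g'

lemma Good.ls_fd (D : Good m h f V) : ∀ (L : List G), (∀ g ∈ L, V g) → FD (ls (L.map m))
  | [], _ => inferInstanceAs (FD (zr : Repn k Q))
  | g :: L, hL => by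
    have := D.fd g (hL g (by simp))
    have := D.ls_fd L fun g hg => hL g (by simp [hg])
    exact inferInstanceAs (FD ((m g).dsum (ls (L.map m))))

lemma homDim_dsum_right (X A B : Repn k Q) [FD X] [FD A] [FD B] :
    homDim X (A.dsum B) = homDim X A + homDim X B := by
  rw [homDim_eq, homDim_eq, homDim_eq, ← Module.finrank_prod]
  exact LinearEquiv.finrank_eq
    { toFun := fun s => ((fst A B).comp s, (snd A B).comp s)
      map_add' := fun s t => by rw [Hm.comp_add, Hm.comp_add]; rfl
      map_smul' := fun c s => rfl
      invFun := fun p => (inl A B).comp p.1 + (inr A B).comp p.2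
      left_inv := fun s => Hm.ext' fun v x => by
        show (((s v x).1 + 0 : A.space v), (0 + (s v x).2 : B.space v)) = _
        exact Prod.ext (add_zero _) (zero_add _)
      right_inv := fun p => by
        refine Prod.ext (Hm.ext' fun v x => ?_) (Hm.ext' fun v x => ?_)
        · show (p.1 v x + 0 : A.space v) = _; simp
        · show (0 + p.2 v x : B.space v) = _; simp }

lemma homDim_dsum_left (X A B : Repn k Q) [FD X] [FD A] [FD B] :
    homDim (A.dsum B) X = homDim A X + homDim B X := by
  rw [homDim_eq, homDim_eq, homDim_eq, ← Module.finrank_prod]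
  exact LinearEquiv.finrank_eq
    { toFun := fun s => (s.comp (inl A B), s.comp (inr A B))
      map_add' := fun s t => by rw [Hm.add_comp, Hm.add_comp]; rfl
      map_smul' := fun c s => rfl
      invFun := fun p => p.1.comp (fst A B) + p.2.comp (snd A B)
      left_inv := fun s => by
        show (s.comp (inl A B)).comp (fst A B) + (s.comp (inr A B)).comp (snd A B) = s
        rw [Hm.comp_assoc, Hm.comp_assoc, ← Hm.comp_add, dsum_id, Hm.comp_id]
      right_inv := fun p => by
        refine Prod.ext (Hm.ext' fun v x => ?_) (Hm.ext' fun v x => ?_)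
        · show (p.1 v x + p.2 v 0 : X.space v) = _; simp
        · show (p.1 v 0 + p.2 v x : X.space v) = _; simp }

lemma Good.hom_right (D : Good m h f V) {x : G} (hx : V x) : ∀ (L : List G), (∀ g ∈ L, V g) →
    homDim (m x) (ls (L.map m)) = (L.map (h x)).sum
  | [], _ => by
    have := D.fd x hx
    exact (homDim_eq_zero (M := m x) (N := zr)).2 fun _ => zr_zero.hom_eq' _
  | g :: L, hL => by
    have := D.fd g (hL g (by simp)); have := D.fd x hx
    have := D.ls_fd L fun g hg => hL g (by simp [hg])
    show homDim (m x) ((m g).dsum (ls (L.map m))) = _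
    rw [homDim_dsum_right, D.hom x g hx (hL g (by simp)), D.hom_right hx L fun g hg => hL g (by simp [hg])]
    simp

lemma Good.hom_left (D : Good m h f V) {x : G} (hx : V x) : ∀ (L : List G), (∀ g ∈ L, V g) →
    homDim (ls (L.map m)) (m x) = (L.map (h · x)).sum
  | [], _ => by
    have := D.fd x hx
    exact (homDim_eq_zero (M := zr) (N := m x)).2 fun _ => zr_zero.hom_eq _
  | g :: L, hL => by
    have := D.fd g (hL g (by simp)); have := D.fd x hx
    have := D.ls_fd L fun g hg => hL g (by simp [hg])
    show homDim ((m g).dsum (ls (L.map m))) (m x) = _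
    rw [homDim_dsum_left, D.hom g x (hL g (by simp)) hx, D.hom_left hx L fun g hg => hL g (by simp [hg])]
    simp

open Classical in
lemma Good.nsm [Finite k] (D : Good m h f V) {x : G} (hx : V x) : ∀ (L : List G), (∀ g ∈ L, V g) →
    Repn.nsm (m x) (ls (L.map m)) * Nat.card k ^ (f x * L.count x) = Nat.card k ^ (L.map (h x)).sum
  | [], _ => by
    have := nsm_zero (D.ind x hx).1 (zr_zero (k := k) (Q := Q))
    simpa [ls] using this
  | g :: L, hL => by
    have hg := hL g (by simp)
    have := D.fd g hg; have := D.fd x hx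
    have ih := D.nsm hx L fun g hg => hL g (by simp [hg])
    show Repn.nsm (m x) ((m g).dsum (ls (L.map m))) * _ = _
    rw [nsm_dsum (D.ind x hx), List.map_cons, List.sum_cons, pow_add, ← ih, ← D.hom x g hx hg]
    by_cases hxg : g = x
    · subst hxg
      rw [← nsm_self (D.ind g hg) (D.rad g hg) (Isom.refl _), List.count_cons_self, mul_add, pow_add]
      ring
    · rw [← nsm_ne (D.ind x hx).1 (D.ind g hg) fun e => hxg (D.inj x g hx hg e).symm,
        List.count_cons_of_ne hxg]
      ring

open Classical in
def apoly (h : G → G → ℕ) (f : G → ℕ) : List G → ℤ[X]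
  | [] => 1
  | g :: L => Polynomial.X ^ (((g :: L).map (h g)).sum - f g * (g :: L).count g) *
      (Polynomial.X ^ (f g * (g :: L).count g) - 1) * Polynomial.X ^ (L.map (h · g)).sum * apoly h f L

lemma apoly_monic (hf : ∀ g, 0 < f g) : ∀ L : List G, (apoly h f L).Monic
  | [] => monic_one
  | g :: L => by
    classical
    refine Monic.mul (Monic.mul (Monic.mul (monic_X_pow _) ?_) (monic_X_pow _)) (apoly_monic hf L)
    have := monic_X_pow_sub_C (1 : ℤ) (n := f g * (g :: L).count g)
      (Nat.mul_ne_zero (hf g).ne' (by simp))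
    simpa using this

lemma apoly_ne (hf : ∀ g, 0 < f g) {q : ℤ} (hq : 2 ≤ q) : ∀ L : List G, (apoly h f L).eval q ≠ 0
  | [] => by simp [apoly]
  | g :: L => by
    classical
    rw [apoly, eval_mul, eval_mul, eval_mul, eval_pow, eval_X, eval_pow, eval_X, eval_sub, eval_pow, eval_X, eval_one]
    have h0 : q ≠ 0 := by omega
    refine mul_ne_zero (mul_ne_zero (mul_ne_zero (pow_ne_zero _ h0) ?_) (pow_ne_zero _ h0)) (apoly_ne hf hq L)
    have : (1 : ℤ) < q ^ (f g * (g :: L).count g) :=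
      one_lt_pow₀ (by omega) (Nat.mul_ne_zero (hf g).ne' (by simp))
    omega

lemma Good.aut [Finite k] (D : Good m h f V) : ∀ (L : List G), (∀ g ∈ L, V g) →
    (autCard (ls (L.map m)) : ℤ) = (apoly h f L).eval (Nat.card k : ℤ)
  | [], _ => by
    show ((autCard (zr : Repn k Q) : ℕ) : ℤ) = _
    have : autCard (zr : Repn k Q) = 1 := Nat.card_eq_one_iff_unique.2
      ⟨⟨fun a b => Iso.ext' fun v x => zr_zero v _⟩, ⟨Iso.refl _⟩⟩
    rw [this]; simp [apoly]
  | g :: L, hL => by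
    classical
    have hg := hL g (by simp)
    have hL' : ∀ g ∈ L, V g := fun g hg => hL g (by simp [hg])
    have := D.fd g hg; have := D.ls_fd L hL'
    have h1 : autCard (ls ((g :: L).map m)) = _ := aut_dsum (M := ls (L.map m)) (D.ind g hg)
    have h2 : homDim (m g) ((m g).dsum (ls (L.map m))) = _ := D.hom_right hg (g :: L) hL
    have h3 : Repn.nsm (m g) ((m g).dsum (ls (L.map m))) * _ = _ := D.nsm hg (g :: L) hL
    rw [h1, h2, D.hom_left hg L hL', Nat.cast_mul, Nat.cast_mul, D.aut L hL', apoly]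
    simp only [eval_mul, eval_pow, eval_X, eval_sub, eval_one]
    set c := f g * (g :: L).count g
    set s := ((g :: L).map (h g)).sum
    have hk : 1 < Nat.card k := Finite.one_lt_card
    have hcs : c ≤ s := by
      rw [← Nat.pow_le_pow_iff_right hk, ← h3]
      refine Nat.le_mul_of_pos_left _ (Nat.pos_of_ne_zero fun h0 => ?_)
      rw [h0, zero_mul] at h3
      exact pow_ne_zero _ (by omega) h3.symm
    have h4 : Repn.nsm (m g) ((m g).dsum (ls (L.map m))) = Nat.card k ^ (s - c) :=
      Nat.eq_of_mul_eq_mul_right (Nat.pos_of_ne_zero (pow_ne_zero c (by omega : Nat.card k ≠ 0)))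
        (h3.trans (by rw [← pow_add, Nat.sub_add_cancel hcs]))
    have h5 : Nat.card k ^ s = Nat.card k ^ (s - c) * Nat.card k ^ c := by
      rw [← pow_add, Nat.sub_add_cancel hcs]
    have h6 : Nat.card k ^ (s - c) ≤ Nat.card k ^ s := Nat.pow_le_pow_right (by omega) (by omega)
    rw [h4, Nat.cast_sub h6, h5]
    push_cast
    ring

/-- Krull–Schmidt uniqueness. -/
lemma Good.ks [Finite k] (D : Good m h f V) {L L' : List G} (hL : ∀ g ∈ L, V g) (hL' : ∀ g ∈ L', V g)
    (e : Isom (ls (L.map m)) (ls (L'.map m))) : L.Perm L' := by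
  classical
  rw [List.perm_iff_count]
  have key : ∀ x, V x → L.count x = L'.count x := fun x hx => by
    have := D.fd x hx; have := D.ls_fd L hL; have := D.ls_fd L' hL'
    have h1 := D.nsm hx L hL
    have h2 := D.nsm hx L' hL'
    rw [← D.hom_right hx L hL, e.nsm, e.homDim_right] at h1
    rw [← D.hom_right hx L' hL', ← h1] at h2
    have hk : 1 < Nat.card k := Finite.one_lt_card
    have h0 : Repn.nsm (m x) (ls (L'.map m)) ≠ 0 := fun h0 => by
      rw [D.hom_right hx L' hL', ← D.nsm hx L' hL', h0] at h1
      have h3 := D.nsm hx L' hL'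
      rw [h0, zero_mul] at h3
      exact pow_ne_zero _ (by omega) h3.symm
    have h3 := Nat.pow_right_injective hk (Nat.eq_of_mul_eq_mul_left (Nat.pos_of_ne_zero h0) h2)
    exact (Nat.eq_of_mul_eq_mul_left (D.pos x) h3).symm
  intro x
  by_cases hx : V x
  · exact key x hx
  · rw [List.count_eq_zero_of_not_mem fun h => hx (hL x h), List.count_eq_zero_of_not_mem fun h => hx (hL' x h)]

end G

abbrev Lab (Q : QuiverData) := (Q.V → ℕ) × ℕ
lemma psub (c : ℕ+) : (c : ℕ) - 1 + 1 = c := Nat.sub_add_cancel c.2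

/-- The homogeneous tubes. -/
def HT (k : Type) [Field k] {Q : QuiverData} (δ : Q.V → ℕ) : Type 1 :=
  Quot (fun a b : {S : Repn k Q // FD S ∧ Stab δ S ∧ Hg S} => Isom a.1 b.1)

def hrep (x : HT k δ) : Repn k Q := (Quot.out x).1
instance hrep_fd (x : HT k δ) : FD (hrep x) := (Quot.out x).2.1
lemma hrep_stab (x : HT k δ) : Stab δ (hrep x) := (Quot.out x).2.2.1
lemma hrep_hg (x : HT k δ) : Hg (hrep x) := (Quot.out x).2.2.2
lemma ht_ext {x y : HT k δ} (h : Isom (hrep x) (hrep y)) : x = y := by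
  rw [← Quot.out_eq x, ← Quot.out_eq y]; exact Quot.sound h

lemma isom_equiv {α : Type*} (F : α → Repn k Q) : Equivalence fun a b : α => Isom (F a) (F b) :=
  ⟨fun a => Isom.refl _, fun h => h.symm, fun h h' => h.trans h'⟩

lemma ht_exists [FD S] (hS : Stab δ S) (hg : Hg S) : ∃ x : HT k δ, Isom S (hrep x) := by
  let a : {S : Repn k Q // FD S ∧ Stab δ S ∧ Hg S} := ⟨S, inferInstance, hS, hg⟩
  refine ⟨Quot.mk _ a, ?_⟩
  have h := Quot.eqvGen_exact (Quot.out_eq (Quot.mk (fun a b : {S : Repn k Q // FD S ∧ Stab δ S ∧ Hg S} => Isom a.1 b.1) a))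
  rw [(isom_equiv fun a : {S : Repn k Q // FD S ∧ Stab δ S ∧ Hg S} => a.1).eqvGen_iff] at h
  exact h.symm

def hdeg (x : HT k δ) : ℕ+ := Classical.epsilon fun e : ℕ+ => ∀ v, dimv (hrep x) v = (e : ℕ) * δ v
lemma hdeg_spec (H : Aff Q δ) (x : HT k δ) : ∀ v, dimv (hrep x) v = (hdeg x : ℕ) * δ v := by
  obtain ⟨e, h0, he⟩ := (hrep_stab x).dim_hg H (hrep_hg x)
  refine Classical.epsilon_spec (p := fun e : ℕ+ => ∀ v, dimv (hrep x) v = (e : ℕ) * δ v) ⟨⟨e, h0⟩, fun v => ?_⟩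
  have := congrFun he v
  simp only [natc, Pi.smul_apply, smul_eq_mul] at this
  exact_mod_cast this

lemma hdeg_eq (H : Aff Q δ) (x : HT k δ) {e : ℕ+} (h : dimv (hrep x) = fun v => (e : ℕ) * δ v) : hdeg x = e := by
  obtain ⟨v, hv⟩ := Function.ne_iff.1 H.min.1
  have := hdeg_spec H x v
  rw [h] at this
  exact PNat.eq (Nat.eq_of_mul_eq_mul_right (Nat.pos_of_ne_zero hv) this.symm)

instance : Nonempty (Repn k Q) := ⟨zr⟩

/-- The indecomposable with a given index. -/
def pm : Lab Q ⊕ (HT k δ × ℕ+) → Repn k Q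
  | .inl p => Classical.epsilon fun X => Rz δ X p
  | .inr y => Classical.epsilon fun X => ∃ i, Col δ (y.2 - 1 : ℕ) (hrep y.1) X i

def vld (k : Type) [Field k] (δ : Q.V → ℕ) (p : Lab Q) : Prop := ∃ X : Repn k Q, Rz δ X p
def vP : Lab Q ⊕ (HT k δ × ℕ+) → Prop
  | .inl p => vld k δ p
  | .inr _ => True

lemma pm_inl {p : Lab Q} (h : vld k δ p) : Rz δ (pm (.inl p : Lab Q ⊕ (HT k δ × ℕ+))) p :=
  Classical.epsilon_spec h

lemma pm_inr (H : Aff Q δ) (x : HT k δ) (c : ℕ+) : ∃ i, Col δ (c - 1 : ℕ) (hrep x) (pm (.inr (x, c))) i :=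
  Classical.epsilon_spec (p := fun X => ∃ i, Col δ (c - 1 : ℕ) (hrep x) X i) (exists_col H _ (hrep_stab x))

open Classical in
def hP (δ : Q.V → ℕ) {T : Type*} (dg : T → ℕ+) : Lab Q ⊕ (T × ℕ+) → Lab Q ⊕ (T × ℕ+) → ℕ
  | .inl p, .inl p' => hnum δ p p'
  | .inl p, .inr y => (-defectOf Q δ (natc p.1) * ((y.2 : ℕ) * (dg y.1 : ℕ) : ℕ)).toNat
  | .inr y, .inl p => (defectOf Q δ (natc p.1) * ((y.2 : ℕ) * (dg y.1 : ℕ) : ℕ)).toNat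
  | .inr y, .inr z => if y.1 = z.1 then (dg y.1 : ℕ) * min (y.2 : ℕ) z.2 else 0

def fP {T : Type*} (dg : T → ℕ+) : Lab Q ⊕ (T × ℕ+) → ℕ
  | .inl _ => 1
  | .inr y => dg y.1

lemma pm_inr_dz (H : Aff Q δ) (x : HT k δ) (c : ℕ+) :
    dz (pm (.inr (x, c))) = (((c : ℕ) * (hdeg x : ℕ) : ℕ) : ℤ) • natc δ := by
  obtain ⟨i, h⟩ := pm_inr H x c
  rw [h.dz_hg H (hrep_hg x), psub c]
  funext v
  have := hdeg_spec H x v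
  simp only [natc, Pi.smul_apply, smul_eq_mul, this]
  push_cast; ring

lemma good (H : Aff Q δ) : Good (pm (k := k) (δ := δ)) (hP δ hdeg) (fP hdeg) vP where
  ind
    | .inl p, h => (pm_inl h).1
    | .inr (x, c), _ => by obtain ⟨i, h⟩ := pm_inr H x c; exact h.ri.ind
  fd
    | .inl p, h => rz_fd (pm_inl h)
    | .inr (x, c), _ => by obtain ⟨i, h⟩ := pm_inr H x c; exact h.fdX
  rad
    | .inl p, h => rz_radF H (pm_inl h)
    | .inr (x, c), _ => by
      obtain ⟨i, h⟩ := pm_inr H x c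
      have := h.radF H
      rwa [(hrep_stab x).end_eq H (hdeg x).2 (hdeg_spec H x)] at this
  pos
    | .inl p => one_pos
    | .inr (x, c) => (hdeg x).2
  hom
    | .inl p, .inl p', h, h' => hnum_eq H (pm_inl h) (pm_inl h')
    | .inl p, .inr (x, c), h, _ => by
      obtain ⟨i, hc⟩ := pm_inr H x c
      have hp := pm_inl (δ := δ) h
      have := rz_fd hp; have := hc.fdX
      have hd := rz_df H hp
      have hy : defectOf Q δ (dz (pm (.inr (x, c)))) = 0 := hc.ri.reg.1
      have he : eulerZ Q (dz (pm (.inl p : Lab Q ⊕ (HT k δ × ℕ+)))) (dz (pm (.inr (x, c)))) =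
          -defectOf Q δ (natc p.1) * ((c : ℕ) * (hdeg x : ℕ) : ℕ) := by
        rw [pm_inr_dz H, eulerZ_smul_right, H.rad, ← hd, defectOf]; ring
      rcases lt_trichotomy (defectOf Q δ (natc p.1)) 0 with h0 | h0 | h0
      · rw [preproj_hom H hp.1 hc.ri.ind (by rw [hd]; exact h0), he]; rfl
      · have e : hP δ hdeg (.inl p) (.inr (x, c)) = 0 := by
          show (-defectOf Q δ (natc p.1) * _).toNat = 0
          rw [h0]; simp
        rw [e]; by_contra hne
        obtain ⟨n, T, j, hT, hg, -, -⟩ := (rz_reg H h0).1 hp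
        exact hg ((hT.hom_hg H hc (Or.inr (hrep_hg x)) hne).symm.hg (hrep_hg x))
      · rw [hom_from_preinj H hc.ri.ind hp.1 hy.le (by rw [hd]; exact h0)]
        exact (Int.toNat_of_nonpos (mul_nonpos_of_nonpos_of_nonneg (by omega) (by omega))).symm
    | .inr (x, c), .inl p, _, h => by
      obtain ⟨i, hc⟩ := pm_inr H x c
      have hp := pm_inl (δ := δ) h
      have := rz_fd hp; have := hc.fdX
      have hd := rz_df H hp
      have hy : defectOf Q δ (dz (pm (.inr (x, c)))) = 0 := hc.ri.reg.1
      have he : eulerZ Q (dz (pm (.inr (x, c)))) (dz (pm (.inl p : Lab Q ⊕ (HT k δ × ℕ+)))) =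
          defectOf Q δ (natc p.1) * ((c : ℕ) * (hdeg x : ℕ) : ℕ) := by
        rw [pm_inr_dz H, eulerZ_smul_left, ← hd, defectOf]; ring
      rcases lt_trichotomy (defectOf Q δ (natc p.1)) 0 with h0 | h0 | h0
      · rw [hom_to_preproj H hp.1 hc.ri.ind (by rw [hd]; exact h0) hy.ge]
        exact (Int.toNat_of_nonpos (mul_nonpos_of_nonpos_of_nonneg (by omega) (by omega))).symm
      · have e : hP δ hdeg (.inr (x, c)) (.inl p) = 0 := by
          show (defectOf Q δ (natc p.1) * _).toNat = 0
          rw [h0]; simp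
        rw [e]; by_contra hne
        obtain ⟨n, T, j, hT, hg, -, -⟩ := (rz_reg H h0).1 hp
        exact hg ((hc.hom_hg H hT (Or.inl (hrep_hg x)) hne).hg (hrep_hg x))
      · rw [preinj_hom H hc.ri.ind hp.1 (by rw [hd]; exact h0), he]; rfl
    | .inr (x, c), .inr (y, c'), _, _ => by
      obtain ⟨i, hc⟩ := pm_inr H x c
      obtain ⟨j, hc'⟩ := pm_inr H y c'
      simp only [hP]
      split_ifs with h
      · subst h
        rw [hc.hom_min H hc' (hrep_hg x) (Isom.refl _), (hrep_stab x).end_eq H (hdeg x).2 (hdeg_spec H x),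
          psub c, psub c']; rfl
      · by_contra hne
        exact h (ht_ext (hc.hom_hg H hc' (Or.inl (hrep_hg x)) hne))
  inj
    | .inl p, .inl p', h, h', e => by rw [rz_inj H (pm_inl h) (pm_inl h') e]
    | .inl p, .inr (x, c), h, _, e => by
      obtain ⟨i, hc⟩ := pm_inr H x c
      exact absurd (((Isom.col e.symm.some hc).homog_iff H).2 (hrep_hg x)) (pm_inl h).2.2.1
    | .inr (x, c), .inl p, _, h, e => by
      obtain ⟨i, hc⟩ := pm_inr H x c
      exact absurd (((Isom.col e.some hc).homog_iff H).2 (hrep_hg x)) (pm_inl h).2.2.1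
    | .inr (x, c), .inr (y, c'), _, _, e => by
      obtain ⟨i, hc⟩ := pm_inr H x c
      obtain ⟨j, hc'⟩ := pm_inr H y c'
      have hc := Isom.col e.some hc
      have h1 : x = y := ht_ext (Soc.unique ⟨_, _, hc⟩ ⟨_, _, hc'⟩)
      have h2 := (hc.filt H).1 ((hc'.filt H).2 rfl)
      rw [psub c, psub c'] at h2
      rw [h1, PNat.eq h2]

lemma hP_map {T T' : Type*} (dg : T → ℕ+) (dg' : T' → ℕ+) {x : T' → T} (hx : Function.Injective x)
    (hd : ∀ j, dg (x j) = dg' j) (a b : Lab Q ⊕ (T' × ℕ+)) :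
    hP δ dg (Sum.map id (Prod.map x id) a) (Sum.map id (Prod.map x id) b) = hP δ dg' a b := by
  classical
  rcases a with p | ⟨y, c⟩ <;> rcases b with p' | ⟨z, c'⟩ <;> simp [hP, hd, hx.eq_iff]

lemma fP_map {T T' : Type*} (dg : T → ℕ+) (dg' : T' → ℕ+) {x : T' → T}
    (hd : ∀ j, dg (x j) = dg' j) (a : Lab Q ⊕ (T' × ℕ+)) :
    fP dg (Sum.map id (Prod.map x id) a) = fP dg' a := by
  rcases a with p | ⟨y, c⟩ <;> simp [fP, hd]

lemma apoly_map {G G' : Type*} {h : G → G → ℕ} {f : G → ℕ} {h' : G' → G' → ℕ} {f' : G' → ℕ} {φ : G' → G}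
    (hφ : Function.Injective φ) (hh : ∀ a b, h (φ a) (φ b) = h' a b) (hf : ∀ a, f (φ a) = f' a) :
    ∀ L : List G', apoly h f (L.map φ) = apoly h' f' L
  | [] => rfl
  | g :: L => by
    classical
    have hc : (φ g :: L.map φ).count (φ g) = (g :: L).count g := by
      rw [← List.map_cons, List.count_map_of_injective _ _ hφ]
    rw [List.map_cons, apoly, apoly, apoly_map hφ hh hf L]
    simp only [hc, hf, List.map_cons, List.map_map, hh, Function.comp_def]

/-- `M` is a direct sum over the multiset `s` of indecomposables. -/
def MS {G : Type*} (m : G → Repn k Q) (s : Multiset G) (M : Repn k Q) : Prop :=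
  ∃ L : List G, (L : Multiset G) = s ∧ Isom M (ls (L.map m))

section
variable {G : Type*} {m : G → Repn k Q}

lemma ls_perm {L L' : List (Repn k Q)} (h : L.Perm L') : Isom (ls L) (ls L') := by
  induction h with
  | nil => exact Isom.refl _
  | cons x _ ih => exact dsum_congr (Isom.refl x) ih
  | swap x y l => exact (dsum_assoc y x (ls l)).symm.trans ((dsum_congr (dsum_comm y x) (Isom.refl _)).trans
      (dsum_assoc x y (ls l)))
  | trans _ _ h1 h2 => exact h1.trans h2

lemma ls_append : ∀ L L' : List (Repn k Q), Isom ((ls L).dsum (ls L')) (ls (L ++ L'))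
  | [], L' => zero_dsum zr_zero
  | x :: L, L' => (dsum_assoc x (ls L) (ls L')).trans (dsum_congr (Isom.refl x) (ls_append L L'))

lemma MS.isom {s : Multiset G} (h : MS m s M) {L : List G} (hL : (L : Multiset G) = s) :
    Isom M (ls (L.map m)) := by
  obtain ⟨L', hL', e⟩ := h
  exact e.trans (ls_perm ((Multiset.coe_eq_coe.1 (hL'.trans hL.symm)).map m))

lemma MS.unique {s : Multiset G} (h : MS m s M) (h' : MS m s N) : Isom M N := by
  obtain ⟨L, hL, e⟩ := h'
  exact (h.isom hL).trans e.symm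

lemma MS.congr {s : Multiset G} (h : MS m s M) (e : Isom N M) : MS m s N := by
  obtain ⟨L, hL, e'⟩ := h
  exact ⟨L, hL, e.trans e'⟩

lemma MS.zero (h : M.IsZero) : MS m 0 M := ⟨[], rfl, h.isom zr_zero⟩
lemma MS.single {g : G} (h : Isom M (m g)) : MS m {g} M :=
  ⟨[g], rfl, h.trans (dsum_zero zr_zero).symm⟩

lemma MS.add {s t : Multiset G} (h : MS m s M) (h' : MS m t N) : MS m (s + t) (M.dsum N) := by
  obtain ⟨L, hL, e⟩ := h
  obtain ⟨L', hL', e'⟩ := h'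
  refine ⟨L ++ L', by rw [← hL, ← hL']; rfl, ?_⟩
  rw [List.map_append]
  exact (dsum_congr e e').trans (ls_append _ _)

lemma MS.fam {ι : Type} [Fintype ι] {s : ι → Multiset G} {X : ι → Repn k Q} (h : ∀ i, MS m (s i) (X i)) :
    MS m (∑ i, s i) (dsumFam X) := by
  revert s X
  refine Fintype.induction_empty_option (P := fun ι _ => ∀ {s : ι → Multiset G} {X : ι → Repn k Q},
    (∀ i, MS m (s i) (X i)) → MS m (∑ i, s i) (dsumFam X)) ?_ ?_ ?_ ι
  · intro α β _ e ih s X h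
    letI := Fintype.ofEquiv β e.symm
    rw [← e.sum_comp]
    exact (ih fun i => h (e i)).congr (dsumFam_equiv X e).symm
  · intro s X _
    exact MS.zero (dsumFam_empty X)
  · intro α _ ih s X h
    rw [Fintype.sum_option]
    exact ((h none).add (ih fun i => h (some i))).congr (dsumFam_option X)

lemma ms_exists (m : G → Repn k Q) (s : Multiset G) : ∃ M, MS m s M :=
  ⟨_, s.toList, Multiset.coe_toList s, Isom.refl _⟩

end

lemma pm_ms (H : Aff Q δ) (M : Repn k Q) [FD M] :
    ∃ s, (∀ g ∈ s, vP g) ∧ MS (pm (k := k) (δ := δ)) s M := by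
  obtain ⟨n, X, hX, e⟩ := exists_decomp M
  have : ∀ i, ∃ g : Lab Q ⊕ (HT k δ × ℕ+), vP g ∧ Isom (X i) (pm g) := fun i => by
    have := (hX i).2
    by_cases h : InHomogTube δ (X i)
    · obtain ⟨n, T, j, hc⟩ := ((regIndec_iff H).1 h.1).col H
      have := hc.fdT
      have hg := (hc.homog_iff H).1 h
      obtain ⟨x, hx⟩ := ht_exists hc.stab hg
      obtain ⟨j', hc'⟩ := pm_inr H x ⟨n + 1, n.succ_pos⟩
      exact ⟨.inr (x, ⟨n + 1, n.succ_pos⟩), trivial, hc.unique H hc' hx⟩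
    · obtain ⟨p, hp⟩ := rz_exists H (hX i).1 h
      exact ⟨.inl p, ⟨_, hp⟩, rz_isom H hp (pm_inl ⟨_, hp⟩)⟩
  choose g hg hi using this
  refine ⟨∑ i, {g i}, fun x hx => ?_, (MS.fam fun i => MS.single (hi i)).congr e⟩
  obtain ⟨i, -, hi⟩ := Multiset.mem_sum.1 hx
  rw [Multiset.mem_singleton.1 hi]; exact hg i

lemma pm_soc (H : Aff Q δ) (x : HT k δ) (c : ℕ+) : Soc δ (pm (.inr (x, c))) (hrep x) := ⟨_, pm_inr H x c⟩
lemma MS.summand {G : Type*} {m : G → Repn k Q} {s : Multiset G} (h : MS m s M) {g : G}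
    (hg : g ∈ s) : SummandOf (m g) M := by
  obtain ⟨t, rfl⟩ := Multiset.exists_cons_of_mem hg
  exact ⟨_, h.isom (L := g :: t.toList) (by rw [← Multiset.cons_coe, Multiset.coe_toList])⟩

lemma soc_ls (H : Aff Q δ) {x : HT k δ} {X : Repn k Q} (hX : RI δ X) : ∀ L : List (Repn k Q),
    (∀ Y ∈ L, Soc δ Y (hrep x)) → FD (ls L) ∧ (homDim X (ls L) ≠ 0 → Soc δ X (hrep x))
  | [], _ => by
    have := hX.fd
    refine ⟨inferInstanceAs (FD (zr : Repn k Q)), fun h => ?_⟩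
    have : FD (ls [] : Repn k Q) := inferInstanceAs (FD (zr : Repn k Q))
    obtain ⟨f, hf⟩ := homDim_ne_zero.1 h
    exact absurd (IsZero.hom_eq' zr_zero f) hf
  | Y :: L, hL => by
    obtain ⟨h1, h2⟩ := soc_ls H hX L fun Y hY => hL Y (by simp [hY])
    have hY := hL Y (by simp)
    have : FD Y := by obtain ⟨n, i, h⟩ := hY; exact h.fdX
    have := hX.fd
    refine ⟨inferInstanceAs (FD (Y.dsum (ls L))), fun h => ?_⟩
    change homDim X (Y.dsum (ls L)) ≠ 0 at h
    rw [homDim_dsum_right] at h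
    by_cases h0 : homDim X Y = 0
    · exact h2 (by omega)
    · obtain ⟨T, hT⟩ := hX.soc H
      exact hT.congr (hT.hom_isom H hY (Or.inr (hrep_hg x)) h0).symm

lemma soc_summand (H : Aff Q δ) {x : HT k δ} {s : Multiset ℕ+}
    (hR : MS pm (s.map fun c => .inr (x, c)) R) (hX : IsRegIndec δ X) (h : SummandOf X R) :
    Soc δ X (hrep x) := by
  rw [regIndec_iff H] at hX
  have e : Isom R (ls ((s.toList.map fun c => Sum.inr (x, c)).map (pm (k := k) (δ := δ)))) :=
    hR.isom (by rw [← Multiset.map_coe, Multiset.coe_toList])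
  obtain ⟨Z, ⟨e'⟩⟩ := h
  obtain ⟨h1, h2⟩ := soc_ls H (x := x) hX ((s.toList.map fun c => Sum.inr (x, c)).map (pm (k := k) (δ := δ)))
    (by simp only [List.map_map, List.mem_map]; rintro _ ⟨c, -, rfl⟩; exact pm_soc H x c)
  refine h2 ?_
  have := hX.fd
  have ei : Isom (X.dsum Z) _ := (Isom.symm ⟨e'⟩).trans e
  refine homDim_ne_zero.2 ⟨ei.some.hom.comp (inl X Z), fun h0 => hX.ind.1 fun v y => ?_⟩
  have := congrArg (fun f : Hm _ _ => f v y) h0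
  have h3 : ei.some.e v (y, 0) = ei.some.e v 0 := this.trans (map_zero _).symm
  exact congrArg Prod.fst ((ei.some.e v).injective h3)

lemma tube_disj (H : Aff Q δ) {x y : HT k δ} {s t : Multiset ℕ+}
    (hR : MS pm (s.map fun c => .inr (x, c)) R) (hR' : MS pm (t.map fun c => .inr (y, c)) R') (h : x ≠ y) :
    TubeDisjoint δ R R' := fun X Y sX sY rX rY hXY => by
  have h1 := soc_summand H hR rX sX
  have h2 := soc_summand H hR' rY sY
  exact h (ht_ext (Soc.unique ((SameTube.soc H hXY (hrep_hg x)).1 h1) h2))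

lemma tube_ne (H : Aff Q δ) {x y : HT k δ} {s t : Multiset ℕ+}
    (hR : MS pm (s.map fun c => .inr (x, c)) R) (hR' : MS pm (t.map fun c => .inr (y, c)) R') (hs : s ≠ 0)
    (ht : t ≠ 0) (h : TubeDisjoint δ R R') : x ≠ y := by
  rintro rfl
  obtain ⟨c, hc⟩ := Multiset.exists_mem_of_ne_zero hs
  obtain ⟨d, hd⟩ := Multiset.exists_mem_of_ne_zero ht
  have hX := pm_soc H x c
  have hY := pm_soc H x d
  refine h _ _ (hR.summand (Multiset.mem_map_of_mem _ hc)) (hR'.summand (Multiset.mem_map_of_mem _ hd))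
    ((regIndec_iff H).2 ?_) ((regIndec_iff H).2 ?_) (sameTube_of_soc H hX hY)
  · obtain ⟨_, _, h⟩ := hX; exact h.ri
  · obtain ⟨_, _, h⟩ := hY; exact h.ri

lemma zero_disj (h : R.IsZero ∨ R'.IsZero) : TubeDisjoint δ R R' :=
    fun X Y sX sY rX rY _ => by
  obtain ⟨Z, ⟨e⟩⟩ := sX
  obtain ⟨Z', ⟨e'⟩⟩ := sY
  rcases h with h | h
  · exact rX.1.1 fun v x => congrArg Prod.fst ((e.e v).symm.injective ((h v _).trans (h v _).symm) : (x, (0 : Z.space v)) = (0, 0))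
  · exact rY.1.1 fun v x => congrArg Prod.fst ((e'.e v).symm.injective ((h v _).trans (h v _).symm) : (x, (0 : Z'.space v)) = (0, 0))

lemma fin_map {α : Type*} (s : Multiset α) : ((Finset.univ : Finset (Fin s.toList.length)).val.map fun i => s.toList.get i) = s := by
  have : (Finset.univ : Finset (Fin s.toList.length)).val = (List.finRange s.toList.length : Multiset _) := rfl
  rw [this, Multiset.map_coe]
  have h : (List.finRange s.toList.length).map (fun i => s.toList.get i) = s.toList := by
    rw [← List.ofFn_eq_map, List.ofFn_get]
  rw [h, Multiset.coe_toList]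

lemma sum_single {ι α β : Type*} [Fintype ι] (l : ι → α) (F : α → β) :
    (Multiset.map l (Finset.univ : Finset ι).val).map F = ∑ i, ({F (l i)} : Multiset β) := by
  rw [← Multiset.sum_map_singleton (Multiset.map F _), Multiset.map_map, Multiset.map_map]; rfl

lemma rhp_iff (H : Aff Q δ) {p : Multiset ℕ+ × ℕ+} : RealizesHomogPair δ R p ↔
    (p.1 = 0 ∧ R.IsZero) ∨ (p.1 ≠ 0 ∧ ∃ x : HT k δ, hdeg x = p.2 ∧ MS pm (p.1.map fun c => .inr (x, c)) R) := by
  constructor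
  · rintro ⟨ι, hι, X, len, hX, hT, hl, ⟨e⟩⟩
    change Multiset.map len (Finset.univ : Finset ι).val = p.1 at hl
    rcases isEmpty_or_nonempty ι with hE | ⟨⟨i₀⟩⟩
    · refine Or.inl ⟨?_, fun v x => (e.e v).injective ((dsumFam_empty X v _).trans (dsumFam_empty X v _).symm)⟩
      rw [← hl, Finset.univ_eq_empty]; rfl
    · refine Or.inr ⟨?_, ?_⟩
      · rw [← hl]; intro h
        have : len i₀ ∈ Multiset.map len (Finset.univ : Finset ι).val := Multiset.mem_map_of_mem _ (Finset.mem_univ i₀)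
        rw [h] at this; simp at this
      obtain ⟨n, T, j, hc⟩ := ((regIndec_iff H).1 (hX i₀).1.1).col H
      have := hc.fdT
      have hg := (hc.homog_iff H).1 (hX i₀).1
      obtain ⟨x, hx⟩ := ht_exists hc.stab hg
      have hs : ∀ i, Soc δ (X i) (hrep x) := fun i =>
        (SameTube.soc H (hT i₀ i) (hrep_hg x)).1 (Soc.congr ⟨_, _, hc⟩ hx.symm)
      refine ⟨x, ?_, ?_⟩
      · obtain ⟨_, _, h⟩ := hs i₀
        exact hdeg_eq H x ((h.socdim H).1 (hX i₀).2.1)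
      · have : ∀ i, MS (pm (k := k) (δ := δ)) {Sum.inr (x, len i)} (X i) := fun i => by
          obtain ⟨n, j, h⟩ := hs i
          obtain ⟨j', h'⟩ := pm_inr H x (len i)
          have hn := (h.filt H).1 (hX i).2.2
          rw [hn, Nat.add_sub_cancel] at h'
          exact MS.single (h.unique H h' (Isom.refl _))
        have := (MS.fam this).congr ⟨e⟩
        rwa [← hl, sum_single]
  · rintro (⟨h, h0⟩ | ⟨h, x, hx, hR⟩)
    · exact ⟨Empty, inferInstance, fun e => e.elim, fun e => e.elim, fun e => e.elim, fun e => e.elim, h.symm,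
        h0.isom (dsumFam_empty _)⟩
    · have hh := fin_map p.1
      refine ⟨Fin p.1.toList.length, inferInstance, fun i => pm (.inr (x, p.1.toList.get i)), fun i => p.1.toList.get i,
        fun i => ?_, fun i j => sameTube_of_soc H (pm_soc H x _) (pm_soc H x _), hh, ?_⟩
      · obtain ⟨j, h⟩ := pm_inr H x (p.1.toList.get i)
        refine ⟨(h.homog_iff H).2 (hrep_hg x), (h.socdim H).2 ?_, (h.filt H).2 (psub _).symm⟩
        funext v; rw [hdeg_spec H, hx]
      · refine MS.unique hR (?_ : MS pm _ _)
        have := MS.fam fun i : Fin p.1.toList.length => MS.single (Isom.refl (pm (k := k) (δ := δ) (.inr (x, p.1.toList.get i))))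
        convert this using 1
        conv_lhs => rw [← hh]
        exact sum_single _ _

open Classical in
lemma fib_card {I A : Type*} [Fintype I] (f : I → A) (c : A) :
    Nat.card {i // f i = c} = Multiset.card ((Multiset.map f (Finset.univ : Finset I).val).filter fun a => a = c) := by
  rw [Nat.card_eq_fintype_card, Fintype.card_subtype, Multiset.filter_map, Multiset.card_map]; rfl

lemma enum {I J A : Type*} [Fintype I] [Fintype J] (f : I → A) (g : J → A)
    (h : Multiset.map f (Finset.univ : Finset I).val = Multiset.map g (Finset.univ : Finset J).val) :
    ∃ e : I ≃ J, ∀ i, g (e i) = f i := by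
  classical
  refine ⟨Equiv.ofFiberEquiv fun c => (Finite.card_eq.1 ?_).some, fun i => Equiv.ofFiberEquiv_map _ i⟩
  rw [fib_card, fib_card, h]

abbrev SS := Multiset (Multiset ℕ+ × ℕ+)

/-- Drop the empty partitions of a Segre symbol. -/
def strip (σ : SS) : SS := σ.filter fun p => p.1 ≠ 0
def sl (σ : SS) (j : Fin σ.toList.length) : Multiset ℕ+ × ℕ+ := σ.toList.get j

lemma sl_map (σ : SS) : Multiset.map (sl σ) (Finset.univ : Finset (Fin σ.toList.length)).val = σ := fin_map σ
lemma sl_mem {σ : SS} (j : Fin σ.toList.length) : sl σ j ∈ σ :=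
  Multiset.mem_toList.1 (List.get_mem _ _)

/-- The multiset of indecomposables attached to a placement `x` of a Segre symbol. -/
def Sx {T : Type*} (μ : Multiset (Lab Q)) (σ : SS) (x : Fin σ.toList.length → T) : Multiset (Lab Q ⊕ (T × ℕ+)) :=
  μ.map .inl + ∑ j, (sl σ j).1.map fun c => .inr (x j, c)

/-- admissible placements -/
def Pl {T : Type*} (dg : T → ℕ+) (σ : SS) (x : Fin σ.toList.length → T) : Prop :=
  Function.Injective x ∧ ∀ j, dg (x j) = (sl σ j).2

lemma strip_enum {κ : Type} [Fintype κ] {p : κ → Multiset ℕ+ × ℕ+} {σ : SS}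
    (h : Multiset.map p (Finset.univ : Finset κ).val = σ) :
    ∃ e : Fin (strip σ).toList.length ≃ {j : κ // (p j).1 ≠ 0}, ∀ i, p (e i) = sl (strip σ) i := by
  classical
  refine enum (sl (strip σ)) (fun j : {j : κ // (p j).1 ≠ 0} => p j) ?_
  rw [sl_map, ← h, strip, Multiset.filter_map]
  have := Finset.univ_val_map_subtype_restrict p (fun j => (p j).1 ≠ 0)
  rw [Subtype.restrict_def] at this
  exact this.symm

lemma sum_strip {κ ι M : Type*} [Fintype κ] [Fintype ι] [AddCommMonoid M] {P : κ → Prop} [DecidablePred P] (f : ι ≃ {j // P j})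
    (G : {j // P j} → M) : ∑ j, (if h : P j then G ⟨j, h⟩ else 0) = ∑ i, G (f i) := by
  rw [f.sum_comp G, ← Finset.sum_filter_of_ne (p := P), Finset.sum_subtype (p := P) _ (by simp)]
  · exact Finset.sum_congr rfl fun a _ => dif_pos a.2
  · intro j _ h; by_contra h'; exact h (dif_neg h')

lemma class_mp (H : Aff Q δ) {α : DSymb Q} (h : InDecompClass δ α M) :
    (∀ p ∈ α.1, vld k δ p) ∧ ∃ x : Fin (strip α.2).toList.length → HT k δ, Pl hdeg (strip α.2) x ∧
      MS pm (Sx α.1 (strip α.2) x) M := by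
  classical
  obtain ⟨D, R, e, ⟨ι, hι, X, tag, hX, ht, eD⟩, ⟨κ, hκ, Y, p, hY, hd, hp, eR⟩⟩ := h
  change Multiset.map tag (Finset.univ : Finset ι).val = α.1 at ht
  change Multiset.map p (Finset.univ : Finset κ).val = α.2 at hp
  refine ⟨fun q hq => ?_, ?_⟩
  · rw [← ht] at hq
    obtain ⟨i, -, rfl⟩ := Multiset.mem_map.1 hq
    exact ⟨_, hX i⟩
  obtain ⟨f, hf⟩ := strip_enum hp
  have h1 : ∀ j : {j : κ // (p j).1 ≠ 0}, ∃ x : HT k δ, hdeg x = (p j).2 ∧ MS pm ((p j).1.map fun c => .inr (x, c)) (Y j) :=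
    fun j => (((rhp_iff H).1 (hY j)).resolve_left fun h => j.2 h.1).2
  choose y hy hm using h1
  refine ⟨fun i => y (f i), ⟨fun i j hij => ?_, fun i => by rw [hy, hf]⟩, ?_⟩
  · by_contra hne
    have h2 : ((f i : {j : κ // (p j).1 ≠ 0}) : κ) ≠ f j := fun h => hne (f.injective (Subtype.ext h))
    exact tube_ne H (hm (f i)) (hm (f j)) (f i).2 (f j).2 (hd _ _ h2) hij
  · refine MS.congr (MS.add (M := D) (N := R) ?_ ?_) e
    · rw [← ht, sum_single]
      exact (MS.fam fun i => MS.single (rz_isom H (hX i) (pm_inl ⟨_, hX i⟩))).congr eD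
    · let s : κ → Multiset (Lab Q ⊕ (HT k δ × ℕ+)) := fun j =>
        if h : (p j).1 ≠ 0 then (p j).1.map fun c => .inr (y ⟨j, h⟩, c) else 0
      have hs : ∀ j, MS pm (s j) (Y j) := fun j => by
        simp only [s]; split_ifs with h
        · exact hm ⟨j, h⟩
        · exact MS.zero (((rhp_iff H).1 (hY j)).resolve_right fun h' => h h'.1).2
      have h3 : ∑ j, s j = ∑ i, (sl (strip α.2) i).1.map fun c => Sum.inr (y (f i), c) := by
        rw [show ∑ j, s j = _ from sum_strip f (fun j => (p j).1.map fun c => Sum.inr (y j, c))]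
        exact Finset.sum_congr rfl fun i _ => by rw [hf]
      rw [← h3]
      exact (MS.fam hs).congr eR

lemma class_mpr (H : Aff Q δ) {α : DSymb Q} (h1 : ∀ p ∈ α.1, vld k δ p)
    {x : Fin (strip α.2).toList.length → HT k δ} (hx : Pl hdeg (strip α.2) x)
    (hM : MS pm (Sx α.1 (strip α.2) x) M) : InDecompClass δ α M := by
  classical
  have hs := sl_map α.2
  obtain ⟨f, hf⟩ := strip_enum hs
  obtain ⟨D, hD⟩ := ms_exists (pm (k := k) (δ := δ)) (α.1.map .inl)
  let s : Fin α.2.toList.length → Multiset (Lab Q ⊕ (HT k δ × ℕ+)) := fun j =>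
    if h : (sl α.2 j).1 ≠ 0 then (sl α.2 j).1.map fun c => .inr (x (f.symm ⟨j, h⟩), c) else 0
  choose Y hY using fun j => ms_exists (pm (k := k) (δ := δ)) (s j)
  have hp : ∀ j (h : (sl α.2 j).1 ≠ 0), MS pm ((sl α.2 j).1.map fun c => .inr (x (f.symm ⟨j, h⟩), c)) (Y j) :=
    fun j h => by have := hY j; simp only [s, dif_pos h] at this; exact this
  have hz : ∀ j (h : (sl α.2 j).1 = 0), (Y j).IsZero := fun j h => by
    have := hY j; simp only [s, dif_neg (not_not.2 h)] at this
    exact (this.unique (MS.zero zr_zero)).symm.isZero zr_zero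
  have hR := MS.fam hY
  have h3 : ∑ j, s j = ∑ i, (sl (strip α.2) i).1.map fun c => Sum.inr (x i, c) := by
    rw [show ∑ j, s j = _ from sum_strip f (fun j => (sl α.2 j).1.map fun c => Sum.inr (x (f.symm j), c))]
    exact Finset.sum_congr rfl fun i _ => by rw [hf, Equiv.symm_apply_apply]
  rw [h3] at hR
  refine ⟨D, dsumFam Y, hM.unique (hD.add hR), ?_, ⟨_, inferInstance, Y, sl α.2, fun j => (rhp_iff H).2 ?_,
    fun j j' hj => ?_, hs, ⟨Iso.refl _⟩⟩⟩
  · refine ⟨Fin α.1.toList.length, inferInstance, fun i => pm (.inl (α.1.toList.get i) : Lab Q ⊕ (HT k δ × ℕ+)),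
      fun i => α.1.toList.get i, fun i => pm_inl (h1 _ (Multiset.mem_toList.1 (List.get_mem _ _))), fin_map α.1, ?_⟩
    refine hD.unique ?_
    have := MS.fam fun i => MS.single (Isom.refl (pm (.inl (α.1.toList.get i) : Lab Q ⊕ (HT k δ × ℕ+))))
    rwa [← sum_single (fun i => α.1.toList.get i), fin_map] at this
  · by_cases h : (sl α.2 j).1 = 0
    · exact Or.inl ⟨h, hz j h⟩
    · refine Or.inr ⟨h, _, ?_, hp j h⟩
      rw [hx.2, ← hf, Equiv.apply_symm_apply]
  · by_cases h : (sl α.2 j).1 = 0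
    · exact zero_disj (Or.inl (hz j h))
    by_cases h' : (sl α.2 j').1 = 0
    · exact zero_disj (Or.inr (hz j' h'))
    refine tube_disj H (hp j h) (hp j' h') fun e => hj ?_
    exact congrArg Subtype.val (f.symm.injective (hx.1 e))

section
variable {T : Type*} {dg : T → ℕ+} {μ μ' : Multiset (Lab Q)} {σ σ' : SS} {x : Fin σ.toList.length → T}
  {x' : Fin σ'.toList.length → T}

open Classical in
lemma count_inl (p : Lab Q) : (Sx μ σ x).count (.inl p) = μ.count p := by
  rw [Sx, Multiset.count_add, Multiset.count_map_eq_count' _ _ Sum.inl_injective, Multiset.count_sum',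
    Finset.sum_eq_zero, add_zero]
  intro j _
  rw [Multiset.count_eq_zero]; simp

open Classical in
lemma count_inr (hx : Function.Injective x) (j : Fin σ.toList.length) (c : ℕ+) :
    (Sx μ σ x).count (.inr (x j, c)) = (sl σ j).1.count c := by
  rw [Sx, Multiset.count_add, Multiset.count_eq_zero_of_notMem (by simp), Multiset.count_sum', zero_add,
    Finset.sum_eq_single j]
  · exact Multiset.count_map_eq_count' (fun c => (Sum.inr (x j, c) : Lab Q ⊕ (T × ℕ+))) _ (fun a b h => by simpa using h) c
  · intro i _ hi
    rw [Multiset.count_eq_zero]; simp only [Multiset.mem_map]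
    rintro ⟨a, -, h⟩
    exact hi (hx (congrArg Prod.fst (Sum.inr_injective h)))
  · simp

lemma mem_inr {y : T} {c : ℕ+} (h : .inr (y, c) ∈ Sx μ σ x) : ∃ j, x j = y := by
  rw [Sx, Multiset.mem_add, Multiset.mem_sum] at h
  rcases h with h | ⟨j, -, h⟩
  · simp at h
  · obtain ⟨a, -, h⟩ := Multiset.mem_map.1 h
    exact ⟨j, congrArg Prod.fst (Sum.inr_injective h)⟩

lemma sx_range (h : ∀ p ∈ σ, p.1 ≠ 0) (he : Sx μ σ x = Sx μ' σ' x') (j : Fin σ.toList.length) :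
    ∃ j', x' j' = x j := by
  obtain ⟨c, hc⟩ := Multiset.exists_mem_of_ne_zero (h _ (sl_mem j))
  refine mem_inr (c := c) (μ := μ') ?_
  rw [← he, Sx, Multiset.mem_add, Multiset.mem_sum]
  exact Or.inr ⟨j, Finset.mem_univ j, Multiset.mem_map_of_mem _ hc⟩

lemma sx_unique (hx : Pl dg σ x) (hx' : Pl dg σ' x') (h : ∀ p ∈ σ, p.1 ≠ 0) (h' : ∀ p ∈ σ', p.1 ≠ 0)
    (he : Sx μ σ x = Sx μ' σ' x') : μ = μ' ∧ σ = σ' ∧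
      ∃ e : Fin σ.toList.length ≃ Fin σ'.toList.length, ∀ j, x' (e j) = x j ∧ sl σ' (e j) = sl σ j := by
  classical
  have h1 : ∃ e : Fin σ.toList.length ≃ Fin σ'.toList.length, ∀ j, x' (e j) = x j ∧ sl σ' (e j) = sl σ j := by
    choose e he1 using sx_range h he
    have hb : Function.Bijective e := by
      refine ⟨fun i j hij => hx.1 (by rw [← he1, ← he1, hij]), fun j' => ?_⟩
      obtain ⟨j, hj⟩ := sx_range h' he.symm j'
      exact ⟨j, hx'.1 (by rw [he1, hj])⟩
    refine ⟨Equiv.ofBijective e hb, fun j => ⟨he1 j, Prod.ext ?_ ?_⟩⟩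
    · refine Multiset.ext.2 fun c => ?_
      rw [← count_inr (μ := μ) hx.1, ← count_inr (μ := μ') hx'.1, he, show x' (Equiv.ofBijective e hb j) = x j from he1 j]
    · rw [← hx.2, ← hx'.2, show x' (Equiv.ofBijective e hb j) = x j from he1 j]
  refine ⟨Multiset.ext.2 fun p => ?_, ?_, h1⟩
  · rw [← count_inl (σ := σ) (x := x), he, count_inl]
  · obtain ⟨e, he⟩ := h1
    rw [← sl_map σ, ← sl_map σ', ← Multiset.map_univ_val_equiv e, Multiset.map_map]
    exact Multiset.map_congr rfl fun j _ => (he j).2.symm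

lemma sx_perm (e : Fin σ.toList.length ≃ Fin σ.toList.length) (he : ∀ j, sl σ (e j) = sl σ j) :
    Sx μ σ (x ∘ e) = Sx μ σ x := by
  rw [Sx, Sx, ← e.sum_comp fun j => (sl σ j).1.map fun c => Sum.inr (x j, c)]
  refine congrArg _ (Finset.sum_congr rfl fun j _ => ?_)
  rw [he]; rfl

lemma split_lr {A B : Type*} (s : Multiset (A ⊕ B)) : ∃ a b, s = Multiset.map Sum.inl a + Multiset.map Sum.inr b := by
  induction s using Multiset.induction_on with
  | empty => exact ⟨0, 0, rfl⟩
  | cons z s ih =>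
    obtain ⟨a, b, rfl⟩ := ih
    rcases z with z | z
    · exact ⟨z ::ₘ a, b, by simp⟩
    · exact ⟨a, z ::ₘ b, by simp⟩

lemma sx_exists (dg : T → ℕ+) (s : Multiset (Lab Q ⊕ (T × ℕ+))) : ∃ (μ : Multiset (Lab Q)) (σ : SS) (x : _),
    (∀ p ∈ σ, p.1 ≠ 0) ∧ Pl dg σ x ∧ s = Sx μ σ x := by
  classical
  obtain ⟨μ, b, rfl⟩ := split_lr s
  let U : Finset T := (b.map Prod.fst).toFinset
  let pt : T → Multiset ℕ+ := fun y => (b.filter fun z => z.1 = y).map Prod.snd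
  let σ : SS := Multiset.map (fun y : U => (pt y, dg y)) (Finset.univ : Finset U).val
  obtain ⟨e, he⟩ := enum (sl σ) (fun y : U => (pt y, dg y)) (sl_map σ)
  refine ⟨μ, σ, fun j => e j, fun p hp => ?_, ⟨fun i j h => e.injective (Subtype.ext h), fun j => congrArg Prod.snd (he j)⟩, ?_⟩
  · obtain ⟨y, -, rfl⟩ := Multiset.mem_map.1 hp
    obtain ⟨z, hz, hy⟩ := Multiset.mem_map.1 (Multiset.mem_toFinset.1 y.2)
    intro h0
    have : z.2 ∈ pt y := Multiset.mem_map_of_mem _ (Multiset.mem_filter.2 ⟨hz, hy⟩)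
    rw [show pt y = 0 from h0] at this
    simp at this
  · rw [Sx]; congr 1
    have h1 : ∀ j, (sl σ j).1.map (fun c => (Sum.inr ((e j : T), c) : Lab Q ⊕ (T × ℕ+))) =
        (b.filter fun z => z.1 = (e j : T)).map Sum.inr := fun j => by
      rw [← he j, Multiset.map_map]
      refine Multiset.map_congr rfl fun z hz => ?_
      rw [← (Multiset.mem_filter.1 hz).2]; rfl
    rw [Finset.sum_congr rfl fun j _ => h1 j, e.sum_comp fun y : U => (b.filter fun z => z.1 = (y : T)).map Sum.inr,
      Finset.sum_coe_sort U fun y => (b.filter fun z => z.1 = y).map (Sum.inr : _ → Lab Q ⊕ (T × ℕ+))]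
    rw [← Multiset.coe_mapAddMonoidHom, ← map_sum]
    congr 1
    refine Multiset.ext.2 fun z => ?_
    simp only [Multiset.count_sum', Multiset.count_filter]
    rw [Finset.sum_ite_eq]
    split_ifs with h
    · rfl
    · exact Multiset.count_eq_zero.2 fun hz => h (Multiset.mem_toFinset.2 (Multiset.mem_map_of_mem _ hz))

/-- Symmetries of a Segre symbol. -/
abbrev Wt (σ : SS) := {e : Fin σ.toList.length ≃ Fin σ.toList.length // ∀ j, sl σ (e j) = sl σ j}
lemma wt_pos (σ : SS) : Nat.card (Wt σ) ≠ 0 := by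
  have : Nonempty (Wt σ) := ⟨⟨Equiv.refl _, fun _ => rfl⟩⟩
  exact Nat.card_pos.ne'

def fibW (h : ∀ p ∈ σ, p.1 ≠ 0) (hx : Pl dg σ x) : Wt σ ≃ {y // Pl dg σ y ∧ Sx μ σ y = Sx μ σ x} :=
  Equiv.ofBijective (fun e => ⟨x ∘ e.1, ⟨hx.1.comp e.1.injective, fun j => by rw [Function.comp, hx.2, e.2]⟩,
    sx_perm _ e.2⟩) ⟨fun e e' h => Subtype.ext (Equiv.ext fun j => hx.1 (congrFun (congrArg Subtype.val h) j)), fun y => by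
      obtain ⟨-, -, e, he⟩ := sx_unique y.2.1 hx h h y.2.2
      exact ⟨⟨e, fun j => (he j).2⟩, Subtype.ext (funext fun j => (he j).1)⟩⟩

end

lemma card_fib {A B : Type*} (f : A → B) {n : ℕ} (hn : n ≠ 0) (h : ∀ b, Nat.card {a // f a = b} = n) :
    Nat.card A = Nat.card B * n := by
  have hf : ∀ b, Nonempty ({a // f a = b} ≃ Fin n) := fun b => by
    have : Finite {a // f a = b} := Nat.finite_of_card_ne_zero (by rw [h]; exact hn)
    exact Finite.card_eq.1 (by rw [h, Nat.card_fin])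
  have e : A ≃ B × Fin n := (Equiv.sigmaFiberEquiv f).symm.trans
    ((Equiv.sigmaCongrRight fun b => (hf b).some).trans (Equiv.sigmaEquivProd _ _))
  rw [Nat.card_congr e, Nat.card_prod, Nat.card_fin]

def isoCongr (e : Iso M M') (e' : Iso N N') : Iso M N ≃ Iso M' N' where
  toFun f := e.symm.trans (f.trans e')
  invFun f := e.trans (f.trans e'.symm)
  left_inv f := by refine Iso.ext' fun v x => ?_; simp [Iso.trans, Iso.symm]
  right_inv f := by refine Iso.ext' fun v x => ?_; simp [Iso.trans, Iso.symm]

lemma Isom.aut (e : Isom M N) : autCard M = autCard N :=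
  Nat.card_congr (isoCongr e.some e.some)

/-- The automorphism polynomial. -/
def aP (δ : Q.V → ℕ) (α : DSymb Q) : ℤ[X] :=
  apoly (hP δ fun j => (sl (strip α.2) j).2) (fP fun j => (sl (strip α.2) j).2) (Sx α.1 (strip α.2) id).toList

lemma fP_pos {T : Type*} (dg : T → ℕ+) (g : Lab Q ⊕ (T × ℕ+)) : 0 < fP dg g := by
  rcases g with p | y
  · exact one_pos
  · exact (dg y.1).2

lemma aP_monic (α : DSymb Q) : (aP δ α).Monic := apoly_monic (fP_pos _) _
lemma sx_map {T : Type*} {μ : Multiset (Lab Q)} {σ : SS} (x : Fin σ.toList.length → T) :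
    (Sx μ σ id).map (Sum.map id (Prod.map x id)) = Sx μ σ x := by
  rw [Sx, Sx, Multiset.map_add, Multiset.map_map]
  refine congrArg₂ _ rfl ((map_sum (Multiset.mapAddMonoidHom (Sum.map id (Prod.map x id))) _ _).trans
    (Finset.sum_congr rfl fun j _ => ?_))
  rw [Multiset.coe_mapAddMonoidHom, Multiset.map_map]; rfl

lemma sx_vP {μ : Multiset (Lab Q)} {σ : SS} {x : Fin σ.toList.length → HT k δ} (h : ∀ p ∈ μ, vld k δ p) :
    ∀ g ∈ Sx μ σ x, vP g := by
  rintro (p | y) hg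
  · classical
    exact h p (Multiset.count_pos.1 (by rw [← count_inl (σ := σ) (x := x)]; exact Multiset.count_pos.2 hg))
  · trivial

lemma class_aut (H : Aff Q δ) [Finite k] {α : DSymb Q} (h : InDecompClass δ α M) :
    (autCard M : ℤ) = (aP δ α).eval (Nat.card k : ℤ) := by
  obtain ⟨hv, x, hx, hM⟩ := class_mp H h
  have hL : (((Sx α.1 (strip α.2) id).toList.map (Sum.map id (Prod.map x id)) : List _) : Multiset _) =
      Sx α.1 (strip α.2) x := by
    rw [← Multiset.map_coe, Multiset.coe_toList, sx_map]
  rw [(hM.isom hL).aut, (good H).aut _ (fun g hg => sx_vP hv g (by rw [← hL]; exact hg)),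
    apoly_map (h' := hP δ fun j => (sl (strip α.2) j).2) (f' := fP fun j => (sl (strip α.2) j).2)
      (Sum.map_injective.2 ⟨Function.injective_id, hx.1.prodMap Function.injective_id⟩)
      (hP_map _ _ hx.1 hx.2) (fP_map _ _ hx.2), aP]

lemma aP_ne (α : DSymb Q) {q : ℤ} (hq : 2 ≤ q) : (aP δ α).eval q ≠ 0 := apoly_ne (fP_pos _) hq _
lemma ms_inj (H : Aff Q δ) [Finite k] {s t : Multiset (Lab Q ⊕ (HT k δ × ℕ+))} (hs : ∀ g ∈ s, vP g) (ht : ∀ g ∈ t, vP g)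
    {M N : Repn k Q} (hM : MS pm s M) (hN : MS pm t N) (e : Isom M N) : s = t := by
  obtain ⟨L, rfl, e1⟩ := hM
  obtain ⟨L', rfl, e2⟩ := hN
  exact Multiset.coe_eq_coe.2 ((good H).ks hs ht (e1.symm.trans (e.trans e2)))

lemma strip_ne (σ : SS) : ∀ p ∈ strip σ, p.1 ≠ 0 := fun _ hp => (Multiset.mem_filter.1 hp).2

/-- the number of placements -/
def nPl (k : Type) [Field k] (δ : Q.V → ℕ) (σ : SS) : ℕ := Nat.card {x // Pl (hdeg (k := k) (δ := δ)) σ x}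
lemma classCount_eq (H : Aff Q δ) [Finite k] {α : DSymb Q} (hv : ∀ p ∈ α.1, vld k δ p) :
    classCount (fun M : Repn k Q => InDecompClass δ α M) * Nat.card (Wt (strip α.2)) = nPl k δ (strip α.2) := by
  choose M hM using fun x : {x // Pl (hdeg (k := k) (δ := δ)) (strip α.2) x} =>
    ms_exists (pm (k := k) (δ := δ)) (Sx α.1 (strip α.2) x.1)
  let r : {M : Repn k Q // InDecompClass δ α M} → {M : Repn k Q // InDecompClass δ α M} → Prop :=
    fun M N => Nonempty (Iso M.1 N.1)
  let f : {x // Pl (hdeg (k := k) (δ := δ)) (strip α.2) x} → Quot r :=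
    fun x => Quot.mk _ ⟨M x, class_mpr H hv x.2 (hM x)⟩
  have hr : ∀ a b, Quot.mk r a = Quot.mk r b ↔ Isom a.1 b.1 := fun a b => by
    refine ⟨fun h => ?_, fun h => Quot.sound h⟩
    have h := Quot.eqvGen_exact h
    exact (isom_equiv fun a : {M : Repn k Q // InDecompClass δ α M} => a.1).eqvGen_iff.1 h
  refine (card_fib f (wt_pos _) fun b => ?_).symm
  obtain ⟨⟨N, hN⟩, rfl⟩ := Quot.exists_rep b
  obtain ⟨-, x, hx, hx'⟩ := class_mp H hN
  refine Nat.card_congr (Equiv.trans ?_ (fibW (μ := α.1) (strip_ne _) hx).symm)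
  refine (Equiv.subtypeEquivRight fun y => ?_).trans (Equiv.subtypeSubtypeEquivSubtypeInter _ fun y => Sx α.1 (strip α.2) y = Sx α.1 (strip α.2) x)
  rw [hr]
  refine ⟨fun h => ms_inj H (sx_vP hv) (sx_vP hv) (hM y) hx' h, fun h => ?_⟩
  exact (hM y).unique (by rw [h]; exact hx')

lemma classCount_zero (H : Aff Q δ) {α : DSymb Q} (hv : ¬ ∀ p ∈ α.1, vld k δ p) :
    classCount (fun M : Repn k Q => InDecompClass δ α M) = 0 := by
  have : IsEmpty {M : Repn k Q // InDecompClass δ α M} := ⟨fun M => hv (class_mp H M.2).1⟩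
  have : IsEmpty (Quot (fun (M N : {M : Repn k Q // InDecompClass δ α M}) => Nonempty (Iso M.1 N.1))) :=
    ⟨fun x => by obtain ⟨a, -⟩ := Quot.exists_rep x; exact this.elim a⟩
  exact Nat.card_of_isEmpty

/-! Representation spaces -/

abbrev Rd (k : Type) [Field k] (d : Q.V → ℕ) := ∀ a : Q.A, (Fin (d (Q.s a)) → k) →ₗ[k] (Fin (d (Q.t a)) → k)
abbrev Gd (k : Type) [Field k] (d : Q.V → ℕ) := ∀ v : Q.V, (Fin (d v) → k) ≃ₗ[k] (Fin (d v) → k)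

def mkR {d : Q.V → ℕ} (ρ : Rd k d) : Repn k Q where
  space v := Fin (d v) → k
  map := ρ

instance {d : Q.V → ℕ} (ρ : Rd k d) : FD (mkR ρ) := ⟨fun v => inferInstanceAs (FiniteDimensional k (Fin (d v) → k))⟩

lemma dimv_mkR {d : Q.V → ℕ} (ρ : Rd k d) : dimv (mkR ρ) = d :=
  funext fun v => Module.finrank_fin_fun k

def frame {d : Q.V → ℕ} (M : Repn k Q) : (Σ ρ : Rd k d, Iso M (mkR ρ)) ≃ ∀ v, M.space v ≃ₗ[k] (Fin (d v) → k) where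
  toFun p := p.2.e
  invFun b := ⟨fun a => (b (Q.t a)).toLinearMap ∘ₗ M.map a ∘ₗ (b (Q.s a)).symm.toLinearMap,
    ⟨b, fun a x => by
      exact congrArg (fun y => b (Q.t a) (M.map a y)) (LinearEquiv.symm_apply_apply (b (Q.s a)) x).symm⟩⟩
  left_inv := by
    rintro ⟨ρ, e, he⟩
    change ∀ v, M.space v ≃ₗ[k] (Fin (d v) → k) at e
    change ∀ a x, e (Q.t a) (M.map a x) = ρ a (e (Q.s a) x) at he
    have : (fun a => (e (Q.t a)).toLinearMap ∘ₗ M.map a ∘ₗ (e (Q.s a)).symm.toLinearMap) = ρ := by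
      funext a
      refine LinearMap.ext fun x => ?_
      have := he a ((e (Q.s a)).symm x)
      rw [LinearEquiv.apply_symm_apply] at this
      exact this
    subst this; rfl
  right_inv b := rfl

def frames {d : Q.V → ℕ} (b : ∀ v, M.space v ≃ₗ[k] (Fin (d v) → k)) :
    (∀ v, M.space v ≃ₗ[k] (Fin (d v) → k)) ≃ Gd k d where
  toFun c v := (b v).symm.trans (c v)
  invFun c v := (b v).trans (c v)
  left_inv c := by funext v; ext x; simp
  right_inv c := by funext v; ext x; simp

lemma exists_frame (M : Repn k Q) [FD M] : Nonempty (∀ v, M.space v ≃ₗ[k] (Fin (dimv M v) → k)) :=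
  ⟨fun v => have := FD.fd (M := M) v; (Module.finBasis k (M.space v)).equivFun⟩

lemma exists_mkR (M : Repn k Q) [FD M] {d : Q.V → ℕ} (h : dimv M = d) : ∃ ρ : Rd k d, Isom M (mkR ρ) := by
  subst h
  obtain ⟨b⟩ := exists_frame M
  exact ⟨_, ⟨((frame M).symm b).2⟩⟩

lemma orbit_card [Finite k] (M : Repn k Q) [FD M] {d : Q.V → ℕ} (h : dimv M = d) (ha : autCard M ≠ 0) :
    Nat.card {ρ : Rd k d // Isom M (mkR ρ)} * autCard M = Nat.card (Gd k d) := by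
  subst h
  obtain ⟨b⟩ := exists_frame M
  rw [← Nat.card_congr ((frame M).trans (frames b))]
  let f : (Σ ρ : Rd k (dimv M), Iso M (mkR ρ)) → {ρ : Rd k (dimv M) // Isom M (mkR ρ)} := fun p => ⟨p.1, ⟨p.2⟩⟩
  refine (card_fib f ha fun ρ => ?_).symm
  obtain ⟨ρ, ⟨e⟩⟩ := ρ
  refine (Nat.card_congr ?_).trans (Nat.card_congr (isoCongr (Iso.refl M) e)).symm
  refine (Equiv.ofBijective (fun i => ⟨⟨ρ, i⟩, rfl⟩) ⟨fun i j h => ?_, ?_⟩).symm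
  · simpa using congrArg Subtype.val h
  · rintro ⟨⟨ρ', i⟩, h⟩; cases (congrArg Subtype.val h : ρ' = ρ); exact ⟨i, rfl⟩

instance [Finite k] (d : Q.V → ℕ) : Finite (Rd k d) :=
  have (a : Q.A) : Finite ((Fin (d (Q.s a)) → k) →ₗ[k] (Fin (d (Q.t a)) → k)) := DFunLike.finite _
  Pi.finite

lemma finite_hdeg (H : Aff Q δ) [Finite k] (e : ℕ+) : Finite {x : HT k δ // hdeg x = e} := by
  have (x : {x : HT k δ // hdeg x = e}) : ∃ ρ : Rd k fun v => (e : ℕ) * δ v, Isom (hrep x.1) (mkR ρ) :=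
    exists_mkR _ (funext fun v => by rw [hdeg_spec H, x.2])
  choose ρ hρ using this
  exact Finite.of_injective ρ fun x y h => Subtype.ext (ht_ext ((hρ x).trans (by rw [h]; exact (hρ y).symm)))

section
variable {T : Type*} (dg : T → ℕ+)

/-- the number of injective sequences with given degrees -/
def pc {n : ℕ} (e : Fin n → ℕ+) : ℕ := Nat.card {x : Fin n → T // Function.Injective x ∧ ∀ j, dg (x j) = e j}
lemma pc_succ (hf : ∀ e, Finite {x // dg x = e}) {n : ℕ} (e : Fin (n + 1) → ℕ+) :
    (pc dg e : ℚ) = pc dg (fun i => e i.castSucc) *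
      (Nat.card {x // dg x = e (Fin.last n)} - Nat.card {i : Fin n // e i.castSucc = e (Fin.last n)}) := by
  let F : Set T := {x | dg x = e (Fin.last n)}
  have hF : F.Finite := hf _
  have : Finite F := hf _
  let f : {x : Fin (n + 1) → T // Function.Injective x ∧ ∀ j, dg (x j) = e j} →
      {x : Fin n → T // Function.Injective x ∧ ∀ j, dg (x j) = e j.castSucc} :=
    fun x => ⟨fun j => x.1 j.castSucc, x.2.1.comp (Fin.castSucc_injective n), fun j => x.2.2 _⟩
  have hinj : ∀ y z, f y = f z → y.1 (Fin.last n) = z.1 (Fin.last n) → y = z := fun y z hyz h => by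
    refine Subtype.ext (funext fun j => ?_)
    refine Fin.lastCases h (fun i => ?_) j
    exact congrArg (fun z => z.1 i) hyz
  have key : ∀ x, Nat.card {y // f y = x} + Nat.card {i : Fin n // e i.castSucc = e (Fin.last n)} =
      Nat.card {x // dg x = e (Fin.last n)} := fun x => by
    have hA : x.1 '' {i | e i.castSucc = e (Fin.last n)} ⊆ F := by
      rintro _ ⟨i, hi, rfl⟩; exact (x.2.2 i).trans hi
    have h1 := Set.ncard_sdiff_add_ncard_of_subset hA hF
    rw [Set.ncard_image_of_injective _ x.2.1] at h1
    refine Eq.trans ?_ h1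
    refine congrArg₂ _ (Nat.card_congr (Equiv.ofBijective (fun y => ⟨y.1.1 (Fin.last n), y.1.2.2 _, ?_⟩) ⟨fun y z h => ?_, ?_⟩)) rfl
    · rintro ⟨i, -, hi⟩
      have hy := congrArg (fun z => z.1 i) y.2
      exact (Fin.castSucc_lt_last i).ne (y.1.2.1 (hy.trans hi))
    · exact Subtype.ext (hinj _ _ (y.2.trans z.2.symm) (congrArg Subtype.val h))
    · rintro ⟨y, hy, hy'⟩
      have hn : ∀ i, x.1 i ≠ y := fun i h => hy' ⟨i, (x.2.2 i).symm.trans (by rw [h]; exact hy), h⟩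
      refine ⟨⟨⟨Fin.snoc (α := fun _ => T) x.1 y, fun i j => ?_, fun j => ?_⟩, ?_⟩, ?_⟩
      · refine Fin.lastCases ?_ (fun i => ?_) i <;> refine Fin.lastCases ?_ (fun j => ?_) j
        · intro; rfl
        · simp only [Fin.snoc_last, Fin.snoc_castSucc]; exact fun h => absurd h.symm (hn j)
        · simp only [Fin.snoc_last, Fin.snoc_castSucc]; exact fun h => absurd h (hn i)
        · simp only [Fin.snoc_castSucc]; exact fun h => by rw [x.2.1 h]
      · refine Fin.lastCases ?_ (fun j => ?_) j
        · rw [Fin.snoc_last]; exact hy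
        · rw [Fin.snoc_castSucc]; exact x.2.2 j
      · exact Subtype.ext (funext fun j => Fin.snoc_castSucc (α := fun _ => T) y x.1 j)
      · exact Subtype.ext (Fin.snoc_last (α := fun _ => T) y x.1)
  rcases isEmpty_or_nonempty {x : Fin n → T // Function.Injective x ∧ ∀ j, dg (x j) = e j.castSucc} with hE | ⟨⟨x₀⟩⟩
  · have : IsEmpty {x : Fin (n + 1) → T // Function.Injective x ∧ ∀ j, dg (x j) = e j} := ⟨fun x => hE.elim (f x)⟩
    rw [pc, pc, Nat.card_of_isEmpty, Nat.card_of_isEmpty]; simp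
  · have hc := key x₀
    rw [← hc, Nat.cast_add, add_sub_cancel_right]
    have hall : ∀ x, Nat.card {y // f y = x} = Nat.card {y // f y = x₀} := fun x => by have := key x; omega
    by_cases h0 : Nat.card {y // f y = x₀} = 0
    · have : IsEmpty {x : Fin (n + 1) → T // Function.Injective x ∧ ∀ j, dg (x j) = e j} := ⟨fun y => by
        have h1 := (hall (f y)).trans h0
        have hfin : Finite {z // f z = f y} := Finite.of_injective
          (fun z => (⟨z.1.1 (Fin.last n), z.1.2.2 _⟩ : F)) fun z w h => Subtype.ext (hinj _ _ (z.2.trans w.2.symm) (congrArg Subtype.val h))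
        have : Nonempty {z // f z = f y} := ⟨⟨y, rfl⟩⟩
        exact Nat.card_pos.ne' h1⟩
      rw [pc, Nat.card_of_isEmpty, h0]; simp
    · rw [pc, card_fib f h0 hall, pc]; push_cast; rfl

end

lemma col_le : ∀ (n : ℕ) {T X : Repn k Q} {i : Hm T X}, Col δ n T X i →
    (∀ v, dimv T v ≤ dimv X v) ∧ tdim T + n ≤ tdim X
  | 0, T, X, i, h => by
    have e := h.2.2.2.isom
    exact ⟨fun v => by rw [e.dimv], by rw [e.tdim]; exact le_rfl⟩
  | n+1, T, X, i, h => by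
    obtain ⟨-, -, hX, T₁, Y, i₁, σ, -, hc, -⟩ := h
    have := hc.fdT
    have h1 := (col_le n hc).2
    have h2 := tdim_pos hc.stab.2.1
    refine ⟨fun v => by rw [σ.dimv v]; omega, ?_⟩
    rw [σ.tdim]; omega

/-- total weight -/
def wt (d : Q.V → ℕ) : ℕ := ∑ v, d v
lemma lab_bd (H : Aff Q δ) {p : Lab Q} (h : vld k δ p) :
    (∀ v, p.1 v ≤ dnum δ p v) ∧ 1 ≤ wt p.1 ∧ wt p.1 + p.2 ≤ wt (dnum δ p) + 1 ∧ 1 ≤ p.2 := by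
  obtain ⟨X, h⟩ := h
  have := rz_fd h
  have hX : wt (dnum δ p) = tdim X := by rw [← dnum_eq H h]; rfl
  rw [hX, ← dnum_eq H h]
  by_cases h0 : defectOf Q δ (natc p.1) = 0
  · obtain ⟨n, T, i, hc, -, h3, h4⟩ := (rz_reg H h0).1 h
    have := hc.fdT
    have h1 := col_le n hc
    have h2 := tdim_pos hc.stab.2.1
    have h5 : wt p.1 = tdim T := by rw [← h3]; rfl
    rw [h5, ← h3]
    exact ⟨h1.1, h2, by omega, by omega⟩
  · obtain ⟨a, b, c, e⟩ := (rz_ne H h0).1 h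
    have h5 : wt p.1 = tdim X := by rw [← e]; rfl
    have h2 := tdim_pos h.1.1
    rw [h5, ← e]
    exact ⟨fun _ => le_rfl, h2, by omega, by omega⟩

lemma vld_ne (H : Aff Q δ) {p : Lab Q} (h0 : defectOf Q δ (natc p.1) ≠ 0) :
    vld k δ p ↔ p.2 = 1 ∧ titsZ Q (natc p.1) = 1 := by
  constructor
  · rintro ⟨X, h⟩
    obtain ⟨a, b, c, e⟩ := (rz_ne H h0).1 h
    have := brick_q H a (by rw [rz_df H h]; exact h0)
    rw [show dz X = natc p.1 from congrArg natc e] at this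
    exact ⟨c, this⟩
  · rintro ⟨h1, h2⟩
    obtain ⟨M, a, b, c⟩ := exists_indec (k := k) H p.1 h2 h0
    exact ⟨M, (rz_ne H h0).2 ⟨b, a, h1, c⟩⟩

lemma vld_reg (H : Aff Q δ) {p : Lab Q} (h0 : defectOf Q δ (natc p.1) = 0) :
    vld k δ p ↔ p.2 ≠ 0 ∧ vld k δ (p.1, 1) := by
  constructor
  · rintro ⟨X, h⟩
    obtain ⟨n, T, i, hc, h2, h3, h4⟩ := (rz_reg H h0).1 h
    have := hc.fdT
    obtain ⟨Y, j, h5⟩ := exists_col H 0 hc.stab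
    exact ⟨by omega, Y, (rz_reg H (p := (p.1, 1)) h0).2 ⟨0, T, j, h5, h2, h3, rfl⟩⟩
  · rintro ⟨h1, X, h⟩
    obtain ⟨n, T, i, hc, h2, h3, h4⟩ := (rz_reg H (p := (p.1, 1)) h0).1 h
    have := hc.fdT
    obtain ⟨Y, j, h5⟩ := exists_col H (p.2 - 1) hc.stab
    exact ⟨Y, (rz_reg H h0).2 ⟨_, T, j, h5, h2, h3, by omega⟩⟩

lemma vld_tits (H : Aff Q δ) {t : Q.V → ℕ} (h : vld k δ (t, 1)) : titsZ Q (natc t) = 1 := by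
  by_cases h0 : defectOf Q δ (natc t) = 0
  · obtain ⟨X, h⟩ := h
    obtain ⟨n, T, i, hc, h2, h3, h4⟩ := (rz_reg H (p := (t, 1)) h0).1 h
    have := hc.fdT
    have := hc.stab.q_real H h2
    rwa [show dz T = natc t from congrArg natc h3] at this
  · exact ((vld_ne H (p := (t, 1)) h0).1 h).2

lemma ls_dim : ∀ (L : List (Repn k Q)), (∀ X ∈ L, FD X) →
    FD (ls L) ∧ ∀ v, dimv (ls L) v = (L.map fun X => dimv X v).sum
  | [], _ => ⟨inferInstanceAs (FD zr), fun v => by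
      have h : dimv (zr : Repn k Q) = 0 := isZero_iff_dimv.1 zr_zero
      exact congrFun h v⟩
  | X :: L, h => by
    have h1 := h X (by simp)
    obtain ⟨h2, h3⟩ := ls_dim L fun Y hY => h Y (by simp [hY])
    exact ⟨inferInstanceAs (FD (X.dsum (ls L))), fun v => by
      rw [List.map_cons, List.sum_cons, ← h3]; exact dimv_dsum X (ls L) v⟩

lemma pm_at (H : Aff Q δ) : ∀ g : Lab Q ⊕ (HT k δ × ℕ+), vP g → FD (pm g) ∧ dimv (pm g) =
    Sum.elim (dnum δ) (fun y v => (y.2 : ℕ) * hdeg y.1 * δ v) g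
  | .inl p, h => ⟨rz_fd (pm_inl h), dnum_eq H (pm_inl h)⟩
  | .inr (x, c), _ => by
    obtain ⟨i, hi⟩ := pm_inr H x c
    refine ⟨hi.fdX, funext fun v => ?_⟩
    have := congrFun (pm_inr_dz H x c) v
    have h2 : ((dimv (pm (.inr (x, c))) v : ℕ) : ℤ) = ((c : ℕ) * (hdeg x : ℕ) : ℕ) * (δ v : ℕ) := this
    show _ = (c : ℕ) * (hdeg x : ℕ) * δ v
    exact_mod_cast h2

/-- dimension vector of a decomposition class -/
def cdim (δ : Q.V → ℕ) (μ : Multiset (Lab Q)) (σ : SS) (v : Q.V) : ℕ :=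
  (μ.map fun p => dnum δ p v).sum + (σ.map fun p => (p.1.map fun c : ℕ+ => (c : ℕ) * p.2 * δ v).sum).sum

lemma ms_dim (H : Aff Q δ) {μ : Multiset (Lab Q)} {σ : SS} {x : Fin σ.toList.length → HT k δ}
    (h1 : ∀ p ∈ μ, vld k δ p) (hx : Pl hdeg σ x) (hM : MS pm (Sx μ σ x) M) :
    FD M ∧ dimv M = cdim δ μ σ := by
  obtain ⟨L, hL, e⟩ := hM
  have hv : ∀ g ∈ L, vP g := fun g hg => sx_vP h1 g (by rw [← hL]; exact hg)
  have hl := ls_dim (L.map pm) fun X hX => by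
    obtain ⟨g, hg, rfl⟩ := List.mem_map.1 hX
    exact (pm_at H g (hv g hg)).1
  have := hl.1
  refine ⟨e.symm.fd, funext fun v => ?_⟩
  let F : Lab Q ⊕ (HT k δ × ℕ+) → ℕ := fun g => Sum.elim (dnum δ) (fun y v => (y.2 : ℕ) * hdeg y.1 * δ v) g v
  rw [e.dimv, hl.2, List.map_map]
  refine (congrArg List.sum (List.map_congr_left (g := F) fun g hg => congrFun (pm_at H g (hv g hg)).2 v)).trans ?_
  rw [← Multiset.sum_coe, ← Multiset.map_coe, hL, Sx, Multiset.map_add, Multiset.sum_add, cdim, Multiset.map_map]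
  refine congrArg₂ _ rfl ?_
  conv_rhs => rw [← sl_map σ, Multiset.map_map]
  refine (map_sum (Multiset.sumAddMonoidHom.comp (Multiset.mapAddMonoidHom F)) _ _).trans ?_
  refine Finset.sum_congr rfl fun j _ => ?_
  show (Multiset.map F _).sum = _
  rw [Multiset.map_map]
  refine congrArg _ (Multiset.map_congr rfl fun c _ => ?_)
  show (c : ℕ) * hdeg (x j) * δ v = _
  rw [hx.2 j]

lemma class_dim (H : Aff Q δ) {α : DSymb Q} (h : InDecompClass δ α M) :
    FD M ∧ dimv M = cdim δ α.1 (strip α.2) := by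
  obtain ⟨h1, x, hx, hM⟩ := class_mp H h
  exact ms_dim H h1 hx hM

lemma fin_ms {A : Type*} {F : Set A} (hF : F.Finite) (n : ℕ) :
    {s : Multiset A | Multiset.card s ≤ n ∧ ∀ a ∈ s, a ∈ F}.Finite := by
  classical
  refine (Finset.finite_toSet ((n • hF.toFinset.val).powerset.toFinset)).subset fun s hs => ?_
  rw [Finset.mem_coe, Multiset.mem_toFinset, Multiset.mem_powerset, Multiset.le_iff_count]
  intro a
  by_cases ha : a ∈ s
  · have h1 : 1 ≤ hF.toFinset.val.count a := Multiset.one_le_count_iff_mem.2 (hF.mem_toFinset.2 (hs.2 a ha))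
    rw [Multiset.count_nsmul]
    calc _ ≤ n := (Multiset.count_le_card a s).trans hs.1
      _ = n * 1 := (mul_one n).symm
      _ ≤ _ := Nat.mul_le_mul_left n h1
  · rw [Multiset.count_eq_zero_of_notMem ha]; exact Nat.zero_le _

lemma ms_card {A : Type*} {s : Multiset A} {f : A → ℕ} (h : ∀ a ∈ s, 1 ≤ f a) : Multiset.card s ≤ (s.map f).sum := by
  induction s using Multiset.induction with
  | empty => simp
  | cons a s ih =>
    have h1 := ih fun b hb => h b (Multiset.mem_cons_of_mem hb)
    have h2 := h a (Multiset.mem_cons_self a s)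
    rw [Multiset.card_cons, Multiset.map_cons, Multiset.sum_cons]; omega

lemma ms_le {A : Type*} {s : Multiset A} (f : A → ℕ) {a : A} (h : a ∈ s) : f a ≤ (s.map f).sum :=
  Multiset.le_sum_of_mem (Multiset.mem_map_of_mem f h)

lemma ms_big {A : Type*} {s : Multiset A} {f : A → ℕ} (h : ∀ a ∈ s, 1 ≤ f a) {a : A} (ha : a ∈ s)
    (hs : (s.map f).sum ≤ f a) : s = {a} := by
  obtain ⟨t, rfl⟩ := Multiset.exists_cons_of_mem ha
  rw [Multiset.map_cons, Multiset.sum_cons] at hs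
  have h1 := ms_card (s := t) (f := f) fun b hb => h b (Multiset.mem_cons_of_mem hb)
  rw [Multiset.card_eq_zero.1 (by omega : Multiset.card t = 0)]; rfl

lemma sum_ms {A V : Type*} [Fintype V] (s : Multiset A) (f : A → V → ℕ) :
    ∑ v, (s.map fun a => f a v).sum = (s.map fun a => ∑ v, f a v).sum := by
  induction s using Multiset.induction with
  | empty => simp
  | cons a s ih => simp only [Multiset.map_cons, Multiset.sum_cons, Finset.sum_add_distrib, ih]

/-- weight of a label -/
def lw (δ : Q.V → ℕ) (p : Lab Q) : ℕ := wt (dnum δ p)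

/-- weight of a homogeneous part -/
def hw (δ : Q.V → ℕ) (p : Multiset ℕ+ × ℕ+) : ℕ := (p.1.map fun c : ℕ+ => (c : ℕ) * p.2 * wt δ).sum
lemma wt_cdim (μ : Multiset (Lab Q)) (σ : SS) :
    wt (cdim δ μ σ) = (μ.map (lw δ)).sum + (σ.map (hw δ)).sum := by
  unfold wt cdim lw
  rw [Finset.sum_add_distrib, sum_ms, sum_ms]
  refine congrArg₂ _ rfl (congrArg _ (Multiset.map_congr rfl fun p _ => ?_))
  rw [sum_ms, hw]
  refine congrArg _ (Multiset.map_congr rfl fun c _ => ?_)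
  rw [← Finset.mul_sum, wt]

lemma wt_delta (H : Aff Q δ) : 1 ≤ wt δ := by
  refine Nat.pos_of_ne_zero fun h => H.min.1 (funext fun v => ?_)
  exact Finset.sum_eq_zero_iff.1 h v (Finset.mem_univ v)

lemma hw_ge (H : Aff Q δ) {p : Multiset ℕ+ × ℕ+} {c : ℕ+} (hc : c ∈ p.1) : (p.2 : ℕ) * wt δ ≤ c * p.2 * wt δ ∧
    (c : ℕ) * p.2 * wt δ ≤ hw δ p ∧ (c : ℕ) ≤ c * p.2 * wt δ := by
  refine ⟨Nat.mul_le_mul_right _ (Nat.le_mul_of_pos_left _ c.2), ms_le (fun c : ℕ+ => (c : ℕ) * p.2 * wt δ) hc, ?_⟩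
  rw [mul_assoc]; exact Nat.le_mul_of_pos_right _ (Nat.mul_pos p.2.2 (wt_delta H))

/-- the symbols which may occur in dimension `d` -/
def Bx (δ d : Q.V → ℕ) : Set (Multiset (Lab Q) × SS) :=
  {α | (∀ p ∈ α.2, p.1 ≠ 0) ∧ cdim δ α.1 α.2 = d ∧
    ∃ (k : Type) (_ : Field k) (_ : Finite k), ∀ p ∈ α.1, vld k δ p}

lemma bx_pos (H : Aff Q δ) {d : Q.V → ℕ} {α : Multiset (Lab Q) × SS} (h : α ∈ Bx δ d) :
    (∀ p ∈ α.1, 1 ≤ lw δ p) ∧ (∀ p ∈ α.2, 1 ≤ hw δ p) := by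
  obtain ⟨h1, h2, k, _, _, h3⟩ := h
  refine ⟨fun p hp => ?_, fun p hp => ?_⟩
  · have := lab_bd H (h3 p hp); unfold lw; omega
  · obtain ⟨c, hc⟩ := Multiset.exists_mem_of_ne_zero (h1 p hp)
    have := hw_ge H hc
    have := c.pos; omega

lemma bx_finite (H : Aff Q δ) (d : Q.V → ℕ) : (Bx δ d).Finite := by
  have hp : {c : ℕ+ | (c : ℕ) ≤ wt d}.Finite := (Set.finite_Iic (wt d)).preimage PNat.coe_injective.injOn
  have hL : {p : Lab Q | (∀ v, p.1 v ≤ wt d) ∧ p.2 ≤ wt d}.Finite :=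
    ((Set.finite_Iic fun _ : Q.V => wt d).prod (Set.finite_Iic (wt d))).subset fun p h => ⟨h.1, h.2⟩
  have hS : {p : Multiset ℕ+ × ℕ+ | (Multiset.card p.1 ≤ wt d ∧ ∀ c ∈ p.1, (c : ℕ) ≤ wt d) ∧ (p.2 : ℕ) ≤ wt d}.Finite :=
    ((fin_ms hp (wt d)).prod hp).subset fun p h => ⟨h.1, h.2⟩
  refine ((fin_ms hL (wt d)).prod (fin_ms hS (wt d))).subset fun α h => ?_
  obtain ⟨b1, b2⟩ := bx_pos H h
  obtain ⟨h1, h2, k, _, _, h3⟩ := h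
  have hw' := wt_cdim (δ := δ) α.1 α.2
  rw [h2] at hw'
  have c1 := ms_card b1
  have c2 := ms_card b2
  refine ⟨⟨by omega, fun p hp => ?_⟩, ⟨by omega, fun p hp => ?_⟩⟩
  · have h4 := ms_le (lw δ) hp
    have h5 := lab_bd H (h3 p hp)
    have h6 : ∀ v, p.1 v ≤ wt p.1 := fun v => Finset.single_le_sum (f := p.1) (fun _ _ => Nat.zero_le _) (Finset.mem_univ v)
    have h8 : lw δ p = wt (dnum δ p) := rfl
    exact ⟨fun v => by have := h6 v; omega, by omega⟩
  · have h4 := ms_le (hw δ) hp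
    have h5 : Multiset.card p.1 ≤ hw δ p := ms_card fun c hc => (Nat.succ_le_of_lt c.2).trans (hw_ge H hc).2.2
    refine ⟨⟨by omega, fun c hc => ?_⟩, ?_⟩
    · have := hw_ge H hc
      show (c : ℕ) ≤ _
      omega
    · obtain ⟨c, hc⟩ := Multiset.exists_mem_of_ne_zero (h1 p hp)
      have := hw_ge H hc
      have : (p.2 : ℕ) ≤ p.2 * wt δ := Nat.le_mul_of_pos_right _ (wt_delta H)
      show (p.2 : ℕ) ≤ _
      omega

lemma dnum_zero {μ : Multiset (Lab Q)} {σ : SS} (hμ : ∀ p ∈ μ, 1 ≤ lw δ p) (hσ : ∀ p ∈ σ, 1 ≤ hw δ p) :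
    ((σ.map (hw δ)).sum = 0 → σ = 0) ∧ ((μ.map (lw δ)).sum = 0 → μ = 0) := by
  have c1 := ms_card hμ
  have c2 := ms_card hσ
  exact ⟨fun h => Multiset.card_eq_zero.1 (by omega), fun h => Multiset.card_eq_zero.1 (by omega)⟩

lemma bx_big1 (H : Aff Q δ) {d : Q.V → ℕ} {α : Multiset (Lab Q) × SS} (h : α ∈ Bx δ d) {p : Lab Q}
    (hp : p ∈ α.1) (hb : wt d ≤ wt p.1) : α = ({(d, 1)}, 0) ∧ p.1 = d := by
  obtain ⟨b1, b2⟩ := bx_pos H h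
  obtain ⟨h1, h2, k, _, _, h3⟩ := h
  have hw' := wt_cdim (δ := δ) α.1 α.2
  rw [h2] at hw'
  have h4 := ms_le (lw δ) hp
  have h5 := lab_bd H (h3 p hp)
  have h7 := Finset.sum_le_sum fun v (_ : v ∈ Finset.univ) => h5.1 v
  change wt p.1 ≤ lw δ p at h7
  have e1 : α.1 = {p} := ms_big b1 hp (by omega)
  have e2 : α.2 = 0 := (dnum_zero b1 b2).1 (by omega)
  have e3 : dnum δ p = d := by rw [← h2, e1, e2]; funext v; simp [cdim]
  have e4 : p.1 = d := by
    rw [← e3] at hb ⊢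
    funext v
    exact (Finset.sum_eq_sum_iff_of_le fun v _ => h5.1 v).1 (le_antisymm h7 hb) v (Finset.mem_univ v)
  have e5 : p.2 = 1 := by rw [e3] at h5; omega
  refine ⟨Prod.ext ?_ e2, e4⟩
  rw [e1, ← e4, ← e5]

lemma bx_big2 (H : Aff Q δ) {d : Q.V → ℕ} {α : Multiset (Lab Q) × SS} (h : α ∈ Bx δ d) {p : Multiset ℕ+ × ℕ+}
    (hp : p ∈ α.2) (hb : wt d ≤ p.2 * wt δ) : α = (0, {({1}, p.2)}) ∧ d = fun v => (p.2 : ℕ) * δ v := by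
  obtain ⟨b1, b2⟩ := bx_pos H h
  obtain ⟨h1, h2, k, _, _, h3⟩ := h
  have hw' := wt_cdim (δ := δ) α.1 α.2
  rw [h2] at hw'
  have h4 := ms_le (hw δ) hp
  obtain ⟨c, hc⟩ := Multiset.exists_mem_of_ne_zero (h1 p hp)
  have h5 := hw_ge H hc
  have e1 : α.2 = {p} := ms_big b2 hp (by omega)
  have e2 : α.1 = 0 := (dnum_zero b1 b2).2 (by omega)
  have e3 : p.1 = {c} := ms_big (f := fun c : ℕ+ => (c : ℕ) * p.2 * wt δ)
    (fun c hc => (Nat.succ_le_of_lt c.2).trans (hw_ge H hc).2.2) hc (by change hw δ p ≤ _; omega)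
  have e4 : c = 1 := by
    have : (c : ℕ) * (p.2 * wt δ) = 1 * (p.2 * wt δ) := by rw [← mul_assoc]; omega
    exact PNat.coe_injective (Nat.eq_of_mul_eq_mul_right (Nat.mul_pos p.2.2 (wt_delta H)) this)
  subst e4
  refine ⟨Prod.ext e2 ?_, ?_⟩
  · rw [e1]; exact congrArg _ (Prod.ext e3 rfl)
  · rw [← h2, e1, e2]; funext v; simp [cdim, e3]

lemma card_Rd [Finite k] (d : Q.V → ℕ) :
    Nat.card (Rd k d) = Nat.card k ^ (∑ a, d (Q.s a) * d (Q.t a)) := by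
  rw [Nat.card_pi, ← Finset.prod_pow_eq_pow_sum]
  refine Finset.prod_congr rfl fun a _ => ?_
  rw [Module.natCard_eq_pow_finrank (K := k), Module.finrank_linearMap, Module.finrank_fin_fun, Module.finrank_fin_fun]

lemma card_Gd [Finite k] (d : Q.V → ℕ) :
    (Nat.card (Gd k d) : ℚ) = (∏ v, ∏ i : Fin (d v), (Polynomial.X ^ d v - Polynomial.X ^ (i : ℕ)) : ℚ[X]).eval (Nat.card k : ℚ) := by
  rw [Nat.card_pi, Nat.cast_prod, eval_prod]
  refine Finset.prod_congr rfl fun v _ => ?_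
  have := Fintype.ofFinite k
  rw [← Nat.card_congr ((Matrix.GeneralLinearGroup.toLin.trans (LinearMap.GeneralLinearGroup.generalLinearEquiv k (Fin (d v) → k))).toEquiv),
    Matrix.card_GL_field, eval_prod, Nat.cast_prod]
  refine Finset.prod_congr rfl fun i _ => ?_
  rw [Nat.cast_sub (Nat.pow_le_pow_right Fintype.card_pos i.2.le)]
  simp

lemma Gd_ne [Finite k] (d : Q.V → ℕ) : Nat.card (Gd k d) ≠ 0 := by
  have (v : Q.V) : Finite ((Fin (d v) → k) ≃ₗ[k] (Fin (d v) → k)) := DFunLike.finite _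
  exact Nat.card_pos.ne'

lemma class_congr (H : Aff Q δ) {α : DSymb Q} (h : InDecompClass δ α M) (e : Isom N M) :
    InDecompClass δ α N := by
  obtain ⟨h1, x, hx, hM⟩ := class_mp H h
  exact class_mpr H h1 hx (hM.congr e)

lemma one_lt_q (k : Type) [Field k] [Finite k] : (2 : ℤ) ≤ Nat.card k := by
  exact_mod_cast Finite.one_lt_card (α := k)

lemma mass1 (H : Aff Q δ) [Finite k] {α : DSymb Q} {d : Q.V → ℕ} (hd : cdim δ α.1 (strip α.2) = d) :
    (Nat.card {ρ : Rd k d // InDecompClass δ α (mkR ρ)} : ℚ) =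
      classCount (fun M : Repn k Q => InDecompClass δ α M) * Nat.card (Gd k d) / ((aP δ α).eval (Nat.card k : ℤ) : ℤ) := by
  have ha : (((aP δ α).eval (Nat.card k : ℤ) : ℤ) : ℚ) ≠ 0 := by exact_mod_cast aP_ne α (one_lt_q k)
  rw [eq_div_iff ha]
  let r : {M : Repn k Q // InDecompClass δ α M} → {M : Repn k Q // InDecompClass δ α M} → Prop :=
    fun M N => Nonempty (Iso M.1 N.1)
  have hr : Equivalence r := isom_equiv fun M : {M : Repn k Q // InDecompClass δ α M} => M.1
  let f : {ρ : Rd k d // InDecompClass δ α (mkR ρ)} → Quot r := fun ρ => Quot.mk r ⟨mkR ρ.1, ρ.2⟩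
  have key : ∀ b, (Nat.card {ρ // f ρ = b} : ℤ) * (aP δ α).eval (Nat.card k : ℤ) = Nat.card (Gd k d) := fun b => by
    obtain ⟨M, rfl⟩ := Quot.exists_rep b
    obtain ⟨h1, h2⟩ := class_dim H M.2
    have h3 := class_aut H M.2
    have h4 : autCard M.1 ≠ 0 := fun h => by
      rw [h] at h3
      exact aP_ne α (one_lt_q k) h3.symm
    rw [← h3, ← orbit_card M.1 (h2.trans hd) h4, Nat.cast_mul]
    refine congrArg (fun n : ℕ => (n : ℤ) * _) (Nat.card_congr ⟨fun ρ => ⟨ρ.1.1, ?_⟩, fun ρ => ⟨⟨ρ.1, ?_⟩, ?_⟩, fun _ => rfl, fun _ => rfl⟩)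
    · exact hr.symm (hr.eqvGen_iff.1 (Quot.eqvGen_exact ρ.2))
    · exact class_congr H M.2 ρ.2.symm
    · exact Quot.sound (r := r) ρ.2.symm
  rcases isEmpty_or_nonempty (Quot r) with hE | ⟨⟨b⟩⟩
  · have : IsEmpty {ρ : Rd k d // InDecompClass δ α (mkR ρ)} := ⟨fun ρ => hE.elim (f ρ)⟩
    have h0 : classCount (fun M : Repn k Q => InDecompClass δ α M) = 0 := Nat.card_of_isEmpty (α := Quot r)
    rw [Nat.card_of_isEmpty, h0]; simp
  · have h0 : Nat.card {ρ // f ρ = b} ≠ 0 := fun h => by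
      have := key b
      rw [h, Nat.cast_zero, zero_mul] at this
      exact Gd_ne (k := k) d (by exact_mod_cast this.symm)
    have h1 := card_fib f h0 fun c => by
      have := (key c).trans (key b).symm
      exact_mod_cast mul_right_cancel₀ (aP_ne α (one_lt_q k)) this
    have h2 : classCount (fun M : Repn k Q => InDecompClass δ α M) = Nat.card (Quot r) := rfl
    rw [h1, h2, Nat.cast_mul, mul_assoc]
    exact congrArg _ (by exact_mod_cast key b)

lemma strip_eq {σ : SS} (h : ∀ p ∈ σ, p.1 ≠ 0) : strip σ = σ := Multiset.filter_eq_self.2 h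
lemma class_mk (H : Aff Q δ) {μ : Multiset (Lab Q)} {σ τ : SS} (h1 : ∀ p ∈ μ, vld k δ p)
    (e : strip σ = τ) {x : Fin τ.toList.length → HT k δ} (hx : Pl hdeg τ x) (hM : MS pm (Sx μ τ x) M) :
    InDecompClass δ (μ, σ) M := by
  subst e
  exact class_mpr (α := (μ, σ)) H h1 hx hM

lemma class_unique (H : Aff Q δ) [Finite k] (M : Repn k Q) [FD M] :
    ∃ α ∈ Bx δ (dimv M), ∀ β ∈ Bx δ (dimv M), InDecompClass δ β M ↔ α = β := by
  obtain ⟨s, hs, hM⟩ := pm_ms H M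
  obtain ⟨μ, σ, x, h1, hx, rfl⟩ := sx_exists hdeg s
  have hv : ∀ p ∈ μ, vld k δ p := fun p hp => hs (.inl p) (Multiset.mem_add.2 (.inl (Multiset.mem_map_of_mem _ hp)))
  refine ⟨(μ, σ), ⟨h1, (ms_dim H hv hx hM).2.symm, k, _, ‹_›, hv⟩, fun β hβ => ⟨fun h => ?_, ?_⟩⟩
  · obtain ⟨a1, y, hy, hN⟩ := class_mp H h
    have h3 := ms_inj H hs (sx_vP a1) hM hN (Isom.refl M)
    obtain ⟨b1, b2, -⟩ := sx_unique hx hy h1 (strip_ne _) h3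
    exact Prod.ext b1 (b2.trans (strip_eq hβ.1))
  · rintro rfl
    exact class_mk H hv (strip_eq h1) hx hM

lemma mass2 (H : Aff Q δ) [Finite k] (d : Q.V → ℕ) :
    Nat.card (Rd k d) = ∑ α ∈ (bx_finite H d).toFinset, Nat.card {ρ : Rd k d // InDecompClass δ α (mkR ρ)} := by
  classical
  have := Fintype.ofFinite (Rd k d)
  have h : ∀ ρ : Rd k d, ∃ α ∈ Bx δ d, ∀ β ∈ Bx δ d, InDecompClass δ β (mkR ρ) ↔ α = β := fun ρ => by
    have := class_unique H (mkR ρ)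
    rwa [dimv_mkR] at this
  choose g hg h using h
  rw [Nat.card_eq_fintype_card, ← Finset.card_univ,
    Finset.card_eq_sum_card_fiberwise (f := g) fun ρ _ => (bx_finite H d).mem_toFinset.2 (hg ρ)]
  refine Finset.sum_congr rfl fun α hα => ?_
  rw [Nat.card_eq_fintype_card, Fintype.card_subtype]
  exact congrArg _ (Finset.filter_congr fun ρ _ => (h ρ α ((bx_finite H d).mem_toFinset.1 hα)).symm)

lemma mass (H : Aff Q δ) [Finite k] (d : Q.V → ℕ) :
    (Nat.card k : ℚ) ^ (∑ a, d (Q.s a) * d (Q.t a)) = ∑ α ∈ (bx_finite H d).toFinset,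
      (classCount (fun M : Repn k Q => InDecompClass δ α M) : ℚ) * Nat.card (Gd k d) / ((aP δ α).eval (Nat.card k : ℤ) : ℤ) := by
  rw [← Nat.cast_pow, ← card_Rd, mass2 H d, Nat.cast_sum]
  refine Finset.sum_congr rfl fun α hα => ?_
  have h := (bx_finite H d).mem_toFinset.1 hα
  exact mass1 H (by rw [show strip _ = _ from strip_eq h.1]; exact h.2.1)

end Repn
end

noncomputable section
namespace Repn
variable {Q : QuiverData} {δ : Q.V → ℕ}

/-- quantities given by a rational function in `q` -/
def Rt (F : ∀ (k : Type) [Field k] [Finite k], ℚ) : Prop :=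
  ∃ A B : ℚ[X], ∀ (k : Type) [Field k] [Finite k], B.eval (Nat.card k : ℚ) ≠ 0 ∧
    F k * B.eval (Nat.card k : ℚ) = A.eval (Nat.card k : ℚ)

section
variable {F G : ∀ (k : Type) [Field k] [Finite k], ℚ}

lemma Rt.congr (h : Rt F) (e : ∀ (k : Type) [Field k] [Finite k], G k = F k) : Rt G := by
  obtain ⟨A, B, h⟩ := h
  exact ⟨A, B, fun k _ _ => by rw [e]; exact h k⟩

lemma Rt.poly (P : ℚ[X]) : Rt fun k _ _ => P.eval (Nat.card k : ℚ) := ⟨P, 1, fun k _ _ => by simp⟩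
lemma Rt.const (c : ℚ) : Rt fun _ _ _ => c := (Rt.poly (C c)).congr fun k _ _ => by simp

lemma Rt.add (h : Rt F) (h' : Rt G) : Rt fun k _ _ => F k + G k := by
  obtain ⟨A, B, h⟩ := h
  obtain ⟨A', B', h'⟩ := h'
  refine ⟨A * B' + A' * B, B * B', fun k _ _ => ⟨?_, ?_⟩⟩
  · rw [eval_mul]; exact mul_ne_zero (h k).1 (h' k).1
  · simp only [eval_mul, eval_add, ← (h k).2, ← (h' k).2]; ring

lemma Rt.mul (h : Rt F) (h' : Rt G) : Rt fun k _ _ => F k * G k := by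
  obtain ⟨A, B, h⟩ := h
  obtain ⟨A', B', h'⟩ := h'
  refine ⟨A * A', B * B', fun k _ _ => ⟨?_, ?_⟩⟩
  · rw [eval_mul]; exact mul_ne_zero (h k).1 (h' k).1
  · simp only [eval_mul, ← (h k).2, ← (h' k).2]; ring

lemma Rt.sub (h : Rt F) (h' : Rt G) : Rt fun k _ _ => F k - G k :=
  (h.add ((Rt.const (-1)).mul h')).congr fun k _ _ => by ring

lemma Rt.div (h : Rt F) (P : ℚ[X]) (hP : ∀ (k : Type) [Field k] [Finite k], P.eval (Nat.card k : ℚ) ≠ 0) :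
    Rt fun k _ _ => F k / P.eval (Nat.card k : ℚ) := by
  obtain ⟨A, B, h⟩ := h
  refine ⟨A, B * P, fun k _ _ => ⟨?_, ?_⟩⟩
  · rw [eval_mul]; exact mul_ne_zero (h k).1 (hP k)
  · rw [eval_mul, ← (h k).2]; field_simp [hP k]

lemma Rt.sum {ι : Type*} (s : Finset ι) (F : ι → ∀ (k : Type) [Field k] [Finite k], ℚ) (h : ∀ i ∈ s, Rt (F i)) :
    Rt fun k _ _ => ∑ i ∈ s, F i k := by
  classical
  induction s using Finset.induction with
  | empty => exact (Rt.const 0).congr fun k _ _ => by simp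
  | insert a s ha ih =>
    refine ((h a (by simp)).add (ih fun i hi => h i (by simp [hi]))).congr fun k _ _ => ?_
    rw [Finset.sum_insert ha]

lemma Rt.prod {ι : Type*} (s : Multiset ι) (F : ι → ∀ (k : Type) [Field k] [Finite k], ℚ) (h : ∀ i ∈ s, Rt (F i)) :
    Rt fun k _ _ => (s.map fun i => F i k).prod := by
  induction s using Multiset.induction with
  | empty => exact (Rt.const 1).congr fun k _ _ => by simp
  | cons a s ih =>
    refine ((h a (by simp)).mul (ih fun i hi => h i (by simp [hi]))).congr fun k _ _ => ?_
    rw [Multiset.map_cons, Multiset.prod_cons]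

open Filter Topology in
lemma Rt.poly_of_nat (h : Rt F) (hF : ∀ (k : Type) [Field k] [Finite k], ∃ m : ℤ, F k = m) :
    ∃ P : ℚ[X], ∀ (k : Type) [Field k] [Finite k], F k = P.eval (Nat.card k : ℚ) := by
  obtain ⟨A, B, h⟩ := h
  have hB : B ≠ 0 := by
    rintro rfl
    have : Fact (Nat.Prime 2) := ⟨Nat.prime_two⟩
    exact (h (ZMod 2)).1 eval_zero
  have hdiv := EuclideanDomain.div_add_mod A B
  have hdeg : (A % B).degree < B.degree := EuclideanDomain.mod_lt A hB
  obtain ⟨b, hb⟩ := IsLocalization.integerNormalization_map_to_map (nonZeroDivisors ℤ) (A / B)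
  have hb0 : ((b : ℤ) : ℚ) ≠ 0 := by exact_mod_cast nonZeroDivisors.ne_zero b.2
  have hzz : ∀ n : ℕ, ∃ m : ℤ, (b : ℤ) * (A / B).eval (n : ℚ) = m := fun n => by
    refine ⟨(IsLocalization.integerNormalization (nonZeroDivisors ℤ) (A / B)).eval (n : ℤ), ?_⟩
    have := congrArg (eval (n : ℚ)) hb
    rw [eval_smul, zsmul_eq_mul, ← Int.cast_natCast (R := ℚ) n] at this
    rw [← Int.cast_natCast (R := ℚ) n, ← this]
    exact eval_intCast_map (algebraMap ℤ ℚ) _ _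
  have ht := (Polynomial.div_tendsto_zero_of_degree_lt (A % B) B hdeg).const_mul ((b : ℤ) : ℚ)
  rw [mul_zero] at ht
  have hev := (ht.comp tendsto_natCast_atTop_atTop).eventually (Metric.ball_mem_nhds (0 : ℚ) one_pos)
  obtain ⟨N, hN⟩ := eventually_atTop.1 hev
  have hroot : ∀ p : ℕ, N ≤ p → p.Prime → (A % B).eval (p : ℚ) = 0 := fun p hp hpp => by
    have : Fact p.Prime := ⟨hpp⟩
    obtain ⟨h1, h2⟩ := h (ZMod p)
    obtain ⟨m, hm⟩ := hF (ZMod p)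
    obtain ⟨m', hm'⟩ := hzz p
    rw [Nat.card_zmod] at h1 h2
    have h3 := hN p hp
    have h4 : ((b : ℤ) : ℚ) * ((A % B).eval (p : ℚ) / B.eval (p : ℚ)) = ((b * m - m' : ℤ) : ℚ) := by
      have h5 := congrArg (eval (p : ℚ)) hdiv
      rw [eval_add, eval_mul, ← h2] at h5
      push_cast
      rw [← hm', ← hm]
      field_simp
      linear_combination h5
    have h6 : |(((b * m - m' : ℤ) : ℚ) : ℝ)| < 1 := by
      rw [← h4]
      rwa [dist_zero_right] at h3
    have h7 : (b * m - m' : ℤ) = 0 := Int.abs_lt_one_iff.1 (by exact_mod_cast h6)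
    rw [h7, Int.cast_zero, mul_eq_zero, div_eq_zero_iff] at h4
    rcases h4 with h4 | h4 | h4
    · exact absurd h4 hb0
    · exact h4
    · exact absurd h4 h1
  have hR : A % B = 0 := by
    by_contra hne
    have hinf : {p : ℕ | N ≤ p ∧ p.Prime}.Infinite := by
      refine Set.infinite_of_forall_exists_gt fun n => ?_
      obtain ⟨p, hp, hpp⟩ := Nat.exists_infinite_primes (max N (n + 1))
      exact ⟨p, ⟨(le_max_left _ _).trans hp, hpp⟩, lt_of_lt_of_le n.lt_succ_self ((le_max_right _ _).trans hp)⟩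
    refine hinf (((A % B).rootSet_finite ℚ).preimage Nat.cast_injective.injOn |>.subset fun p hp => ?_)
    rw [Set.mem_preimage, mem_rootSet]
    exact ⟨hne, by rw [coe_aeval_eq_eval]; exact hroot p hp.1 hp.2⟩
  refine ⟨A / B, fun k _ _ => mul_right_cancel₀ (h k).1 ?_⟩
  rw [hR, add_zero] at hdiv
  rw [(h k).2, ← eval_mul, mul_comm, hdiv]

end

open Classical in
/-- indicator of validity of a label -/
def ind (k : Type) [Field k] (δ : Q.V → ℕ) (p : Lab Q) : ℚ := if vld k δ p then 1 else 0

/-- number of points of given degree -/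
def Nn (k : Type) [Field k] (δ : Q.V → ℕ) (e : ℕ+) : ℚ := Nat.card {x : HT k δ // hdeg x = e}

/-- size of a decomposition class -/
def cc (k : Type) [Field k] (δ : Q.V → ℕ) (α : DSymb Q) : ℚ :=
  classCount (fun M : Repn k Q => InDecompClass δ α M)

lemma rt_pc (H : Aff Q δ) : ∀ (n : ℕ) (e : Fin n → ℕ+), (∀ i, Rt fun k _ _ => Nn k δ (e i)) →
    Rt fun k _ _ => pc (hdeg (k := k) (δ := δ)) e
  | 0, e, _ => (Rt.const 1).congr fun k _ _ => by
      have : Nat.card {x : Fin 0 → HT k δ // Function.Injective x ∧ ∀ j, hdeg (x j) = e j} = 1 :=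
        Nat.card_eq_one_iff_unique.2 ⟨⟨fun a b => Subtype.ext (Subsingleton.elim _ _)⟩,
          ⟨⟨Fin.elim0, fun a => a.elim0, fun a => a.elim0⟩⟩⟩
      rw [pc, this, Nat.cast_one]
  | n+1, e, h => ((rt_pc H n (fun i => e i.castSucc) fun i => h i.castSucc).mul ((h (Fin.last n)).sub
      (Rt.const (Nat.card {i : Fin n // e i.castSucc = e (Fin.last n)})))).congr fun k _ _ =>
      pc_succ hdeg (finite_hdeg H) e

lemma cc_eq (H : Aff Q δ) {k : Type} [Field k] [Finite k] (α : DSymb Q) :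
    cc k δ α = (Multiset.map (ind k δ) α.1).prod * (nPl k δ (strip α.2) / Nat.card (Wt (strip α.2))) := by
  have hw : (Nat.card (Wt (strip α.2)) : ℚ) ≠ 0 := by exact_mod_cast wt_pos _
  by_cases hv : ∀ p ∈ α.1, vld k δ p
  · rw [Multiset.prod_eq_one fun a ha => ?_, one_mul, eq_div_iff hw, cc]
    · exact_mod_cast classCount_eq H hv
    · obtain ⟨p, hp, rfl⟩ := Multiset.mem_map.1 ha
      exact if_pos (hv p hp)
  · rw [cc, classCount_zero H hv]
    push Not at hv
    obtain ⟨p, hp, hv⟩ := hv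
    rw [Multiset.prod_eq_zero (Multiset.mem_map.2 ⟨p, hp, if_neg hv⟩)]; simp

lemma rt_cc (H : Aff Q δ) (α : DSymb Q) (h1 : ∀ p ∈ α.1, Rt fun k _ _ => ind k δ p)
    (h2 : ∀ p ∈ strip α.2, Rt fun k _ _ => Nn k δ p.2) : Rt fun k _ _ => cc k δ α := by
  have h3 := (rt_pc H _ (fun j => (sl (strip α.2) j).2) fun j => h2 _ (sl_mem j)).mul (Rt.const (Nat.card (Wt (strip α.2)))⁻¹)
  exact ((Rt.prod α.1 (fun p k _ _ => ind k δ p) h1).mul h3).congr fun k _ _ => cc_eq H α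

lemma rt_ind (H : Aff Q δ) (p : Lab Q)
    (h : defectOf Q δ (natc p.1) = 0 → Rt fun k _ _ => ind k δ (p.1, 1)) : Rt fun k _ _ => ind k δ p := by
  classical
  by_cases h0 : defectOf Q δ (natc p.1) = 0
  · refine ((Rt.const (if p.2 ≠ 0 then 1 else 0)).mul (h h0)).congr fun k _ _ => ?_
    simp only [ind]
    rw [vld_reg H h0]
    split_ifs <;> simp_all
  · refine (Rt.const (if p.2 = 1 ∧ titsZ Q (natc p.1) = 1 then 1 else 0)).congr fun k _ _ => ?_
    simp only [ind]
    rw [vld_ne H h0]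
    split_ifs <;> rfl

lemma tits_mul (H : Aff Q δ) (e : ℕ) : titsZ Q (natc fun v => e * δ v) = 0 := by
  have h := H.min.2.1
  have : titsZ Q (natc fun v => e * δ v) = e * e * titsZ Q (natc δ) := by
    simp only [titsZ, eulerZ, natc, mul_sub, Finset.mul_sum]
    refine congrArg₂ _ (Finset.sum_congr rfl fun v _ => ?_) (Finset.sum_congr rfl fun v _ => ?_) <;> push_cast <;> ring
  rw [this, h, mul_zero]

lemma gd_poly (d : Q.V → ℕ) : ∃ P : ℚ[X], ∀ (k : Type) [Field k] [Finite k],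
    P.eval (Nat.card k : ℚ) ≠ 0 ∧ (Nat.card (Gd k d) : ℚ) = P.eval (Nat.card k : ℚ) :=
  ⟨_, fun k _ _ => ⟨by rw [← card_Gd]; exact_mod_cast Gd_ne d, card_Gd d⟩⟩

lemma ap_poly (α : DSymb Q) : ∃ P : ℚ[X], ∀ (k : Type) [Field k] [Finite k],
    P.eval (Nat.card k : ℚ) ≠ 0 ∧ (((aP δ α).eval (Nat.card k : ℤ) : ℤ) : ℚ) = P.eval (Nat.card k : ℚ) := by
  refine ⟨(aP δ α).map (Int.castRingHom ℚ), fun k _ _ => ?_⟩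
  have : (((aP δ α).eval (Nat.card k : ℤ) : ℤ) : ℚ) = ((aP δ α).map (Int.castRingHom ℚ)).eval (Nat.card k : ℚ) := by
    rw [← Int.cast_natCast (R := ℚ)]
    exact (eval_intCast_map (Int.castRingHom ℚ) _ _).symm
  exact ⟨by rw [← this]; exact_mod_cast aP_ne α (one_lt_q k), this⟩

/-- solving the mass formula for one class -/
lemma rt_solve (H : Aff Q δ) {d : Q.V → ℕ} {α : Multiset (Lab Q) × SS} (hα : α ∈ Bx δ d)
    (h : ∀ β ∈ Bx δ d, β ≠ α → Rt fun k _ _ => cc k δ β) : Rt fun k _ _ => cc k δ α := by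
  let _i : DecidableEq (Multiset (Lab Q) × SS) := Classical.decEq _
  obtain ⟨G, hG⟩ := gd_poly d
  have h1 : Rt fun k _ _ => ∑ β ∈ @Finset.erase _ _i (bx_finite H d).toFinset α,
      (cc k δ β * Nat.card (Gd k d) / ((aP δ β).eval (Nat.card k : ℤ) : ℤ) : ℚ) := by
    refine Rt.sum _ (fun β k _ _ => (cc k δ β * Nat.card (Gd k d) / ((aP δ β).eval (Nat.card k : ℤ) : ℤ) : ℚ)) fun β hβ => ?_
    obtain ⟨hne, hβ⟩ := (@Finset.mem_erase _ _i _ _ _).1 hβ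
    obtain ⟨P, hP⟩ := ap_poly (δ := δ) β
    refine (((h β ((bx_finite H d).mem_toFinset.1 hβ) hne).mul (Rt.poly G)).div P fun k _ _ => (hP k).1).congr fun k _ _ => ?_
    rw [(hP k).2, (hG k).2]
  obtain ⟨P, hP⟩ := ap_poly (δ := δ) α
  refine ((((Rt.poly (X ^ (∑ a, d (Q.s a) * d (Q.t a)))).sub h1).mul (Rt.poly P)).div G fun k _ _ => (hG k).1).congr fun k _ _ => ?_
  have h2 := mass (k := k) H d
  rw [← @Finset.add_sum_erase _ _ _ _i _ _ _ ((bx_finite H d).mem_toFinset.2 hα)] at h2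
  rw [eval_pow, eval_X, h2]
  have e : ∀ x y : ℚ, x + y - y = x := fun x y => by ring
  refine (eq_div_iff (hG k).1).2 ?_
  refine Eq.trans ?_ (congrArg (· * eval (Nat.card k : ℚ) P) (e _ _)).symm
  rw [← (hP k).2, ← (hG k).2]
  have h3 := (hP k).1
  rw [← (hP k).2] at h3
  exact (div_mul_cancel₀ _ h3).symm

/-- the inductive step -/
lemma rt_bx (H : Aff Q δ) {d : Q.V → ℕ}
    (h1 : ∀ t : Q.V → ℕ, wt t < wt d → defectOf Q δ (natc t) = 0 → Rt fun k _ _ => ind k δ (t, 1))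
    (h2 : ∀ e : ℕ+, (e : ℕ) * wt δ < wt d → Rt fun k _ _ => Nn k δ e) :
    ∀ α ∈ Bx δ d, Rt fun k _ _ => cc k δ α := by
  have key : ∀ α ∈ Bx δ d, ¬ (Rt fun k _ _ => cc k δ α) →
      (α = ({(d, 1)}, 0) ∧ titsZ Q (natc d) = 1) ∨ ∃ e : ℕ+, α = (0, {({1}, e)}) ∧ d = fun v => (e : ℕ) * δ v := by
    intro α hα hn
    by_contra hc
    push Not at hc
    refine hn (rt_cc H α (fun p hp => rt_ind H p fun h0 => h1 _ ?_ h0) fun p hp => h2 _ ?_)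
    · by_contra hlt
      obtain ⟨e1, e2⟩ := bx_big1 H hα hp (not_lt.1 hlt)
      refine hc.1 e1 ?_
      obtain ⟨-, -, k, _, _, h3⟩ := hα
      have h4 := h3 p hp
      rw [← e2]
      exact vld_tits H (k := k) ((vld_reg H h0).1 h4).2
    · rw [show strip _ = _ from strip_eq hα.1] at hp
      by_contra hlt
      obtain ⟨e1, e2⟩ := bx_big2 H hα hp (not_lt.1 hlt)
      exact hc.2 _ e1 e2
  intro α hα
  by_contra hn
  refine hn (rt_solve H hα fun β hβ hne => ?_)
  by_contra hn'
  refine hne ?_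
  rcases key α hα hn with ⟨a1, a2⟩ | ⟨e, a1, a2⟩ <;> rcases key β hβ hn' with ⟨b1, b2⟩ | ⟨e', b1, b2⟩
  · rw [a1, b1]
  · rw [b2, tits_mul H] at a2; exact absurd a2 (by norm_num)
  · rw [a2, tits_mul H] at b2; exact absurd b2 (by norm_num)
  · have : e = e' := by
      have h3 : (e : ℕ) * wt δ = e' * wt δ := by
        unfold wt
        rw [Finset.mul_sum, Finset.mul_sum]
        exact congrArg (fun d : Q.V → ℕ => ∑ v, d v) (a2.symm.trans b2)
      exact PNat.coe_injective (Nat.eq_of_mul_eq_mul_right (wt_delta H) h3)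
    rw [a1, b1, this]

lemma pc_z (k : Type) [Field k] {n : ℕ} (hn : n = 0) (e : Fin n → ℕ+) : pc (hdeg (k := k) (δ := δ)) e = 1 := by
  subst hn
  exact Nat.card_eq_one_iff_unique.2 ⟨⟨fun a b => Subtype.ext (Subsingleton.elim _ _)⟩,
    ⟨⟨Fin.elim0, fun a => a.elim0, fun a => a.elim0⟩⟩⟩

lemma pc_o (H : Aff Q δ) (k : Type) [Field k] [Finite k] {n : ℕ} (hn : n = 1) (e : Fin n → ℕ+) (a : ℕ+)
    (ha : ∀ j, e j = a) : (pc (hdeg (k := k) (δ := δ)) e : ℚ) = Nn k δ a := by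
  subst hn
  rw [pc_succ hdeg (finite_hdeg H) e, pc_z k rfl, ha (Fin.last 0)]
  simp [Nn]

lemma rt_all (H : Aff Q δ) (n : ℕ) :
    (∀ t : Q.V → ℕ, wt t = n → defectOf Q δ (natc t) = 0 → Rt fun k _ _ => ind k δ (t, 1)) ∧
    (∀ e : ℕ+, (e : ℕ) * wt δ = n → Rt fun k _ _ => Nn k δ e) := by
  induction n using Nat.strong_induction_on with
  | _ n ih =>
  have step := fun (d : Q.V → ℕ) (hd : wt d = n) => rt_bx H (d := d)
    (fun t ht => (ih _ (hd ▸ ht)).1 t rfl) (fun e he => (ih _ (hd ▸ he)).2 e rfl)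
  refine ⟨fun t ht h0 => ?_, fun e he => ?_⟩
  · by_cases hk : ∃ (k : Type) (_ : Field k) (_ : Finite k), vld k δ (t, 1)
    · obtain ⟨k, ik, fk, hv⟩ := hk
      have hα : (({(t, 1)}, 0) : Multiset (Lab Q) × SS) ∈ Bx δ t := by
        refine ⟨fun p hp => absurd hp (Multiset.notMem_zero p), ?_, k, ik, fk, fun p hp => ?_⟩
        · have : dnum δ (t, 1) = t := by
            obtain ⟨X, h⟩ := hv
            obtain ⟨m, T, i, hc, -, h3, h4⟩ := (rz_reg H (p := (t, 1)) h0).1 h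
            obtain rfl : m = 0 := by simpa using h4.symm
            rw [← dnum_eq H h]; refine Eq.trans ?_ h3; exact hc.2.2.2.isom.dimv.symm
          funext v; simp [cdim, this]
        · rw [Multiset.mem_singleton.1 hp]; exact hv
      have h1 := step t ht _ hα
      refine (h1.mul (Rt.const (Nat.card (Wt (strip 0))))).congr fun K _ _ => ?_
      have hw : (Nat.card (Wt (strip 0)) : ℚ) ≠ 0 := by exact_mod_cast wt_pos _
      have h2 : nPl K δ (strip 0) = 1 :=
        pc_z K (by rw [Multiset.length_toList, strip, Multiset.filter_zero]; rfl) fun j => (sl (strip 0) j).2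
      rw [show cc K δ _ = _ from cc_eq H (({(t, 1)}, 0) : Multiset (Lab Q) × SS)]
      show _ = (Multiset.map (ind K δ) {(t, 1)}).prod * ((nPl K δ (strip 0) : ℚ) / Nat.card (Wt (strip 0))) * Nat.card (Wt (strip 0))
      rw [h2, Multiset.map_singleton, Multiset.prod_singleton, mul_assoc, div_mul_cancel₀ _ hw, Nat.cast_one, mul_one]
    · refine (Rt.const 0).congr fun k _ _ => ?_
      exact if_neg fun h => hk ⟨k, ‹_›, ‹_›, h⟩
  · have hα : ((0, {({1}, e)}) : Multiset (Lab Q) × SS) ∈ Bx δ (fun v => (e : ℕ) * δ v) := by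
      have : Fact (Nat.Prime 2) := ⟨Nat.prime_two⟩
      refine ⟨fun p hp => ?_, funext fun v => by simp [cdim], ZMod 2, inferInstance, inferInstance, fun p hp => absurd hp (Multiset.notMem_zero p)⟩
      rw [Multiset.mem_singleton.1 hp]; simp
    have h1 := step _ (by rw [← he]; unfold wt; rw [Finset.mul_sum]) _ hα
    refine (h1.mul (Rt.const (Nat.card (Wt (strip {({1}, e)}))))).congr fun K _ _ => ?_
    have hw : (Nat.card (Wt (strip {({1}, e)})) : ℚ) ≠ 0 := by exact_mod_cast wt_pos _
    have h3 : strip {({1}, e)} = {({1}, e)} := strip_eq hα.1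
    have h2 : (nPl K δ (strip {({1}, e)}) : ℚ) = Nn K δ e :=
      pc_o H K (by rw [Multiset.length_toList, h3]; rfl) (fun j => (sl (strip {({1}, e)}) j).2) e fun j => by
        have h4 : sl (strip {({1}, e)}) j ∈ ({({1}, e)} : SS) := Multiset.mem_of_le (Multiset.filter_le _ _) (sl_mem j)
        rw [Multiset.mem_singleton.1 h4]
    rw [show cc K δ _ = _ from cc_eq H ((0, {({1}, e)}) : Multiset (Lab Q) × SS)]
    show _ = (Multiset.map (ind K δ) 0).prod * ((nPl K δ (strip {({1}, e)}) : ℚ) / Nat.card (Wt (strip {({1}, e)}))) * Nat.card (Wt (strip {({1}, e)}))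
    rw [h2, Multiset.map_zero, Multiset.prod_zero, one_mul, div_mul_cancel₀ _ hw]

lemma count_poly (H : Aff Q δ) (α : DSymb Q) : ∃ P : ℚ[X], ∀ (k : Type) [Field k] [Finite k],
    cc k δ α = P.eval (Nat.card k : ℚ) :=
  Rt.poly_of_nat (rt_cc H α (fun p _ => rt_ind H p fun h0 => (rt_all H _).1 _ rfl h0)
    fun p _ => (rt_all H _).2 _ rfl) fun k _ _ => ⟨(classCount (fun M : Repn k Q => InDecompClass δ α M) : ℕ), by simp [cc]⟩

end Repn
end

/-- For an affine quiver `Q` (not an oriented cycle) and any decomposition symbol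
`α = (μ,σ)` there are a monic `a_α ∈ ℤ[T]` and a universal polynomial `n_α` such that
for every finite field `k` with `q` elements: `|Aut(A)| = a_α(q)` for all
`A ∈ S(α,k)`, and `|S(α,k)| = n_α(q)`. -/
theorem decomposition_class_aut_and_count_polynomials
    (Q : QuiverData) (δ : Q.V → ℕ)
    (hQ : IsAffine Q) (hnc : ¬ IsOrientedCycle Q) (hδ : IsMinImagRoot Q δ)
    (α : DSymb Q) :
    ∃ a : Polynomial ℤ, a.Monic ∧ ∃ n : Polynomial ℚ,
      ∀ (k : Type) [Field k] [Fintype k],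
        (∀ A : Repn k Q, InDecompClass δ α A →
          (autCard A : ℤ) = a.eval ((Fintype.card k : ℤ))) ∧
        (classCount (fun M : Repn k Q => InDecompClass δ α M) : ℚ)
          = n.eval ((Fintype.card k : ℚ)) := by
  obtain ⟨P, hP⟩ := Repn.count_poly (⟨hQ, hnc, hδ⟩ : Repn.Aff Q δ) α
  refine ⟨Repn.aP δ α, Repn.aP_monic α, P, fun k _ _ => ⟨fun A hA => ?_, ?_⟩⟩
  · rw [← Nat.card_eq_fintype_card]
    exact Repn.class_aut ⟨hQ, hnc, hδ⟩ hA
  · rw [← Nat.card_eq_fintype_card]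
    exact hP k
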